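/- Let d > 4. There exist β0 > 0 and C > 0 such that for all β ∈ (0, β0], all integers r ≥ 3 and all z ∈ ℂ with |z| ≤ z_c(1 − V^{−1/2}), one has |χ^𝕋(z) − χ(z)| ≤ C β |χ(z)|² (r² + χ(|z|)) / V. -/

import Mathlib

open scoped BigOperators

/-- A unit step in `ℤ^d`: a coordinate direction together with a sign. -/
def wsawStep (d : ℕ) (e : Fin d × Bool) : Fin d → ℤ :=
  fun i => if i = e.1 then (if e.2 then 1 else -1) else 0

/-- The position after `k` steps of the walk on `ℤ^d` with step sequence `s`.
(An `n`-step nearest-neighbour walk on `ℤ^d` started at `0` is the same thing as a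
sequence of `n` unit steps.) -/
def wsawPos {d n : ℕ} (s : Fin n → Fin d × Bool) (k : ℕ) : Fin d → ℤ :=
  ∑ j ∈ Finset.univ.filter (fun j : Fin n => (j : ℕ) < k), wsawStep d (s j)

/-- The weakly self-avoiding walk weight `∏_{0 ≤ s < t ≤ n} (1 + β U_{st}(ω))`
of the `ℤ^d` walk with step sequence `s`. -/
noncomputable def wsawWeight {d : ℕ} (β : ℝ) (n : ℕ) (s : Fin n → Fin d × Bool) : ℝ :=
  ∏ p ∈ (Finset.range (n + 1) ×ˢ Finset.range (n + 1)).filter (fun p => p.1 < p.2),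
    (1 + β * (if wsawPos s p.1 = wsawPos s p.2 then (-1 : ℝ) else 0))

/-- The two-point partition function `c_n(x)` on `ℤ^d`. -/
noncomputable def cZx (d : ℕ) (β : ℝ) (n : ℕ) (x : Fin d → ℤ) : ℝ :=
  ∑ s ∈ Finset.univ.filter (fun s : Fin n → Fin d × Bool => wsawPos s n = x),
    wsawWeight β n s

/-- The partition function `c_n = Σ_x c_n(x)` on `ℤ^d`. -/
noncomputable def cZ (d : ℕ) (β : ℝ) (n : ℕ) : ℝ :=
  ∑ s : Fin n → Fin d × Bool, wsawWeight β n s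

/-- The position after `k` steps of the torus walk with step sequence `s`:
the mod-`r` projection of the `ℤ^d` position (for `r ≥ 3`, `n`-step torus walks
started at `0` correspond bijectively to step sequences). -/
def wsawPosT {d : ℕ} (r : ℕ) {n : ℕ} (s : Fin n → Fin d × Bool) (k : ℕ) : Fin d → ZMod r :=
  fun i => ((wsawPos s k i : ℤ) : ZMod r)

/-- The weakly self-avoiding walk weight of the torus walk with step sequence `s`. -/
noncomputable def wsawWeightT {d : ℕ} (r : ℕ) (β : ℝ) (n : ℕ) (s : Fin n → Fin d × Bool) : ℝ :=
  ∏ p ∈ (Finset.range (n + 1) ×ˢ Finset.range (n + 1)).filter (fun p => p.1 < p.2),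
    (1 + β * (if wsawPosT r s p.1 = wsawPosT r s p.2 then (-1 : ℝ) else 0))

/-- The torus partition function `c_n^𝕋`. -/
noncomputable def cT (d r : ℕ) (β : ℝ) (n : ℕ) : ℝ :=
  ∑ s : Fin n → Fin d × Bool, wsawWeightT r β n s

/-- `μ` is the growth constant: `μ = lim_{n→∞} c_n^{1/n}`. -/
def HasGrowthConst (d : ℕ) (β μ : ℝ) : Prop :=
  Filter.Tendsto (fun n : ℕ => (cZ d β n) ^ ((n : ℝ)⁻¹)) Filter.atTop (nhds μ)

/-- The susceptibility `χ(z)` on `ℤ^d`, for complex `z`. -/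
noncomputable def chi (d : ℕ) (β : ℝ) (z : ℂ) : ℂ := ∑' n : ℕ, (cZ d β n : ℂ) * z ^ n

/-- The susceptibility `χ(z)` on `ℤ^d`, for real `z`. -/
noncomputable def chiR (d : ℕ) (β : ℝ) (z : ℝ) : ℝ := ∑' n : ℕ, cZ d β n * z ^ n

/-- The torus susceptibility `χ^𝕋(z)`, for complex `z`. -/
noncomputable def chiT (d r : ℕ) (β : ℝ) (z : ℂ) : ℂ := ∑' n : ℕ, (cT d r β n : ℂ) * z ^ n

/-- The torus susceptibility `χ^𝕋(z)`, for real `z`. -/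
noncomputable def chiTR (d r : ℕ) (β : ℝ) (z : ℝ) : ℝ := ∑' n : ℕ, cT d r β n * z ^ n

/-- The sup norm `‖x‖_∞` of `x ∈ ℤ^d`, as a real number. -/
noncomputable def nInf {d : ℕ} (x : Fin d → ℤ) : ℝ :=
  ((Finset.univ.sup fun i => (x i).natAbs : ℕ) : ℝ)

/-- `⟨x⟩ = max {1, ‖x‖_∞}`. -/
noncomputable def vee {d : ℕ} (x : Fin d → ℤ) : ℝ := max 1 (nInf x)

/-- The two-point function `G_z(x) = Σ_n c_n(x) z^n` on `ℤ^d`. -/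
noncomputable def Gpt (d : ℕ) (β z : ℝ) (x : Fin d → ℤ) : ℝ := ∑' n : ℕ, cZx d β n x * z ^ n

/-- The bubble diagram `B_z = G_z * G_z`. -/
noncomputable def Bpt (d : ℕ) (β z : ℝ) (x : Fin d → ℤ) : ℝ :=
  ∑' y : Fin d → ℤ, Gpt d β z (x - y) * Gpt d β z y

/-- The triangle diagram `T_z = G_z * G_z * G_z`. -/
noncomputable def Tpt (d : ℕ) (β z : ℝ) (x : Fin d → ℤ) : ℝ :=
  ∑' y : Fin d → ℤ, Bpt d β z (x - y) * Gpt d β z y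

/-- The representative in `[-r/2, r/2) ∩ ℤ` of `x ∈ ℤ/rℤ`. -/
def repC (r : ℕ) (x : ZMod r) : ℤ :=
  if 2 * (x.val : ℤ) < (r : ℤ) then (x.val : ℤ) else (x.val : ℤ) - (r : ℤ)

namespace WSAW

section Splitting

variable {S : Type*}

/-- The nonempty suffixes of a list, longest first. -/
def sfxs : List S → List (List S)
  | [] => []
  | e :: l => (e :: l) :: sfxs l

/-- The nonempty prefixes of a list, shortest first. -/
def pfxs : List S → List (List S)
  | [] => []
  | e :: l => [e] :: (pfxs l).map (List.cons e)

/-- The decompositions `l = l₁ ++ l₂` with `l₁` nonempty. -/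
def psplits : List S → List (List S × List S)
  | [] => []
  | e :: l => ([e], l) :: (psplits l).map (fun p => (e :: p.1, p.2))

/-- All decompositions `l = l₁ ++ l₂`. -/
def splits (l : List S) : List (List S × List S) := ([], l) :: psplits l

theorem splits_cons (e : S) (l : List S) :
    splits (e :: l) = ([], e :: l) :: (splits l).map (fun p => (e :: p.1, p.2)) := by
  simp [splits, psplits]

theorem sfxs_append (a b : List S) : sfxs (a ++ b) = (sfxs a).map (· ++ b) ++ sfxs b := by
  induction a with
  | nil => simp [sfxs]
  | cons e a ih => simp [sfxs, ih]

theorem pfxs_append (a b : List S) : pfxs (a ++ b) = pfxs a ++ (pfxs b).map (a ++ ·) := by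
  induction a with
  | nil => simp [pfxs]
  | cons e a ih => simp [pfxs, ih, Function.comp_def]

theorem mem_psplits {l : List S} {p : List S × List S} (h : p ∈ psplits l) :
    p.1 ++ p.2 = l ∧ p.1 ≠ [] := by
  induction l generalizing p with
  | nil => simp [psplits] at h
  | cons e l ih =>
    simp only [psplits, List.mem_cons, List.mem_map] at h
    rcases h with rfl | ⟨q, hq, rfl⟩
    · simp
    · simp [(ih hq).1]

theorem mem_splits {l : List S} {p : List S × List S} : p ∈ splits l ↔ p.1 ++ p.2 = l := by
  induction l generalizing p with
  | nil => rcases p with ⟨a, b⟩; simp [splits, psplits]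
  | cons e l ih =>
    rcases p with ⟨a, b⟩
    rw [splits_cons]
    cases a with
    | nil => simp
    | cons x a =>
      simp only [List.mem_cons, List.mem_map, Prod.mk.injEq, reduceCtorEq, false_and, false_or,
        List.cons_append, List.cons.injEq, Prod.exists, ih]
      constructor
      · rintro ⟨a', b', h, ⟨rfl, rfl⟩, rfl⟩; exact ⟨rfl, h⟩
      · rintro ⟨rfl, h⟩; exact ⟨a, b, h, ⟨rfl, rfl⟩, rfl⟩

theorem nodup_splits (l : List S) : (splits l).Nodup := by
  induction l with
  | nil => simp [splits, psplits]
  | cons e l ih =>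
    rw [splits_cons, List.nodup_cons]
    refine ⟨by simp, ih.map ?_⟩
    rintro ⟨a, b⟩ ⟨a', b'⟩ h
    simpa using h

theorem sum_psplits_assoc {M : Type*} [AddCommMonoid M] (F : List S → List S → List S → M)
    (l : List S) :
    ((psplits l).map fun p => ((splits p.2).map fun r => F p.1 r.1 r.2).sum).sum =
      ((psplits l).map fun p => ((psplits p.1).map fun r => F r.1 r.2 p.2).sum).sum := by
  induction l generalizing F with
  | nil => simp [psplits]
  | cons e l ih =>
    have h := ih fun a b c => F (e :: a) b c
    simp only [psplits, List.map_cons, List.sum_cons, List.map_map, Function.comp_def,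
      List.map_nil, List.sum_nil, add_zero] at h ⊢
    rw [h]
    simp [splits, add_assoc, List.sum_map_add]

theorem prod_pfxs_telescope (f : List S → ℝ) (l : List S) :
    ((pfxs l).map f).prod = 1 + ((psplits l).map fun p =>
      (f p.1 - 1) * ((pfxs p.1.dropLast).map f).prod).sum := by
  induction l generalizing f with
  | nil => simp [pfxs, psplits]
  | cons e l ih =>
    have h := ih fun a => f (e :: a)
    have key : ((psplits l).map fun p => (f (e :: p.1) - 1) *
        ((pfxs (e :: p.1).dropLast).map f).prod).sum = f [e] * ((psplits l).map fun p =>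
        (f (e :: p.1) - 1) * ((pfxs p.1.dropLast).map fun a => f (e :: a)).prod).sum := by
      rw [← List.sum_map_mul_left]
      congr 1
      refine List.map_congr_left fun p hp => ?_
      obtain ⟨x, y, hxy⟩ := List.exists_cons_of_ne_nil (mem_psplits hp).2
      simp only [hxy, List.dropLast_cons_cons, pfxs, List.map_cons, List.map_map, List.prod_cons,
        Function.comp_def]
      ring
    simp only [pfxs, psplits, List.map_cons, List.prod_cons, List.sum_cons, List.map_map,
      Function.comp_def] at h key ⊢
    rw [h, key]
    simp [pfxs]
    ring

end Splitting

section Weights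

variable {S : Type*} (w : List S → ℝ)

/-- The total weight of a walk: the product of `w` over its nonempty contiguous pieces. -/
noncomputable def wt (l : List S) : ℝ := ((sfxs l).map fun s => ((pfxs s).map w).prod).prod

/-- The interaction of a walk with a single later time. -/
noncomputable def inter (a p : List S) : ℝ := ((sfxs a).map fun s => w (s ++ p)).prod

/-- The one-edge kernel of the expansion. -/
noncomputable def edgeKer (a t : List S) : ℝ :=
  (inter w a t - 1) * ((pfxs t.dropLast).map (inter w a)).prod * wt w t

/-- The coefficients of the expansion, with at most `n` edges. -/
noncomputable def lace : ℕ → List S → List S → ℝ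
  | 0, _, ρ => if ρ = [] then 1 else 0
  | n + 1, a, ρ => (if ρ = [] then 1 else 0) +
      ((psplits ρ).map fun p => edgeKer w a p.1 * lace n p.1 p.2).sum

theorem prod_comm_list {A B : Type*} (f : A → B → ℝ) (a : List A) (b : List B) :
    (a.map fun x => (b.map fun y => f x y).prod).prod =
      (b.map fun y => (a.map fun x => f x y).prod).prod := by
  induction a with
  | nil => simp
  | cons x a ih => simp [ih, List.prod_map_mul]

theorem wt_append (a b : List S) :
    wt w (a ++ b) = wt w a * ((pfxs b).map (inter w a)).prod * wt w b := by
  unfold wt inter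
  rw [sfxs_append, List.map_append, List.prod_append, List.map_map]
  congr 1
  rw [← prod_comm_list, ← List.prod_map_mul]
  simp [Function.comp_def, pfxs_append]

theorem lace_identity (n : ℕ) (l : List S) (hl : l.length ≤ n) (a : List S) :
    ((pfxs l).map (inter w a)).prod * wt w l =
      ((splits l).map fun p => lace w n a p.1 * wt w p.2).sum := by
  induction n generalizing l a with
  | zero =>
    obtain rfl : l = [] := by simpa using hl
    simp [pfxs, splits, psplits, lace]
  | succ n ih =>
    have h1 : ((psplits l).map fun p => lace w (n + 1) a p.1 * wt w p.2) =
        (psplits l).map fun p => ((psplits p.1).map fun r =>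
          edgeKer w a r.1 * lace w n r.1 r.2 * wt w p.2).sum := by
      refine List.map_congr_left fun p hp => ?_
      simp [lace, (mem_psplits hp).2, ← List.sum_map_mul_right]
    rw [prod_pfxs_telescope, splits, List.map_cons, List.sum_cons, h1,
      ← sum_psplits_assoc fun t r k => edgeKer w a t * lace w n t r * wt w k]
    rw [add_mul, ← List.sum_map_mul_right]
    congr 1
    · simp [lace, psplits]
    · congr 1
      refine List.map_congr_left fun p hp => ?_
      obtain ⟨h2, h3⟩ := mem_psplits hp
      have h4 : p.2.length ≤ n := by
        have := congrArg List.length h2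
        have := List.length_pos_iff.2 h3
        simp at *; omega
      have := ih p.2 h4 p.1
      simp only [mul_assoc, List.sum_map_mul_left] at this ⊢
      rw [← this, ← h2, wt_append]
      simp only [edgeKer]
      ring_nf

theorem lace_stable (n m : ℕ) (a ρ : List S) (hn : ρ.length ≤ n) (hm : ρ.length ≤ m) :
    lace w n a ρ = lace w m a ρ := by
  induction n generalizing m a ρ with
  | zero =>
    obtain rfl : ρ = [] := by simpa using hn
    cases m <;> simp [lace, psplits]
  | succ n ih =>
    cases m with
    | zero =>
      obtain rfl : ρ = [] := by simpa using hm
      simp [lace, psplits]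
    | succ m =>
      simp only [lace]
      congr 2
      refine List.map_congr_left fun p hp => ?_
      obtain ⟨h2, h3⟩ := mem_psplits hp
      have := congrArg List.length h2
      have := List.length_pos_iff.2 h3
      simp only [List.length_append] at *
      rw [ih m p.1 p.2 (by omega) (by omega)]

/-- The coefficients of the expansion. -/
noncomputable def laceInf (a ρ : List S) : ℝ := lace w ρ.length a ρ

theorem wt_cons (e : S) (l : List S) (he : w [e] = 1) :
    wt w (e :: l) = ((splits l).map fun p => laceInf w [e] p.1 * wt w p.2).sum := by
  have h := lace_identity w l.length l le_rfl [e]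
  have h2 := wt_append w [e] l
  rw [List.singleton_append] at h2
  rw [h2, mul_assoc, h]
  simp only [wt, sfxs, pfxs, List.map_cons, List.map_nil, List.prod_cons, List.prod_nil, he, one_mul,
    mul_one]
  congr 1
  refine List.map_congr_left fun p hp => ?_
  have := congrArg List.length (mem_splits.1 hp)
  simp only [List.length_append] at this
  rw [laceInf, lace_stable w _ p.1.length _ _ (by omega) le_rfl]

end Weights
end WSAW

namespace WSAW
open scoped ENNReal

section Sums

variable {S : Type*}

theorem sum_splits_eq_tsum {M : Type*} [AddCommMonoid M] [TopologicalSpace M] [DecidableEq (List S)]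
    (F : List S × List S → M) (l : List S) :
    ((splits l).map F).sum =
      ∑' p : (fun p : List S × List S => p.1 ++ p.2) ⁻¹' {l}, F p := by
  classical
  have h : (fun p : List S × List S => p.1 ++ p.2) ⁻¹' {l} = ((splits l).toFinset : Set _) := by
    ext p; simp [mem_splits]
  rw [h, Finset.tsum_subtype' (splits l).toFinset F, List.sum_toFinset _ (nodup_splits l)]

theorem tsum_splits (F : List S → List S → ℝ≥0∞) :
    ∑' l, ((splits l).map fun p => F p.1 p.2).sum = ∑' a, ∑' b, F a b := by
  classical
  rw [← ENNReal.tsum_prod (f := F)]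
  rw [← (Equiv.sigmaFiberEquiv (fun p : List S × List S => p.1 ++ p.2)).tsum_eq, ENNReal.tsum_sigma']
  refine tsum_congr fun l => ?_
  rw [sum_splits_eq_tsum (fun p => F p.1 p.2) l]
  rfl

theorem map_snd_splits (l : List S) : (splits l).map Prod.snd = sfxs l ++ [[]] := by
  induction l with
  | nil => simp [splits, psplits, sfxs]
  | cons e l ih =>
    rw [splits_cons]
    simp [Function.comp_def, sfxs, ih]

theorem map_fst_splits (l : List S) : (splits l).map Prod.fst = [] :: pfxs l := by
  induction l with
  | nil => simp [splits, psplits, pfxs]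
  | cons e l ih =>
    rw [splits_cons]
    have : (splits l).map (fun p => e :: p.1) = ((splits l).map Prod.fst).map (List.cons e) := by
      simp
    simp [Function.comp_def, pfxs, this, ih]

theorem sum_sfxs_le (F : List S → ℝ≥0∞) (l : List S) :
    ((sfxs l).map F).sum ≤ ((splits l).map fun p => F p.2).sum := by
  have : ((splits l).map fun p => F p.2) = ((splits l).map Prod.snd).map F := by simp
  rw [this, map_snd_splits]
  simp

theorem sum_pfxs_le (F : List S → ℝ≥0∞) (l : List S) :
    ((pfxs l).map F).sum ≤ ((splits l).map fun p => F p.1).sum := by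
  have : ((splits l).map fun p => F p.1) = ((splits l).map Prod.fst).map F := by simp
  rw [this, map_fst_splits]
  simp

theorem sum_psplits_le (F : List S → List S → ℝ≥0∞) (l : List S) :
    ((psplits l).map fun p => F p.1 p.2).sum ≤ ((splits l).map fun p => F p.1 p.2).sum := by
  simp [splits]

theorem list_sum_le {A : Type*} (l : List A) (f h : A → ℝ≥0∞) (H : ∀ x ∈ l, f x ≤ h x) :
    (l.map f).sum ≤ (l.map h).sum := List.sum_le_sum H

theorem tsum_list_sum {A B : Type*} (l : List A) (f : A → B → ℝ≥0∞) :
    ∑' b, (l.map fun a => f a b).sum = (l.map fun a => ∑' b, f a b).sum := by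
  induction l with
  | nil => simp
  | cons x l ih => simp [ENNReal.tsum_add, ih]

/-- Summing over a walk and one of its suffixes. -/
theorem tsum_sfxs_le (H : List S → List S → ℝ≥0∞) :
    ∑' l, ((sfxs l).map (H l)).sum ≤ ∑' s, ∑' b, H (b ++ s) s := by
  calc ∑' l, ((sfxs l).map (H l)).sum
      ≤ ∑' l, ((splits l).map fun p => H (p.1 ++ p.2) p.2).sum := by
        refine ENNReal.tsum_le_tsum fun l => (sum_sfxs_le _ l).trans ?_
        exact list_sum_le _ _ _ fun p hp => by rw [mem_splits.1 hp]
    _ = _ := by rw [tsum_splits fun a b => H (a ++ b) b, ENNReal.tsum_comm]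

/-- Summing over a walk and one of its prefixes. -/
theorem tsum_pfxs_le (H : List S → List S → ℝ≥0∞) :
    ∑' l, ((pfxs l).map (H l)).sum ≤ ∑' p, ∑' b, H (p ++ b) p := by
  calc ∑' l, ((pfxs l).map (H l)).sum
      ≤ ∑' l, ((splits l).map fun p => H (p.1 ++ p.2) p.1).sum := by
        refine ENNReal.tsum_le_tsum fun l => (sum_pfxs_le _ l).trans ?_
        exact list_sum_le _ _ _ fun p hp => by rw [mem_splits.1 hp]
    _ = _ := by rw [tsum_splits fun a b => H (a ++ b) a]

/-- A double sum over suffixes, grouped by the shorter one. -/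
theorem sum_sfxs_pair_le (f : List S → List S → ℝ≥0∞) (l : List S) :
    ((sfxs l).map fun s => ((sfxs l).map fun t => f s t).sum).sum ≤
      ((sfxs l).map fun s => ((sfxs s).map fun t => f s t + f t s).sum).sum := by
  induction l with
  | nil => simp [sfxs]
  | cons e l ih =>
    simp only [sfxs, List.map_cons, List.sum_cons, List.sum_map_add] at ih ⊢
    calc _ = f (e :: l) (e :: l) + (((sfxs l).map fun t => f (e :: l) t).sum +
            ((sfxs l).map fun s => f s (e :: l)).sum) +
            ((sfxs l).map fun s => ((sfxs l).map fun t => f s t).sum).sum := by ring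
      _ ≤ _ := by
        refine add_le_add ?_ ih
        calc _ ≤ (f (e :: l) (e :: l) + (((sfxs l).map fun t => f (e :: l) t).sum +
            ((sfxs l).map fun s => f s (e :: l)).sum)) + f (e :: l) (e :: l) := le_self_add
          _ = _ := by ring

end Sums

section Products

variable {A : Type*}

theorem list_prod_mem_unit (l : List A) (f : A → ℝ) (h : ∀ x ∈ l, 0 ≤ f x ∧ f x ≤ 1) :
    0 ≤ (l.map f).prod ∧ (l.map f).prod ≤ 1 := by
  induction l with
  | nil => simp
  | cons x l ih =>
    have h1 := h x (by simp)
    have h2 := ih fun y hy => h y (by simp [hy])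
    simp only [List.map_cons, List.prod_cons]
    exact ⟨mul_nonneg h1.1 h2.1, mul_le_one₀ h1.2 h2.1 h2.2⟩

theorem one_sub_list_prod_le (l : List A) (f : A → ℝ) (h : ∀ x ∈ l, 0 ≤ f x ∧ f x ≤ 1) :
    1 - (l.map f).prod ≤ (l.map fun x => 1 - f x).sum := by
  induction l with
  | nil => simp
  | cons x l ih =>
    have h1 := h x (by simp)
    have h2 := ih fun y hy => h y (by simp [hy])
    have h3 := list_prod_mem_unit l f fun y hy => h y (by simp [hy])
    simp only [List.map_cons, List.prod_cons, List.sum_cons]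
    nlinarith

theorem ofReal_one_sub_list_prod_le (l : List A) (f : A → ℝ) (h : ∀ x ∈ l, 0 ≤ f x ∧ f x ≤ 1) :
    ENNReal.ofReal (1 - (l.map f).prod) ≤ (l.map fun x => ENNReal.ofReal (1 - f x)).sum := by
  refine (ENNReal.ofReal_le_ofReal (one_sub_list_prod_le l f h)).trans (le_of_eq ?_)
  induction l with
  | nil => simp
  | cons x l ih =>
    have h1 := h x (by simp)
    have h2 : 0 ≤ (l.map fun x => 1 - f x).sum :=
      List.sum_nonneg (by simp only [List.mem_map]; rintro _ ⟨y, hy, rfl⟩; linarith [(h y (by simp [hy])).2])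
    simp only [List.map_cons, List.sum_cons]
    rw [ENNReal.ofReal_add (by linarith) h2, ih fun y hy => h y (by simp [hy])]

end Products
end WSAW

namespace WSAW
open scoped ENNReal

section Delta

variable {Γ : Type*} [AddCommGroup Γ]

open Classical in
/-- The Kronecker delta at the origin. -/
noncomputable def del (x : Γ) : ℝ≥0∞ := if x = 0 then 1 else 0

theorem del_neg (x : Γ) : del (-x) = del x := by by_cases h : x = 0 <;> simp [del, h]

theorem del_zero : del (0 : Γ) = 1 := by simp [del]

theorem del_mul_congr {x : Γ} {a b : ℝ≥0∞} (h : x = 0 → a = b) : del x * a = del x * b := by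
  unfold del; split_ifs with hx
  · simp [h hx]
  · simp

theorem tsum_mul_del (F : Γ → ℝ≥0∞) (c : Γ) : ∑' x, F x * del (x + c) = F (-c) := by
  rw [tsum_eq_single (-c)]
  · simp [del]
  · intro x hx
    have : x + c ≠ 0 := fun h => hx (eq_neg_of_add_eq_zero_left h)
    simp [del, this]

theorem mul_le_sq_add_sq (a b : ℝ≥0∞) : a * b ≤ a ^ 2 + b ^ 2 := by
  rcases le_total a b with h | h
  · calc a * b ≤ b * b := by gcongr
      _ = b ^ 2 := by ring
      _ ≤ _ := le_add_self
  · calc a * b ≤ a * a := by gcongr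
      _ = a ^ 2 := by ring
      _ ≤ _ := le_self_add

end Delta

variable {S Γ : Type*} [AddCommGroup Γ]

/-- A family of walk weights `k`, displacement map `D`, whose lines are dominated by `g`. -/
structure IsLine (D : List S → Γ) (k : List S → ℝ≥0∞) (g : Γ → ℝ≥0∞) (K B : ℝ≥0∞) : Prop where
  D_append : ∀ a b, D (a ++ b) = D a + D b
  k_append : ∀ a b, k (a ++ b) ≤ k a * k b
  even : ∀ x, g (-x) = g x
  quasi : ∀ x y, g x * g y ≤ K * g (x + y) * (g x + g y)
  sq : ∑' x, g x ^ 2 ≤ B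
  line : ∀ F : Γ → ℝ≥0∞, ∑' l, k l * F (D l) ≤ ∑' x, g x * F x

/-- The sum of `g` over all suffix displacements, shifted by `c`. -/
noncomputable def mark (D : List S → Γ) (g : Γ → ℝ≥0∞) (c : Γ) (l : List S) : ℝ≥0∞ :=
  ((sfxs l).map fun s => g (D s + c)).sum

namespace IsLine

variable {D : List S → Γ} {k : List S → ℝ≥0∞} {g : Γ → ℝ≥0∞} {K B : ℝ≥0∞}

theorem sum_sq_le (h : IsLine D k g K B) {f : Γ → Γ} (hf : f.Injective) :
    ∑' x, g (f x) ^ 2 ≤ B :=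
  (ENNReal.tsum_comp_le_tsum_of_injective hf fun x => g x ^ 2).trans h.sq

theorem bubble (h : IsLine D k g K B) {f₁ f₂ : Γ → Γ} (h₁ : f₁.Injective) (h₂ : f₂.Injective) :
    ∑' x, g (f₁ x) * g (f₂ x) ≤ 2 * B :=
  calc _ ≤ ∑' x, (g (f₁ x) ^ 2 + g (f₂ x) ^ 2) :=
        ENNReal.tsum_le_tsum fun x => mul_le_sq_add_sq _ _
    _ ≤ B + B := by
        rw [ENNReal.tsum_add]; exact add_le_add (h.sum_sq_le h₁) (h.sum_sq_le h₂)
    _ = _ := by ring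

/-- Convolving two lines. -/
theorem tsum_two (h : IsLine D k g K B) (H : List S → ℝ≥0∞) (F : Γ → ℝ≥0∞) (G : List S → ℝ≥0∞)
    (hG : ∀ s b, G (b ++ s) ≤ F (D b + D s)) :
    ∑' l, k l * G l * ((sfxs l).map H).sum ≤
      ∑' s, k s * H s * ∑' x, g x * F (x + D s) := by
  calc _ = ∑' l, ((sfxs l).map fun s => k l * G l * H s).sum := by
        simp only [List.sum_map_mul_left]
    _ ≤ ∑' s, ∑' b, k (b ++ s) * G (b ++ s) * H s := tsum_sfxs_le fun l s => k l * G l * H s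
    _ ≤ ∑' s, k s * H s * ∑' b, k b * F (D b + D s) := by
        refine ENNReal.tsum_le_tsum fun s => ?_
        rw [← ENNReal.tsum_mul_left]
        refine ENNReal.tsum_le_tsum fun b => ?_
        calc _ ≤ (k b * k s) * F (D b + D s) * H s := by
              gcongr
              · exact h.k_append b s
              · exact hG s b
          _ = _ := by ring
    _ ≤ _ := by
        gcongr with s
        exact h.line fun x => F (x + D s)

theorem mark_append (h : IsLine D k g K B) (c : Γ) (a b : List S) :
    mark D g c (a ++ b) = mark D g (D b + c) a + mark D g c b := by
  simp [mark, sfxs_append, Function.comp_def, h.D_append, add_assoc]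

theorem one_add_mark_append (h : IsLine D k g K B) (c : Γ) (a b : List S) :
    1 + mark D g c (a ++ b) ≤ (1 + mark D g (D b + c) a) * (1 + mark D g c b) := by
  rw [h.mark_append]
  calc _ ≤ (1 + (mark D g (D b + c) a + mark D g c b)) + mark D g (D b + c) a * mark D g c b :=
        le_self_add
    _ = _ := by ring

/-- A line carrying one mark. -/
theorem dressed (h : IsLine D k g K B) (c : Γ) (F : Γ → ℝ≥0∞) :
    ∑' l, k l * (1 + mark D g c l) * F (D l) ≤ (1 + 4 * K * B) * ∑' x, g x * F x := by
  have h1 : ∑' l, k l * F (D l) * mark D g c l ≤ 4 * K * B * ∑' x, g x * F x := by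
    calc _ ≤ ∑' s, k s * g (D s + c) * ∑' x, g x * F (x + D s) :=
          h.tsum_two (fun s => g (D s + c)) F (fun l => F (D l)) fun s b => by rw [h.D_append]
      _ = ∑' s, k s * (fun y => g (y + c) * ∑' x, g x * F (x + y)) (D s) := by
          simp only [mul_assoc]
      _ ≤ _ := h.line fun y => g (y + c) * ∑' x, g x * F (x + y)
      _ = ∑' y, ∑' u, g y * (g (y + c) * (g (u - y) * F u)) := by
          refine tsum_congr fun y => ?_
          rw [← ENNReal.tsum_mul_left, ← ENNReal.tsum_mul_left,
            ← (Equiv.subRight y).tsum_eq]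
          simp
      _ = ∑' u, F u * ∑' y, g y * g (u - y) * g (y + c) := by
          rw [ENNReal.tsum_comm]
          refine tsum_congr fun u => ?_
          rw [← ENNReal.tsum_mul_left]
          exact tsum_congr fun y => by ring
      _ ≤ ∑' u, F u * (K * g u * (4 * B)) := by
          gcongr with u
          calc _ ≤ ∑' y, K * g u * (g y * g (y + c) + g (u - y) * g (y + c)) := by
                refine ENNReal.tsum_le_tsum fun y => ?_
                calc _ ≤ K * g (y + (u - y)) * (g y + g (u - y)) * g (y + c) := by
                      gcongr ?_ * _; exact h.quasi _ _
                  _ = _ := by rw [add_sub_cancel]; ring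
            _ ≤ K * g u * (2 * B + 2 * B) := by
                rw [ENNReal.tsum_mul_left, ENNReal.tsum_add]
                gcongr
                · exact h.bubble (f₁ := fun y => y) (fun _ _ => id) (add_left_injective c)
                · exact h.bubble (sub_right_injective) (add_left_injective c)
            _ = _ := by ring
      _ = _ := by
          rw [← ENNReal.tsum_mul_left]
          exact tsum_congr fun y => by ring
  calc _ = ∑' l, k l * F (D l) + ∑' l, k l * F (D l) * mark D g c l := by
        rw [← ENNReal.tsum_add]; exact tsum_congr fun y => by ring
    _ ≤ ∑' x, g x * F x + 4 * K * B * ∑' x, g x * F x := add_le_add (h.line F) h1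
    _ = _ := by ring

theorem dressed_del (h : IsLine D k g K B) (c y : Γ) :
    ∑' l, k l * (1 + mark D g c l) * del (D l + y) ≤ (1 + 4 * K * B) * g y := by
  have := h.dressed c fun x => del (x + y)
  rwa [tsum_mul_del, h.even] at this

end IsLine

/-- The expansion with nonnegative edge kernel `q`. -/
noncomputable def elace (q : List S → List S → ℝ≥0∞) : ℕ → List S → List S → ℝ≥0∞
  | 0, _, ρ => if ρ = [] then 1 else 0
  | n + 1, a, ρ => (if ρ = [] then 1 else 0) +
      ((psplits ρ).map fun p => q a p.1 * elace q n p.1 p.2).sum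

theorem tsum_ite_nil : ∑' ρ : List S, (if ρ = [] then (1 : ℝ≥0∞) else 0) = 1 := by
  classical
  rw [tsum_ite_eq]

theorem tsum_elace_succ_le (q : List S → List S → ℝ≥0∞) (n : ℕ) (a : List S) :
    ∑' ρ, elace q (n + 1) a ρ ≤ 1 + ∑' t, q a t * ∑' ρ, elace q n t ρ := by
  simp only [elace]
  rw [ENNReal.tsum_add, tsum_ite_nil]
  refine add_le_add le_rfl ?_
  calc _ ≤ ∑' ρ, ((splits ρ).map fun p => q a p.1 * elace q n p.1 p.2).sum :=
        ENNReal.tsum_le_tsum fun ρ => sum_psplits_le (fun a' b => q a a' * elace q n a' b) ρ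
    _ = _ := by
        rw [tsum_splits fun t ρ => q a t * elace q n t ρ]
        simp only [ENNReal.tsum_mul_left]

/-- The basic bound on an edge kernel. -/
def EdgeBound (D : List S → Γ) (k : List S → ℝ≥0∞) (β : ℝ≥0∞)
    (q : List S → List S → ℝ≥0∞) : Prop :=
  ∀ a t, q a t ≤ β * ((sfxs a).map fun s => del (D t + D s)).sum * k t

namespace IsLine

variable {D : List S → Γ} {k : List S → ℝ≥0∞} {g : Γ → ℝ≥0∞} {K B β : ℝ≥0∞}
  {q : List S → List S → ℝ≥0∞}

theorem tsum_edge_le (_h : IsLine D k g K B) (hq : EdgeBound D k β q) (a : List S)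
    (G : List S → ℝ≥0∞) (H : Γ → ℝ≥0∞) (hG : ∀ y, ∑' t, k t * G t * del (D t + y) ≤ H y) :
    ∑' t, q a t * G t ≤ β * ((sfxs a).map fun s => H (D s)).sum := by
  calc _ ≤ ∑' t, β * ((sfxs a).map fun s => k t * G t * del (D t + D s)).sum := by
        refine ENNReal.tsum_le_tsum fun t => ?_
        calc _ ≤ β * ((sfxs a).map fun s => del (D t + D s)).sum * k t * G t := by
              gcongr; exact hq a t
          _ = _ := by rw [List.sum_map_mul_left]; ring
    _ = β * ((sfxs a).map fun s => ∑' t, k t * G t * del (D t + D s)).sum := by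
        rw [ENNReal.tsum_mul_left, tsum_list_sum]
    _ ≤ _ := by
        gcongr
        exact list_sum_le _ _ _ fun s _ => hG _

theorem tsum_elace_le (h : IsLine D k g K B) (hq : EdgeBound D k β q)
    (hβ : β * (1 + 4 * K * B) ≤ 1) (n : ℕ) (a : List S) :
    ∑' ρ, elace q n a ρ ≤ 1 + mark D g 0 a := by
  induction n generalizing a with
  | zero => simp [elace]
  | succ n ih =>
    refine (tsum_elace_succ_le q n a).trans ?_
    gcongr
    calc _ ≤ ∑' t, q a t * (1 + mark D g 0 t) := by gcongr with t; exact ih t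
      _ ≤ β * ((sfxs a).map fun s => (1 + 4 * K * B) * g (D s)).sum :=
          h.tsum_edge_le hq a _ _ fun y => h.dressed_del 0 y
      _ = β * (1 + 4 * K * B) * mark D g 0 a := by
          simp [mark, List.sum_map_mul_left, mul_assoc]
      _ ≤ 1 * mark D g 0 a := by gcongr
      _ = _ := one_mul _

end IsLine
end WSAW

namespace WSAW
open scoped ENNReal

variable {S Γ : Type*} [AddCommGroup Γ]

/-- The expansion coefficients at nonempty walks. -/
noncomputable def elaceNE (q : List S → List S → ℝ≥0∞) (n : ℕ) (a ρ : List S) : ℝ≥0∞ :=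
  if ρ = [] then 0 else elace q n a ρ

theorem elace_nil (q : List S → List S → ℝ≥0∞) (n : ℕ) (a : List S) : elace q n a [] = 1 := by
  cases n <;> simp [elace, psplits]

theorem elaceNE_succ_le (q : List S → List S → ℝ≥0∞) (n : ℕ) (a ρ : List S) :
    elaceNE q (n + 1) a ρ ≤ ((splits ρ).map fun p =>
      q a p.1 * ((if p.2 = [] then 1 else 0) + elaceNE q n p.1 p.2)).sum := by
  unfold elaceNE
  split_ifs with h
  · simp
  · simp only [elace, h, if_false, zero_add]
    refine le_trans (le_of_eq ?_) (sum_psplits_le (fun a' b => q a a' *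
      ((if b = [] then 1 else 0) + if b = [] then 0 else elace q n a' b)) ρ)
    congr 1
    refine List.map_congr_left fun p _ => ?_
    split_ifs with h2
    · simp [h2, elace_nil]
    · simp

namespace IsLine

variable {D : List S → Γ} {k : List S → ℝ≥0∞} {g : Γ → ℝ≥0∞} {K B β : ℝ≥0∞}
  {q : List S → List S → ℝ≥0∞}

theorem D_nil (h : IsLine D k g K B) : D [] = 0 := by
  simpa using h.D_append [] []

/-- A line with fixed end-point, summed over its suffixes. -/
theorem line_sfxs (h : IsLine D k g K B) (y : Γ) (H : Γ → ℝ≥0∞) :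
    ∑' l, k l * del (D l - y) * ((sfxs l).map fun s => H (D s)).sum ≤
      ∑' v, g v * H v * g (v - y) := by
  calc _ ≤ ∑' s, k s * H (D s) * ∑' x, g x * del (x + D s - y) :=
        h.tsum_two (fun s => H (D s)) (fun x => del (x - y)) (fun l => del (D l - y))
          fun s b => by rw [h.D_append]
    _ = ∑' s, k s * (fun v => H v * g (v - y)) (D s) := by
        refine tsum_congr fun s => ?_
        simp only [add_sub_assoc]
        rw [tsum_mul_del, h.even, mul_assoc]
    _ ≤ ∑' v, g v * (H v * g (v - y)) := h.line fun v => H v * g (v - y)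
    _ = _ := tsum_congr fun v => by ring

theorem triple (h : IsLine D k g K B) (y u : Γ) :
    ∑' v, g v * g (u + v) ^ 2 * g (v - y) ≤ 8 * K ^ 2 * B * (g (y + u) * g u) := by
  calc _ ≤ ∑' v, K ^ 2 * (g (y + u) * g u) *
        (g (v - y) * g v + g (v - y) * g (u + v) + g (u + v) * g v + g (u + v) ^ 2) := by
        refine ENNReal.tsum_le_tsum fun v => ?_
        have h1 := h.quasi (-(v - y)) (u + v)
        have h2 := h.quasi (-v) (u + v)
        rw [h.even, show -(v - y) + (u + v) = y + u by abel] at h1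
        rw [h.even, show -v + (u + v) = u by abel] at h2
        calc _ = (g (v - y) * g (u + v)) * (g v * g (u + v)) := by ring
          _ ≤ (K * g (y + u) * (g (v - y) + g (u + v))) * (K * g u * (g v + g (u + v))) := by
              exact mul_le_mul' h1 h2
          _ = _ := by ring
    _ ≤ K ^ 2 * (g (y + u) * g u) * (2 * B + 2 * B + 2 * B + 2 * B) := by
        rw [ENNReal.tsum_mul_left, ENNReal.tsum_add, ENNReal.tsum_add, ENNReal.tsum_add]
        gcongr
        · exact h.bubble sub_left_injective (fun _ _ => id)
        · exact h.bubble sub_left_injective (add_right_injective u)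
        · exact h.bubble (add_right_injective u) (fun _ _ => id)
        · refine (h.sum_sq_le (add_right_injective u)).trans ?_
          rw [two_mul]; exact le_self_add
    _ = _ := by ring

/-- Pointwise bound on the expansion coefficients. -/
theorem pointwise (h : IsLine D k g K B) (hq : EdgeBound D k β q)
    (hβ : β * (16 * K ^ 2 * B) ≤ 1) (n : ℕ) (y u : Γ) :
    ∑' a, k a * del (D a - y) * ∑' ρ, elaceNE q n a ρ * del (D ρ - u) ≤
      2 * β * (g (y + u) * g u ^ 2) := by
  induction n generalizing y u with
  | zero =>
    have : ∀ a ρ : List S, elaceNE q 0 a ρ = 0 := fun a ρ => by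
      unfold elaceNE elace; split_ifs <;> rfl
    simp [this]
  | succ n ih =>
    have hstep : ∀ a, ∑' ρ, elaceNE q (n + 1) a ρ * del (D ρ - u) ≤
        ∑' t, q a t * (del (D t - u) + ∑' ρ, elaceNE q n t ρ * del (D ρ - (u - D t))) := by
      intro a
      calc _ ≤ ∑' ρ, ((splits ρ).map fun p => q a p.1 *
              ((if p.2 = [] then 1 else 0) + elaceNE q n p.1 p.2) * del (D p.1 + D p.2 - u)).sum := by
            refine ENNReal.tsum_le_tsum fun ρ => ?_
            refine (mul_le_mul' (elaceNE_succ_le q n a ρ) le_rfl).trans ?_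
            rw [← List.sum_map_mul_right]
            exact list_sum_le _ _ _ fun p hp => by rw [← h.D_append, mem_splits.1 hp]
        _ = ∑' t, q a t * ∑' ρ, ((if ρ = [] then 1 else 0) * del (D t + D ρ - u) +
              elaceNE q n t ρ * del (D ρ - (u - D t))) := by
            rw [tsum_splits fun t ρ => q a t * ((if ρ = [] then 1 else 0) + elaceNE q n t ρ) *
              del (D t + D ρ - u)]
            refine tsum_congr fun t => ?_
            rw [← ENNReal.tsum_mul_left]
            refine tsum_congr fun ρ => ?_
            rw [show D ρ - (u - D t) = D t + D ρ - u by abel]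
            ring
        _ ≤ _ := by
            gcongr with t
            rw [ENNReal.tsum_add]
            gcongr
            rw [tsum_eq_single []]
            · simp [h.D_nil]
            · intro ρ hρ; simp [hρ]
    have hH : ∀ v, ∑' t, k t * (del (D t - u) + ∑' ρ, elaceNE q n t ρ * del (D ρ - (u - D t))) *
        del (D t + v) ≤ del (v + u) * g v + 2 * β * (g u * g (u + v) ^ 2) := by
      intro v
      calc _ = ∑' t, (k t * (del (v + u) * del (D t + v)) + k t * del (D t - -v) *
            ∑' ρ, elaceNE q n t ρ * del (D ρ - (u + v))) := by
            refine tsum_congr fun t => ?_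
            have h1 : del (D t + v) * (del (D t - u) +
                ∑' ρ, elaceNE q n t ρ * del (D ρ - (u - D t))) =
                del (D t + v) * (del (v + u) + ∑' ρ, elaceNE q n t ρ * del (D ρ - (u + v))) := by
              refine del_mul_congr fun h0 => ?_
              have h0' := eq_neg_of_add_eq_zero_left h0
              rw [h0', ← del_neg (v + u)]
              congr 2
              · abel
              · simp
            rw [sub_neg_eq_add, mul_assoc, mul_comm _ (del (D t + v)), h1]
            ring
        _ ≤ _ := by
            rw [ENNReal.tsum_add]
            refine add_le_add ?_ ?_
            · refine (h.line fun x => del (v + u) * del (x + v)).trans (le_of_eq ?_)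
              rw [← h.even v, ← tsum_mul_del g v, ← ENNReal.tsum_mul_left]
              exact tsum_congr fun x => by ring
            · have := ih (-v) (u + v)
              rwa [show -v + (u + v) = u by abel] at this
    calc _ ≤ ∑' a, k a * del (D a - y) * (β * ((sfxs a).map fun s =>
            del (D s + u) * g (D s) + 2 * β * (g u * g (u + D s) ^ 2)).sum) := by
          gcongr with a
          exact (hstep a).trans (h.tsum_edge_le hq a _ _ hH)
      _ = β * ∑' a, k a * del (D a - y) * ((sfxs a).map fun s =>
            del (D s + u) * g (D s) + 2 * β * (g u * g (u + D s) ^ 2)).sum := by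
          rw [← ENNReal.tsum_mul_left]; exact tsum_congr fun a => by ring
      _ ≤ β * ∑' v, g v * (del (v + u) * g v + 2 * β * (g u * g (u + v) ^ 2)) * g (v - y) := by
          gcongr
          exact h.line_sfxs y fun v => del (v + u) * g v + 2 * β * (g u * g (u + v) ^ 2)
      _ = β * (g (y + u) * g u ^ 2 + 2 * β * g u * ∑' v, g v * g (u + v) ^ 2 * g (v - y)) := by
          have : g (y + u) * g u ^ 2 = ∑' v, (g v * g v * g (v - y)) * del (v + u) := by
            rw [tsum_mul_del fun v => g v * g v * g (v - y), h.even,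
              ← h.even (-u - y), show -(-u - y) = y + u by abel]
            ring
          rw [this, ← ENNReal.tsum_mul_left (a := 2 * β * g u), ← ENNReal.tsum_add]
          congr 1
          exact tsum_congr fun v => by ring
      _ ≤ β * (g (y + u) * g u ^ 2 + 2 * β * g u * (8 * K ^ 2 * B * (g (y + u) * g u))) := by
          gcongr; exact h.triple y u
      _ = β * ((1 + β * (16 * K ^ 2 * B)) * (g (y + u) * g u ^ 2)) := by ring
      _ ≤ β * ((1 + 1) * (g (y + u) * g u ^ 2)) := by gcongr
      _ = _ := by ring

end IsLine
end WSAW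

namespace WSAW
open scoped ENNReal

variable {S Γ : Type*} [AddCommGroup Γ]

/-- Walks that are long, in a sense stable under concatenation. -/
structure IsLong (D : List S → Γ) (k bad ℓ₀ ℓ₁ : List S → ℝ≥0∞) (θ : ℝ≥0∞) : Prop where
  bad_le : ∀ l, bad l ≤ del (D l) * ℓ₀ l
  bad_append : ∀ a b, bad (a ++ b) ≤ del (D b + D a) * (ℓ₀ a + ℓ₀ b)
  append : ∀ a b, ℓ₀ (a ++ b) ≤ ℓ₁ a + ℓ₁ b
  le : ∀ l, ℓ₀ l ≤ ℓ₁ l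
  long : ∀ F : Γ → ℝ≥0∞, ∑' l, k l * ℓ₁ l * F (D l) ≤ θ * ∑' x, F x

/-- Bound on the difference of two edge kernels. -/
def DiffBound (D : List S → Γ) (k bad : List S → ℝ≥0∞) (β : ℝ≥0∞)
    (qd : List S → List S → ℝ≥0∞) : Prop :=
  ∀ a t, qd a t ≤ β * ((sfxs a).map fun s => bad (s ++ t)).sum * k t +
    β ^ 2 * ((sfxs a).map fun s => del (D t + D s)).sum *
      (((pfxs t).map fun p => ((sfxs a).map fun s => bad (s ++ p)).sum).sum +
        ((sfxs t).map fun u => ((pfxs u).map bad).sum).sum) * k t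

section

variable {D : List S → Γ} {k bad ℓ₀ ℓ₁ : List S → ℝ≥0∞} {g : Γ → ℝ≥0∞} {K B β θ : ℝ≥0∞}

theorem IsLong.long_zero (hl : IsLong D k bad ℓ₀ ℓ₁ θ) (F : Γ → ℝ≥0∞) :
    ∑' l, k l * ℓ₀ l * F (D l) ≤ θ * ∑' x, F x := by
  refine le_trans ?_ (hl.long F)
  gcongr with l
  exact hl.le l

namespace IsLine

/-- A long line carrying one mark. -/
theorem long_dressed (h : IsLine D k g K B) (hl : IsLong D k bad ℓ₀ ℓ₁ θ) (c : Γ)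
    (F : Γ → ℝ≥0∞) :
    ∑' l, k l * ℓ₀ l * (1 + mark D g c l) * F (D l) ≤ (1 + 4 * B) * θ * ∑' x, F x := by
  have h1 : ∑' l, k l * ℓ₀ l * mark D g c l * F (D l) ≤ 4 * B * θ * ∑' x, F x := by
    calc _ = ∑' l, ((sfxs l).map fun s => k l * ℓ₀ l * F (D l) * g (D s + c)).sum := by
          refine tsum_congr fun l => ?_
          rw [List.sum_map_mul_left, mark]; ring
      _ ≤ ∑' s, ∑' b, k (b ++ s) * ℓ₀ (b ++ s) * F (D (b ++ s)) * g (D s + c) :=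
          tsum_sfxs_le fun l s => k l * ℓ₀ l * F (D l) * g (D s + c)
      _ ≤ ∑' s, ∑' b, (k b * k s) * (ℓ₁ b + ℓ₁ s) * F (D b + D s) * g (D s + c) := by
          gcongr with s b
          · exact h.k_append b s
          · exact hl.append b s
          · rw [h.D_append]
      _ = ∑' s, k s * (g (D s + c) * ∑' b, k b * ℓ₁ b * F (D b + D s)) +
            ∑' s, k s * ℓ₁ s * (g (D s + c) * ∑' b, k b * F (D b + D s)) := by
          rw [← ENNReal.tsum_add]
          refine tsum_congr fun s => ?_
          rw [← ENNReal.tsum_mul_left, ← ENNReal.tsum_mul_left, ← ENNReal.tsum_mul_left,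
            ← ENNReal.tsum_mul_left, ← ENNReal.tsum_add]
          exact tsum_congr fun b => by ring
      _ ≤ ∑' s, k s * (g (D s + c) * (θ * ∑' x, F x)) +
            ∑' s, k s * ℓ₁ s * (g (D s + c) * ∑' x, g x * F (x + D s)) := by
          gcongr with s s
          · refine (hl.long fun x => F (x + D s)).trans (le_of_eq ?_)
            rw [← (Equiv.addRight (D s)).tsum_eq F]; rfl
          · exact h.line fun x => F (x + D s)
      _ ≤ ∑' x, g x * (g (x + c) * (θ * ∑' x, F x)) +
            θ * ∑' y, (g (y + c) * ∑' x, g x * F (x + y)) :=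
          add_le_add (h.line fun x => g (x + c) * (θ * ∑' x, F x))
            (hl.long fun y => g (y + c) * ∑' x, g x * F (x + y))
      _ = (θ * ∑' x, F x) * ∑' x, g x * g (x + c) + θ * ∑' u, F u * ∑' y, g (y + c) * g (u - y) := by
          congr 1
          · rw [← ENNReal.tsum_mul_left (a := θ * ∑' x, F x)]
            exact tsum_congr fun x => by ring
          · congr 1
            calc _ = ∑' y, ∑' u, g (y + c) * (g (u - y) * F u) := by
                  refine tsum_congr fun y => ?_
                  rw [← ENNReal.tsum_mul_left, ← (Equiv.subRight y).tsum_eq]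
                  simp
              _ = _ := by
                  rw [ENNReal.tsum_comm]
                  refine tsum_congr fun u => ?_
                  rw [← ENNReal.tsum_mul_left]
                  exact tsum_congr fun y => by ring
      _ ≤ (θ * ∑' x, F x) * (2 * B) + θ * ∑' u, F u * (2 * B) := by
          gcongr with u
          · exact h.bubble (fun _ _ => id) (add_left_injective c)
          · exact h.bubble (add_left_injective c) sub_right_injective
      _ = _ := by rw [ENNReal.tsum_mul_right]; ring
  calc _ = ∑' l, k l * ℓ₀ l * F (D l) + ∑' l, k l * ℓ₀ l * mark D g c l * F (D l) := by
        rw [← ENNReal.tsum_add]; exact tsum_congr fun y => by ring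
    _ ≤ θ * ∑' x, F x + 4 * B * θ * ∑' x, F x := add_le_add (hl.long_zero F) h1
    _ = _ := by ring

theorem long_dressed_del (h : IsLine D k g K B) (hl : IsLong D k bad ℓ₀ ℓ₁ θ) (c y : Γ) :
    ∑' l, k l * ℓ₀ l * (1 + mark D g c l) * del (D l + y) ≤ (1 + 4 * B) * θ := by
  have h0 : ∑' x : Γ, del (x + y) = 1 := by simpa using tsum_mul_del (fun _ => 1) y
  have := h.long_dressed hl c fun x => del (x + y)
  rwa [h0, mul_one] at this

/-- A marked line ending at `-y`, either itself long or attached to a long piece. -/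
theorem dressed_either (h : IsLine D k g K B) (hl : IsLong D k bad ℓ₀ ℓ₁ θ) (c y : Γ) (e : ℝ≥0∞) :
    ∑' l, k l * (1 + mark D g c l) * ((e + ℓ₀ l) * del (D l + y)) ≤
      e * ((1 + 4 * K * B) * g y) + (1 + 4 * B) * θ := by
  calc _ = e * ∑' l, k l * (1 + mark D g c l) * del (D l + y) +
        ∑' l, k l * ℓ₀ l * (1 + mark D g c l) * del (D l + y) := by
        rw [← ENNReal.tsum_mul_left, ← ENNReal.tsum_add]
        exact tsum_congr fun l => by ring
    _ ≤ _ := by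
        gcongr
        · exact h.dressed_del c y
        · exact h.long_dressed_del hl c y

/-- The long edge attached to the previous piece of the walk. -/
theorem diff_edge (h : IsLine D k g K B) (hl : IsLong D k bad ℓ₀ ℓ₁ θ) (a : List S) :
    ∑' t, ((sfxs a).map fun s => bad (s ++ t)).sum * k t * (1 + mark D g 0 t) ≤
      ((sfxs a).map fun s => ℓ₀ s * ((1 + 4 * K * B) * g (D s)) + (1 + 4 * B) * θ).sum := by
  calc _ = ((sfxs a).map fun s => ∑' t, k t * (1 + mark D g 0 t) * bad (s ++ t)).sum := by
        rw [← tsum_list_sum]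
        refine tsum_congr fun t => ?_
        rw [List.sum_map_mul_left]; ring
    _ ≤ _ := list_sum_le _ _ _ fun s _ => by
        refine le_trans ?_ (h.dressed_either hl 0 (D s) (ℓ₀ s))
        gcongr with t
        rw [mul_comm]
        exact hl.bad_append s t

/-- A long interaction between the previous piece of the walk and the inside of the edge. -/
theorem diff_prefix (h : IsLine D k g K B) (hl : IsLong D k bad ℓ₀ ℓ₁ θ) (s s' : List S) :
    ∑' t, ((pfxs t).map fun p => k t * (1 + mark D g 0 t) * del (D t + D s) * bad (s' ++ p)).sum ≤
      (1 + 4 * K * B) * g (D s - D s') *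
        (ℓ₀ s' * ((1 + 4 * K * B) * g (D s')) + (1 + 4 * B) * θ) := by
  calc _ ≤ ∑' p, ∑' b, k (p ++ b) * (1 + mark D g 0 (p ++ b)) * del (D (p ++ b) + D s) *
          bad (s' ++ p) :=
        tsum_pfxs_le fun t p => k t * (1 + mark D g 0 t) * del (D t + D s) * bad (s' ++ p)
    _ ≤ ∑' p, ∑' b, k b * (1 + mark D g 0 b) * del (D b + (D s - D s')) *
          (k p * (1 + mark D g (D s' - D s) p) * ((ℓ₀ s' + ℓ₀ p) * del (D p + D s'))) := by
        refine ENNReal.tsum_le_tsum fun p => ENNReal.tsum_le_tsum fun b => ?_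
        calc _ ≤ (k p * k b) * ((1 + mark D g (D b + 0) p) * (1 + mark D g 0 b)) *
              del (D p + D b + D s) * (del (D p + D s') * (ℓ₀ s' + ℓ₀ p)) := by
              gcongr
              · exact h.k_append p b
              · exact h.one_add_mark_append 0 p b
              · rw [h.D_append]
              · exact hl.bad_append s' p
          _ = k p * k b * (1 + mark D g 0 b) * (ℓ₀ s' + ℓ₀ p) * (del (D p + D s') *
              (del (D p + D b + D s) * (1 + mark D g (D b) p))) := by rw [add_zero]; ring
          _ = k p * k b * (1 + mark D g 0 b) * (ℓ₀ s' + ℓ₀ p) * (del (D p + D s') *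
              (del (D b + (D s - D s')) * (1 + mark D g (D s' - D s) p))) := by
              congr 1
              refine del_mul_congr fun h0 => ?_
              rw [eq_neg_of_add_eq_zero_left h0,
                show -D s' + D b + D s = D b + (D s - D s') by abel]
              refine del_mul_congr fun h1 => ?_
              rw [eq_neg_of_add_eq_zero_left h1, neg_sub]
          _ ≤ _ := le_of_eq (by ring)
    _ = (∑' p, k p * (1 + mark D g (D s' - D s) p) * ((ℓ₀ s' + ℓ₀ p) * del (D p + D s'))) *
          ∑' b, k b * (1 + mark D g 0 b) * del (D b + (D s - D s')) := by
        rw [← ENNReal.tsum_mul_right]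
        refine tsum_congr fun p => ?_
        rw [ENNReal.tsum_mul_right, mul_comm]
    _ ≤ (ℓ₀ s' * ((1 + 4 * K * B) * g (D s')) + (1 + 4 * B) * θ) *
          ((1 + 4 * K * B) * g (D s - D s')) :=
        mul_le_mul' (h.dressed_either hl _ _ _) (h.dressed_del _ _)
    _ = _ := mul_comm _ _

/-- A long interaction inside the edge. -/
theorem diff_inside (h : IsLine D k g K B) (hl : IsLong D k bad ℓ₀ ℓ₁ θ) (s : List S) :
    ∑' t, ((sfxs t).map fun u => ((pfxs u).map fun p =>
      k t * (1 + mark D g 0 t) * del (D t + D s) * bad p).sum).sum ≤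
      (1 + 4 * B) * θ * ((1 + 4 * K * B) ^ 2 * (2 * B)) := by
  have h1 : ∀ c, ∑' b, k b * (1 + mark D g (D c) b) * del (D b + (D c + D s)) ≤
      (1 + 4 * K * B) * g (D c + D s) := fun c => h.dressed_del _ _
  have h2 : ∀ c, ∑' p, k p * ℓ₀ p * (1 + mark D g (D c) p) * del (D p) ≤ (1 + 4 * B) * θ :=
    fun c => by simpa using h.long_dressed_del hl (D c) 0
  calc _ ≤ ∑' u, ∑' b, ((pfxs u).map fun p =>
          k (b ++ u) * (1 + mark D g 0 (b ++ u)) * del (D (b ++ u) + D s) * bad p).sum :=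
        tsum_sfxs_le fun t u => ((pfxs u).map fun p =>
          k t * (1 + mark D g 0 t) * del (D t + D s) * bad p).sum
    _ = ∑' b, ∑' u, ((pfxs u).map fun p =>
          k (b ++ u) * (1 + mark D g 0 (b ++ u)) * del (D (b ++ u) + D s) * bad p).sum :=
        ENNReal.tsum_comm
    _ ≤ ∑' b, ∑' p, ∑' c, k (b ++ (p ++ c)) * (1 + mark D g 0 (b ++ (p ++ c))) *
          del (D (b ++ (p ++ c)) + D s) * bad p := by
        refine ENNReal.tsum_le_tsum fun b => ?_
        exact tsum_pfxs_le fun u p =>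
          k (b ++ u) * (1 + mark D g 0 (b ++ u)) * del (D (b ++ u) + D s) * bad p
    _ ≤ ∑' b, ∑' p, ∑' c, (k c * (1 + mark D g 0 c)) *
          ((k p * ℓ₀ p * (1 + mark D g (D c) p) * del (D p)) *
          (k b * (1 + mark D g (D c) b) * del (D b + (D c + D s)))) := by
        refine ENNReal.tsum_le_tsum fun b => ENNReal.tsum_le_tsum fun p =>
          ENNReal.tsum_le_tsum fun c => ?_
        calc _ ≤ (k b * (k p * k c)) * ((1 + mark D g (D (p ++ c) + 0) b) *
              ((1 + mark D g (D c + 0) p) * (1 + mark D g 0 c))) *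
              del (D b + (D p + D c) + D s) * (del (D p) * ℓ₀ p) := by
              gcongr
              · exact (h.k_append _ _).trans (by gcongr; exact h.k_append _ _)
              · exact (h.one_add_mark_append _ _ _).trans
                  (by gcongr; exact h.one_add_mark_append _ _ _)
              · rw [h.D_append, h.D_append]
              · exact hl.bad_le p
          _ = k b * (k p * k c) * (1 + mark D g (D c) p) * (1 + mark D g 0 c) * ℓ₀ p *
              (del (D p) * ((1 + mark D g (D p + D c) b) * del (D b + (D p + D c) + D s))) := by
              rw [add_zero, add_zero, h.D_append]; ring
          _ = k b * (k p * k c) * (1 + mark D g (D c) p) * (1 + mark D g 0 c) * ℓ₀ p *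
              (del (D p) * ((1 + mark D g (D c) b) * del (D b + (D c + D s)))) := by
              congr 1
              refine del_mul_congr fun h0 => ?_
              rw [h0, zero_add, add_assoc]
          _ ≤ _ := le_of_eq (by ring)
    _ = ∑' c, (k c * (1 + mark D g 0 c)) * ((∑' p, k p * ℓ₀ p * (1 + mark D g (D c) p) * del (D p)) *
          ∑' b, k b * (1 + mark D g (D c) b) * del (D b + (D c + D s))) := by
        rw [tsum_congr fun b => ENNReal.tsum_comm, ENNReal.tsum_comm]
        refine tsum_congr fun c => ?_
        rw [ENNReal.tsum_comm, ← ENNReal.tsum_mul_right, ← ENNReal.tsum_mul_left]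
        refine tsum_congr fun p => ?_
        rw [← ENNReal.tsum_mul_left, ← ENNReal.tsum_mul_left]
    _ ≤ ∑' c, (k c * (1 + mark D g 0 c)) * (((1 + 4 * B) * θ) *
          ((1 + 4 * K * B) * g (D c + D s))) := by
        gcongr with c
        · exact h2 c
        · exact h1 c
    _ = (1 + 4 * B) * θ * (1 + 4 * K * B) *
          ∑' c, k c * (1 + mark D g 0 c) * g (D c + D s) := by
        rw [← ENNReal.tsum_mul_left]; exact tsum_congr fun c => by ring
    _ ≤ (1 + 4 * B) * θ * (1 + 4 * K * B) *
          ((1 + 4 * K * B) * (2 * B)) := by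
        gcongr
        refine (h.dressed 0 fun x => g (x + D s)).trans ?_
        gcongr
        exact h.bubble (fun _ _ => id) (add_left_injective _)
    _ = _ := by ring

end IsLine
end
end WSAW

namespace WSAW
open scoped ENNReal

variable {S Γ : Type*} [AddCommGroup Γ]

/-- The constant in the bound on the difference of two expansions. -/
noncomputable def diffConst (K B : ℝ≥0∞) : ℝ≥0∞ :=
  (1 + 4 * K * B) * (2 * B) + (1 + 4 * B) * (2 * B) +
    ((1 + 4 * K * B) * ((1 + 4 * K * B) * (8 * B ^ 2) + 2 * (1 + 4 * B) * (2 * B ^ 2)) +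
      (1 + 4 * B) * ((1 + 4 * K * B) ^ 2 * (2 * B)) * (2 * B))

theorem diffConst_ne_top {K B : ℝ≥0∞} (hK : K ≠ ∞) (hB : B ≠ ∞) : diffConst K B ≠ ∞ := by
  unfold diffConst
  finiteness

/-- The difference of two expansions. -/
noncomputable def dlace (qd q : List S → List S → ℝ≥0∞) : ℕ → List S → List S → ℝ≥0∞
  | 0, _, _ => 0
  | n + 1, a, ρ => ((psplits ρ).map fun p =>
      qd a p.1 * elace q n p.1 p.2 + q a p.1 * dlace qd q n p.1 p.2).sum

section

variable {D : List S → Γ} {k bad ℓ₀ ℓ₁ : List S → ℝ≥0∞} {g : Γ → ℝ≥0∞} {K B β θ : ℝ≥0∞}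
  {q qd : List S → List S → ℝ≥0∞}

namespace IsLine

/-- A line with fixed end-point, summed over its suffixes. -/
theorem line_sfxs' (h : IsLine D k g K B) (y : Γ) (H : List S → ℝ≥0∞) :
    ∑' l, k l * del (D l - y) * ((sfxs l).map H).sum ≤ ∑' s, k s * g (D s - y) * H s := by
  calc _ ≤ ∑' s, k s * H s * ∑' x, g x * del (x + D s - y) :=
        h.tsum_two H (fun x => del (x - y)) (fun l => del (D l - y)) fun s b => by rw [h.D_append]
    _ = _ := by
        refine tsum_congr fun s => ?_
        simp only [add_sub_assoc]
        rw [tsum_mul_del, h.even]; ring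

theorem line_sfxs_const (h : IsLine D k g K B) (y : Γ) (c : ℝ≥0∞) :
    ∑' l, k l * del (D l - y) * ((sfxs l).map fun _ => c).sum ≤ 2 * B * c := by
  refine (h.line_sfxs y fun _ => c).trans ?_
  calc _ = (∑' v, g v * g (v - y)) * c := by
        rw [← ENNReal.tsum_mul_right]; exact tsum_congr fun v => by ring
    _ ≤ _ := by gcongr; exact h.bubble (fun _ _ => id) sub_left_injective

theorem line_sfxs_long (h : IsLine D k g K B) (hl : IsLong D k bad ℓ₀ ℓ₁ θ) (y : Γ) :
    ∑' l, k l * del (D l - y) * ((sfxs l).map fun s => ℓ₀ s * g (D s)).sum ≤ 2 * B * θ := by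
  refine (h.line_sfxs' y _).trans ?_
  calc _ = ∑' s, k s * ℓ₀ s * (g (D s) * g (D s - y)) := tsum_congr fun s => by ring
    _ ≤ θ * ∑' x, g x * g (x - y) := hl.long_zero fun x => g x * g (x - y)
    _ ≤ θ * (2 * B) := by gcongr; exact h.bubble (fun _ _ => id) sub_left_injective
    _ = _ := mul_comm _ _

theorem sum_sq_mul (h : IsLine D k g K B) {f₁ f₂ : Γ → Γ → Γ} (h₁ : ∀ x, (f₁ x).Injective)
    (h₂ : ∀ x, (f₂ x).Injective) : ∑' x, ∑' v, g x ^ 2 * g (f₁ x v) * g (f₂ x v) ≤ 2 * B ^ 2 := by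
  calc _ = ∑' x, g x ^ 2 * ∑' v, g (f₁ x v) * g (f₂ x v) := by
        refine tsum_congr fun x => ?_
        rw [← ENNReal.tsum_mul_left]; exact tsum_congr fun v => by ring
    _ ≤ ∑' x, g x ^ 2 * (2 * B) := by gcongr with x; exact h.bubble (h₁ x) (h₂ x)
    _ ≤ B * (2 * B) := by rw [ENNReal.tsum_mul_right]; gcongr; exact h.sq
    _ = _ := by ring

/-- Two suffixes of a line, one of which is long. -/
theorem line_pair_long (h : IsLine D k g K B) (hl : IsLong D k bad ℓ₀ ℓ₁ θ) (y : Γ) :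
    ∑' l, k l * del (D l - y) * ((sfxs l).map fun s => ((sfxs l).map fun s' =>
      g (D s - D s') * (ℓ₀ s' * g (D s'))).sum).sum ≤ 8 * B ^ 2 * θ := by
  set P : List S → List S → ℝ≥0∞ := fun s s' => g (D s - D s') * (ℓ₀ s' * g (D s')) with hP
  have hQ : ∀ c t, P (c ++ t) t + P t (c ++ t) ≤
      g (D c) * (ℓ₀ t * g (D t) + (ℓ₁ c + ℓ₁ t) * g (D c + D t)) := by
    intro c t
    simp only [hP, h.D_append]
    rw [add_sub_cancel_right, show D t - (D c + D t) = -D c by abel, h.even, mul_add]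
    gcongr
    exact hl.append c t
  calc _ ≤ ∑' l, k l * del (D l - y) *
          ((sfxs l).map fun s => ((sfxs s).map fun t => P s t + P t s).sum).sum := by
        gcongr with l; exact sum_sfxs_pair_le P l
    _ ≤ ∑' s, k s * g (D s - y) * ((sfxs s).map fun t => P s t + P t s).sum := h.line_sfxs' y _
    _ = ∑' s, ((sfxs s).map fun t => k s * g (D s - y) * (P s t + P t s)).sum := by
        simp only [List.sum_map_mul_left]
    _ ≤ ∑' t, ∑' c, k (c ++ t) * g (D (c ++ t) - y) * (P (c ++ t) t + P t (c ++ t)) :=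
        tsum_sfxs_le fun s t => k s * g (D s - y) * (P s t + P t s)
    _ ≤ ∑' t, ∑' c, (k c * k t) * g (D c + D t - y) *
          (g (D c) * (ℓ₀ t * g (D t) + (ℓ₁ c + ℓ₁ t) * g (D c + D t))) := by
        gcongr with t c
        · exact h.k_append c t
        · rw [h.D_append]
        · exact hQ c t
    _ ≤ ∑' t, ∑' c, (k t * ℓ₁ t * (k c * (g (D c) * g (D t) * g (D c + D t - y))) +
          k t * ℓ₁ t * (k c * (g (D c) * g (D c + D t) * g (D c + D t - y))) +
          k c * ℓ₁ c * (k t * (g (D c) * g (D c + D t) * g (D c + D t - y)))) := by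
        refine ENNReal.tsum_le_tsum fun t => ENNReal.tsum_le_tsum fun c => ?_
        calc _ ≤ (k c * k t) * g (D c + D t - y) *
              (g (D c) * (ℓ₁ t * g (D t) + (ℓ₁ c + ℓ₁ t) * g (D c + D t))) := by
              gcongr; exact hl.le t
          _ = _ := by ring
    _ = ∑' t, k t * ℓ₁ t * ∑' c, k c * (g (D c) * g (D t) * g (D c + D t - y)) +
          ∑' t, k t * ℓ₁ t * ∑' c, k c * (g (D c) * g (D c + D t) * g (D c + D t - y)) +
          ∑' c, k c * ℓ₁ c * ∑' t, k t * (g (D c) * g (D c + D t) * g (D c + D t - y)) := by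
        simp only [ENNReal.tsum_add, ENNReal.tsum_mul_left]
        congr 1
        rw [ENNReal.tsum_comm]
        simp only [ENNReal.tsum_mul_left]
    _ ≤ ∑' t, k t * ℓ₁ t * ∑' x, g x * (g x * g (D t) * g (x + D t - y)) +
          ∑' t, k t * ℓ₁ t * ∑' x, g x * (g x * g (x + D t) * g (x + D t - y)) +
          ∑' c, k c * ℓ₁ c * ∑' v, g v * (g (D c) * g (D c + v) * g (D c + v - y)) := by
        gcongr with t t c
        · exact h.line fun x => g x * g (D t) * g (x + D t - y)
        · exact h.line fun x => g x * g (x + D t) * g (x + D t - y)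
        · exact h.line fun v => g (D c) * g (D c + v) * g (D c + v - y)
    _ ≤ θ * (∑' v, ∑' x, g x * (g x * g v * g (x + v - y))) +
          θ * (∑' v, ∑' x, g x * (g x * g (x + v) * g (x + v - y))) +
          θ * (∑' x, ∑' v, g v * (g x * g (x + v) * g (x + v - y))) := by
        gcongr
        · exact hl.long fun v => ∑' x, g x * (g x * g v * g (x + v - y))
        · exact hl.long fun v => ∑' x, g x * (g x * g (x + v) * g (x + v - y))
        · exact hl.long fun x => ∑' v, g v * (g x * g (x + v) * g (x + v - y))
    _ ≤ θ * (2 * B ^ 2) + θ * (2 * B ^ 2) + θ * ((2 * B) * (2 * B)) := by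
        gcongr
        · refine le_trans (le_of_eq ?_) (h.sum_sq_mul (f₁ := fun _ v => v)
            (f₂ := fun x v => x + v - y) (fun _ _ _ => id) (fun x _ _ h => by simpa using h))
          rw [ENNReal.tsum_comm]
          exact tsum_congr fun x => tsum_congr fun v => by ring
        · refine le_trans (le_of_eq ?_) (h.sum_sq_mul (f₁ := fun x v => x + v)
            (f₂ := fun x v => x + v - y) (fun x _ _ h => by simpa using h)
            (fun x _ _ h => by simpa using h))
          rw [ENNReal.tsum_comm]
          exact tsum_congr fun x => tsum_congr fun v => by ring
        · calc _ = ∑' x, ∑' u, g x * g (u - x) * (g u * g (u - y)) := by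
                refine tsum_congr fun x => ?_
                rw [← (Equiv.subRight x).tsum_eq]
                refine tsum_congr fun u => ?_
                simp only [Equiv.subRight_apply, add_sub_cancel]
                ring
            _ = ∑' u, (g u * g (u - y)) * ∑' x, g x * g (u - x) := by
                rw [ENNReal.tsum_comm]
                refine tsum_congr fun u => ?_
                rw [← ENNReal.tsum_mul_left]; exact tsum_congr fun x => by ring
            _ ≤ ∑' u, (g u * g (u - y)) * (2 * B) := by
                gcongr with u; exact h.bubble (fun _ _ => id) sub_right_injective
            _ ≤ _ := by
                rw [ENNReal.tsum_mul_right]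
                gcongr; exact h.bubble (fun _ _ => id) sub_left_injective
    _ = _ := by ring

/-- Two suffixes of a line. -/
theorem line_pair (h : IsLine D k g K B) (y : Γ) :
    ∑' l, k l * del (D l - y) * ((sfxs l).map fun s => ((sfxs l).map fun s' =>
      g (D s - D s')).sum).sum ≤ 2 * (2 * B ^ 2) := by
  calc _ ≤ ∑' l, k l * del (D l - y) * ((sfxs l).map fun s =>
            ((sfxs s).map fun t => g (D s - D t) + g (D t - D s)).sum).sum := by
        gcongr with l; exact sum_sfxs_pair_le (fun s s' => g (D s - D s')) l
    _ ≤ ∑' s, k s * g (D s - y) * ((sfxs s).map fun t => g (D s - D t) + g (D t - D s)).sum :=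
        h.line_sfxs' y _
    _ = ∑' s, ((sfxs s).map fun t => k s * g (D s - y) * (g (D s - D t) + g (D t - D s))).sum := by
        simp only [List.sum_map_mul_left]
    _ ≤ ∑' t, ∑' c, k (c ++ t) * g (D (c ++ t) - y) *
          (g (D (c ++ t) - D t) + g (D t - D (c ++ t))) :=
        tsum_sfxs_le fun s t => k s * g (D s - y) * (g (D s - D t) + g (D t - D s))
    _ ≤ ∑' t, ∑' c, (k c * k t) * g (D c + D t - y) * (2 * g (D c)) := by
        gcongr with t c
        · exact h.k_append c t
        · rw [h.D_append]
        · rw [h.D_append, add_sub_cancel_right, show D t - (D c + D t) = -D c by abel, h.even,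
            two_mul]
    _ = 2 * ∑' t, k t * ∑' c, k c * (g (D c) * g (D c + D t - y)) := by
        rw [← ENNReal.tsum_mul_left]
        refine tsum_congr fun t => ?_
        rw [← ENNReal.tsum_mul_left, ← ENNReal.tsum_mul_left]
        exact tsum_congr fun c => by ring
    _ ≤ 2 * ∑' t, k t * ∑' x, g x * (g x * g (x + D t - y)) := by
        gcongr with t; exact h.line fun x => g x * g (x + D t - y)
    _ ≤ 2 * ∑' v, g v * ∑' x, g x * (g x * g (x + v - y)) := by
        gcongr; exact h.line fun v => ∑' x, g x * (g x * g (x + v - y))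
    _ = 2 * ∑' x, ∑' v, g x ^ 2 * g v * g (x + v - y) := by
        rw [ENNReal.tsum_comm]
        congr 1
        refine tsum_congr fun v => ?_
        rw [← ENNReal.tsum_mul_left]
        exact tsum_congr fun x => by ring
    _ ≤ _ := by
        gcongr
        exact h.sum_sq_mul (fun _ _ _ => id) (fun x _ _ h => by simpa using h)

/-- Total contribution of the difference of two edge kernels. -/
theorem diff_total (h : IsLine D k g K B) (hl : IsLong D k bad ℓ₀ ℓ₁ θ)
    (hqd : DiffBound D k bad β qd) (hβ : β ≤ 1) (y : Γ) :
    ∑' a, k a * del (D a - y) * ∑' t, qd a t * (1 + mark D g 0 t) ≤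
      β * diffConst K B * θ := by
  have hk1 : ∀ a, ∑' t, qd a t * (1 + mark D g 0 t) ≤
      β * (((1 + 4 * K * B) * ((sfxs a).map fun s => ℓ₀ s * g (D s)).sum +
          ((sfxs a).map fun _ => (1 + 4 * B) * θ).sum) +
        ((1 + 4 * K * B) * ((1 + 4 * K * B) * ((sfxs a).map fun s => ((sfxs a).map fun s' =>
          g (D s - D s') * (ℓ₀ s' * g (D s'))).sum).sum + (1 + 4 * B) * θ *
          ((sfxs a).map fun s => ((sfxs a).map fun s' => g (D s - D s')).sum).sum) +
          ((sfxs a).map fun _ => (1 + 4 * B) * θ * ((1 + 4 * K * B) ^ 2 * (2 * B))).sum)) := by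
    intro a
    calc _ ≤ ∑' t, (β * (((sfxs a).map fun s => bad (s ++ t)).sum * k t * (1 + mark D g 0 t)) +
          β * (((sfxs a).map fun s => ((sfxs a).map fun s' => ((pfxs t).map fun p =>
              k t * (1 + mark D g 0 t) * del (D t + D s) * bad (s' ++ p)).sum).sum).sum +
            ((sfxs a).map fun s => ((sfxs t).map fun u => ((pfxs u).map fun p =>
              k t * (1 + mark D g 0 t) * del (D t + D s) * bad p).sum).sum).sum)) := by
          refine ENNReal.tsum_le_tsum fun t => ?_
          have hb : β ^ 2 ≤ β := by
            rw [pow_two]; exact (mul_le_mul' hβ le_rfl).trans_eq (one_mul _)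
          have hc : ∀ s, ((sfxs a).map fun s' => ((pfxs t).map fun p =>
              k t * (1 + mark D g 0 t) * del (D t + D s) * bad (s' ++ p)).sum).sum =
              del (D t + D s) * (k t * (1 + mark D g 0 t) *
                ((pfxs t).map fun p => ((sfxs a).map fun s' => bad (s' ++ p)).sum).sum) := by
            intro s
            have hcomm : ((sfxs a).map fun s' => ((pfxs t).map fun p => bad (s' ++ p)).sum).sum =
                ((pfxs t).map fun p => ((sfxs a).map fun s' => bad (s' ++ p)).sum).sum := by
              generalize sfxs a = l
              induction l with
              | nil => simp
              | cons x l ih => simp [ih, List.sum_map_add]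
            simp only [List.sum_map_mul_left, hcomm]; ring
          have hd : ∀ s, ((sfxs t).map fun u => ((pfxs u).map fun p =>
              k t * (1 + mark D g 0 t) * del (D t + D s) * bad p).sum).sum =
              del (D t + D s) * (k t * (1 + mark D g 0 t) *
                ((sfxs t).map fun u => ((pfxs u).map bad).sum).sum) := by
            intro s
            simp only [List.sum_map_mul_left]; ring
          simp only [hc, hd, List.sum_map_mul_right]
          refine (mul_le_mul' (hqd a t) le_rfl).trans ?_
          calc _ ≤ (β * ((sfxs a).map fun s => bad (s ++ t)).sum * k t +
                β * ((sfxs a).map fun s => del (D t + D s)).sum *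
                (((pfxs t).map fun p => ((sfxs a).map fun s => bad (s ++ p)).sum).sum +
                  ((sfxs t).map fun u => ((pfxs u).map bad).sum).sum) * k t) *
                (1 + mark D g 0 t) := by gcongr
            _ = _ := by ring
      _ ≤ _ := by
          rw [ENNReal.tsum_add, ENNReal.tsum_mul_left, ENNReal.tsum_mul_left, ENNReal.tsum_add,
            ← mul_add]
          refine mul_le_mul' le_rfl (add_le_add ?_ (add_le_add ?_ ?_))
          · refine (h.diff_edge hl a).trans (le_of_eq ?_)
            rw [List.sum_map_add, ← List.sum_map_mul_left]
            congr 2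
            exact List.map_congr_left fun s _ => by ring
          · simp only [tsum_list_sum]
            refine (list_sum_le _ _ _ fun s _ => list_sum_le _ _ _ fun s' _ =>
              h.diff_prefix hl s s').trans (le_of_eq ?_)
            simp only [← List.sum_map_mul_left, ← List.sum_map_add]
            congr 1
            refine List.map_congr_left fun s _ => ?_
            congr 1
            exact List.map_congr_left fun s' _ => by ring
          · rw [tsum_list_sum]
            exact list_sum_le _ _ _ fun s _ => h.diff_inside hl s
  calc _ ≤ ∑' a, k a * del (D a - y) * (β * (((1 + 4 * K * B) * ((sfxs a).map fun s => ℓ₀ s * g (D s)).sum +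
          ((sfxs a).map fun _ => (1 + 4 * B) * θ).sum) +
        ((1 + 4 * K * B) * ((1 + 4 * K * B) * ((sfxs a).map fun s => ((sfxs a).map fun s' =>
          g (D s - D s') * (ℓ₀ s' * g (D s'))).sum).sum + (1 + 4 * B) * θ *
          ((sfxs a).map fun s => ((sfxs a).map fun s' => g (D s - D s')).sum).sum) +
          ((sfxs a).map fun _ => (1 + 4 * B) * θ * ((1 + 4 * K * B) ^ 2 * (2 * B))).sum))) := by
        gcongr with a; exact hk1 a
    _ = β * (((1 + 4 * K * B) * (∑' a, k a * del (D a - y) * ((sfxs a).map fun s => ℓ₀ s * g (D s)).sum) +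
          (∑' a, k a * del (D a - y) * ((sfxs a).map fun _ => (1 + 4 * B) * θ).sum)) +
        ((1 + 4 * K * B) * ((1 + 4 * K * B) * (∑' a, k a * del (D a - y) * ((sfxs a).map fun s => ((sfxs a).map fun s' =>
          g (D s - D s') * (ℓ₀ s' * g (D s'))).sum).sum) + (1 + 4 * B) * θ *
          (∑' a, k a * del (D a - y) * ((sfxs a).map fun s => ((sfxs a).map fun s' => g (D s - D s')).sum).sum)) +
          (∑' a, k a * del (D a - y) * ((sfxs a).map fun _ => (1 + 4 * B) * θ * ((1 + 4 * K * B) ^ 2 * (2 * B))).sum))) := by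
        simp only [← ENNReal.tsum_mul_left, ← ENNReal.tsum_add]
        exact tsum_congr fun a => by ring
    _ ≤ β * (((1 + 4 * K * B) * (2 * B * θ) + 2 * B * ((1 + 4 * B) * θ)) +
        ((1 + 4 * K * B) * ((1 + 4 * K * B) * (8 * B ^ 2 * θ) + (1 + 4 * B) * θ *
          (2 * (2 * B ^ 2))) + 2 * B * ((1 + 4 * B) * θ * ((1 + 4 * K * B) ^ 2 * (2 * B))))) := by
        gcongr
        · exact h.line_sfxs_long hl y
        · exact h.line_sfxs_const y _
        · exact h.line_pair_long hl y
        · exact h.line_pair y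
        · exact h.line_sfxs_const y _
    _ = _ := by unfold diffConst; ring

end IsLine
end
end WSAW

namespace WSAW
open scoped ENNReal

variable {S Γ : Type*} [AddCommGroup Γ]

section

variable {D : List S → Γ} {k bad ℓ₀ ℓ₁ : List S → ℝ≥0∞} {g : Γ → ℝ≥0∞} {K B β θ : ℝ≥0∞}
  {q qd : List S → List S → ℝ≥0∞}

/-- The difference of two expansions is small. -/
theorem IsLine.tsum_dlace (h : IsLine D k g K B) (hq : EdgeBound D k β q)
    (hl : IsLong D k bad ℓ₀ ℓ₁ θ) (hqd : DiffBound D k bad β qd)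
    (hβ : β * (1 + 4 * K * B) ≤ 1) (hβ' : β * (4 * B) ≤ 1) (n : ℕ) (y : Γ) :
    ∑' a, k a * del (D a - y) * ∑' ρ, dlace qd q n a ρ ≤ 2 * (β * diffConst K B * θ) := by
  have hβ1 : β ≤ 1 := le_trans (le_mul_of_one_le_right' le_self_add) hβ
  set E := β * diffConst K B * θ
  induction n generalizing y with
  | zero => simp [dlace]
  | succ n ih =>
    have h1 : ∀ a, ∑' ρ, dlace qd q (n + 1) a ρ ≤ ∑' t, qd a t * (1 + mark D g 0 t) +
        β * ((sfxs a).map fun _ => 2 * E).sum := by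
      intro a
      calc _ ≤ ∑' ρ, ((splits ρ).map fun p =>
              qd a p.1 * elace q n p.1 p.2 + q a p.1 * dlace qd q n p.1 p.2).sum :=
            ENNReal.tsum_le_tsum fun ρ => sum_psplits_le (fun t r =>
              qd a t * elace q n t r + q a t * dlace qd q n t r) ρ
        _ = ∑' t, qd a t * ∑' ρ, elace q n t ρ + ∑' t, q a t * ∑' ρ, dlace qd q n t ρ := by
            rw [tsum_splits fun t r => qd a t * elace q n t r + q a t * dlace qd q n t r]
            simp only [ENNReal.tsum_add, ENNReal.tsum_mul_left]
        _ ≤ _ := by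
            gcongr with t
            · exact h.tsum_elace_le hq hβ n t
            · refine h.tsum_edge_le hq a _ (fun _ => 2 * E) fun y => ?_
              refine le_trans (le_of_eq (tsum_congr fun t => ?_)) (ih (-y))
              rw [sub_neg_eq_add]; ring
    calc _ ≤ ∑' a, k a * del (D a - y) * (∑' t, qd a t * (1 + mark D g 0 t) +
            β * ((sfxs a).map fun _ => 2 * E).sum) := by gcongr with a; exact h1 a
      _ = ∑' a, k a * del (D a - y) * ∑' t, qd a t * (1 + mark D g 0 t) +
            β * ∑' a, k a * del (D a - y) * ((sfxs a).map fun _ => 2 * E).sum := by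
          rw [← ENNReal.tsum_mul_left, ← ENNReal.tsum_add]
          exact tsum_congr fun a => by ring
      _ ≤ E + β * (2 * B * (2 * E)) := by
          gcongr
          · exact h.diff_total hl hqd hβ1 y
          · exact h.line_sfxs_const y _
      _ = E + β * (4 * B) * E := by ring
      _ ≤ E + 1 * E := by gcongr
      _ = _ := by ring

end

section Real

variable {w w' wZ wT wV : List S → ℝ} {ζ : ℝ≥0∞}

theorem ofReal_abs_list_sum_le {A : Type*} (l : List A) (f : A → ℝ) :
    ENNReal.ofReal |(l.map f).sum| ≤ (l.map fun x => ENNReal.ofReal |f x|).sum := by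
  induction l with
  | nil => simp
  | cons x l ih =>
    simp only [List.map_cons, List.sum_cons]
    exact (ENNReal.ofReal_le_ofReal (abs_add_le _ _)).trans
      ((ENNReal.ofReal_add_le).trans (add_le_add le_rfl ih))

theorem list_sum_map_sub {A : Type*} (l : List A) (f f' : A → ℝ) :
    (l.map fun x => f x - f' x).sum = (l.map f).sum - (l.map f').sum := by
  induction l with
  | nil => simp
  | cons x l ih => simp [ih]; ring

theorem lace_le_elace {q : List S → List S → ℝ≥0∞}
    (hq : ∀ a t, ENNReal.ofReal |edgeKer w a t| * ζ ^ t.length ≤ q a t) (n : ℕ) (a ρ : List S) :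
    ENNReal.ofReal |lace w n a ρ| * ζ ^ ρ.length ≤ elace q n a ρ := by
  induction n generalizing a ρ with
  | zero => simp only [lace, elace]; split_ifs with h <;> simp [h]
  | succ n ih =>
    simp only [lace, elace]
    refine (mul_le_mul' ((ENNReal.ofReal_le_ofReal (abs_add_le _ _)).trans
      ENNReal.ofReal_add_le) le_rfl).trans ?_
    rw [add_mul]
    gcongr
    · split_ifs with h <;> simp [h]
    · refine (mul_le_mul' (ofReal_abs_list_sum_le _ _) le_rfl).trans ?_
      rw [← List.sum_map_mul_right]
      refine list_sum_le _ _ _ fun p hp => ?_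
      rw [abs_mul, ENNReal.ofReal_mul (abs_nonneg _), ← (mem_psplits hp).1, List.length_append,
        pow_add]
      calc _ = (ENNReal.ofReal |edgeKer w a p.1| * ζ ^ p.1.length) *
            (ENNReal.ofReal |lace w n p.1 p.2| * ζ ^ p.2.length) := by ring
        _ ≤ _ := mul_le_mul' (hq _ _) (ih _ _)

theorem sub_le_dlace {q qd : List S → List S → ℝ≥0∞}
    (hq : ∀ a t, ENNReal.ofReal |edgeKer w a t| * ζ ^ t.length ≤ q a t)
    (hq' : ∀ a t, ENNReal.ofReal |edgeKer w' a t| * ζ ^ t.length ≤ q a t)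
    (hqd : ∀ a t, ENNReal.ofReal |edgeKer w' a t - edgeKer w a t| * ζ ^ t.length ≤ qd a t)
    (n : ℕ) (a ρ : List S) :
    ENNReal.ofReal |lace w' n a ρ - lace w n a ρ| * ζ ^ ρ.length ≤ dlace qd q n a ρ := by
  induction n generalizing a ρ with
  | zero => simp [lace, dlace]
  | succ n ih =>
    simp only [lace, dlace]
    rw [add_sub_add_left_eq_sub]
    have : ((psplits ρ).map fun p => edgeKer w' a p.1 * lace w' n p.1 p.2).sum -
        ((psplits ρ).map fun p => edgeKer w a p.1 * lace w n p.1 p.2).sum =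
        ((psplits ρ).map fun p => (edgeKer w' a p.1 - edgeKer w a p.1) * lace w' n p.1 p.2 +
          edgeKer w a p.1 * (lace w' n p.1 p.2 - lace w n p.1 p.2)).sum := by
      rw [← list_sum_map_sub]
      congr 1
      exact List.map_congr_left fun p _ => by ring
    rw [this]
    refine (mul_le_mul' (ofReal_abs_list_sum_le _ _) le_rfl).trans ?_
    rw [← List.sum_map_mul_right]
    refine list_sum_le _ _ _ fun p hp => ?_
    rw [← (mem_psplits hp).1, List.length_append, pow_add]
    refine (mul_le_mul' ((ENNReal.ofReal_le_ofReal (abs_add_le _ _)).trans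
      ENNReal.ofReal_add_le) le_rfl).trans ?_
    rw [abs_mul, abs_mul, ENNReal.ofReal_mul (abs_nonneg _), ENNReal.ofReal_mul (abs_nonneg _)]
    calc _ = (ENNReal.ofReal |edgeKer w' a p.1 - edgeKer w a p.1| * ζ ^ p.1.length) *
            (ENNReal.ofReal |lace w' n p.1 p.2| * ζ ^ p.2.length) +
            (ENNReal.ofReal |edgeKer w a p.1| * ζ ^ p.1.length) *
            (ENNReal.ofReal |lace w' n p.1 p.2 - lace w n p.1 p.2| * ζ ^ p.2.length) := by ring
      _ ≤ _ := by
        gcongr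
        · exact hqd _ _
        · exact lace_le_elace hq' n _ _
        · exact hq _ _
        · exact ih _ _

theorem inter_mem (hw : ∀ l, 0 ≤ w l ∧ w l ≤ 1) (a p : List S) :
    0 ≤ inter w a p ∧ inter w a p ≤ 1 :=
  list_prod_mem_unit _ _ fun _ _ => hw _

theorem wt_mem (hw : ∀ l, 0 ≤ w l ∧ w l ≤ 1) (l : List S) : 0 ≤ wt w l ∧ wt w l ≤ 1 :=
  list_prod_mem_unit _ _ fun _ _ => list_prod_mem_unit _ _ fun _ _ => hw _

theorem prod_inter_mem (hw : ∀ l, 0 ≤ w l ∧ w l ≤ 1) (a : List S) (l : List (List S)) :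
    0 ≤ (l.map (inter w a)).prod ∧ (l.map (inter w a)).prod ≤ 1 :=
  list_prod_mem_unit _ _ fun _ _ => inter_mem hw _ _

theorem wt_append_le (hw : ∀ l, 0 ≤ w l ∧ w l ≤ 1) (a b : List S) :
    wt w (a ++ b) ≤ wt w a * wt w b := by
  rw [wt_append]
  have h1 := wt_mem hw a
  have h2 := wt_mem hw b
  have h3 := prod_inter_mem hw a (pfxs b)
  exact mul_le_mul_of_nonneg_right (mul_le_of_le_one_right h1.1 h3.2) h2.1

theorem ofReal_one_sub_inter_le {β : ℝ≥0∞} {b : List S → ℝ≥0∞} (hw : ∀ l, 0 ≤ w l ∧ w l ≤ 1)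
    (hb : ∀ l, ENNReal.ofReal (1 - w l) ≤ β * b l) (a p : List S) :
    ENNReal.ofReal (1 - inter w a p) ≤ β * ((sfxs a).map fun s => b (s ++ p)).sum := by
  rw [← List.sum_map_mul_left]
  exact (ofReal_one_sub_list_prod_le _ _ fun _ _ => hw _).trans
    (list_sum_le _ _ _ fun s _ => hb _)

theorem abs_edgeKer_le (hw : ∀ l, 0 ≤ w l ∧ w l ≤ 1) (a t : List S) :
    |edgeKer w a t| ≤ (1 - inter w a t) * wt w t := by
  have h1 := inter_mem hw a t
  have h2 := wt_mem hw t
  have h3 := prod_inter_mem hw a (pfxs t.dropLast)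
  rw [edgeKer, abs_mul, abs_mul, abs_of_nonneg h2.1, abs_of_nonneg h3.1, abs_sub_comm,
    abs_of_nonneg (by linarith)]
  exact mul_le_mul_of_nonneg_right (mul_le_of_le_one_right (by linarith) h3.2) h2.1

theorem edgeKer_bound {D : List S → Γ} {k : List S → ℝ≥0∞} {β : ℝ≥0∞}
    (hD : ∀ a b, D (a ++ b) = D a + D b) (hw : ∀ l, 0 ≤ w l ∧ w l ≤ 1)
    (hb : ∀ l, ENNReal.ofReal (1 - w l) ≤ β * del (D l))
    (hk : ∀ l, ENNReal.ofReal (wt w l) * ζ ^ l.length ≤ k l) (a t : List S) :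
    ENNReal.ofReal |edgeKer w a t| * ζ ^ t.length ≤
      β * ((sfxs a).map fun s => del (D t + D s)).sum * k t := by
  have h1 := inter_mem hw a t
  calc _ ≤ ENNReal.ofReal ((1 - inter w a t) * wt w t) * ζ ^ t.length := by
        gcongr; exact abs_edgeKer_le hw a t
    _ = ENNReal.ofReal (1 - inter w a t) * (ENNReal.ofReal (wt w t) * ζ ^ t.length) := by
        rw [ENNReal.ofReal_mul (by linarith), mul_assoc]
    _ ≤ _ := by
        gcongr
        · refine (ofReal_one_sub_inter_le hw hb a t).trans ?_
          simp only [hD, add_comm (D t)]; rfl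
        · exact hk t

theorem wt_mul (hwT : ∀ l, wT l = wZ l * wV l) (l : List S) : wt wT l = wt wZ l * wt wV l := by
  obtain rfl : wT = fun l => wZ l * wV l := funext hwT
  simp only [wt, List.prod_map_mul]

theorem inter_mul (hwT : ∀ l, wT l = wZ l * wV l) (a p : List S) :
    inter wT a p = inter wZ a p * inter wV a p := by
  simp only [inter, ← List.prod_map_mul, hwT]

theorem pfxs_dropLast_sublist (t : List S) : (pfxs t.dropLast).Sublist (pfxs t) := by
  induction t with
  | nil => simp [pfxs]
  | cons e t ih =>
    cases t with
    | nil => simp [pfxs]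
    | cons x t =>
      simp only [List.dropLast_cons_cons, pfxs, List.map_cons, List.map_map] at ih ⊢
      simpa [pfxs] using ih.map (List.cons e)

theorem abs_edgeKer_sub_le (hwT : ∀ l, wT l = wZ l * wV l) (hZ : ∀ l, 0 ≤ wZ l ∧ wZ l ≤ 1)
    (hV : ∀ l, 0 ≤ wV l ∧ wV l ≤ 1) (a t : List S) :
    |edgeKer wT a t - edgeKer wZ a t| ≤ ((1 - inter wV a t) + (1 - inter wZ a t) *
      ((1 - ((pfxs t.dropLast).map (inter wV a)).prod) + (1 - wt wV t))) * wt wZ t := by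
  have i1 := inter_mem hZ a t
  have i2 := inter_mem hV a t
  have k1 := wt_mem hZ t
  have k2 := wt_mem hV t
  have p1 := prod_inter_mem hZ a (pfxs t.dropLast)
  have p2 := prod_inter_mem hV a (pfxs t.dropLast)
  have hp : ((pfxs t.dropLast).map (inter wT a)).prod =
      ((pfxs t.dropLast).map (inter wZ a)).prod * ((pfxs t.dropLast).map (inter wV a)).prod := by
    rw [← List.prod_map_mul]
    congr 1
    exact List.map_congr_left fun p _ => inter_mul hwT a p
  simp only [edgeKer, hp, wt_mul hwT, inter_mul hwT]
  generalize inter wZ a t = I at *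
  generalize inter wV a t = J at *
  generalize ((pfxs t.dropLast).map (inter wZ a)).prod = P at *
  generalize ((pfxs t.dropLast).map (inter wV a)).prod = Q at *
  generalize wt wZ t = k at *
  generalize wt wV t = m at *
  have e : (I * J - 1) * (P * Q) * (k * m) - (I - 1) * P * k =
      (-(I * (1 - J) * P * Q * m) + (1 - I) * P * (1 - Q * m)) * k := by ring
  rw [e, abs_mul, abs_of_nonneg k1.1]
  refine mul_le_mul_of_nonneg_right ?_ k1.1
  refine (abs_add_le _ _).trans (add_le_add ?_ ?_)
  · have h0 : 0 ≤ I * P * Q * m := by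
      have := i1.1; have := p1.1; have := p2.1; have := k2.1; positivity
    have h1 : I * P * Q * m ≤ 1 := by
      refine mul_le_one₀ (mul_le_one₀ (mul_le_one₀ i1.2 p1.1 p1.2) p2.1 p2.2) k2.1 k2.2
    rw [abs_neg, show I * (1 - J) * P * Q * m = I * P * Q * m * (1 - J) by ring,
      abs_of_nonneg (mul_nonneg h0 (by linarith))]
    nlinarith
  · have h2 : Q * m ≤ 1 := mul_le_one₀ p2.2 k2.1 k2.2
    have h3 : 1 - Q * m ≤ (1 - Q) + (1 - m) := by nlinarith
    have h4 : 0 ≤ 1 - I := by linarith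
    rw [abs_of_nonneg (mul_nonneg (mul_nonneg h4 p1.1) (by linarith)), mul_assoc]
    refine mul_le_mul_of_nonneg_left ?_ h4
    nlinarith

theorem edgeKer_diff_bound {D : List S → Γ} {k bad : List S → ℝ≥0∞} {β : ℝ≥0∞}
    (hD : ∀ a b, D (a ++ b) = D a + D b)
    (hwT : ∀ l, wT l = wZ l * wV l) (hZ : ∀ l, 0 ≤ wZ l ∧ wZ l ≤ 1)
    (hV : ∀ l, 0 ≤ wV l ∧ wV l ≤ 1)
    (hbZ : ∀ l, ENNReal.ofReal (1 - wZ l) ≤ β * del (D l))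
    (hbV : ∀ l, ENNReal.ofReal (1 - wV l) ≤ β * bad l)
    (hk : ∀ l, ENNReal.ofReal (wt wZ l) * ζ ^ l.length ≤ k l) :
    DiffBound D k bad β fun a t =>
      ENNReal.ofReal |edgeKer wT a t - edgeKer wZ a t| * ζ ^ t.length := by
  intro a t
  have i1 := inter_mem hZ a t
  have i2 := inter_mem hV a t
  have k1 := wt_mem hZ t
  have k2 := wt_mem hV t
  have p2 := prod_inter_mem hV a (pfxs t.dropLast)
  have e1 := ofReal_one_sub_inter_le hV hbV a t
  have e2 : ENNReal.ofReal (1 - inter wZ a t) ≤ β * ((sfxs a).map fun s => del (D t + D s)).sum := by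
    refine (ofReal_one_sub_inter_le hZ hbZ a t).trans ?_
    simp only [hD, add_comm (D t)]; rfl
  have e3 : ENNReal.ofReal (1 - ((pfxs t.dropLast).map (inter wV a)).prod) ≤
      β * ((pfxs t).map fun p => ((sfxs a).map fun s => bad (s ++ p)).sum).sum := by
    refine (ofReal_one_sub_list_prod_le _ _ fun _ _ => inter_mem hV _ _).trans ?_
    rw [← List.sum_map_mul_left]
    refine le_trans (list_sum_le _ _ _ fun p _ => ofReal_one_sub_inter_le hV hbV a p) ?_
    exact ((pfxs_dropLast_sublist t).map _).sum_le_sum fun _ _ => zero_le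
  have e4 : ENNReal.ofReal (1 - wt wV t) ≤
      β * ((sfxs t).map fun u => ((pfxs u).map bad).sum).sum := by
    refine (ofReal_one_sub_list_prod_le _ _ fun _ _ =>
      list_prod_mem_unit _ _ fun _ _ => hV _).trans ?_
    simp only [← List.sum_map_mul_left]
    refine list_sum_le _ _ _ fun u _ => ?_
    exact (ofReal_one_sub_list_prod_le _ _ fun _ _ => hV _).trans
      (list_sum_le _ _ _ fun s _ => hbV _)
  calc _ ≤ ENNReal.ofReal (((1 - inter wV a t) + (1 - inter wZ a t) *
      ((1 - ((pfxs t.dropLast).map (inter wV a)).prod) + (1 - wt wV t))) * wt wZ t) *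
        ζ ^ t.length := by exact mul_le_mul' (ENNReal.ofReal_le_ofReal (abs_edgeKer_sub_le hwT hZ hV a t)) le_rfl
    _ = (ENNReal.ofReal (1 - inter wV a t) + ENNReal.ofReal (1 - inter wZ a t) *
        (ENNReal.ofReal (1 - ((pfxs t.dropLast).map (inter wV a)).prod) +
          ENNReal.ofReal (1 - wt wV t))) * (ENNReal.ofReal (wt wZ t) * ζ ^ t.length) := by
        rw [ENNReal.ofReal_mul' k1.1, ENNReal.ofReal_add (by linarith)
          (mul_nonneg (by linarith) (by linarith)), ENNReal.ofReal_mul (by linarith),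
          ENNReal.ofReal_add (by linarith) (by linarith), mul_assoc]
    _ ≤ (β * ((sfxs a).map fun s => bad (s ++ t)).sum +
        β * ((sfxs a).map fun s => del (D t + D s)).sum *
        (β * ((pfxs t).map fun p => ((sfxs a).map fun s => bad (s ++ p)).sum).sum +
          β * ((sfxs t).map fun u => ((pfxs u).map bad).sum).sum)) * k t := by
        exact mul_le_mul' (add_le_add e1 (mul_le_mul' e2 (add_le_add e3 e4))) (hk t)
    _ = _ := by ring

end Real
end WSAW

namespace WSAW
open scoped ENNReal

section General

variable {S Γ : Type*} [AddCommGroup Γ]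

open Classical in
/-- The weakly self-avoiding weight of a walk piece: `1 - β` for loops, and `1` otherwise. -/
noncomputable def sawW (β : ℝ) (D : List S → Γ) (l : List S) : ℝ := if D l = 0 then 1 - β else 1

theorem sawW_mem {β : ℝ} (h0 : 0 ≤ β) (h1 : β ≤ 1) (D : List S → Γ) (l : List S) :
    0 ≤ sawW β D l ∧ sawW β D l ≤ 1 := by
  unfold sawW; split_ifs <;> constructor <;> linarith

theorem one_sub_sawW (β : ℝ) (D : List S → Γ) (l : List S) :
    ENNReal.ofReal (1 - sawW β D l) = ENNReal.ofReal β * del (D l) := by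
  unfold sawW del; split_ifs <;> simp

theorem prod_pfxs_range (f : List S → ℝ) (l : List S) :
    ((pfxs l).map f).prod = ∏ j ∈ Finset.range l.length, f (l.take (j + 1)) := by
  induction l generalizing f with
  | nil => simp [pfxs]
  | cons e l ih =>
    simp only [pfxs, List.map_cons, List.map_map, List.prod_cons, List.length_cons,
      Finset.prod_range_succ', List.take_succ_cons]
    rw [mul_comm, ih]
    simp

theorem prod_pairs_eq_wt [DecidableEq Γ] {D : List S → Γ} (hD : ∀ a b, D (a ++ b) = D a + D b)
    (β : ℝ) (l : List S) :
    ∏ p ∈ (Finset.range (l.length + 1) ×ˢ Finset.range (l.length + 1)).filter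
      (fun p => p.1 < p.2), (1 + β * (if D (l.take p.1) = D (l.take p.2) then (-1 : ℝ) else 0)) =
      wt (sawW β D) l := by
  have hnil : D [] = 0 := by simpa using hD [] []
  rw [Finset.prod_filter, Finset.prod_product]
  induction l with
  | nil => simp [wt, sfxs]
  | cons e l ih =>
    have hc : ∀ t, D (e :: t) = D [e] + D t := fun t => by rw [← hD]; rfl
    rw [List.length_cons, Finset.prod_range_succ']
    have h1 : ∀ i, ∏ j ∈ Finset.range (l.length + 1 + 1), (if i + 1 < j then
        (1 + β * (if D ((e :: l).take (i + 1)) = D ((e :: l).take j) then (-1 : ℝ) else 0)) else 1) =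
        ∏ j ∈ Finset.range (l.length + 1), (if i < j then
        (1 + β * (if D (l.take i) = D (l.take j) then (-1 : ℝ) else 0)) else 1) := by
      intro i
      rw [Finset.prod_range_succ', if_neg (by omega), mul_one]
      refine Finset.prod_congr rfl fun j _ => ?_
      rw [List.take_succ_cons, List.take_succ_cons, hc (l.take i), hc (l.take j)]
      simp only [add_lt_add_iff_right, add_right_inj]
    simp only [h1, ih]
    have h2 : wt (sawW β D) (e :: l) = ((pfxs (e :: l)).map (sawW β D)).prod * wt (sawW β D) l := by
      simp [wt, sfxs]
    rw [h2, prod_pfxs_range, Finset.prod_range_succ', mul_comm]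
    congr 1
    simp only [List.take_zero, hnil, lt_self_iff_false, if_false, mul_one, Nat.succ_pos, if_true]
    refine Finset.prod_congr rfl fun j _ => ?_
    generalize (e :: l).take (j + 1) = a
    unfold sawW
    by_cases h : D a = 0
    · rw [if_pos h.symm, if_pos h]; ring
    · rw [if_neg (Ne.symm h), if_neg h]; ring

/-- Sums over all walks as sums over lengths. -/
theorem tsum_list_ennreal [Fintype S] (F : List S → ℝ≥0∞) :
    ∑' l, F l = ∑' n : ℕ, ∑ s : Fin n → S, F (List.ofFn s) := by
  rw [← (List.equivSigmaTuple (α := S)).symm.tsum_eq, ENNReal.tsum_sigma']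
  refine tsum_congr fun n => ?_
  rw [tsum_fintype]; rfl

theorem tsum_list [Fintype S] {F : List S → ℂ} (hF : Summable F) :
    ∑' l, F l = ∑' n : ℕ, ∑ s : Fin n → S, F (List.ofFn s) := by
  rw [← (List.equivSigmaTuple (α := S)).symm.tsum_eq, Summable.tsum_sigma']
  · refine tsum_congr fun n => ?_
    rw [tsum_fintype]; rfl
  · exact fun n => (hasSum_fintype _).summable
  · exact ((List.equivSigmaTuple (α := S)).symm.summable_iff).2 hF

end General

variable {d : ℕ}

/-- The displacement of a walk in `ℤ^d`. -/
def disp (l : List (Fin d × Bool)) : Fin d → ℤ := (l.map (wsawStep d)).sum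

theorem disp_append (a b : List (Fin d × Bool)) : disp (a ++ b) = disp a + disp b := by
  simp [disp]

/-- Projection of `ℤ^d` to the torus. -/
def toT (d r : ℕ) : (Fin d → ℤ) →+ (Fin d → ZMod r) where
  toFun x i := (x i : ZMod r)
  map_zero' := by ext; simp
  map_add' x y := by ext; simp

/-- The displacement of a walk on the torus. -/
def dispT (r : ℕ) (l : List (Fin d × Bool)) : Fin d → ZMod r := toT d r (disp l)

theorem dispT_append (r : ℕ) (a b : List (Fin d × Bool)) :
    dispT r (a ++ b) = dispT r a + dispT r b := by
  simp [dispT, disp_append]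

theorem wsawPos_eq {n : ℕ} (s : Fin n → Fin d × Bool) (k : ℕ) :
    wsawPos s k = disp ((List.ofFn s).take k) := by
  rw [disp, List.map_take, List.map_ofFn, List.sum_take_ofFn]
  rfl

/-- The weight of a walk on `ℤ^d`. -/
noncomputable def KZ (d : ℕ) (β : ℝ) (l : List (Fin d × Bool)) : ℝ := wt (sawW β disp) l

/-- The weight of a walk on the torus. -/
noncomputable def KT (d r : ℕ) (β : ℝ) (l : List (Fin d × Bool)) : ℝ := wt (sawW β (dispT r)) l

theorem wsawWeight_eq (β : ℝ) (n : ℕ) (s : Fin n → Fin d × Bool) :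
    wsawWeight β n s = KZ d β (List.ofFn s) := by
  rw [KZ, ← prod_pairs_eq_wt disp_append]
  simp [wsawWeight, wsawPos_eq]

theorem wsawWeightT_eq (r : ℕ) (β : ℝ) (n : ℕ) (s : Fin n → Fin d × Bool) :
    wsawWeightT r β n s = KT d r β (List.ofFn s) := by
  rw [KT, ← prod_pairs_eq_wt (dispT_append r)]
  have h : ∀ k, wsawPosT r s k = dispT r ((List.ofFn s).take k) := fun k => by
    ext i; simp [wsawPosT, wsawPos_eq, dispT, toT]
  simp [wsawWeightT, h]

theorem cZ_eq (β : ℝ) (n : ℕ) : cZ d β n = ∑ s : Fin n → Fin d × Bool, KZ d β (List.ofFn s) := by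
  simp [cZ, wsawWeight_eq]

theorem cT_eq (r : ℕ) (β : ℝ) (n : ℕ) :
    cT d r β n = ∑ s : Fin n → Fin d × Bool, KT d r β (List.ofFn s) := by
  simp [cT, wsawWeightT_eq]

theorem chi_eq {β : ℝ} {z : ℂ} (h : Summable fun l : List (Fin d × Bool) => (KZ d β l : ℂ) * z ^ l.length) :
    chi d β z = ∑' l : List (Fin d × Bool), (KZ d β l : ℂ) * z ^ l.length := by
  rw [tsum_list h, chi]
  simp [cZ_eq, Finset.sum_mul]

theorem chiT_eq {r : ℕ} {β : ℝ} {z : ℂ}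
    (h : Summable fun l : List (Fin d × Bool) => (KT d r β l : ℂ) * z ^ l.length) :
    chiT d r β z = ∑' l : List (Fin d × Bool), (KT d r β l : ℂ) * z ^ l.length := by
  rw [tsum_list h, chiT]
  simp [cT_eq, Finset.sum_mul]

end WSAW

namespace WSAW

section HeatKernel
open Real intervalIntegral

/-- The integrand representing iterated second differences of the one-dimensional heat kernel. -/
noncomputable def hkInt (a : ℕ) (j : ℤ) (t k : ℝ) : ℝ :=
  exp (-(t * (1 - cos k))) * (2 * (cos k - 1)) ^ a * cos (j * k)

/-- The `a`-th iterated second difference of the heat kernel of continuous time simple random walk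
on `ℤ`. -/
noncomputable def hk (a : ℕ) (t : ℝ) (j : ℤ) : ℝ := (2 * π)⁻¹ * ∫ k in (-π)..π, hkInt a j t k

theorem continuous_hkInt (a : ℕ) (j : ℤ) (t : ℝ) : Continuous (hkInt a j t) := by
  unfold hkInt; fun_prop

theorem hkInt_second_diff (a : ℕ) (j : ℤ) (t k : ℝ) :
    hkInt a (j + 1) t k + hkInt a (j - 1) t k - 2 * hkInt a j t k = hkInt (a + 1) j t k := by
  unfold hkInt
  have h1 : cos ((j + 1 : ℤ) * k) = cos (j * k) * cos k - sin (j * k) * sin k := by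
    rw [← cos_add]; push_cast; ring_nf
  have h2 : cos ((j - 1 : ℤ) * k) = cos (j * k) * cos k + sin (j * k) * sin k := by
    rw [← cos_sub]; push_cast; ring_nf
  rw [h1, h2]; ring

theorem hk_second_diff (a : ℕ) (t : ℝ) (j : ℤ) :
    hk a t (j + 1) + hk a t (j - 1) - 2 * hk a t j = hk (a + 1) t j := by
  have hi : ∀ a j, IntervalIntegrable (hkInt a j t) MeasureTheory.volume (-π) π := fun a j =>
    (continuous_hkInt a j t).intervalIntegrable _ _
  have : ∫ k in (-π)..π, hkInt (a + 1) j t k = (∫ k in (-π)..π, hkInt a (j + 1) t k) +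
      (∫ k in (-π)..π, hkInt a (j - 1) t k) - 2 * ∫ k in (-π)..π, hkInt a j t k := by
    rw [← integral_add (hi _ _) (hi _ _), ← integral_const_mul,
      ← integral_sub ((hi _ _).add (hi _ _)) ((hi _ _).const_mul _)]
    exact integral_congr fun k _ => (hkInt_second_diff a j t k).symm
  rw [hk, hk, hk, hk, this]; ring

theorem hk_zero (j : ℤ) : hk 0 0 j = if j = 0 then 1 else 0 := by
  unfold hk hkInt
  split_ifs with h
  · subst h; simp; field_simp; ring
  · have hj : (j : ℝ) ≠ 0 := by exact_mod_cast h
    have : ∀ k : ℝ, exp (-(0 * (1 - cos k))) * (2 * (cos k - 1)) ^ 0 * cos (j * k) = cos (j * k) :=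
      fun k => by simp
    simp_rw [this]
    rw [integral_comp_mul_left _ hj, integral_cos]
    simp [mul_neg, sin_int_mul_pi]

theorem hk_neg (a : ℕ) (t : ℝ) (j : ℤ) : hk a t (-j) = hk a t j := by
  simp [hk, hkInt, neg_mul]

theorem hasDerivAt_hk (a : ℕ) (j : ℤ) (t : ℝ) :
    HasDerivAt (fun t => hk a t j) (hk (a + 1) t j / 2) t := by
  have key := hasDerivAt_integral_of_dominated_loc_of_deriv_le (μ := MeasureTheory.volume)
    (a := -π) (b := π) (F := fun t k => hkInt a j t k) (F' := fun t k => hkInt (a + 1) j t k / 2)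
    (x₀ := t) (s := Set.Ioo (t - 1) (t + 1))
    (bound := fun _ => exp (2 * (|t| + 1)) * 4 ^ (a + 1))
    (Ioo_mem_nhds (by linarith) (by linarith))
    (Filter.Eventually.of_forall fun x => (continuous_hkInt a j x).aestronglyMeasurable)
    ((continuous_hkInt a j t).intervalIntegrable _ _)
    (((continuous_hkInt (a + 1) j t).div_const 2).aestronglyMeasurable)
    (Filter.Eventually.of_forall fun k _ x hx => ?_) intervalIntegrable_const
    (Filter.Eventually.of_forall fun k _ x hx => ?_)
  · refine (key.2.const_mul (2 * π)⁻¹).congr_deriv ?_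
    rw [integral_div, hk]; ring
  · have hc := cos_le_one k
    have hc' := neg_one_le_cos k
    have hx' : |x| ≤ |t| + 1 := by
      have : |x - t| ≤ 1 := abs_le.2 ⟨by linarith [hx.1], by linarith [hx.2]⟩
      linarith [abs_sub_abs_le_abs_sub x t]
    have h1 : -(x * (1 - cos k)) ≤ 2 * (|t| + 1) := by
      calc -(x * (1 - cos k)) = (-x) * (1 - cos k) := by ring
        _ ≤ |x| * (1 - cos k) := mul_le_mul_of_nonneg_right (neg_le_abs x) (by linarith)
        _ ≤ (|t| + 1) * 2 := by gcongr; linarith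
        _ = _ := by ring
    have h2 : |2 * (cos k - 1)| ≤ 4 := abs_le.2 ⟨by linarith, by linarith⟩
    have h3 := abs_cos_le_one (j * k)
    rw [hkInt, norm_div, norm_mul, norm_mul, norm_pow, Real.norm_eq_abs, Real.norm_eq_abs,
      Real.norm_eq_abs, abs_exp, Real.norm_eq_abs, abs_two]
    calc exp (-(x * (1 - cos k))) * |2 * (cos k - 1)| ^ (a + 1) * |cos (j * k)| / 2
        ≤ exp (2 * (|t| + 1)) * 4 ^ (a + 1) * 1 / 1 := by gcongr; norm_num
      _ = _ := by ring
  · have h1 : HasDerivAt (fun x => -(x * (1 - cos k))) (-(1 - cos k)) x :=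
      ((hasDerivAt_id x).mul_const (1 - cos k)).fun_neg.congr_deriv (by simp)
    refine ((h1.exp.mul_const ((2 * (cos k - 1)) ^ a)).mul_const (cos (j * k))).congr_deriv ?_
    simp only [hkInt]; ring

/-- The analytic continuation of the integrand `hkInt`. -/
noncomputable def hkIntC (a : ℕ) (j : ℤ) (t : ℝ) (w : ℂ) : ℂ :=
  Complex.exp (-(t * (1 - Complex.cos w))) * (2 * (Complex.cos w - 1)) ^ a *
    Complex.exp (Complex.I * j * w)

theorem hkIntC_re (a : ℕ) (j : ℤ) (t k : ℝ) : (hkIntC a j t k).re = hkInt a j t k := by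
  have h1 : Complex.exp (-(t * (1 - Complex.cos k))) * (2 * (Complex.cos k - 1)) ^ a =
      ((exp (-(t * (1 - cos k))) * (2 * (cos k - 1)) ^ a : ℝ) : ℂ) := by push_cast; rfl
  have h2 : Complex.exp (Complex.I * j * k) = Complex.exp (((j * k : ℝ) : ℂ) * Complex.I) := by
    congr 1; push_cast; ring
  rw [hkIntC, h1, h2, Complex.re_ofReal_mul, Complex.exp_ofReal_mul_I_re, hkInt]

theorem hkIntC_add_two_pi (a : ℕ) (j : ℤ) (t : ℝ) (w : ℂ) :
    hkIntC a j t (w + 2 * π) = hkIntC a j t w := by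
  have h : Complex.exp (Complex.I * j * (w + 2 * π)) = Complex.exp (Complex.I * j * w) := by
    have : Complex.I * j * (w + 2 * π) = Complex.I * j * w + j * (2 * π * Complex.I) := by ring
    rw [this, Complex.exp_periodic.int_mul]
  rw [hkIntC, Complex.cos_add_two_pi, h, hkIntC]

theorem hkIntC_shift (a : ℕ) (j : ℤ) (t θ : ℝ) :
    ∫ k in (-π)..π, hkIntC a j t k = ∫ k in (-π)..π, hkIntC a j t (k + θ * Complex.I) := by
  have hd : Differentiable ℂ (hkIntC a j t) := by unfold hkIntC; fun_prop
  have key := Complex.integral_boundary_rect_eq_zero_of_differentiableOn (hkIntC a j t)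
    ((-π : ℝ) : ℂ) (π + θ * Complex.I) hd.differentiableOn
  have hv : ∫ y in (0 : ℝ)..θ, hkIntC a j t ((π : ℝ) + y * Complex.I) =
      ∫ y in (0 : ℝ)..θ, hkIntC a j t (((-π : ℝ) : ℂ) + y * Complex.I) := by
    refine integral_congr fun y _ => ?_
    rw [← hkIntC_add_two_pi a j t (((-π : ℝ) : ℂ) + y * Complex.I)]
    congr 1; push_cast; ring
  simp only [Complex.ofReal_re, Complex.add_re, Complex.mul_re, Complex.I_re, mul_zero,
    Complex.ofReal_im, Complex.I_im, mul_one, sub_self, add_zero, Complex.add_im, Complex.mul_im,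
    zero_add, Complex.ofReal_zero, zero_mul] at key
  rw [hv] at key
  linear_combination key

theorem abs_hk_le_integral (a : ℕ) (j : ℤ) (t θ : ℝ) :
    |hk a t j| ≤ (2 * π)⁻¹ * ∫ k in (-π)..π, ‖hkIntC a j t (k + θ * Complex.I)‖ := by
  have hd : Differentiable ℂ (hkIntC a j t) := by unfold hkIntC; fun_prop
  have h1 : ∫ k in (-π)..π, hkInt a j t k = (∫ k in (-π)..π, hkIntC a j t k).re := by
    have := Complex.reCLM.intervalIntegral_comp_comm (μ := MeasureTheory.volume) (a := -π) (b := π)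
      (f := fun k : ℝ => hkIntC a j t k)
      ((hd.continuous.comp Complex.continuous_ofReal).intervalIntegrable _ _)
    simp only [Complex.reCLM_apply, hkIntC_re] at this
    exact this
  rw [hk, h1, abs_mul, abs_of_pos (by positivity), hkIntC_shift a j t θ]
  gcongr
  exact (Complex.abs_re_le_norm _).trans (norm_integral_le_integral_norm (by linarith [pi_pos]))

theorem norm_cos_sub_one (k θ : ℝ) :
    ‖Complex.cos (k + θ * Complex.I) - 1‖ = cosh θ - cos k := by
  have h0 : 0 ≤ cosh θ - cos k := by linarith [one_le_cosh θ, cos_le_one k]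
  rw [Complex.cos_add_mul_I, ← sq_eq_sq₀ (norm_nonneg _) h0, Complex.sq_norm, Complex.normSq_apply]
  have h1 : Complex.cos k * Complex.cosh θ = ((cos k * cosh θ : ℝ) : ℂ) := by push_cast; rfl
  have h2 : Complex.sin k * Complex.sinh θ = ((sin k * sinh θ : ℝ) : ℂ) := by push_cast; rfl
  rw [h1, h2]
  simp only [Complex.sub_re, Complex.sub_im, Complex.ofReal_re, Complex.ofReal_im, Complex.mul_re,
    Complex.mul_im, Complex.I_re, Complex.I_im, Complex.one_re, Complex.one_im]
  nlinarith [sin_sq_add_cos_sq k, cosh_sq θ]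

theorem norm_hkIntC (a : ℕ) (j : ℤ) (t k θ : ℝ) :
    ‖hkIntC a j t (k + θ * Complex.I)‖ =
      exp (-(t * (1 - cos k * cosh θ))) * (2 * (cosh θ - cos k)) ^ a * exp (-(j * θ)) := by
  rw [hkIntC, norm_mul, norm_mul, norm_pow, norm_mul, norm_cos_sub_one, Complex.norm_exp,
    Complex.norm_exp, Complex.cos_add_mul_I]
  have h1 : Complex.cos k * Complex.cosh θ = ((cos k * cosh θ : ℝ) : ℂ) := by push_cast; rfl
  have h2 : Complex.sin k * Complex.sinh θ = ((sin k * sinh θ : ℝ) : ℂ) := by push_cast; rfl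
  rw [h1, h2]
  have h3 : (-((t : ℂ) * (1 - (((cos k * cosh θ : ℝ) : ℂ) -
      ((sin k * sinh θ : ℝ) : ℂ) * Complex.I)))).re = -(t * (1 - cos k * cosh θ)) := by
    simp [-Complex.ofReal_mul]
  have h4 : (Complex.I * j * (k + θ * Complex.I)).re = -(j * θ) := by simp
  rw [h3, h4, Complex.norm_ofNat]

theorem cosh_le_one_add_sq {θ : ℝ} (h0 : 0 ≤ θ) (h1 : θ ≤ 1) : cosh θ ≤ 1 + θ ^ 2 := by
  have h := cosh_le_exp_half_sq θ
  have h2 : θ ^ 2 ≤ 1 := pow_le_one₀ h0 h1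
  have h3 := abs_exp_sub_one_le (x := θ ^ 2 / 2) (by rw [abs_of_nonneg (by positivity)]; linarith)
  rw [abs_of_nonneg (a := θ ^ 2 / 2) (by positivity)] at h3
  linarith [le_abs_self (exp (θ ^ 2 / 2) - 1)]

theorem norm_hkIntC_le (a : ℕ) (j : ℤ) {t k s : ℝ} (ht : 0 ≤ t) (hs : 0 < s) (hs2 : s ^ 2 = 1 + t)
    (hk : |k| ≤ π) :
    ‖hkIntC a j t (k + (s⁻¹ : ℝ) * Complex.I)‖ ≤
      (exp 4 * a.factorial * 4 ^ a * s⁻¹ ^ (2 * a) * exp (-(j / s))) *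
        exp (-(s ^ 2 / π ^ 2) * k ^ 2) := by
  have hs1 : 1 ≤ s := by nlinarith
  set θ := s⁻¹ with hθ
  have hθ0 : 0 < θ := by positivity
  have hθ1 : θ ≤ 1 := inv_le_one_of_one_le₀ hs1
  have hθs : s * θ = 1 := mul_inv_cancel₀ hs.ne'
  have hch := cosh_le_one_add_sq hθ0.le hθ1
  have hch1 := one_le_cosh θ
  obtain ⟨w, hw⟩ : ∃ w, w = 1 - cos k := ⟨_, rfl⟩
  have hc1 := cos_le_one k
  have hc2 := neg_one_le_cos k
  have hw2 : 2 / π ^ 2 * k ^ 2 ≤ w := by linarith [cos_le_one_sub_mul_cos_sq hk]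
  have hw0 : 0 ≤ w := by linarith
  have hc : cos k = 1 - w := by linarith
  rw [norm_hkIntC, hc]
  have h1 : -(t * (1 - (1 - w) * cosh θ)) ≤ 3 - s ^ 2 * w := by
    have e1 : (1 - w) * (cosh θ - 1) ≤ θ ^ 2 := by nlinarith
    have e2 : t * ((1 - w) * (cosh θ - 1)) ≤ t * θ ^ 2 := mul_le_mul_of_nonneg_left e1 ht
    have e3 : (1 + t) * θ ^ 2 = 1 := by rw [← hs2, ← mul_pow, hθs, one_pow]
    nlinarith [sq_nonneg θ]
  have h2 : (2 * (cosh θ - (1 - w))) ^ a ≤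
      4 ^ a * θ ^ (2 * a) * (a.factorial * exp ((1 + s ^ 2 * w) / 2)) := by
    have e1 : 2 * (cosh θ - (1 - w)) ≤ 4 * θ ^ 2 * ((1 + s ^ 2 * w) / 2) := by
      have : θ ^ 2 * (s ^ 2 * w) = w := by rw [← mul_assoc, ← mul_pow, mul_comm θ, hθs]; ring
      nlinarith
    have e2 := pow_div_factorial_le_exp (x := (1 + s ^ 2 * w) / 2) (by positivity) a
    rw [div_le_iff₀ (by positivity)] at e2
    calc (2 * (cosh θ - (1 - w))) ^ a ≤ (4 * θ ^ 2 * ((1 + s ^ 2 * w) / 2)) ^ a :=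
          pow_le_pow_left₀ (by linarith) e1 a
      _ = 4 ^ a * θ ^ (2 * a) * ((1 + s ^ 2 * w) / 2) ^ a := by rw [mul_pow, mul_pow, pow_mul]
      _ ≤ 4 ^ a * θ ^ (2 * a) * (exp ((1 + s ^ 2 * w) / 2) * a.factorial) := by gcongr
      _ = _ := by ring
  have h3 : exp (3 - s ^ 2 * w) * exp ((1 + s ^ 2 * w) / 2) ≤
      exp 4 * exp (-(s ^ 2 / π ^ 2) * k ^ 2) := by
    rw [← exp_add, ← exp_add]
    refine exp_le_exp.2 ?_
    have : s ^ 2 / π ^ 2 * k ^ 2 = s ^ 2 * (2 / π ^ 2 * k ^ 2) / 2 := by ring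
    have := mul_le_mul_of_nonneg_left hw2 (sq_nonneg s)
    linarith
  have h4 : exp (-(j * θ)) = exp (-(j / s)) := by rw [hθ, div_eq_mul_inv]
  rw [h4]
  calc exp (-(t * (1 - (1 - w) * cosh θ))) * (2 * (cosh θ - (1 - w))) ^ a * exp (-(j / s))
      ≤ exp (3 - s ^ 2 * w) * (4 ^ a * θ ^ (2 * a) *
          (a.factorial * exp ((1 + s ^ 2 * w) / 2))) * exp (-(j / s)) := by
        gcongr
        exact pow_nonneg (by linarith) _
    _ = (a.factorial * 4 ^ a * θ ^ (2 * a) * exp (-(j / s))) *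
          (exp (3 - s ^ 2 * w) * exp ((1 + s ^ 2 * w) / 2)) := by ring
    _ ≤ (a.factorial * 4 ^ a * θ ^ (2 * a) * exp (-(j / s))) *
          (exp 4 * exp (-(s ^ 2 / π ^ 2) * k ^ 2)) := by gcongr
    _ = _ := by ring

theorem exists_abs_hk_le (a : ℕ) : ∃ c : ℝ, 0 < c ∧ ∀ t s : ℝ, 0 ≤ t → 0 < s → s ^ 2 = 1 + t →
    ∀ j : ℤ, |hk a t j| ≤ c * s⁻¹ ^ (2 * a + 1) * exp (-(|(j : ℝ)| / s)) := by
  refine ⟨(2 * π)⁻¹ * (exp 4 * a.factorial * 4 ^ a * √(π * π ^ 2)), by positivity,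
    fun t s ht hs hs2 j => ?_⟩
  wlog hj : 0 ≤ j generalizing j
  · have := this (-j) (by omega)
    rwa [hk_neg, Int.cast_neg, abs_neg] at this
  have hj' : |(j : ℝ)| = j := abs_of_nonneg (by exact_mod_cast hj)
  rw [hj']
  refine (abs_hk_le_integral a j t s⁻¹).trans ?_
  have hpi : -π ≤ π := by linarith [pi_pos]
  have hb : 0 < s ^ 2 / π ^ 2 := by positivity
  set A := exp 4 * a.factorial * 4 ^ a * s⁻¹ ^ (2 * a) * exp (-(j / s)) with hA
  have hA0 : 0 ≤ A := by positivity
  have hd : Differentiable ℂ (hkIntC a j t) := by unfold hkIntC; fun_prop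
  have h1 : ∫ k in (-π)..π, ‖hkIntC a j t (k + (s⁻¹ : ℝ) * Complex.I)‖ ≤
      ∫ k in (-π)..π, A * exp (-(s ^ 2 / π ^ 2) * k ^ 2) := by
    refine integral_mono_on hpi ?_ ?_ fun k hk =>
      norm_hkIntC_le a j ht hs hs2 (abs_le.2 hk)
    · refine Continuous.intervalIntegrable ?_ _ _
      exact (hd.continuous.comp (by fun_prop)).norm
    · exact Continuous.intervalIntegrable (by fun_prop) _ _
  have h2 : ∫ k in (-π)..π, exp (-(s ^ 2 / π ^ 2) * k ^ 2) ≤ √(π * π ^ 2) * s⁻¹ := by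
    rw [integral_of_le hpi]
    refine (MeasureTheory.setIntegral_le_integral (integrable_exp_neg_mul_sq hb)
      (Filter.Eventually.of_forall fun _ => (exp_pos _).le)).trans ?_
    rw [integral_gaussian]
    have : π / (s ^ 2 / π ^ 2) = π * π ^ 2 * (s⁻¹) ^ 2 := by field_simp
    rw [this, sqrt_mul (by positivity), sqrt_sq (by positivity)]
  rw [integral_const_mul] at h1
  calc (2 * π)⁻¹ * ∫ k in (-π)..π, ‖hkIntC a j t (k + (s⁻¹ : ℝ) * Complex.I)‖
      ≤ (2 * π)⁻¹ * (A * (√(π * π ^ 2) * s⁻¹)) := by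
        gcongr; exact h1.trans (mul_le_mul_of_nonneg_left h2 hA0)
    _ = _ := by rw [hA]; ring

end HeatKernel
end WSAW

namespace WSAW

section Taylor

/-- Symmetric second difference with step `n`. -/
def symDiff2 (f : ℤ → ℝ) (j : ℤ) (n : ℕ) : ℝ := f (j + n) + f (j - n) - 2 * f j

theorem symDiff2_zero (f : ℤ → ℝ) (j : ℤ) : symDiff2 f j 0 = 0 := by
  simp only [symDiff2, Nat.cast_zero, add_zero, sub_zero]; ring

theorem symDiff2_second_diff (f : ℤ → ℝ) (j : ℤ) (n : ℕ) :
    symDiff2 f j (n + 2) - 2 * symDiff2 f j (n + 1) + symDiff2 f j n =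
      symDiff2 (fun k => symDiff2 f k 1) j (n + 1) + 2 * symDiff2 f j 1 := by
  simp only [symDiff2]
  push_cast
  have e : ∀ x : ℤ, ∀ y : ℤ, x = y → f x = f y := fun x y h => by rw [h]
  rw [e (j + (n + 1) + 1) (j + (n + 2)) (by ring), e (j + (n + 1) - 1) (j + n) (by ring),
    e (j - (n + 1) + 1) (j - n) (by ring), e (j - (n + 1) - 1) (j - (n + 2)) (by ring)]
  ring

theorem abs_symDiff2_le {f : ℤ → ℝ} {j : ℤ} {n : ℕ} {M : ℝ}
    (hM : ∀ k : ℤ, |k - j| < n → |symDiff2 f k 1| ≤ M) : |symDiff2 f j n| ≤ n ^ 2 * M := by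
  rcases n with _ | m
  · simp [symDiff2_zero]
  have hM0 : |symDiff2 f j 1| ≤ M := hM j (by simp)
  have hMn : 0 ≤ M := (abs_nonneg _).trans hM0
  have key : ∀ n, n ≤ m + 1 → |symDiff2 f j n| ≤ n ^ 2 * M ∧
      (n ≤ m → |symDiff2 f j (n + 1) - symDiff2 f j n| ≤ (2 * n + 1) * M) := by
    intro n
    induction n with
    | zero => intro _; simpa [symDiff2_zero] using hM0
    | succ n ih =>
      intro hn
      obtain ⟨ih1, ih2⟩ := ih (by omega)
      have ih2 := ih2 (by omega)
      refine ⟨?_, fun hn' => ?_⟩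
      · have h3 : symDiff2 f j (n + 1) = (symDiff2 f j (n + 1) - symDiff2 f j n) + symDiff2 f j n := by
          ring
        rw [h3]
        refine (abs_add_le _ _).trans ((add_le_add ih2 ih1).trans ?_)
        push_cast; linarith
      · have h3 : symDiff2 f j (n + 1 + 1) - symDiff2 f j (n + 1) =
            (symDiff2 f j (n + 1) - symDiff2 f j n) +
            (symDiff2 f (j + (n + 1 : ℕ)) 1 + symDiff2 f (j - (n + 1 : ℕ)) 1) := by
          have h1 := symDiff2_second_diff f j n
          have h2 : symDiff2 (fun k => symDiff2 f k 1) j (n + 1) = symDiff2 f (j + (n + 1 : ℕ)) 1 +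
            symDiff2 f (j - (n + 1 : ℕ)) 1 - 2 * symDiff2 f j 1 := rfl
          linear_combination h1 + h2
        rw [h3]
        have e1 := hM (j + (n + 1 : ℕ)) (by rw [add_sub_cancel_left, Nat.abs_cast]; omega)
        have e2 := hM (j - (n + 1 : ℕ)) (by rw [sub_sub_cancel_left, abs_neg, Nat.abs_cast]; omega)
        refine (abs_add_le _ _).trans ?_
        have := abs_add_le (symDiff2 f (j + (n + 1 : ℕ)) 1) (symDiff2 f (j - (n + 1 : ℕ)) 1)
        push_cast at *
        linarith
  exact (key (m + 1) le_rfl).1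

theorem abs_symDiff2_sub_le {f : ℤ → ℝ} {j : ℤ} {n : ℕ} {M : ℝ} (hM0 : 0 ≤ M)
    (hM : ∀ k : ℤ, |k - j| < n → |symDiff2 (fun k => symDiff2 f k 1) k 1| ≤ M) :
    |symDiff2 f j n - n ^ 2 * symDiff2 f j 1| ≤ n ^ 4 * M := by
  have key : ∀ m, m ≤ n → |symDiff2 f j m - m ^ 2 * symDiff2 f j 1| ≤ m ^ 4 * M ∧
      (m + 1 ≤ n → |(symDiff2 f j (m + 1) - (m + 1) ^ 2 * symDiff2 f j 1) -
        (symDiff2 f j m - m ^ 2 * symDiff2 f j 1)| ≤ m ^ 3 * M) := by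
    intro m
    induction m with
    | zero => intro _; simp [symDiff2_zero]
    | succ m ih =>
      intro hm
      obtain ⟨ih1, ih2⟩ := ih (by omega)
      have ih2 := ih2 hm
      refine ⟨?_, fun hm' => ?_⟩
      · have h3 := abs_add_le ((symDiff2 f j (m + 1) - (m + 1) ^ 2 * symDiff2 f j 1) -
          (symDiff2 f j m - m ^ 2 * symDiff2 f j 1)) (symDiff2 f j m - m ^ 2 * symDiff2 f j 1)
        rw [sub_add_cancel] at h3
        push_cast
        refine h3.trans ((add_le_add ih2 ih1).trans ?_)
        rw [← add_mul]
        refine mul_le_mul_of_nonneg_right ?_ hM0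
        have : (0 : ℝ) ≤ m := Nat.cast_nonneg m
        nlinarith [pow_nonneg this 3, pow_nonneg this 2]
      · have e1 := abs_symDiff2_le (f := fun k => symDiff2 f k 1) (j := j) (n := m + 1) (M := M)
          fun k hk => hM k (hk.trans_le (by exact_mod_cast hm))
        have h3 := abs_add_le ((symDiff2 f j (m + 1) - (m + 1) ^ 2 * symDiff2 f j 1) -
          (symDiff2 f j m - m ^ 2 * symDiff2 f j 1)) (symDiff2 (fun k => symDiff2 f k 1) j (m + 1))
        have h4 := symDiff2_second_diff f j m
        push_cast at *
        have h5 : symDiff2 f j (m + 1 + 1) - (m + 1 + 1) ^ 2 * symDiff2 f j 1 -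
            (symDiff2 f j (m + 1) - (m + 1) ^ 2 * symDiff2 f j 1) =
            symDiff2 f j (m + 1) - (m + 1) ^ 2 * symDiff2 f j 1 -
            (symDiff2 f j m - m ^ 2 * symDiff2 f j 1) +
            symDiff2 (fun k => symDiff2 f k 1) j (m + 1) := by
          rw [show m + 1 + 1 = m + 2 by ring]
          linear_combination h4
        rw [h5]
        refine h3.trans ((add_le_add ih2 e1).trans ?_)
        rw [← add_mul]
        refine mul_le_mul_of_nonneg_right ?_ hM0
        have : (0 : ℝ) ≤ m := Nat.cast_nonneg m
        nlinarith [pow_nonneg this 3, pow_nonneg this 2]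
  exact (key n le_rfl).1

end Taylor
end WSAW

namespace WSAW

section ProductTaylor

theorem abs_prod_sub_prod_le {ι : Type*} [DecidableEq ι] (S : Finset ι) {A q b ε : ι → ℝ} {ν : ℝ}
    (hA : ∀ i, |A i| ≤ ε i) (hq : ∀ i, |q i| ≤ ε i) (h2 : ∀ i, |A i - q i| ≤ ν ^ 2 * ε i)
    (h4 : ∀ i, |A i - q i - b i| ≤ ν ^ 4 * ε i) :
    |∏ i ∈ S, A i - ∏ i ∈ S, q i| ≤ S.card * ν ^ 2 * ∏ i ∈ S, ε i ∧
    |∏ i ∈ S, A i - ∏ i ∈ S, q i - ∑ i ∈ S, b i * ∏ k ∈ S.erase i, q k| ≤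
      S.card ^ 2 * ν ^ 4 * ∏ i ∈ S, ε i := by
  have hε : ∀ i, 0 ≤ ε i := fun i => (abs_nonneg _).trans (hA i)
  have hprod : ∀ (S : Finset ι) (f : ι → ℝ), (∀ i, |f i| ≤ ε i) →
      |∏ i ∈ S, f i| ≤ ∏ i ∈ S, ε i := fun S f hf => by
    rw [Finset.abs_prod]
    exact Finset.prod_le_prod (fun _ _ => abs_nonneg _) fun i _ => hf i
  induction S using Finset.induction_on with
  | empty => simp
  | insert k S hk ih =>
    obtain ⟨ih1, ih2⟩ := ih
    have hE : 0 ≤ ∏ i ∈ S, ε i := Finset.prod_nonneg fun i _ => hε i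
    have hν2 : 0 ≤ ν ^ 2 := sq_nonneg ν
    rw [Finset.prod_insert hk, Finset.prod_insert hk, Finset.prod_insert hk,
      Finset.sum_insert hk, Finset.erase_insert hk, Finset.card_insert_of_notMem hk]
    have hsum : ∑ i ∈ S, b i * ∏ j ∈ (insert k S).erase i, q j =
        q k * ∑ i ∈ S, b i * ∏ j ∈ S.erase i, q j := by
      rw [Finset.mul_sum]
      refine Finset.sum_congr rfl fun i hi => ?_
      have hik : k ≠ i := fun h => hk (h ▸ hi)
      rw [Finset.erase_insert_of_ne hik, Finset.prod_insert (by simp [hk])]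
      ring
    rw [hsum]
    set PA := ∏ i ∈ S, A i
    set Pq := ∏ i ∈ S, q i
    set T := ∑ i ∈ S, b i * ∏ j ∈ S.erase i, q j
    set PE := ∏ i ∈ S, ε i
    have hPA : |PA| ≤ PE := hprod S A hA
    have hPq : |Pq| ≤ PE := hprod S q hq
    have hn : (0 : ℝ) ≤ S.card := Nat.cast_nonneg _
    push_cast
    constructor
    · have e : A k * PA - q k * Pq = A k * (PA - Pq) + (A k - q k) * Pq := by ring
      rw [e]
      refine (abs_add_le _ _).trans ?_
      rw [abs_mul, abs_mul]
      calc |A k| * |PA - Pq| + |A k - q k| * |Pq|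
          ≤ ε k * (S.card * ν ^ 2 * PE) + (ν ^ 2 * ε k) * PE :=
            add_le_add (mul_le_mul (hA k) ih1 (abs_nonneg _) (hε k))
              (mul_le_mul (h2 k) hPq (abs_nonneg _) (mul_nonneg hν2 (hε k)))
        _ = _ := by ring
    · have e : A k * PA - q k * Pq - (b k * Pq + q k * T) =
        q k * (PA - Pq - T) + (A k - q k - b k) * Pq + (A k - q k) * (PA - Pq) := by ring
      rw [e]
      refine (abs_add_three _ _ _).trans ?_
      rw [abs_mul, abs_mul, abs_mul]
      calc |q k| * |PA - Pq - T| + |A k - q k - b k| * |Pq| + |A k - q k| * |PA - Pq|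
          ≤ ε k * (S.card ^ 2 * ν ^ 4 * PE) + (ν ^ 4 * ε k) * PE +
            (ν ^ 2 * ε k) * (S.card * ν ^ 2 * PE) := by
            refine add_le_add (add_le_add ?_ ?_) ?_
            · exact mul_le_mul (hq k) ih2 (abs_nonneg _) (hε k)
            · exact mul_le_mul (h4 k) hPq (abs_nonneg _) (mul_nonneg (by positivity) (hε k))
            · exact mul_le_mul (h2 k) ih1 (abs_nonneg _) (mul_nonneg hν2 (hε k))
        _ ≤ ((S.card : ℝ) + 1) ^ 2 * ν ^ 4 * (ε k * PE) := by
          have : 0 ≤ ν ^ 4 * (ε k * PE) := mul_nonneg (by positivity) (mul_nonneg (hε k) hE)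
          nlinarith [mul_nonneg hn this]

end ProductTaylor

section HeatKernelZd

variable {d : ℕ}

/-- The `ℓ¹` norm on `ℤ^d`. -/
def nOne (x : Fin d → ℤ) : ℝ := ∑ i, |(x i : ℝ)|

/-- Flip the signs of coordinates. -/
def flip (σ : Fin d → Bool) : (Fin d → ℤ) ≃ (Fin d → ℤ) where
  toFun y i := if σ i then y i else -y i
  invFun y i := if σ i then y i else -y i
  left_inv y := by ext i; by_cases h : σ i <;> simp [h]
  right_inv y := by ext i; by_cases h : σ i <;> simp [h]

/-- Heat kernel of continuous time simple random walk on `ℤ^d`. -/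
noncomputable def heat (t : ℝ) (x : Fin d → ℤ) : ℝ := ∏ i, hk 0 (t / d) (x i)

/-- Half the second difference of the heat kernel in coordinate direction `i`. -/
noncomputable def heat2 (t : ℝ) (i : Fin d) (x : Fin d → ℤ) : ℝ :=
  hk 1 (t / d) (x i) / 2 * ∏ k ∈ Finset.univ.erase i, hk 0 (t / d) (x k)

theorem nOne_nonneg (x : Fin d → ℤ) : 0 ≤ nOne x := Finset.sum_nonneg fun _ _ => abs_nonneg _

theorem nOne_flip (σ : Fin d → Bool) (x : Fin d → ℤ) : nOne (flip σ x) = nOne x := by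
  refine Finset.sum_congr rfl fun i _ => ?_
  by_cases h : σ i <;> simp [flip, h]

theorem nOne_neg (x : Fin d → ℤ) : nOne (-x) = nOne x := by simp [nOne]

theorem nOne_add_le (x y : Fin d → ℤ) : nOne (x + y) ≤ nOne x + nOne y := by
  rw [nOne, nOne, nOne, ← Finset.sum_add_distrib]
  refine Finset.sum_le_sum fun i _ => ?_
  rw [Pi.add_apply, Int.cast_add]
  exact abs_add_le _ _

theorem sum_flip_heat (t : ℝ) (x y : Fin d → ℤ) :
    (∑ σ : Fin d → Bool, heat t (x - flip σ y)) / 2 ^ d =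
      ∏ i, (hk 0 (t / d) (x i + y i) + hk 0 (t / d) (x i - y i)) / 2 := by
  rw [Finset.prod_div_distrib, Finset.prod_const, Finset.card_univ, Fintype.card_fin]
  congr 1
  have h : ∀ i, hk 0 (t / d) (x i + y i) + hk 0 (t / d) (x i - y i) =
      ∑ b : Bool, hk 0 (t / d) (x i - if b then y i else -y i) := fun i => by
    rw [Fintype.sum_bool, add_comm]; simp
  simp_rw [h]
  rw [Finset.prod_univ_sum, Fintype.piFinset_univ]
  rfl

theorem prod_eps (c s : ℝ) (x y : Fin d → ℤ) :
    ∏ i, (c * s⁻¹ * Real.exp (-((|(x i : ℝ)| - |(y i : ℝ)|) / s))) =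
      c ^ d * s⁻¹ ^ d * Real.exp (-((nOne x - nOne y) / s)) := by
  rw [Finset.prod_mul_distrib, ← Real.exp_sum, Finset.prod_const, Finset.card_univ,
    Fintype.card_fin, mul_pow, Finset.sum_neg_distrib, ← Finset.sum_div, Finset.sum_sub_distrib]
  rfl

theorem exists_heat_bounds (d : ℕ) : ∃ c : ℝ, 0 < c ∧ ∀ t s : ℝ, 0 ≤ t → 0 < s →
    s ^ 2 = 1 + t / d → ∀ x : Fin d → ℤ,
    |heat t x| ≤ c * s⁻¹ ^ d * Real.exp (-(nOne x / s)) ∧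
    (∀ i, |heat2 t i x| ≤ c * s⁻¹ ^ (d + 2) * Real.exp (-(nOne x / s))) ∧
    ∀ y, 2 * nOne y ≤ nOne x →
      |(∑ σ : Fin d → Bool, heat t (x - flip σ y)) / 2 ^ d - heat t x -
        ∑ i, (y i : ℝ) ^ 2 * heat2 t i x| ≤
      c * nOne y ^ 4 * (s⁻¹ ^ (d + 4) * Real.exp (-(nOne x / 2 / s))) := by
  obtain ⟨c0, h0, hc0⟩ := exists_abs_hk_le 0
  obtain ⟨c1, h1, hc1⟩ := exists_abs_hk_le 1
  obtain ⟨c2, h2, hc2⟩ := exists_abs_hk_le 2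
  set c := c0 + c1 + c2 with hc
  have hcpos : 0 < c := by positivity
  refine ⟨c ^ d * (1 + (d : ℝ) ^ 2), by positivity, fun t s ht hs hs2 x => ?_⟩
  have htd : 0 ≤ t / d := by positivity
  have hexp : ∀ z : ℝ, 0 < Real.exp z := Real.exp_pos
  have hsi : 0 < s⁻¹ := inv_pos.2 hs
  have b0 : ∀ j : ℤ, |hk 0 (t / d) j| ≤ c * s⁻¹ * Real.exp (-(|(j : ℝ)| / s)) := fun j => by
    refine (hc0 _ s htd hs hs2 j).trans ?_
    rw [show 2 * 0 + 1 = 1 from rfl, pow_one]; gcongr; linarith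
  have b1 : ∀ j : ℤ, |hk 1 (t / d) j| ≤ s⁻¹ ^ 2 * (c * s⁻¹ * Real.exp (-(|(j : ℝ)| / s))) :=
    fun j => by
    refine (hc1 _ s htd hs hs2 j).trans ?_
    rw [show s⁻¹ ^ 2 * (c * s⁻¹ * Real.exp (-(|(j : ℝ)| / s))) =
      c * s⁻¹ ^ (2 * 1 + 1) * Real.exp (-(|(j : ℝ)| / s)) by ring]
    gcongr; linarith
  have b2 : ∀ j : ℤ, |hk 2 (t / d) j| ≤ s⁻¹ ^ 4 * (c * s⁻¹ * Real.exp (-(|(j : ℝ)| / s))) :=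
    fun j => by
    refine (hc2 _ s htd hs hs2 j).trans ?_
    rw [show s⁻¹ ^ 4 * (c * s⁻¹ * Real.exp (-(|(j : ℝ)| / s))) =
      c * s⁻¹ ^ (2 * 2 + 1) * Real.exp (-(|(j : ℝ)| / s)) by ring]
    gcongr; linarith
  have hpe := fun y => prod_eps c s x y
  have hpe0 : ∏ i, (c * s⁻¹ * Real.exp (-(|(x i : ℝ)| / s))) =
      c ^ d * s⁻¹ ^ d * Real.exp (-(nOne x / s)) := by simpa [nOne] using hpe 0
  have hd1 : (1 : ℝ) ≤ 1 + (d : ℝ) ^ 2 := by nlinarith [sq_nonneg (d : ℝ)]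
  refine ⟨?_, fun i => ?_, fun y hy => ?_⟩
  · rw [heat, Finset.abs_prod]
    refine (Finset.prod_le_prod (fun _ _ => abs_nonneg _) fun i _ => b0 (x i)).trans ?_
    rw [hpe0]
    have : c ^ d ≤ c ^ d * (1 + (d : ℝ) ^ 2) := le_mul_of_one_le_right (by positivity) hd1
    gcongr
  · rw [heat2, abs_mul, Finset.abs_prod, abs_div, abs_two]
    have e1 : |hk 1 (t / d) (x i)| / 2 ≤
        s⁻¹ ^ 2 * (c * s⁻¹ * Real.exp (-(|(x i : ℝ)| / s))) := by
      have := b1 (x i); have := abs_nonneg (hk 1 (t / d) (x i)); linarith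
    refine (mul_le_mul e1 (Finset.prod_le_prod (fun _ _ => abs_nonneg _) fun k _ => b0 (x k))
      (Finset.prod_nonneg fun _ _ => abs_nonneg _) (by positivity)).trans ?_
    rw [mul_assoc, Finset.mul_prod_erase Finset.univ
      (fun i => c * s⁻¹ * Real.exp (-(|(x i : ℝ)| / s))) (Finset.mem_univ i), hpe0]
    have : c ^ d ≤ c ^ d * (1 + (d : ℝ) ^ 2) := le_mul_of_one_le_right (by positivity) hd1
    calc s⁻¹ ^ 2 * (c ^ d * s⁻¹ ^ d * Real.exp (-(nOne x / s)))
        = c ^ d * s⁻¹ ^ (d + 2) * Real.exp (-(nOne x / s)) := by ring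
      _ ≤ _ := by gcongr
  · rw [sum_flip_heat, heat]
    set ε : Fin d → ℝ := fun i => c * s⁻¹ * Real.exp (-((|(x i : ℝ)| - |(y i : ℝ)|) / s))
    set ν := nOne y / s with hν
    have hν0 : 0 ≤ ν := div_nonneg (nOne_nonneg y) hs.le
    have hyi : ∀ i, |(y i : ℝ)| ≤ nOne y := fun i =>
      Finset.single_le_sum (f := fun i => |(y i : ℝ)|) (fun _ _ => abs_nonneg _) (Finset.mem_univ i)
    have hε0 : ∀ i, 0 ≤ ε i := fun i => by positivity
    have hwin : ∀ i (k : ℤ), |k - x i| ≤ |y i| →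
        c * s⁻¹ * Real.exp (-(|(k : ℝ)| / s)) ≤ ε i := fun i k hk' => by
      have e : |((k : ℝ) - x i)| ≤ |(y i : ℝ)| := by exact_mod_cast hk'
      have e2 := abs_sub_abs_le_abs_sub (x i : ℝ) k
      rw [abs_sub_comm] at e2
      simp only [ε]
      gcongr
      linarith
    have hsd : ∀ a (k : ℤ), symDiff2 (hk a (t / d)) k 1 = hk (a + 1) (t / d) k := fun a k => by
      rw [← hk_second_diff, symDiff2]; norm_num
    have hsd' : ∀ a, (fun k => symDiff2 (hk a (t / d)) k 1) = hk (a + 1) (t / d) :=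
      fun a => funext (hsd a)
    have hq : ∀ i, |hk 0 (t / d) (x i)| ≤ ε i := fun i =>
      (b0 _).trans (hwin i (x i) (by simp))
    have hA : ∀ i, |(hk 0 (t / d) (x i + y i) + hk 0 (t / d) (x i - y i)) / 2| ≤ ε i := fun i => by
      have e1 := (b0 (x i + y i)).trans (hwin i _ (by simp))
      have e2 := (b0 (x i - y i)).trans (hwin i _ (by simp))
      rw [abs_div, abs_two]
      have := abs_add_le (hk 0 (t / d) (x i + y i)) (hk 0 (t / d) (x i - y i))
      linarith
    have hAq : ∀ i, (hk 0 (t / d) (x i + y i) + hk 0 (t / d) (x i - y i)) / 2 -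
        hk 0 (t / d) (x i) = symDiff2 (hk 0 (t / d)) (x i) (y i).natAbs / 2 := fun i => by
      rw [symDiff2]
      rcases Int.natAbs_eq (y i) with h | h
      · rw [← h]; ring
      · rw [show ((y i).natAbs : ℤ) = -y i by omega, sub_neg_eq_add, ← sub_eq_add_neg]; ring
    have hna : ∀ i, ((y i).natAbs : ℝ) = |(y i : ℝ)| := fun i => by
      rw [Nat.cast_natAbs, Int.cast_abs]
    have hνi : ∀ i, |(y i : ℝ)| * s⁻¹ ≤ ν := fun i => by
      rw [hν, div_eq_mul_inv]; exact mul_le_mul_of_nonneg_right (hyi i) hsi.le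
    have h2' : ∀ i, |(hk 0 (t / d) (x i + y i) + hk 0 (t / d) (x i - y i)) / 2 -
        hk 0 (t / d) (x i)| ≤ ν ^ 2 * ε i := fun i => by
      rw [hAq]
      have := abs_symDiff2_le (f := hk 0 (t / d)) (j := x i) (n := (y i).natAbs)
        (M := s⁻¹ ^ 2 * ε i) fun k hk' => by
          rw [hsd]
          refine (b1 k).trans (mul_le_mul_of_nonneg_left (hwin i k ?_) (by positivity))
          rw [Int.abs_eq_natAbs (y i)]; exact hk'.le
      rw [abs_div, abs_two, hna] at *
      calc |symDiff2 (hk 0 (t / d)) (x i) (y i).natAbs| / 2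
          ≤ |symDiff2 (hk 0 (t / d)) (x i) (y i).natAbs| := by
            have := abs_nonneg (symDiff2 (hk 0 (t / d)) (x i) (y i).natAbs); linarith
        _ ≤ (|(y i : ℝ)| * s⁻¹) ^ 2 * ε i := by rw [mul_pow, mul_assoc]; exact this
        _ ≤ _ := mul_le_mul_of_nonneg_right
          (pow_le_pow_left₀ (by positivity) (hνi i) 2) (hε0 i)
    have h4' : ∀ i, |(hk 0 (t / d) (x i + y i) + hk 0 (t / d) (x i - y i)) / 2 -
        hk 0 (t / d) (x i) - (y i : ℝ) ^ 2 * (hk 1 (t / d) (x i) / 2)| ≤ ν ^ 4 * ε i := fun i => by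
      rw [hAq]
      have := abs_symDiff2_sub_le (f := hk 0 (t / d)) (j := x i) (n := (y i).natAbs)
        (M := s⁻¹ ^ 4 * ε i) (mul_nonneg (by positivity) (hε0 i)) fun k hk' => by
          rw [hsd', hsd]
          refine (b2 k).trans (mul_le_mul_of_nonneg_left (hwin i k ?_) (by positivity))
          rw [Int.abs_eq_natAbs (y i)]; exact hk'.le
      rw [hna, sq_abs, hsd] at this
      rw [show symDiff2 (hk 0 (t / d)) (x i) (y i).natAbs / 2 -
        (y i : ℝ) ^ 2 * (hk 1 (t / d) (x i) / 2) = (symDiff2 (hk 0 (t / d)) (x i) (y i).natAbs -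
        (y i : ℝ) ^ 2 * hk (0 + 1) (t / d) (x i)) / 2 by ring, abs_div, abs_two]
      calc _ ≤ |symDiff2 (hk 0 (t / d)) (x i) (y i).natAbs -
            (y i : ℝ) ^ 2 * hk (0 + 1) (t / d) (x i)| := by
            have := abs_nonneg (symDiff2 (hk 0 (t / d)) (x i) (y i).natAbs -
              (y i : ℝ) ^ 2 * hk (0 + 1) (t / d) (x i))
            linarith
        _ ≤ (|(y i : ℝ)| * s⁻¹) ^ 4 * ε i := by rw [mul_pow, mul_assoc]; exact this
        _ ≤ _ := mul_le_mul_of_nonneg_right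
          (pow_le_pow_left₀ (by positivity) (hνi i) 4) (hε0 i)
    have key := (abs_prod_sub_prod_le Finset.univ hA hq h2' h4').2
    rw [hpe y, Finset.card_univ, Fintype.card_fin] at key
    have hsum : ∑ i, (y i : ℝ) ^ 2 * heat2 t i x = ∑ i, (y i : ℝ) ^ 2 * (hk 1 (t / d) (x i) / 2) *
        ∏ k ∈ Finset.univ.erase i, hk 0 (t / d) (x k) :=
      Finset.sum_congr rfl fun i _ => by rw [heat2, mul_assoc]
    rw [hsum]
    refine key.trans ?_
    have e1 : Real.exp (-((nOne x - nOne y) / s)) ≤ Real.exp (-(nOne x / 2 / s)) := by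
      gcongr; linarith
    have hny := nOne_nonneg y
    calc (d : ℝ) ^ 2 * ν ^ 4 * (c ^ d * s⁻¹ ^ d * Real.exp (-((nOne x - nOne y) / s)))
        = (c ^ d * (d : ℝ) ^ 2) * nOne y ^ 4 *
          (s⁻¹ ^ (d + 4) * Real.exp (-((nOne x - nOne y) / s))) := by
          rw [hν, div_eq_mul_inv]; ring
      _ ≤ _ := by gcongr; linarith

end HeatKernelZd
end WSAW

namespace WSAW
open MeasureTheory

section TimeIntegral

theorem inv_pow_mul_exp_le (p : ℕ) {s ρ : ℝ} (hs : 0 < s) (hρ : 0 ≤ ρ) :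
    s⁻¹ ^ p * Real.exp (-(ρ / s)) ≤ p.factorial * Real.exp 1 * (s + ρ)⁻¹ ^ p := by
  have h := Real.pow_div_factorial_le_exp (1 + ρ / s) (by positivity) p
  rw [div_le_iff₀ (by positivity), Real.exp_add] at h
  have e : s + ρ = s * (1 + ρ / s) := by field_simp
  have h1 : 0 < 1 + ρ / s := by positivity
  rw [e, mul_inv, mul_pow, Real.exp_neg, inv_pow (1 + ρ / s)]
  have hE := Real.exp_pos (ρ / s)
  have key : (Real.exp (ρ / s))⁻¹ ≤ p.factorial * Real.exp 1 * ((1 + ρ / s) ^ p)⁻¹ := by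
    rw [← div_eq_mul_inv, le_div_iff₀ (by positivity), inv_mul_le_iff₀ hE]
    linarith
  calc s⁻¹ ^ p * (Real.exp (ρ / s))⁻¹
      ≤ s⁻¹ ^ p * (p.factorial * Real.exp 1 * ((1 + ρ / s) ^ p)⁻¹) := by gcongr
    _ = _ := by ring

theorem integral_shift_rpow {D a : ℝ} (hD : 0 < D) (ha : 0 < a) :
    IntegrableOn (fun t : ℝ => (a ^ 2 + t / D) ^ (-(3 / 2) : ℝ)) (Set.Ioi 0) ∧
    ∫ t in Set.Ioi (0 : ℝ), (a ^ 2 + t / D) ^ (-(3 / 2) : ℝ) = 2 * D / a := by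
  have hder : ∀ x : ℝ, 0 ≤ x → HasDerivAt (fun t : ℝ => -(2 * D) * (a ^ 2 + t / D) ^ (-(1 / 2) : ℝ))
      ((a ^ 2 + x / D) ^ (-(3 / 2) : ℝ)) x := fun x hx => by
    have h0 : 0 < a ^ 2 + x / D := by positivity
    have h1 : HasDerivAt (fun t : ℝ => a ^ 2 + t / D) (1 / D) x :=
      ((hasDerivAt_id x).div_const D).const_add _
    refine ((h1.rpow_const (p := -(1 / 2)) (Or.inl h0.ne')).const_mul (-(2 * D))).congr_deriv ?_
    rw [show (-(1 / 2) : ℝ) - 1 = -(3 / 2) by norm_num]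
    field_simp
  have hlim : Filter.Tendsto (fun t : ℝ => -(2 * D) * (a ^ 2 + t / D) ^ (-(1 / 2) : ℝ))
      Filter.atTop (nhds 0) := by
    have h1 : Filter.Tendsto (fun t : ℝ => a ^ 2 + t / D) Filter.atTop Filter.atTop :=
      Filter.tendsto_atTop_add_const_left _ _ (Filter.tendsto_id.atTop_div_const hD)
    simpa using ((tendsto_rpow_neg_atTop (y := 1 / 2) (by norm_num)).comp h1).const_mul (-(2 * D))
  have hc := (hder 0 le_rfl).continuousAt.continuousWithinAt (s := Set.Ici 0)
  have hpos : ∀ x ∈ Set.Ioi (0 : ℝ), 0 ≤ (a ^ 2 + x / D) ^ (-(3 / 2) : ℝ) := fun x hx =>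
    Real.rpow_nonneg (by have := (Set.mem_Ioi.1 hx).le; positivity) _
  refine ⟨integrableOn_Ioi_deriv_of_nonneg hc (fun x hx => hder x (Set.mem_Ioi.1 hx).le) hpos hlim, ?_⟩
  rw [integral_Ioi_of_hasDerivAt_of_nonneg hc (fun x hx => hder x (Set.mem_Ioi.1 hx).le) hpos hlim]
  have : (a ^ 2 : ℝ) ^ (-(1 / 2) : ℝ) = a⁻¹ := by
    rw [Real.rpow_neg (by positivity), ← Real.sqrt_eq_rpow, Real.sqrt_sq ha.le]
  simp only [zero_div, add_zero, this]
  ring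

theorem integral_decay (D : ℝ) (hD : 0 < D) (n : ℕ) : ∃ c : ℝ, 0 < c ∧ ∀ (f : ℝ → ℝ) (B ρ : ℝ),
    0 ≤ B → 0 ≤ ρ → Measurable f →
    (∀ t s : ℝ, 0 ≤ t → 0 < s → s ^ 2 = 1 + t / D →
      |f t| ≤ B * (s⁻¹ ^ (n + 3) * Real.exp (-(ρ / s)))) →
    IntegrableOn f (Set.Ioi 0) ∧ |∫ t in Set.Ioi 0, f t| ≤ c * B * (1 + ρ)⁻¹ ^ (n + 1) := by
  set c0 : ℝ := (n + 3).factorial * Real.exp 1 with hc0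
  have hc0p : 0 < c0 := by positivity
  refine ⟨c0 * (4 * D), by positivity, fun f B ρ hB hρ hf hb => ?_⟩
  set a := (1 + ρ) / 2 with ha
  have hap : 0 < a := by positivity
  obtain ⟨hInt, hval⟩ := integral_shift_rpow hD hap
  set M := B * c0 * (1 + ρ)⁻¹ ^ n with hM
  have hMp : 0 ≤ M := by positivity
  have hdom : ∀ t ∈ Set.Ioi (0 : ℝ), ‖f t‖ ≤ M * (a ^ 2 + t / D) ^ (-(3 / 2) : ℝ) := fun t ht => by
    have ht0 := (Set.mem_Ioi.1 ht).le
    have h1 : 0 < 1 + t / D := by positivity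
    have hs : 0 < √(1 + t / D) := Real.sqrt_pos.2 h1
    have hs2 := Real.sq_sqrt h1.le
    set s := √(1 + t / D)
    have hs1 : 1 ≤ s := by
      have : 0 ≤ t / D := by positivity
      nlinarith
    have hw : a ^ 2 + t / D ≤ (s + ρ) ^ 2 := by
      rw [ha]; nlinarith [mul_nonneg hs.le hρ, sq_nonneg (ρ - 1)]
    have hwp : 0 < a ^ 2 + t / D := by positivity
    have h3 : (s + ρ)⁻¹ ^ 3 ≤ (a ^ 2 + t / D) ^ (-(3 / 2) : ℝ) := by
      have e : (s + ρ)⁻¹ ^ 3 = ((s + ρ) ^ 2) ^ (-(3 / 2) : ℝ) := by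
        rw [← Real.rpow_natCast (s + ρ) 2, ← Real.rpow_mul (by positivity), inv_pow,
          ← Real.rpow_natCast, ← Real.rpow_neg (by positivity)]
        norm_num
      rw [e]
      exact Real.rpow_le_rpow_of_nonpos hwp hw (by norm_num)
    refine (hb t s ht0 hs hs2).trans ?_
    calc B * (s⁻¹ ^ (n + 3) * Real.exp (-(ρ / s)))
        ≤ B * (c0 * (s + ρ)⁻¹ ^ (n + 3)) := by
          exact mul_le_mul_of_nonneg_left (inv_pow_mul_exp_le _ hs hρ) hB
      _ = B * c0 * ((s + ρ)⁻¹ ^ n * (s + ρ)⁻¹ ^ 3) := by ring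
      _ ≤ B * c0 * ((1 + ρ)⁻¹ ^ n * (a ^ 2 + t / D) ^ (-(3 / 2) : ℝ)) := by gcongr
      _ = _ := by rw [hM]; ring
  have hdom' : ∀ᵐ t ∂(volume.restrict (Set.Ioi (0 : ℝ))),
      ‖f t‖ ≤ M * (a ^ 2 + t / D) ^ (-(3 / 2) : ℝ) :=
    (ae_restrict_iff' measurableSet_Ioi).2 (Filter.Eventually.of_forall hdom)
  refine ⟨(hInt.const_mul M).mono' hf.aestronglyMeasurable hdom', ?_⟩
  refine (norm_integral_le_of_norm_le (hInt.const_mul M) hdom').trans ?_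
  have e : 2 * D / ((1 + ρ) / 2) = 4 * D * (1 + ρ)⁻¹ := by field_simp; ring
  rw [integral_const_mul, hval, hM, ha, e]
  exact le_of_eq (by ring)

end TimeIntegral

section Green

variable {d : ℕ}

/-- The weight `1 + ‖x‖₁`. -/
def J (x : Fin d → ℤ) : ℝ := 1 + nOne x

theorem one_le_J (x : Fin d → ℤ) : 1 ≤ J x := by have := nOne_nonneg x; unfold J; linarith

theorem J_pos (x : Fin d → ℤ) : 0 < J x := zero_lt_one.trans_le (one_le_J x)

/-- The massive Green function of simple random walk. -/
noncomputable def greenC (m : ℝ) (x : Fin d → ℤ) : ℝ :=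
  ∫ t in Set.Ioi (0 : ℝ), Real.exp (-(m * t)) * heat t x

/-- Half the second difference of the Green function in direction `i`. -/
noncomputable def greenL (m : ℝ) (i : Fin d) (x : Fin d → ℤ) : ℝ :=
  ∫ t in Set.Ioi (0 : ℝ), Real.exp (-(m * t)) * heat2 t i x

theorem continuous_hk (a : ℕ) (j : ℤ) : Continuous fun t => hk a t j :=
  continuous_iff_continuousAt.2 fun t => (hasDerivAt_hk a j t).continuousAt

theorem continuous_heat (x : Fin d → ℤ) : Continuous fun t => heat t x :=
  continuous_finsetProd _ fun i _ => (continuous_hk 0 (x i)).comp (continuous_id.div_const _)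

theorem continuous_heat2 (i : Fin d) (x : Fin d → ℤ) : Continuous fun t => heat2 t i x :=
  (((continuous_hk 1 (x i)).comp (continuous_id.div_const _)).div_const 2).mul
    (continuous_finsetProd _ fun k _ => (continuous_hk 0 (x k)).comp (continuous_id.div_const _))

theorem continuous_exp_mul (m : ℝ) : Continuous fun t : ℝ => Real.exp (-(m * t)) := by fun_prop

theorem abs_exp_mul_le {m t v B : ℝ} (hm : 0 ≤ m) (ht : 0 ≤ t) (h : |v| ≤ B) :
    |Real.exp (-(m * t)) * v| ≤ B := by
  rw [abs_mul, abs_of_pos (Real.exp_pos _)]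
  have : Real.exp (-(m * t)) ≤ 1 := Real.exp_le_one_iff.2 (by have := mul_nonneg hm ht; linarith)
  calc _ ≤ 1 * |v| := by gcongr
    _ ≤ B := by rwa [one_mul]

theorem exists_green_bounds (d : ℕ) (hd : 3 ≤ d) : ∃ c : ℝ, 0 < c ∧ ∀ m : ℝ, 0 ≤ m →
    ∀ x : Fin d → ℤ,
    IntegrableOn (fun t => Real.exp (-(m * t)) * heat t x) (Set.Ioi 0) ∧
    (∀ i, IntegrableOn (fun t => Real.exp (-(m * t)) * heat2 t i x) (Set.Ioi 0)) ∧
    |greenC m x| ≤ c * (J x)⁻¹ ^ (d - 2) ∧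
    (∀ i, |greenL m i x| ≤ c * (J x)⁻¹ ^ d) ∧
    ∀ y, 2 * nOne y ≤ nOne x →
      |(∑ σ : Fin d → Bool, greenC m (x - flip σ y)) / 2 ^ d - greenC m x -
        ∑ i, (y i : ℝ) ^ 2 * greenL m i x| ≤ c * nOne y ^ 4 * (J x)⁻¹ ^ (d + 2) := by
  obtain ⟨b, hb, hB⟩ := exists_heat_bounds d
  have hd0 : (0 : ℝ) < d := by exact_mod_cast (by omega : 0 < d)
  obtain ⟨c0, h0, I0⟩ := integral_decay d hd0 (d - 3)
  obtain ⟨c1, h1, I1⟩ := integral_decay d hd0 (d - 1)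
  obtain ⟨c2, h2, I2⟩ := integral_decay d hd0 (d + 1)
  rw [show d - 3 + 3 = d by omega, show d - 3 + 1 = d - 2 by omega] at I0
  rw [show d - 1 + 3 = d + 2 by omega, show d - 1 + 1 = d by omega] at I1
  rw [show d + 1 + 3 = d + 4 by omega, show d + 1 + 1 = d + 2 by omega] at I2
  refine ⟨b * (c0 + c1 + 2 ^ (d + 2) * c2), by positivity, fun m hm x => ?_⟩
  have hJ := J_pos x
  have E0 : ∀ x : Fin d → ℤ, _ := fun x => I0 (fun t => Real.exp (-(m * t)) * heat t x) b (nOne x)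
    hb.le (nOne_nonneg x) ((continuous_exp_mul m).mul (continuous_heat x)).measurable
    fun t s ht hs hs2 => by
      rw [← mul_assoc]; exact abs_exp_mul_le hm ht (hB t s ht hs hs2 x).1
  have E1 : ∀ i, _ := fun i => I1 (fun t => Real.exp (-(m * t)) * heat2 t i x) b (nOne x)
    hb.le (nOne_nonneg x) ((continuous_exp_mul m).mul (continuous_heat2 i x)).measurable
    fun t s ht hs hs2 => by
      rw [← mul_assoc]; exact abs_exp_mul_le hm ht ((hB t s ht hs hs2 x).2.1 i)
  refine ⟨(E0 x).1, fun i => (E1 i).1, ?_, fun i => ?_, fun y hy => ?_⟩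
  · refine (E0 x).2.trans ?_
    rw [← J]
    have : (0 : ℝ) < b * c1 + b * (2 ^ (d + 2) * c2) := by positivity
    exact mul_le_mul_of_nonneg_right (by linarith) (by positivity)
  · refine (E1 i).2.trans ?_
    rw [← J]
    have : (0 : ℝ) < b * c0 + b * (2 ^ (d + 2) * c2) := by positivity
    exact mul_le_mul_of_nonneg_right (by linarith) (by positivity)
  · have hny := nOne_nonneg y
    have hnx := nOne_nonneg x
    have E2 := I2 (fun t => Real.exp (-(m * t)) *
      ((∑ σ : Fin d → Bool, heat t (x - flip σ y)) / 2 ^ d - heat t x -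
        ∑ i, (y i : ℝ) ^ 2 * heat2 t i x)) (b * nOne y ^ 4) (nOne x / 2) (by positivity)
      (by positivity) ((continuous_exp_mul m).mul ((((continuous_finsetSum _ fun σ _ =>
        continuous_heat _).div_const _).sub (continuous_heat x)).sub (continuous_finsetSum _
        fun i _ => continuous_const.mul (continuous_heat2 i x)))).measurable
      fun t s ht hs hs2 => abs_exp_mul_le hm ht ((hB t s ht hs hs2 x).2.2 y hy)
    have hval : ∫ t in Set.Ioi (0 : ℝ), Real.exp (-(m * t)) *
      ((∑ σ : Fin d → Bool, heat t (x - flip σ y)) / 2 ^ d - heat t x -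
        ∑ i, (y i : ℝ) ^ 2 * heat2 t i x) =
        (∑ σ : Fin d → Bool, greenC m (x - flip σ y)) / 2 ^ d - greenC m x -
        ∑ i, (y i : ℝ) ^ 2 * greenL m i x := by
      simp only [greenC, greenL]
      simp_rw [← integral_const_mul]
      rw [← integral_finsetSum _ fun σ _ => (E0 _).1, ← integral_div,
        ← integral_finsetSum _ fun i _ => (E1 i).1.const_mul _, ← integral_sub, ← integral_sub]
      · refine integral_congr_ae (Filter.Eventually.of_forall fun t => ?_)
        simp only [mul_sub, mul_div_assoc', Finset.mul_sum]
        congr 1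
        exact Finset.sum_congr rfl fun i _ => by ring
      · exact ((integrable_finsetSum _ fun σ _ => (E0 _).1).div_const _).sub (E0 x).1
      · exact integrable_finsetSum _ fun i _ => (E1 i).1.const_mul _
      · exact (integrable_finsetSum _ fun σ _ => (E0 _).1).div_const _
      · exact (E0 x).1
    rw [← hval]
    refine E2.2.trans ?_
    have e : (1 + nOne x / 2)⁻¹ ≤ 2 * (J x)⁻¹ := by
      rw [← div_eq_mul_inv, le_div_iff₀ hJ, inv_mul_le_iff₀ (by positivity), J]; linarith
    calc c2 * (b * nOne y ^ 4) * (1 + nOne x / 2)⁻¹ ^ (d + 2)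
        ≤ c2 * (b * nOne y ^ 4) * (2 * (J x)⁻¹) ^ (d + 2) := by gcongr
      _ = (b * (2 ^ (d + 2) * c2)) * nOne y ^ 4 * (J x)⁻¹ ^ (d + 2) := by rw [mul_pow]; ring
      _ ≤ _ := by
        have : (0 : ℝ) < b * c0 + b * c1 := by positivity
        exact mul_le_mul_of_nonneg_right (mul_le_mul_of_nonneg_right (by linarith) (by positivity))
          (by positivity)

end Green

end WSAW

namespace WSAW
open MeasureTheory

section GreenEquation

variable {d : ℕ}

theorem heat_zero (x : Fin d → ℤ) : heat 0 x = if x = 0 then 1 else 0 := by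
  rw [heat, zero_div]
  simp_rw [hk_zero, Finset.prod_ite_zero, Finset.prod_const_one, funext_iff]
  simp

theorem heat2_eq (t : ℝ) (i : Fin d) (x : Fin d → ℤ) : heat2 t i x =
    (∑ b : Bool, heat t (x - wsawStep d (i, b))) / 2 - heat t x := by
  have h : ∀ b : Bool, heat t (x - wsawStep d (i, b)) = hk 0 (t / d) (x i - if b then 1 else -1) *
      ∏ k ∈ Finset.univ.erase i, hk 0 (t / d) (x k) := fun b => by
    rw [heat, ← Finset.mul_prod_erase Finset.univ _ (Finset.mem_univ i)]
    congr 1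
    · simp [wsawStep]
    · refine Finset.prod_congr rfl fun k hk' => ?_
      simp [wsawStep, Finset.ne_of_mem_erase hk']
  have h0 : heat t x = hk 0 (t / d) (x i) * ∏ k ∈ Finset.univ.erase i, hk 0 (t / d) (x k) :=
    (Finset.mul_prod_erase Finset.univ (fun k => hk 0 (t / d) (x k)) (Finset.mem_univ i)).symm
  rw [Fintype.sum_bool, h, h, h0, heat2, ← hk_second_diff]
  simp only [if_true, Bool.false_eq_true, if_false, sub_neg_eq_add]
  ring

theorem hasDerivAt_heat (hd : 0 < d) (t : ℝ) (x : Fin d → ℤ) : HasDerivAt (fun t => heat t x)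
    ((∑ e : Fin d × Bool, heat t (x - wsawStep d e)) / (2 * d) - heat t x) t := by
  have hd0 : (d : ℝ) ≠ 0 := by exact_mod_cast hd.ne'
  have h := HasDerivAt.fun_finsetProd (u := Finset.univ) (f := fun (i : Fin d) t => hk 0 (t / d) (x i))
    (x := t) fun i _ => HasDerivAt.comp (h₂ := fun t => hk 0 t (x i)) t
      (hasDerivAt_hk 0 (x i) (t / d)) ((hasDerivAt_id t).div_const (d : ℝ))
  refine h.congr_deriv ?_
  rw [Fintype.sum_prod_type]
  have e : ∀ i : Fin d, ∑ b : Bool, heat t (x - wsawStep d (i, b)) =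
      2 * (heat2 t i x + heat t x) := fun i => by rw [heat2_eq]; ring
  simp_rw [e, ← Finset.mul_sum, Finset.sum_add_distrib]
  rw [Finset.sum_const, Finset.card_univ, Fintype.card_fin, nsmul_eq_mul]
  have e2 : ∑ i, heat2 t i x = d * ∑ i : Fin d,
      (∏ j ∈ Finset.univ.erase i, hk 0 (t / d) (x j)) • (hk (0 + 1) (t / d) (x i) / 2 * (1 / d)) := by
    rw [Finset.mul_sum]
    refine Finset.sum_congr rfl fun i _ => ?_
    rw [heat2, smul_eq_mul]
    field_simp
  rw [e2]
  field_simp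
  ring

theorem greenC_equation (hd : 3 ≤ d) {m : ℝ} (hm : 0 < m) (x : Fin d → ℤ) :
    (1 + m) * greenC m x - (∑ e : Fin d × Bool, greenC m (x - wsawStep d e)) / (2 * d) =
      if x = 0 then 1 else 0 := by
  obtain ⟨c, hc, hG⟩ := exists_green_bounds d hd
  obtain ⟨b, hb, hB⟩ := exists_heat_bounds d
  have hI := fun y => (hG m hm.le y).1
  set f : ℝ → ℝ := fun t => Real.exp (-(m * t)) * heat t x with hf
  set f' : ℝ → ℝ := fun t => (∑ e : Fin d × Bool, Real.exp (-(m * t)) *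
    heat t (x - wsawStep d e)) / (2 * d) - (1 + m) * f t with hf'
  have hder : ∀ t, HasDerivAt f (f' t) t := fun t => by
    have h1 : HasDerivAt (fun t : ℝ => Real.exp (-(m * t))) (Real.exp (-(m * t)) * -m) t :=
      (((hasDerivAt_id t).const_mul m).fun_neg.exp).congr_deriv (by simp)
    refine (h1.mul (hasDerivAt_heat (by omega) t x)).congr_deriv ?_
    simp only [hf', hf, ← Finset.mul_sum]
    ring
  have hInt' : IntegrableOn f' (Set.Ioi 0) :=
    ((integrable_finsetSum _ fun e _ => hI _).div_const _).sub ((hI x).const_mul _)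
  have hlim : Filter.Tendsto f Filter.atTop (nhds 0) := by
    have hexp : Filter.Tendsto (fun t : ℝ => b * Real.exp (-(m * t))) Filter.atTop (nhds 0) := by
      have := (Real.tendsto_exp_neg_atTop_nhds_zero.comp
        (Filter.tendsto_id.const_mul_atTop hm)).const_mul b
      simpa using this
    refine squeeze_zero_norm' ?_ hexp
    filter_upwards [Filter.eventually_ge_atTop 0] with t ht
    have h1 : (0 : ℝ) < 1 + t / d := by positivity
    have h := (hB t _ ht (Real.sqrt_pos.2 h1) (Real.sq_sqrt h1.le) x).1
    have hs1 : (√(1 + t / d))⁻¹ ≤ 1 := inv_le_one_of_one_le₀ (by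
      rw [Real.one_le_sqrt]; have : 0 ≤ t / d := by positivity
      linarith)
    have hx : Real.exp (-(nOne x / √(1 + t / d))) ≤ 1 := Real.exp_le_one_iff.2 (by
      have := nOne_nonneg x
      have : 0 ≤ nOne x / √(1 + t / d) := by positivity
      linarith)
    have hle : |heat t x| ≤ b := h.trans (by
      calc _ ≤ b * 1 ^ d * 1 := by gcongr
        _ = b := by ring)
    rw [hf, Real.norm_eq_abs, abs_mul, abs_of_pos (Real.exp_pos _), mul_comm]
    gcongr
  have key := integral_Ioi_of_hasDerivAt_of_tendsto (hder 0).continuousAt.continuousWithinAt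
    (fun t _ => hder t) hInt' hlim
  have hf0 : f 0 = if x = 0 then 1 else 0 := by simp [hf, heat_zero]
  have hv : ∫ t in Set.Ioi 0, f' t = (∑ e : Fin d × Bool, greenC m (x - wsawStep d e)) / (2 * d) -
      (1 + m) * greenC m x := by
    simp only [hf', greenC]
    rw [integral_sub ((integrable_finsetSum _ fun e _ => hI _).div_const _) ((hI x).const_mul _),
      integral_div, integral_finsetSum _ fun e _ => hI _, integral_const_mul]
  rw [← hf0]
  linarith

end GreenEquation

end WSAW

namespace WSAW
open MeasureTheory
open scoped ENNReal

section LatticeSums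

theorem tsum_pi_prod {α : Type*} {n : ℕ} (f : Fin n → α → ℝ≥0∞) :
    ∑' x : Fin n → α, ∏ i, f i (x i) = ∏ i, ∑' j, f i j := by
  induction n with
  | zero => simp
  | succ n ih =>
    rw [Fin.prod_univ_succ, ← ih, ← (Fin.consEquiv fun _ => α).tsum_eq, ENNReal.tsum_prod',
      ← ENNReal.tsum_mul_right]
    refine tsum_congr fun a => ?_
    rw [← ENNReal.tsum_mul_left]
    refine tsum_congr fun x => ?_
    simp [Fin.prod_univ_succ, Fin.consEquiv]

theorem tsum_exp_le {u : ℝ} (hu : 0 < u) :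
    ∑' k : ℕ, ENNReal.ofReal (Real.exp (-(u * k))) ≤ ENNReal.ofReal (1 + u⁻¹) := by
  have h : ∀ k : ℕ, Real.exp (-(u * k)) = Real.exp (-u) ^ k := fun k => by
    rw [← Real.exp_nat_mul]; ring_nf
  have h1 : Real.exp (-u) < 1 := Real.exp_lt_one_iff.2 (by linarith)
  have hs := summable_geometric_of_lt_one (Real.exp_pos _).le h1
  simp_rw [h]
  rw [← ENNReal.ofReal_tsum_of_nonneg (fun k => by positivity) hs,
    tsum_geometric_of_lt_one (Real.exp_pos _).le h1]
  apply ENNReal.ofReal_le_ofReal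
  have h2 : Real.exp (-u) ≤ (1 + u)⁻¹ := by
    rw [Real.exp_neg]
    exact inv_anti₀ (by positivity) (by linarith [Real.add_one_le_exp u])
  have h3 : u * (1 + u)⁻¹ ≤ 1 - Real.exp (-u) := by
    have : u * (1 + u)⁻¹ = 1 - (1 + u)⁻¹ := by field_simp; ring
    linarith
  calc (1 - Real.exp (-u))⁻¹ ≤ (u * (1 + u)⁻¹)⁻¹ := inv_anti₀ (by positivity) h3
    _ = _ := by field_simp; ring

theorem tsum_residue_exp {r : ℕ} (hr : 1 ≤ r) (a : ZMod r) {s : ℝ} (hs : 0 < s) :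
    ∑' j : ℤ, (if (j : ZMod r) = a then ENNReal.ofReal (Real.exp (-(|(j : ℝ)| / s))) else 0) ≤
      ENNReal.ofReal (2 * (1 + s / r)) := by
  have : NeZero r := ⟨by omega⟩
  have hr0 : (0 : ℝ) < r := by exact_mod_cast hr
  have hav : (a.val : ℤ) < r := by exact_mod_cast ZMod.val_lt a
  have hav' : (a.val : ℝ) < r := by exact_mod_cast ZMod.val_lt a
  have hinj : Function.Injective fun k : ℤ => (a.val : ℤ) + r * k := fun k l h => by
    have h' : (r : ℤ) * k = r * l := by simpa using h
    exact mul_left_cancel₀ (by exact_mod_cast (by omega : r ≠ 0)) h'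
  rw [← hinj.tsum_eq]
  · have hcast : ∀ k : ℤ, (((a.val : ℤ) + r * k : ℤ) : ZMod r) = a := fun k => by simp
    simp only [hcast, if_true]
    rw [tsum_of_nat_of_neg_add_one ENNReal.summable ENNReal.summable, two_mul,
      ENNReal.ofReal_add (by positivity) (by positivity)]
    have hu : 0 < (r : ℝ) / s := by positivity
    have hg := tsum_exp_le hu
    rw [inv_div] at hg
    refine add_le_add ((ENNReal.tsum_le_tsum fun k => ?_).trans hg)
      ((ENNReal.tsum_le_tsum fun k => ?_).trans hg)
    · apply ENNReal.ofReal_le_ofReal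
      rw [Real.exp_le_exp, neg_le_neg_iff, div_mul_eq_mul_div]
      refine div_le_div_of_nonneg_right ?_ hs.le
      push_cast
      exact (by have : (0 : ℝ) ≤ a.val := Nat.cast_nonneg _
                linarith : (r : ℝ) * k ≤ a.val + r * k).trans (le_abs_self _)
    · apply ENNReal.ofReal_le_ofReal
      rw [Real.exp_le_exp, neg_le_neg_iff, div_mul_eq_mul_div]
      refine div_le_div_of_nonneg_right ?_ hs.le
      push_cast
      rw [← abs_neg]
      exact (by linarith : (r : ℝ) * k ≤ -(a.val + r * (-(k + 1)))).trans (le_abs_self _)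
  · intro j hj
    by_contra h
    apply hj
    refine if_neg ?_
    rintro rfl
    apply h
    refine ⟨j / r, ?_⟩
    have : ((j : ZMod r).val : ℤ) = j % r := ZMod.val_intCast j
    simp only [this]
    exact Int.emod_add_mul_ediv j r

variable {d : ℕ}

theorem tsum_residue_decay {r : ℕ} (hr : 1 ≤ r) (a : Fin d → ZMod r) {s : ℝ} (hs : 0 < s) :
    ∑' x : Fin d → ℤ, (if toT d r x = a then ENNReal.ofReal (Real.exp (-(nOne x / s))) else 0) ≤
      ENNReal.ofReal ((2 * (1 + s / r)) ^ d) := by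
  have h : ∀ x : Fin d → ℤ,
      (if toT d r x = a then ENNReal.ofReal (Real.exp (-(nOne x / s))) else 0) =
      ∏ i, (if (x i : ZMod r) = a i then ENNReal.ofReal (Real.exp (-(|(x i : ℝ)| / s))) else 0) :=
    fun x => by
    rw [Finset.prod_ite_zero, ← ENNReal.ofReal_prod_of_nonneg fun i _ => (Real.exp_pos _).le,
      ← Real.exp_sum, Finset.sum_neg_distrib, ← Finset.sum_div, ← nOne]
    congr 1
    simp [funext_iff, toT]
  simp_rw [h]
  rw [tsum_pi_prod (fun i (j : ℤ) =>
    if (j : ZMod r) = a i then ENNReal.ofReal (Real.exp (-(|(j : ℝ)| / s))) else 0),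
    ENNReal.ofReal_pow (by positivity)]
  refine (Finset.prod_le_prod' fun i _ => tsum_residue_exp hr (a i) hs).trans ?_
  simp

/-- `F` has mass at most `M` against every normalised exponential profile of width at least one. -/
def Tested (F : (Fin d → ℤ) → ℝ≥0∞) (M : ℝ≥0∞) : Prop :=
  ∀ s : ℝ, 1 ≤ s → ∑' x, F x * ENNReal.ofReal (s⁻¹ ^ d * Real.exp (-(nOne x / s))) ≤ M

theorem tested_one : Tested (fun _ : Fin d → ℤ => 1) (ENNReal.ofReal (4 ^ d)) := fun s hs => by
  have hs0 : 0 < s := by linarith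
  have h := tsum_residue_decay (r := 1) le_rfl (fun _ : Fin d => (0 : ZMod 1)) hs0
  have e : ∀ x : Fin d → ℤ, toT d 1 x = fun _ => 0 := fun x => Subsingleton.elim _ _
  simp only [e, if_true] at h
  simp_rw [one_mul, ENNReal.ofReal_mul (show (0 : ℝ) ≤ s⁻¹ ^ d by positivity)]
  rw [ENNReal.tsum_mul_left]
  refine (mul_le_mul_right h _).trans ?_
  rw [← ENNReal.ofReal_mul (by positivity), ← mul_pow]
  apply ENNReal.ofReal_le_ofReal
  refine pow_le_pow_left₀ (by positivity) ?_ d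
  rw [inv_mul_le_iff₀ hs0]
  push_cast
  linarith

theorem exists_tested_residue (d : ℕ) {κ : ℝ} (hκ : 0 < κ) : ∃ c : ℝ, 0 < c ∧ ∀ r : ℕ, 1 ≤ r →
    ∀ a : Fin d → ZMod r, Tested (fun x => if toT d r x = a ∧ κ * r ≤ nOne x then 1 else 0)
      (ENNReal.ofReal (c * (r : ℝ)⁻¹ ^ d)) := by
  set q : ℝ := 1 + κ⁻¹ with hq
  have hqp : 0 < q := by positivity
  refine ⟨(4 * q) ^ d * (d.factorial * Real.exp 1), by positivity, fun r hr a s hs => ?_⟩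
  have hs0 : 0 < s := by linarith
  have hr0 : (0 : ℝ) < r := by exact_mod_cast hr
  have hpt : ∀ x : Fin d → ℤ, (if toT d r x = a ∧ κ * r ≤ nOne x then (1 : ℝ≥0∞) else 0) *
      ENNReal.ofReal (s⁻¹ ^ d * Real.exp (-(nOne x / s))) ≤
      ENNReal.ofReal (s⁻¹ ^ d * Real.exp (-(κ * r / (2 * s)))) *
      (if toT d r x = a then ENNReal.ofReal (Real.exp (-(nOne x / (2 * s)))) else 0) := fun x => by
    by_cases h1 : toT d r x = a
    · by_cases h2 : κ * r ≤ nOne x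
      · simp only [h1, h2, and_self, if_true, one_mul]
        rw [← ENNReal.ofReal_mul (by positivity), mul_assoc, ← Real.exp_add]
        apply ENNReal.ofReal_le_ofReal
        have : nOne x / s = nOne x / (2 * s) + nOne x / (2 * s) := by field_simp; ring
        rw [this]
        gcongr
        have : κ * r / (2 * s) ≤ nOne x / (2 * s) := by gcongr
        linarith
      · simp [h2]
    · simp [h1]
  refine (ENNReal.tsum_le_tsum hpt).trans ?_
  rw [ENNReal.tsum_mul_left]
  refine (mul_le_mul_right (tsum_residue_decay hr a (by positivity : 0 < 2 * s)) _).trans ?_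
  rw [← ENNReal.ofReal_mul (by positivity)]
  apply ENNReal.ofReal_le_ofReal
  set v := κ * r / (2 * s) with hv
  have hv0 : 0 < v := by positivity
  have hE : (1 + v) ^ d * Real.exp (-v) ≤ d.factorial * Real.exp 1 := by
    have h := Real.pow_div_factorial_le_exp (1 + v) (by positivity) d
    rw [div_le_iff₀ (by positivity), Real.exp_add] at h
    rw [Real.exp_neg, ← div_eq_mul_inv, div_le_iff₀ (Real.exp_pos _)]
    linarith
  have hb : s⁻¹ * (2 * (1 + 2 * s / r)) ≤ 4 * q * (r : ℝ)⁻¹ * (1 + v) := by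
    have e : s⁻¹ * (2 * (1 + 2 * s / r)) = 4 * (r : ℝ)⁻¹ * (κ⁻¹ * v + 1) := by
      rw [hv]; field_simp; ring
    rw [e, hq]
    have hk : 0 < κ⁻¹ := by positivity
    have : κ⁻¹ * v + 1 ≤ (1 + κ⁻¹) * (1 + v) := by nlinarith [mul_pos hk hv0]
    calc 4 * (r : ℝ)⁻¹ * (κ⁻¹ * v + 1) ≤ 4 * (r : ℝ)⁻¹ * ((1 + κ⁻¹) * (1 + v)) := by gcongr
      _ = _ := by ring
  calc s⁻¹ ^ d * Real.exp (-v) * (2 * (1 + 2 * s / r)) ^ d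
      = (s⁻¹ * (2 * (1 + 2 * s / r))) ^ d * Real.exp (-v) := by
        rw [mul_pow s⁻¹]; ring
    _ ≤ (4 * q * (r : ℝ)⁻¹ * (1 + v)) ^ d * Real.exp (-v) := by gcongr
    _ = (4 * q) ^ d * ((1 + v) ^ d * Real.exp (-v)) * (r : ℝ)⁻¹ ^ d := by
      rw [mul_pow, mul_pow]; ring
    _ ≤ (4 * q) ^ d * (d.factorial * Real.exp 1) * (r : ℝ)⁻¹ ^ d := by gcongr

theorem exists_tested_greenC (d : ℕ) (hd : 3 ≤ d) : ∃ c : ℝ, 0 < c ∧ ∀ m : ℝ, 0 < m →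
    ∀ (F : (Fin d → ℤ) → ℝ≥0∞) (M : ℝ≥0∞), Tested F M →
      ∑' x, F x * ENNReal.ofReal |greenC m x| ≤ ENNReal.ofReal (c / m) * M := by
  obtain ⟨b, hb, hB⟩ := exists_heat_bounds d
  obtain ⟨c, hc, hG⟩ := exists_green_bounds d hd
  refine ⟨b, hb, fun m hm F M hF => ?_⟩
  have hpt : ∀ x : Fin d → ℤ, F x * ENNReal.ofReal |greenC m x| ≤
      ∫⁻ t in Set.Ioi (0 : ℝ), ENNReal.ofReal (b * Real.exp (-(m * t))) *
        (F x * ENNReal.ofReal ((√(1 + t / d))⁻¹ ^ d * Real.exp (-(nOne x / √(1 + t / d))))) :=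
    fun x => by
    have h1 : ENNReal.ofReal |greenC m x| ≤
        ∫⁻ t in Set.Ioi (0 : ℝ), ‖Real.exp (-(m * t)) * heat t x‖ₑ := by
      rw [← Real.enorm_eq_ofReal_abs]; exact enorm_integral_le_lintegral_enorm _
    have hmeas : Measurable fun t : ℝ => ‖Real.exp (-(m * t)) * heat t x‖ₑ :=
      ((continuous_exp_mul m).mul (continuous_heat x)).measurable.enorm
    refine (mul_le_mul_right h1 _).trans ?_
    rw [← lintegral_const_mul _ hmeas]
    refine setLIntegral_mono' measurableSet_Ioi fun t ht => ?_
    have ht0 := (Set.mem_Ioi.1 ht).le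
    have hp : (0 : ℝ) < 1 + t / d := by positivity
    have h := (hB t _ ht0 (Real.sqrt_pos.2 hp) (Real.sq_sqrt hp.le) x).1
    rw [mul_left_comm]
    refine mul_le_mul_right ?_ _
    rw [← ENNReal.ofReal_mul (by positivity), Real.enorm_eq_ofReal_abs, abs_mul,
      abs_of_pos (Real.exp_pos _)]
    apply ENNReal.ofReal_le_ofReal
    calc _ ≤ Real.exp (-(m * t)) * (b * (√(1 + t / d))⁻¹ ^ d * Real.exp (-(nOne x / √(1 + t / d)))) :=
          by gcongr
      _ = _ := by ring
  refine (ENNReal.tsum_le_tsum hpt).trans ?_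
  rw [← lintegral_tsum fun x => ?_]
  · calc ∫⁻ t in Set.Ioi (0 : ℝ), ∑' x, ENNReal.ofReal (b * Real.exp (-(m * t))) *
          (F x * ENNReal.ofReal ((√(1 + t / d))⁻¹ ^ d * Real.exp (-(nOne x / √(1 + t / d)))))
        ≤ ∫⁻ t in Set.Ioi (0 : ℝ), ENNReal.ofReal (b * Real.exp (-(m * t))) * M := by
          refine setLIntegral_mono' measurableSet_Ioi fun t ht => ?_
          rw [ENNReal.tsum_mul_left]
          refine mul_le_mul_right (hF _ ?_) _
          have := (Set.mem_Ioi.1 ht).le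
          rw [Real.one_le_sqrt]
          have : 0 ≤ t / d := by positivity
          linarith
      _ = ENNReal.ofReal (b / m) * M := by
        have hneg : -m < 0 := by linarith
        have hi := (integrableOn_exp_mul_Ioi hneg 0).const_mul b
        have hv := integral_exp_mul_Ioi hneg 0
        simp_rw [neg_mul] at hi hv
        rw [lintegral_mul_const _ (by fun_prop),
          ← ofReal_integral_eq_lintegral_ofReal hi
            (Filter.Eventually.of_forall fun t => by positivity), integral_const_mul, hv]
        simp [div_eq_mul_inv]
  · have : Measurable fun t : ℝ => (√(1 + t / d))⁻¹ ^ d * Real.exp (-(nOne x / √(1 + t / d))) := by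
      fun_prop
    exact (by fun_prop : Measurable _).aemeasurable

/-- The summable weight `(1 + ‖x‖₁)^{-(d+1)}`. -/
noncomputable def hW (x : Fin d → ℤ) : ℝ := (J x)⁻¹ ^ (d + 1)

theorem hW_pos (x : Fin d → ℤ) : 0 < hW x := pow_pos (inv_pos.2 (J_pos x)) _

theorem Tested.tsum_hW {F : (Fin d → ℤ) → ℝ≥0∞} {M : ℝ≥0∞} (hF : Tested F M) :
    ∑' x, F x * ENNReal.ofReal (hW x) ≤ ENNReal.ofReal (2 * Real.exp 2) * M := by
  have hpt : ∀ x : Fin d → ℤ, F x * ENNReal.ofReal (hW x) ≤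
      ∑' k : ℕ, ENNReal.ofReal (Real.exp 2 * (1 / 2) ^ k) * (F x * ENNReal.ofReal
        (((2 : ℝ) ^ k)⁻¹ ^ d * Real.exp (-(nOne x / 2 ^ k)))) := fun x => by
    obtain ⟨k, hk1, hk2⟩ := exists_nat_pow_near (one_le_J x) one_lt_two
    refine le_trans ?_ (ENNReal.le_tsum k)
    rw [mul_left_comm, ← ENNReal.ofReal_mul (by positivity)]
    refine mul_le_mul_right (ENNReal.ofReal_le_ofReal ?_) _
    have h2k : (0 : ℝ) < 2 ^ k := by positivity
    have he : 1 ≤ Real.exp 2 * Real.exp (-(nOne x / 2 ^ k)) := by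
      rw [← Real.exp_add, Real.one_le_exp_iff]
      have : nOne x / 2 ^ k ≤ 2 := by
        rw [div_le_iff₀ h2k]; rw [pow_succ] at hk2; unfold J at hk2; linarith
      linarith
    have hi : (J x)⁻¹ ≤ ((2 : ℝ) ^ k)⁻¹ := inv_anti₀ h2k hk1
    calc hW x ≤ ((2 : ℝ) ^ k)⁻¹ ^ (d + 1) * 1 := by
          rw [mul_one, hW]; exact pow_le_pow_left₀ (inv_pos.2 (J_pos x)).le hi _
      _ ≤ ((2 : ℝ) ^ k)⁻¹ ^ (d + 1) * (Real.exp 2 * Real.exp (-(nOne x / 2 ^ k))) := by gcongr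
      _ = _ := by rw [div_pow, one_pow, one_div]; ring
  refine (ENNReal.tsum_le_tsum hpt).trans ?_
  rw [ENNReal.tsum_comm]
  calc ∑' k : ℕ, ∑' x, ENNReal.ofReal (Real.exp 2 * (1 / 2) ^ k) * (F x * ENNReal.ofReal
        (((2 : ℝ) ^ k)⁻¹ ^ d * Real.exp (-(nOne x / 2 ^ k))))
      ≤ ∑' k : ℕ, ENNReal.ofReal (Real.exp 2 * (1 / 2) ^ k) * M := by
        refine ENNReal.tsum_le_tsum fun k => ?_
        rw [ENNReal.tsum_mul_left]
        exact mul_le_mul_right (hF _ (one_le_pow₀ one_le_two)) _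
    _ = ENNReal.ofReal (2 * Real.exp 2) * M := by
      rw [ENNReal.tsum_mul_right, ← ENNReal.ofReal_tsum_of_nonneg (fun k => by positivity)
        (summable_geometric_two.mul_left _), tsum_mul_left, tsum_geometric_two, mul_comm 2]

end LatticeSums

end WSAW

namespace WSAW
open MeasureTheory
open scoped ENNReal

section Weights

variable {d : ℕ}

theorem J_add_le (x y : Fin d → ℤ) : J (x + y) ≤ J x + J y := by
  have := nOne_add_le x y; unfold J; linarith

theorem J_neg (x : Fin d → ℤ) : J (-x) = J x := by unfold J; rw [nOne_neg]

theorem J_flip (σ : Fin d → Bool) (x : Fin d → ℤ) : J (flip σ x) = J x := by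
  unfold J; rw [nOne_flip]

theorem inv_le_two_mul_inv {a b c : ℝ} (ha : 0 < a) (hb : 0 < b) (hc : 0 < c) (h : c ≤ a + b) :
    a⁻¹ ≤ 2 * c⁻¹ ∨ b⁻¹ ≤ 2 * c⁻¹ := by
  rcases le_total a b with hab | hab
  · right
    rw [← div_eq_mul_inv, le_div_iff₀ hc, inv_mul_le_iff₀ hb]; linarith
  · left
    rw [← div_eq_mul_inv, le_div_iff₀ hc, inv_mul_le_iff₀ ha]; linarith

theorem pow_mul_pow_le_add {a b : ℝ} (ha : 0 ≤ a) (hb : 0 ≤ b) (p q : ℕ) :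
    a ^ p * b ^ q ≤ a ^ (p + q) + b ^ (p + q) := by
  rcases le_total a b with h | h
  · calc a ^ p * b ^ q ≤ b ^ p * b ^ q := by gcongr
      _ = b ^ (p + q) := (pow_add _ _ _).symm
      _ ≤ _ := le_add_of_nonneg_left (by positivity)
  · calc a ^ p * b ^ q ≤ a ^ p * a ^ q := by gcongr
      _ = a ^ (p + q) := (pow_add _ _ _).symm
      _ ≤ _ := le_add_of_nonneg_right (by positivity)

theorem exists_tsum_hW (d : ℕ) : ∃ c : ℝ, 0 < c ∧
    ∑' x : Fin d → ℤ, ENNReal.ofReal (hW x) ≤ ENNReal.ofReal c := by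
  have h := (tested_one (d := d)).tsum_hW
  simp only [one_mul] at h
  rw [← ENNReal.ofReal_mul (by positivity)] at h
  exact ⟨_, by positivity, h⟩

theorem tsum_sub_left {Γ : Type*} [AddCommGroup Γ] (F : Γ → ℝ≥0∞) (x : Γ) :
    ∑' y, F (x - y) = ∑' y, F y := (Equiv.subLeft x).tsum_eq F

theorem exists_conv_hW (d : ℕ) : ∃ c : ℝ, 0 < c ∧ ∀ q : ℕ, q ≤ d + 1 → ∀ x : Fin d → ℤ,
    ∑' y, ENNReal.ofReal (hW (x - y)) * ENNReal.ofReal ((J y)⁻¹ ^ q) ≤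
      ENNReal.ofReal (c * (J x)⁻¹ ^ q) := by
  obtain ⟨c, hc, h⟩ := exists_tsum_hW d
  refine ⟨2 ^ (d + 1) * (c + c), by positivity, fun q hq x => ?_⟩
  have hx := inv_pos.2 (J_pos x)
  have hpt : ∀ y, ENNReal.ofReal (hW (x - y)) * ENNReal.ofReal ((J y)⁻¹ ^ q) ≤
      ENNReal.ofReal (2 ^ (d + 1) * (J x)⁻¹ ^ q) *
        (ENNReal.ofReal (hW (x - y)) + ENNReal.ofReal (hW y)) := fun y => by
    have ha := inv_pos.2 (J_pos (x - y))
    have hb := inv_pos.2 (J_pos y)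
    rw [← ENNReal.ofReal_add (hW_pos _).le (hW_pos _).le, ← ENNReal.ofReal_mul (hW_pos _).le,
      ← ENNReal.ofReal_mul (by positivity)]
    apply ENNReal.ofReal_le_ofReal
    unfold hW
    set a := (J (x - y))⁻¹
    set b := (J y)⁻¹
    set e := (J x)⁻¹
    have h2 : a ^ (d + 1) * b ^ q ≤ (2 * e) ^ q * (a ^ (d + 1) + b ^ (d + 1)) := by
      rcases inv_le_two_mul_inv (J_pos (x - y)) (J_pos y) (J_pos x)
        (by simpa using J_add_le (x - y) y) with h | h
      · have hp := pow_mul_pow_le_add ha.le hb.le (d + 1 - q) q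
        rw [Nat.sub_add_cancel hq] at hp
        calc a ^ (d + 1) * b ^ q = a ^ q * (a ^ (d + 1 - q) * b ^ q) := by
              rw [← mul_assoc, ← pow_add]; congr 2; omega
          _ ≤ _ := by gcongr
      · calc a ^ (d + 1) * b ^ q ≤ a ^ (d + 1) * (2 * e) ^ q := by gcongr
          _ = (2 * e) ^ q * a ^ (d + 1) := mul_comm _ _
          _ ≤ _ := by gcongr; exact le_add_of_nonneg_right (by positivity)
    refine h2.trans ?_
    rw [mul_pow]
    gcongr
    exact one_le_two
  refine (ENNReal.tsum_le_tsum hpt).trans ?_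
  rw [ENNReal.tsum_mul_left, ENNReal.tsum_add, tsum_sub_left (fun y => ENNReal.ofReal (hW y))]
  refine (mul_le_mul_right (add_le_add h h) _).trans ?_
  rw [← ENNReal.ofReal_add hc.le hc.le, ← ENNReal.ofReal_mul (by positivity)]
  exact ENNReal.ofReal_le_ofReal (le_of_eq (by ring))

theorem quasi_of_length {Γ : Type*} [AddCommGroup Γ] {N : Γ → ℝ} (hN : ∀ x, 0 < N x)
    (hadd : ∀ x y, N (x + y) ≤ N x + N y) (p : ℕ) {A τ : ℝ} (hA : 0 ≤ A) (hτ : 0 ≤ τ) (x y : Γ) :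
    ENNReal.ofReal (A * (N x)⁻¹ ^ p + τ) * ENNReal.ofReal (A * (N y)⁻¹ ^ p + τ) ≤
      2 ^ p * ENNReal.ofReal (A * (N (x + y))⁻¹ ^ p + τ) *
        (ENNReal.ofReal (A * (N x)⁻¹ ^ p + τ) + ENNReal.ofReal (A * (N y)⁻¹ ^ p + τ)) := by
  have key : ∀ z, (N z)⁻¹ ≤ 2 * (N (x + y))⁻¹ → ENNReal.ofReal (A * (N z)⁻¹ ^ p + τ) ≤
      2 ^ p * ENNReal.ofReal (A * (N (x + y))⁻¹ ^ p + τ) := fun z hz => by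
    have hzp := inv_pos.2 (hN z)
    rw [show (2 : ℝ≥0∞) ^ p = ENNReal.ofReal (2 ^ p) by simp [ENNReal.ofReal_pow],
      ← ENNReal.ofReal_mul (by positivity)]
    apply ENNReal.ofReal_le_ofReal
    have h1 : (N z)⁻¹ ^ p ≤ 2 ^ p * (N (x + y))⁻¹ ^ p := by
      rw [← mul_pow]; gcongr
    have h2 : (1 : ℝ) ≤ 2 ^ p := one_le_pow₀ one_le_two
    nlinarith
  rcases inv_le_two_mul_inv (hN x) (hN y) (hN (x + y)) (hadd x y) with h | h
  · exact mul_le_mul' (key x h) le_add_self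
  · rw [mul_comm]
    exact mul_le_mul' (key y h) le_self_add

end Weights

end WSAW

namespace WSAW
open MeasureTheory
open scoped ENNReal

section Taylor

variable {d : ℕ}

theorem summable_of_ofReal_tsum {α : Type*} {f : α → ℝ} (hf : ∀ x, 0 ≤ f x)
    (h : ∑' x, ENNReal.ofReal (f x) ≠ ⊤) : Summable f := by
  have := ENNReal.summable_toReal h
  simpa only [ENNReal.toReal_ofReal (hf _)] using this

theorem summable_hW (d : ℕ) : Summable (hW : (Fin d → ℤ) → ℝ) := by
  obtain ⟨c, -, h⟩ := exists_tsum_hW d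
  exact summable_of_ofReal_tsum (fun x => (hW_pos x).le) (ne_top_of_le_ne_top ENNReal.ofReal_ne_top h)

theorem ofReal_abs_tsum_le {α : Type*} (f : α → ℝ) :
    ENNReal.ofReal |∑' x, f x| ≤ ∑' x, ENNReal.ofReal |f x| := by
  simp_rw [← Real.enorm_eq_ofReal_abs]
  exact enorm_tsum_le_tsum_enorm

theorem abs_coord_le (y : Fin d → ℤ) (i : Fin d) : |(y i : ℝ)| ≤ nOne y :=
  Finset.single_le_sum (f := fun i => |(y i : ℝ)|) (fun _ _ => abs_nonneg _) (Finset.mem_univ i)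

theorem sq_coord_le (y : Fin d → ℤ) (i : Fin d) : (y i : ℝ) ^ 2 ≤ J y ^ 2 := by
  rw [← sq_abs]
  have := abs_coord_le y i
  exact pow_le_pow_left₀ (abs_nonneg _) (by unfold J; linarith) 2

theorem J_mul_inv (y : Fin d → ℤ) : J y * (J y)⁻¹ = 1 := mul_inv_cancel₀ (J_pos y).ne'

theorem abs_tsum_le_of_le_add {α : Type*} {f w u : α → ℝ} {A B a b : ℝ} (hA : 0 ≤ A) (hB : 0 ≤ B)
    (hw : ∀ y, 0 ≤ w y) (hu : ∀ y, 0 ≤ u y) (ha : 0 ≤ a) (hb : 0 ≤ b)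
    (hf : ∀ y, |f y| ≤ A * w y + B * u y)
    (hsw : ∑' y, ENNReal.ofReal (w y) ≤ ENNReal.ofReal a)
    (hsu : ∑' y, ENNReal.ofReal (u y) ≤ ENNReal.ofReal b) : |∑' y, f y| ≤ A * a + B * b := by
  rw [← ENNReal.ofReal_le_ofReal_iff (by positivity)]
  refine (ofReal_abs_tsum_le _).trans ?_
  calc ∑' y, ENNReal.ofReal |f y|
      ≤ ∑' y, (ENNReal.ofReal A * ENNReal.ofReal (w y) + ENNReal.ofReal B * ENNReal.ofReal (u y)) := by
        refine ENNReal.tsum_le_tsum fun y => (ENNReal.ofReal_le_ofReal (hf y)).trans (le_of_eq ?_)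
        rw [ENNReal.ofReal_add (mul_nonneg hA (hw y)) (mul_nonneg hB (hu y)),
          ENNReal.ofReal_mul hA, ENNReal.ofReal_mul hB]
    _ ≤ ENNReal.ofReal A * ENNReal.ofReal a + ENNReal.ofReal B * ENNReal.ofReal b := by
        rw [ENNReal.tsum_add, ENNReal.tsum_mul_left, ENNReal.tsum_mul_left]
        exact add_le_add (mul_le_mul_right hsw _) (mul_le_mul_right hsu _)
    _ = _ := by
        rw [ENNReal.ofReal_add (mul_nonneg hA ha) (mul_nonneg hB hb),
          ENNReal.ofReal_mul hA, ENNReal.ofReal_mul hB]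

theorem tsum_flip_average_le {g : (Fin d → ℤ) → ℝ} {f : (Fin d → Bool) → (Fin d → ℤ) → ℝ} {b : ℝ}
    (hg : ∀ y, 0 ≤ g y) (hf : ∀ σ y, f σ y = g (flip σ y))
    (h : ∑' y, ENNReal.ofReal (g y) ≤ ENNReal.ofReal b) :
    ∑' y, ENNReal.ofReal ((∑ σ, f σ y) / 2 ^ d) ≤ ENNReal.ofReal b := by
  have hp : (0 : ℝ) ≤ (2 ^ d)⁻¹ := by positivity
  calc _ = ∑' y, ∑ σ : Fin d → Bool, ENNReal.ofReal (g (flip σ y)) * ENNReal.ofReal ((2 ^ d)⁻¹) :=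
        tsum_congr fun y => by
          simp_rw [hf]
          rw [← Finset.sum_mul, div_eq_mul_inv, ENNReal.ofReal_mul (Finset.sum_nonneg fun σ _ => hg _),
            ENNReal.ofReal_sum_of_nonneg fun σ _ => hg _]
    _ = ∑ σ : Fin d → Bool, (∑' y, ENNReal.ofReal (g y)) * ENNReal.ofReal ((2 ^ d)⁻¹) := by
        rw [Summable.tsum_finsetSum fun _ _ => ENNReal.summable]
        refine Finset.sum_congr rfl fun σ _ => ?_
        rw [ENNReal.tsum_mul_right, (flip σ).tsum_eq fun y => ENNReal.ofReal (g y)]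
    _ ≤ ∑ σ : Fin d → Bool, ENNReal.ofReal b * ENNReal.ofReal ((2 ^ d)⁻¹) :=
        Finset.sum_le_sum fun σ _ => mul_le_mul_left h _
    _ = ENNReal.ofReal b := by
        rw [Finset.sum_const, Finset.card_univ, Fintype.card_fun, Fintype.card_bool, Fintype.card_fin,
          nsmul_eq_mul, mul_left_comm, ← ENNReal.ofReal_natCast, ← ENNReal.ofReal_mul (by positivity)]
        push_cast
        rw [mul_inv_cancel₀ (by positivity), ENNReal.ofReal_one, mul_one]

theorem far_bound {e f η b i wy wx q S p0 p1 D : ℝ} (hη : 0 ≤ η) (hb : 0 ≤ b) (_hi : 0 ≤ i)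
    (hwy : 0 ≤ wy) (hwx : 0 ≤ wx) (he : 0 ≤ e) (hS : 0 ≤ S) (hp0 : 0 ≤ p0) (hp1 : 0 ≤ p1)
    (e1 : i * p1 = wx) (e2 : i ^ 3 * p0 = wx) (hD : 0 ≤ D)
    (hE3 : e ≤ 8 * η * i ^ 3 * wy) (hE1 : e * q ≤ 2 * η * i * wy)
    (hf : f ≤ b * S + b * p0 + q * (D * b * p1)) :
    e * f ≤ (η * b * wx + 8 * η * (b + 2 * D * b) * wx) * wy + 8 * η * b * i ^ 3 * (wy * S) := by
  calc e * f ≤ e * (b * S + b * p0 + q * (D * b * p1)) := mul_le_mul_of_nonneg_left hf he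
    _ = e * (b * S + b * p0) + (e * q) * (D * b * p1) := by ring
    _ ≤ (8 * η * i ^ 3 * wy) * (b * S + b * p0) + (2 * η * i * wy) * (D * b * p1) :=
      add_le_add (mul_le_mul_of_nonneg_right hE3 (by positivity))
        (mul_le_mul_of_nonneg_right hE1 (by positivity))
    _ = 8 * η * b * i ^ 3 * (wy * S) + 8 * η * b * wy * (i ^ 3 * p0) +
        2 * η * D * b * wy * (i * p1) := by ring
    _ = 8 * η * b * i ^ 3 * (wy * S) + 8 * η * b * wy * wx + 2 * η * D * b * wy * wx := by
      rw [e1, e2]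
    _ ≤ _ := by
      have h1 : 0 ≤ η * b * wx * wy := by positivity
      have h2 : 0 ≤ D * (η * b * wx * wy) := by positivity
      nlinarith

theorem exists_taylor (d : ℕ) (hd : 4 < d) : ∃ c : ℝ, 0 < c ∧ ∀ m η : ℝ, 0 ≤ m → 0 ≤ η →
    ∀ E : (Fin d → ℤ) → ℝ, (∀ x, |E x| ≤ η * (J x)⁻¹ ^ (d + 4)) →
    (∀ σ x, E (flip σ x) = E x) → ∑' x, E x = 0 → (∀ i, ∑' x, (x i : ℝ) ^ 2 * E x = 0) →
    ∀ x, |∑' y, E y * greenC m (x - y)| ≤ c * η * hW x := by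
  obtain ⟨b, hb, hG⟩ := exists_green_bounds d (by omega)
  obtain ⟨a, ha, hA⟩ := exists_tsum_hW d
  obtain ⟨k, hk, hK⟩ := exists_conv_hW d
  refine ⟨a * b + 8 * (k * b + b * a + 2 * d * b * a), by positivity,
    fun m η hm hη E hE hflip hE0 hE2 x => ?_⟩
  have hCb := fun y => (hG m hm y).2.2.1
  have hLb := fun y => (hG m hm y).2.2.2.1
  have hT := fun y => (hG m hm y).2.2.2.2
  have hi : ∀ y : Fin d → ℤ, 0 < (J y)⁻¹ := fun y => inv_pos.2 (J_pos y)
  have hi1 : ∀ y : Fin d → ℤ, (J y)⁻¹ ≤ 1 := fun y => inv_le_one_of_one_le₀ (one_le_J y)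
  have hsE : Summable E := by
    refine Summable.of_norm_bounded ((summable_hW d).mul_left η) fun y => (hE y).trans ?_
    unfold hW
    gcongr ?_ * ?_
    exact pow_le_pow_of_le_one (hi y).le (hi1 y) (by omega)
  have hsE2 : ∀ i, Summable fun y => (y i : ℝ) ^ 2 * E y := fun i => by
    refine Summable.of_norm_bounded ((summable_hW d).mul_left η) fun y => ?_
    rw [Real.norm_eq_abs, abs_mul, abs_of_nonneg (sq_nonneg _)]
    have hJ := J_pos y
    calc (y i : ℝ) ^ 2 * |E y| ≤ J y ^ 2 * (η * (J y)⁻¹ ^ (d + 4)) :=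
          mul_le_mul (sq_coord_le y i) (hE y) (abs_nonneg _) (by positivity)
      _ = η * (J y)⁻¹ ^ (d + 2) := by
          have h := J_mul_inv y
          generalize (J y)⁻¹ = i at h ⊢
          calc _ = η * i ^ (d + 2) * (J y * i) ^ 2 := by ring
            _ = _ := by rw [h]; ring
      _ ≤ η * hW y := by
        unfold hW
        gcongr ?_ * ?_
        exact pow_le_pow_of_le_one (hi y).le (hi1 y) (by omega)
  have hsC : ∀ σ : Fin d → Bool, Summable fun y => E y * greenC m (x - flip σ y) := fun σ => by
    refine Summable.of_norm_bounded (hsE.abs.mul_right b) fun y => ?_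
    rw [Real.norm_eq_abs, abs_mul]
    gcongr
    exact (hCb _).trans (mul_le_of_le_one_right hb.le (pow_le_one₀ (hi _).le (hi1 _)))
  set F : (Fin d → ℤ) → ℝ := fun y => (∑ σ : Fin d → Bool, greenC m (x - flip σ y)) / 2 ^ d -
    greenC m x - ∑ i, (y i : ℝ) ^ 2 * greenL m i x with hF
  have hσ : ∀ σ : Fin d → Bool, ∑' y, E y * greenC m (x - flip σ y) =
      ∑' y, E y * greenC m (x - y) := fun σ => by
    rw [← (flip σ).tsum_eq fun y => E y * greenC m (x - y)]
    exact tsum_congr fun y => by rw [hflip]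
  have hval : ∑' y, E y * greenC m (x - y) = ∑' y, E y * F y := by
    have e : ∀ y, E y * F y = (∑ σ : Fin d → Bool, E y * greenC m (x - flip σ y)) / 2 ^ d -
        E y * greenC m x - ∑ i, (y i : ℝ) ^ 2 * E y * greenL m i x := fun y => by
      simp only [hF, mul_sub, Finset.mul_sum, mul_div_assoc']
      congr 1
      exact Finset.sum_congr rfl fun i _ => by ring
    have s1 := (summable_sum (s := Finset.univ) fun (σ : Fin d → Bool) _ => hsC σ).div_const (2 ^ d)
    have s2 := hsE.mul_right (greenC m x)
    have s3 := summable_sum (s := Finset.univ) fun (i : Fin d) _ => (hsE2 i).mul_right (greenL m i x)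
    simp_rw [e]
    rw [(s1.sub s2).tsum_sub s3, s1.tsum_sub s2, tsum_div_const,
      Summable.tsum_finsetSum fun σ _ => hsC σ,
      Summable.tsum_finsetSum fun i _ => (hsE2 i).mul_right (greenL m i x), tsum_mul_right, hE0]
    simp_rw [tsum_mul_right, hE2, hσ]
    simp
  have hx := hi x
  -- pointwise bound
  have hpt : ∀ y, |E y * F y| ≤ (η * b * hW x + 8 * η * (b + 2 * d * b) * hW x) * hW y +
      8 * η * b * (J x)⁻¹ ^ 3 * ((∑ σ : Fin d → Bool, hW y * (J (x - flip σ y))⁻¹ ^ (d - 2)) / 2 ^ d)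
      := fun y => by
    have hy := hi y
    have hJy := J_pos y
    have hJx := J_pos x
    have hwy := hW_pos y
    have hwx := hW_pos x
    have hsn : 0 ≤ (∑ σ : Fin d → Bool, hW y * (J (x - flip σ y))⁻¹ ^ (d - 2)) / 2 ^ d :=
      div_nonneg (Finset.sum_nonneg fun σ _ => mul_nonneg hwy.le (pow_nonneg (hi _).le _)) (by positivity)
    rw [abs_mul]
    by_cases hxy : 2 * nOne y ≤ nOne x
    · have h1 : |E y| * |F y| ≤ η * b * hW x * hW y := by
        have hny := nOne_nonneg y
        have e4 : nOne y ^ 4 ≤ J y ^ 3 * J x := by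
          calc nOne y ^ 4 = nOne y ^ 3 * nOne y := by ring
            _ ≤ J y ^ 3 * J x := by
              have h1 : nOne y ≤ J y := by unfold J; linarith
              have h2 : nOne y ≤ J x := by unfold J; linarith
              gcongr
        calc |E y| * |F y| ≤ (η * (J y)⁻¹ ^ (d + 4)) * (b * nOne y ^ 4 * (J x)⁻¹ ^ (d + 2)) :=
              mul_le_mul (hE y) (hT x y hxy) (abs_nonneg _) (by positivity)
          _ ≤ (η * (J y)⁻¹ ^ (d + 4)) * (b * (J y ^ 3 * J x) * (J x)⁻¹ ^ (d + 2)) := by gcongr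
          _ = η * b * hW x * hW y := by
            have h := J_mul_inv y
            have h' := J_mul_inv x
            unfold hW
            generalize (J y)⁻¹ = i at h ⊢
            generalize (J x)⁻¹ = j at h' ⊢
            calc _ = η * b * j ^ (d + 1) * i ^ (d + 1) * (J y * i) ^ 3 * (J x * j) := by ring
              _ = _ := by rw [h, h']; ring
      have h2 : 0 ≤ 8 * η * (b + 2 * d * b) * hW x * hW y := by positivity
      have h3 : 0 ≤ 8 * η * b * (J x)⁻¹ ^ 3 *
        ((∑ σ : Fin d → Bool, hW y * (J (x - flip σ y))⁻¹ ^ (d - 2)) / 2 ^ d) :=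
        mul_nonneg (by positivity) hsn
      linarith
    · have hyx : (J y)⁻¹ ≤ 2 * (J x)⁻¹ := by
        rw [← div_eq_mul_inv, le_div_iff₀ hJx, inv_mul_le_iff₀ hJy]
        unfold J; linarith [nOne_nonneg y]
      have hE3 : |E y| ≤ 8 * η * (J x)⁻¹ ^ 3 * hW y := by
        refine (hE y).trans ?_
        calc η * (J y)⁻¹ ^ (d + 4) = η * (J y)⁻¹ ^ 3 * hW y := by unfold hW; ring
          _ ≤ η * (2 * (J x)⁻¹) ^ 3 * hW y := by gcongr
          _ = _ := by rw [mul_pow]; ring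
      have hE1 : |E y| * J y ^ 2 ≤ 2 * η * (J x)⁻¹ * hW y := by
        calc |E y| * J y ^ 2 ≤ (η * (J y)⁻¹ ^ (d + 4)) * J y ^ 2 := by gcongr; exact hE y
          _ = η * (J y)⁻¹ * hW y := by
            have h := J_mul_inv y
            unfold hW
            generalize (J y)⁻¹ = i at h ⊢
            calc _ = η * i * i ^ (d + 1) * (J y * i) ^ 2 := by ring
              _ = _ := by rw [h]; ring
          _ ≤ η * (2 * (J x)⁻¹) * hW y := by gcongr
          _ = _ := by ring
      have hFb : |F y| ≤ b * ((∑ σ : Fin d → Bool, (J (x - flip σ y))⁻¹ ^ (d - 2)) / 2 ^ d) +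
          b * (J x)⁻¹ ^ (d - 2) + J y ^ 2 * (d * b * (J x)⁻¹ ^ d) := by
        simp only [hF]
        refine (abs_sub _ _).trans (add_le_add ((abs_sub _ _).trans (add_le_add ?_ (hCb x))) ?_)
        · rw [abs_div, abs_of_pos (by positivity : (0 : ℝ) < 2 ^ d), mul_div_assoc', Finset.mul_sum]
          gcongr
          exact (Finset.abs_sum_le_sum_abs _ _).trans (Finset.sum_le_sum fun σ _ => hCb _)
        · refine (Finset.abs_sum_le_sum_abs _ _).trans ?_
          calc ∑ i, |(y i : ℝ) ^ 2 * greenL m i x| ≤ ∑ i : Fin d, J y ^ 2 * (b * (J x)⁻¹ ^ d) := by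
                refine Finset.sum_le_sum fun i _ => ?_
                rw [abs_mul, abs_of_nonneg (sq_nonneg _)]
                exact mul_le_mul (sq_coord_le y i) (hLb x i) (abs_nonneg _) (by positivity)
            _ = _ := by rw [Finset.sum_const, Finset.card_univ, Fintype.card_fin, nsmul_eq_mul]; ring
      have hS0 : 0 ≤ (∑ σ : Fin d → Bool, (J (x - flip σ y))⁻¹ ^ (d - 2)) / 2 ^ d :=
        div_nonneg (Finset.sum_nonneg fun σ _ => pow_nonneg (hi _).le _) (by positivity)
      set S := (∑ σ : Fin d → Bool, (J (x - flip σ y))⁻¹ ^ (d - 2)) / 2 ^ d with hS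
      have hS' : (∑ σ : Fin d → Bool, hW y * (J (x - flip σ y))⁻¹ ^ (d - 2)) / 2 ^ d = hW y * S := by
        rw [← Finset.mul_sum, mul_div_assoc]
      rw [hS']
      clear_value S F
      have e2 : (J x)⁻¹ ^ 3 * (J x)⁻¹ ^ (d - 2) = hW x := by
        rw [← pow_add, hW]; congr 1; omega
      have e1 : (J x)⁻¹ * (J x)⁻¹ ^ d = hW x := by rw [hW, pow_succ']
      exact far_bound hη hb.le hx.le (hW_pos y).le (hW_pos x).le (abs_nonneg _) hS0 (by positivity)
        (by positivity) e1 e2 (Nat.cast_nonneg d) hE3 hE1 hFb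
  have hsum : ∑' y, ENNReal.ofReal (hW y * (J (x - y))⁻¹ ^ (d - 2)) ≤
      ENNReal.ofReal (k * (J x)⁻¹ ^ (d - 2)) := by
    rw [← tsum_sub_left _ x]
    refine le_trans (le_of_eq (tsum_congr fun y => ?_)) (hK (d - 2) (by omega) x)
    rw [sub_sub_cancel, ENNReal.ofReal_mul (hW_pos _).le]
  have hwx := hW_pos x
  have hfin' := abs_tsum_le_of_le_add (by positivity) (by positivity) (fun y => (hW_pos y).le)
    (fun y => div_nonneg (Finset.sum_nonneg fun σ _ =>
        mul_nonneg (hW_pos y).le (pow_nonneg (hi _).le _)) (by positivity)) ha.le (by positivity)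
    hpt hA (tsum_flip_average_le (g := fun y => hW y * (J (x - y))⁻¹ ^ (d - 2))
      (fun y => mul_nonneg (hW_pos y).le (pow_nonneg (hi _).le _))
      (fun σ y => by rw [hW, hW, J_flip]) hsum)
  rw [hval]
  refine hfin'.trans (le_of_eq ?_)
  have e2 : (J x)⁻¹ ^ 3 * (J x)⁻¹ ^ (d - 2) = hW x := by
    rw [← pow_add, hW]; congr 1; omega
  rw [show 8 * η * b * (J x)⁻¹ ^ 3 * (k * (J x)⁻¹ ^ (d - 2)) =
    8 * η * b * k * ((J x)⁻¹ ^ 3 * (J x)⁻¹ ^ (d - 2)) by ring, e2]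
  ring

end Taylor

end WSAW

namespace WSAW
open scoped ENNReal

section Expansion

variable {S : Type*}

theorem tsum_list_cons {A : Type*} [AddCommGroup A] [UniformSpace A] [IsUniformAddGroup A]
    [CompleteSpace A] [T2Space A] [Fintype S] {f : List S → A} (hf : Summable f) :
    ∑' l, f l = f [] + ∑ e, ∑' l, f (e :: l) := by
  let φ : Unit ⊕ S × List S ≃ List S :=
    { toFun := Sum.elim (fun _ => []) fun p => p.1 :: p.2
      invFun := fun l => match l with
        | [] => Sum.inl ()
        | e :: l => Sum.inr (e, l)
      left_inv := by rintro (_ | ⟨e, l⟩) <;> rfl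
      right_inv := by rintro (_ | ⟨e, l⟩) <;> rfl }
  have hφ := φ.summable_iff.2 hf
  have h2 : Summable fun p : S × List S => f (p.1 :: p.2) :=
    hφ.comp_injective Sum.inr_injective
  rw [← φ.tsum_eq, Summable.tsum_sum (f := fun x => f (φ x)) (hasSum_fintype _).summable h2]
  congr 1
  · simp [φ]
  · rw [← tsum_fintype (L := SummationFilter.unconditional _)]
    exact h2.tsum_prod

theorem tsum_splits_field {𝕜 : Type*} [NormedField 𝕜] [CompleteSpace 𝕜]
    {H : List S × List S → 𝕜} (hH : Summable H) :
    ∑' l, ((splits l).map H).sum = ∑' p, H p := by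
  classical
  have h := (Equiv.sigmaFiberEquiv (fun p : List S × List S => p.1 ++ p.2)).summable_iff.2 hH
  rw [← (Equiv.sigmaFiberEquiv (fun p : List S × List S => p.1 ++ p.2)).tsum_eq]
  refine Eq.trans (tsum_congr fun l => ?_) (Summable.tsum_sigma (f := fun x => H
    (Equiv.sigmaFiberEquiv (fun p : List S × List S => p.1 ++ p.2) x)) h).symm
  rw [sum_splits_eq_tsum]
  rfl

/-- Resummation of the first-step recursion against a bounded test function. -/
theorem tsum_expand {𝕜 : Type*} [NormedField 𝕜] [CompleteSpace 𝕜] [Fintype S] {P F : List S → 𝕜}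
    {L : S → List S → 𝕜} {M : ℝ}
    (hcons : ∀ e l, P (e :: l) = ((splits l).map fun p => L e p.1 * P p.2).sum)
    (hP : Summable fun l => ‖P l‖) (hL : ∀ e, Summable fun ρ => ‖L e ρ‖) (hF : ∀ l, ‖F l‖ ≤ M) :
    ∑' l, P l * F l = P [] * F [] + ∑ e, ∑' ρ, L e ρ * ∑' m, P m * F (e :: (ρ ++ m)) := by
  have hPF : Summable fun l => P l * F l :=
    Summable.of_norm_bounded (hP.mul_right M) fun l => by
      rw [norm_mul]; exact mul_le_mul_of_nonneg_left (hF _) (norm_nonneg _)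
  rw [tsum_list_cons hPF]
  congr 1
  refine Finset.sum_congr rfl fun e _ => ?_
  have hH : Summable fun p : List S × List S => L e p.1 * (P p.2 * F (e :: (p.1 ++ p.2))) := by
    refine Summable.of_norm_bounded (((hL e).mul_of_nonneg hP (fun _ => norm_nonneg _)
      fun _ => norm_nonneg _).mul_right M) fun p => ?_
    rw [← mul_assoc, norm_mul, norm_mul]
    exact mul_le_mul_of_nonneg_left (hF _) (by positivity)
  have h1 := tsum_splits_field hH
  rw [hH.tsum_prod] at h1
  simp_rw [tsum_mul_left] at h1
  rw [← h1]
  refine tsum_congr fun l => ?_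
  rw [hcons, ← List.sum_map_mul_right]
  congr 1
  refine List.map_congr_left fun p hp => ?_
  rw [mem_splits.1 hp]
  ring

theorem tsum_le_of_length {F : List S → ℝ≥0∞} {c : ℝ≥0∞}
    (H : ∀ n, ∃ G : List S → ℝ≥0∞, (∀ ρ, ρ.length ≤ n → F ρ ≤ G ρ) ∧ ∑' ρ, G ρ ≤ c) :
    ∑' ρ, F ρ ≤ c := by
  rw [ENNReal.tsum_eq_iSup_sum]
  refine iSup_le fun s => ?_
  obtain ⟨G, h1, h2⟩ := H (s.sup List.length)
  exact (Finset.sum_le_sum fun ρ hρ => h1 ρ (Finset.le_sup hρ)).trans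
    ((ENNReal.sum_le_tsum s).trans h2)

variable {w w' : List S → ℝ} {ζ : ℝ≥0∞} {q qd : List S → List S → ℝ≥0∞}

theorem tsum_laceInf_le (hq : ∀ a t, ENNReal.ofReal |edgeKer w a t| * ζ ^ t.length ≤ q a t)
    (a : List S) (F : List S → ℝ≥0∞) {c : ℝ≥0∞} (hc : ∀ n, ∑' ρ, elace q n a ρ * F ρ ≤ c) :
    ∑' ρ, ENNReal.ofReal |laceInf w a ρ| * ζ ^ ρ.length * F ρ ≤ c := by
  refine tsum_le_of_length fun n => ⟨fun ρ => elace q n a ρ * F ρ, fun ρ hρ => ?_, hc n⟩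
  rw [laceInf, lace_stable w ρ.length n a ρ le_rfl hρ]
  exact mul_le_mul' (lace_le_elace hq n a ρ) le_rfl

theorem tsum_laceInf_sub_le (hq : ∀ a t, ENNReal.ofReal |edgeKer w a t| * ζ ^ t.length ≤ q a t)
    (hq' : ∀ a t, ENNReal.ofReal |edgeKer w' a t| * ζ ^ t.length ≤ q a t)
    (hqd : ∀ a t, ENNReal.ofReal |edgeKer w' a t - edgeKer w a t| * ζ ^ t.length ≤ qd a t)
    (a : List S) {c : ℝ≥0∞} (hc : ∀ n, ∑' ρ, dlace qd q n a ρ ≤ c) :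
    ∑' ρ, ENNReal.ofReal |laceInf w' a ρ - laceInf w a ρ| * ζ ^ ρ.length ≤ c := by
  refine tsum_le_of_length fun n => ⟨fun ρ => dlace qd q n a ρ, fun ρ hρ => ?_, hc n⟩
  rw [laceInf, laceInf, lace_stable w ρ.length n a ρ le_rfl hρ,
    lace_stable w' ρ.length n a ρ le_rfl hρ]
  exact sub_le_dlace hq hq' hqd n a ρ

theorem laceInf_nil (a : List S) : laceInf w a [] = 1 := by simp [laceInf, lace]

theorem wt_nil : wt w [] = 1 := by simp [wt, sfxs]

theorem wt_singleton (e : S) : wt w [e] = w [e] := by simp [wt, sfxs, pfxs]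

/-- The first-step recursion with an activity attached to each step. -/
theorem activity_cons {𝕜 : Type*} [RCLike 𝕜] (he : ∀ e, w [e] = 1) (z : 𝕜) (e : S) (l : List S) :
    (wt w (e :: l) : 𝕜) * z ^ (e :: l).length = ((splits l).map fun p =>
      (z * ((laceInf w [e] p.1 : 𝕜) * z ^ p.1.length)) * ((wt w p.2 : 𝕜) * z ^ p.2.length)).sum := by
  rw [wt_cons w e l (he e)]
  have hs : ∀ L : List (List S × List S), ((L.map fun p => laceInf w [e] p.1 * wt w p.2).sum : ℝ) =
      ((L.map fun p => (laceInf w [e] p.1 : 𝕜) * (wt w p.2 : 𝕜)).sum : 𝕜) := fun L => by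
    induction L with
    | nil => simp
    | cons x L ih => simp [ih]
  rw [hs, ← List.sum_map_mul_right]
  congr 1
  refine List.map_congr_left fun p hp => ?_
  rw [← mem_splits.1 hp, List.length_cons, List.length_append]
  ring

end Expansion

end WSAW

namespace WSAW
open scoped ENNReal

section GreenFunction

variable {d : ℕ}

/-- The weight of a walk on `ℤ^d` together with an activity `ζ` per step. -/
noncomputable def kZ (d : ℕ) (β : ℝ) (ζ : ℝ≥0∞) (l : List (Fin d × Bool)) : ℝ≥0∞ :=
  ENNReal.ofReal (KZ d β l) * ζ ^ l.length

/-- The two-point function of the weakly self-avoiding walk on `ℤ^d`. -/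
noncomputable def GE (d : ℕ) (β : ℝ) (ζ : ℝ≥0∞) (x : Fin d → ℤ) : ℝ≥0∞ :=
  ∑' l, kZ d β ζ l * del (disp l - x)

theorem tsum_weight_mul_eq {S Γ : Type*} [AddCommGroup Γ] (k : List S → ℝ≥0∞) (D : List S → Γ)
    (F : Γ → ℝ≥0∞) : ∑' l, k l * F (D l) = ∑' x, (∑' l, k l * del (D l - x)) * F x := by
  have h : ∀ l, F (D l) = ∑' x, F x * del (D l - x) := fun l => by
    have := tsum_mul_del F (-D l)
    rw [neg_neg] at this
    rw [← this]
    exact tsum_congr fun x => by rw [← del_neg (D l - x)]; congr 2; abel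
  simp_rw [← ENNReal.tsum_mul_right]
  rw [ENNReal.tsum_comm]
  refine tsum_congr fun l => ?_
  rw [h l, ← ENNReal.tsum_mul_left]
  exact tsum_congr fun x => by ring

theorem tsum_kZ_mul (β : ℝ) (ζ : ℝ≥0∞) (F : (Fin d → ℤ) → ℝ≥0∞) :
    ∑' l, kZ d β ζ l * F (disp l) = ∑' x, GE d β ζ x * F x :=
  tsum_weight_mul_eq _ _ _

theorem kZ_append {β : ℝ} (h0 : 0 ≤ β) (h1 : β ≤ 1) (ζ : ℝ≥0∞) (a b : List (Fin d × Bool)) :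
    kZ d β ζ (a ++ b) ≤ kZ d β ζ a * kZ d β ζ b := by
  have h := wt_append_le (sawW_mem h0 h1 (disp (d := d))) a b
  unfold kZ
  rw [List.length_append, pow_add]
  calc _ ≤ ENNReal.ofReal (KZ d β a * KZ d β b) * (ζ ^ a.length * ζ ^ b.length) :=
        mul_le_mul_left (ENNReal.ofReal_le_ofReal h) _
    _ = _ := by
        rw [ENNReal.ofReal_mul (p := KZ d β a) (wt_mem (sawW_mem h0 h1 _) a).1]
        ring

theorem disp_singleton (e : Fin d × Bool) : disp [e] = wsawStep d e := by simp [disp]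

theorem disp_cons (e : Fin d × Bool) (l : List (Fin d × Bool)) :
    disp (e :: l) = wsawStep d e + disp l := by simp [disp]

theorem nOne_step (e : Fin d × Bool) : nOne (wsawStep d e) = 1 := by
  unfold nOne wsawStep
  rw [Finset.sum_eq_single e.1]
  · rcases e with ⟨i, _ | _⟩ <;> simp
  · intro i _ hi; simp [hi]
  · simp

theorem J_step (e : Fin d × Bool) : J (wsawStep d e) = 2 := by
  rw [J, nOne_step]; norm_num

theorem sawW_step (β : ℝ) (e : Fin d × Bool) : sawW β disp [e] = 1 := by
  rw [sawW, if_neg]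
  intro h
  rw [disp_singleton] at h
  have := nOne_step e
  rw [h] at this
  simp [nOne] at this

theorem kZ_singleton (β : ℝ) (ζ : ℝ≥0∞) (e : Fin d × Bool) : kZ d β ζ [e] = ζ := by
  rw [kZ, KZ, wt_singleton, sawW_step]; simp

theorem ofReal_weight_sq (d : ℕ) (hd : 4 < d) {A : ℝ} (hA : 0 ≤ A) (x : Fin d → ℤ) :
    ENNReal.ofReal (A * (J x)⁻¹ ^ (d - 2)) ^ 2 ≤ ENNReal.ofReal (A ^ 2) * ENNReal.ofReal (hW x) := by
  have hi : 0 < (J x)⁻¹ := inv_pos.2 (J_pos x)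
  rw [← ENNReal.ofReal_pow (by positivity), ← ENNReal.ofReal_mul (by positivity), mul_pow, ← pow_mul,
    hW]
  refine ENNReal.ofReal_le_ofReal (mul_le_mul_of_nonneg_left ?_ (by positivity))
  exact pow_le_pow_of_le_one hi.le (inv_le_one_of_one_le₀ (one_le_J x)) (by omega)

theorem isLine_disp (hd : 4 < d) {β : ℝ} (h0 : 0 ≤ β) (h1 : β ≤ 1) {ζ : ℝ≥0∞} {A a : ℝ} (hA : 0 ≤ A)
    (ha : ∑' x : Fin d → ℤ, ENNReal.ofReal (hW x) ≤ ENNReal.ofReal a)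
    (hG : ∀ x, GE d β ζ x ≤ ENNReal.ofReal (A * (J x)⁻¹ ^ (d - 2))) :
    IsLine disp (kZ d β ζ) (fun x => ENNReal.ofReal (A * (J x)⁻¹ ^ (d - 2))) (2 ^ (d - 2))
      (ENNReal.ofReal (A ^ 2) * ENNReal.ofReal a) where
  D_append := disp_append
  k_append := kZ_append h0 h1 ζ
  even x := by rw [J_neg]
  quasi x y := by
    simpa using quasi_of_length J_pos J_add_le (d - 2) hA le_rfl x y
  sq := by
    refine (ENNReal.tsum_le_tsum fun x => ofReal_weight_sq d hd hA x).trans ?_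
    rw [ENNReal.tsum_mul_left]
    exact mul_le_mul_right ha _
  line F := by
    rw [tsum_kZ_mul]
    exact ENNReal.tsum_le_tsum fun x => mul_le_mul_left (hG x) _

theorem edgeKer_disp_bound {β : ℝ} (h0 : 0 ≤ β) (h1 : β ≤ 1) (ζ : ℝ≥0∞) (a t : List (Fin d × Bool)) :
    ENNReal.ofReal |edgeKer (sawW β disp) a t| * ζ ^ t.length ≤
      ENNReal.ofReal β * ((sfxs a).map fun s => del (disp t + disp s)).sum * kZ d β ζ t :=
  edgeKer_bound disp_append (sawW_mem h0 h1 _) (fun l => (one_sub_sawW β _ l).le) (fun _ => le_rfl) a t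

/-- A threshold below which a real multiple of `β` is at most `1`, as extended reals. -/
theorem ofReal_mul_le_one {β : ℝ} {c : ℝ} {X : ℝ≥0∞} (hX : X ≤ ENNReal.ofReal c) (hc : 0 < c)
    (hβ : β ≤ c⁻¹) : ENNReal.ofReal β * X ≤ 1 := by
  calc _ ≤ ENNReal.ofReal c⁻¹ * ENNReal.ofReal c := mul_le_mul' (ENNReal.ofReal_le_ofReal hβ) hX
    _ = 1 := by rw [← ENNReal.ofReal_mul (by positivity), inv_mul_cancel₀ hc.ne', ENNReal.ofReal_one]

theorem exists_ofReal_mul_le_one {X : ℝ≥0∞} (hX : X ≠ ⊤) :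
    ∃ b : ℝ, 0 < b ∧ ∀ β ≤ b, ENNReal.ofReal β * X ≤ 1 :=
  ⟨(X.toReal + 1)⁻¹, by have := X.toReal_nonneg; positivity, fun β hβ => by
    refine ofReal_mul_le_one (c := X.toReal + 1) ?_ (by have := X.toReal_nonneg; positivity) hβ
    rw [← ENNReal.ofReal_toReal hX]
    exact ENNReal.ofReal_le_ofReal (by simp)⟩

theorem exists_lace_bounds (d : ℕ) (hd : 4 < d) {A : ℝ} (hA : 0 < A) :
    ∃ b c : ℝ, 0 < b ∧ 0 < c ∧ ∀ β, 0 ≤ β → β ≤ 1 → β ≤ b → ∀ ζ : ℝ≥0∞,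
    (∀ x, GE d β ζ x ≤ ENNReal.ofReal (A * (J x)⁻¹ ^ (d - 2))) →
    (∀ e : Fin d × Bool,
      ∑' ρ, ENNReal.ofReal |laceInf (sawW β disp) [e] ρ| * ζ ^ ρ.length ≤ ENNReal.ofReal c) ∧
    ∀ x, ∑ e : Fin d × Bool, ∑' ρ, ENNReal.ofReal |laceInf (sawW β disp) [e] ρ| * ζ ^ ρ.length *
      (if ρ = [] then 0 else ζ * del (disp (e :: ρ) - x)) ≤
      ENNReal.ofReal (c * β * (J x)⁻¹ ^ (d + 4)) := by
  obtain ⟨a, ha0, ha⟩ := exists_tsum_hW d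
  set B : ℝ≥0∞ := ENNReal.ofReal (A ^ 2) * ENNReal.ofReal a with hB
  obtain ⟨b1, hb1, hb1'⟩ := exists_ofReal_mul_le_one (X := 1 + 4 * 2 ^ (d - 2) * B)
    (by simp [hB, ENNReal.mul_eq_top])
  obtain ⟨b2, hb2, hb2'⟩ := exists_ofReal_mul_le_one (X := 16 * (2 ^ (d - 2)) ^ 2 * B)
    (by simp [hB, ENNReal.mul_eq_top])
  refine ⟨min b1 b2, (1 + A) + 2 * d * (2 * (A ^ 3 * 9 ^ (d - 2))), lt_min hb1 hb2, by positivity,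
    fun β h0 h1 hβ ζ hG => ?_⟩
  have hL := isLine_disp hd h0 h1 hA.le ha hG
  have hq := edgeKer_disp_bound (d := d) h0 h1 ζ
  have hE : EdgeBound disp (kZ d β ζ) (ENNReal.ofReal β) fun a t =>
    ENNReal.ofReal β * ((sfxs a).map fun s => del (disp t + disp s)).sum * kZ d β ζ t :=
    fun _ _ => le_rfl
  have hJi : ∀ x : Fin d → ℤ, 0 < (J x)⁻¹ := fun x => inv_pos.2 (J_pos x)
  have hJ1 : ∀ x : Fin d → ℤ, (J x)⁻¹ ≤ 1 := fun x => inv_le_one_of_one_le₀ (one_le_J x)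
  refine ⟨fun e => ?_, fun x => ?_⟩
  · have h := tsum_laceInf_le hq [e] (fun _ => 1) (c := 1 + ENNReal.ofReal A) fun n => by
      simp only [mul_one]
      refine (hL.tsum_elace_le hE (hb1' β (hβ.trans (min_le_left _ _))) n [e]).trans ?_
      refine add_le_add le_rfl ?_
      simp only [mark, sfxs, List.map_cons, List.map_nil, List.sum_cons, List.sum_nil, add_zero]
      exact ENNReal.ofReal_le_ofReal (mul_le_of_le_one_right hA.le (pow_le_one₀ (hJi _).le (hJ1 _)))
    simp only [mul_one] at h
    refine h.trans ?_
    rw [← ENNReal.ofReal_one, ← ENNReal.ofReal_add zero_le_one hA.le]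
    exact ENNReal.ofReal_le_ofReal (le_add_of_nonneg_right (by positivity))
  · have hone : ∀ e : Fin d × Bool, ∑' ρ, ENNReal.ofReal |laceInf (sawW β disp) [e] ρ| *
        ζ ^ ρ.length * (if ρ = [] then 0 else ζ * del (disp (e :: ρ) - x)) ≤
        ENNReal.ofReal (β * (2 * (A ^ 3 * 9 ^ (d - 2))) * (J x)⁻¹ ^ (d + 4)) := fun e => by
      refine tsum_laceInf_le hq [e] _ fun n => ?_
      set u := x - disp [e] with hu
      have hp := hL.pointwise hE (hb2' β (hβ.trans (min_le_right _ _))) n (disp [e]) u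
      rw [hu, add_sub_cancel, ← hu] at hp
      refine le_trans (le_trans (le_of_eq ?_) (ENNReal.le_tsum [e])) (hp.trans ?_)
      · rw [sub_self, del_zero, kZ_singleton, mul_one, ← ENNReal.tsum_mul_left]
        refine tsum_congr fun ρ => ?_
        have : disp (e :: ρ) - x = disp ρ - u := by rw [hu, disp_cons, disp_singleton]; abel
        rw [this, elaceNE]
        split_ifs <;> ring
      · have hux : (J u)⁻¹ ≤ 3 * (J x)⁻¹ := by
          rw [← div_eq_mul_inv, le_div_iff₀ (J_pos x), inv_mul_le_iff₀ (J_pos u)]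
          have h2 := J_add_le u (disp [e])
          rw [hu, sub_add_cancel, ← hu, disp_singleton, J_step] at h2
          linarith [one_le_J u]
        have h2 : ((J u)⁻¹ ^ (d - 2)) ^ 2 ≤ 9 ^ (d - 2) * ((J x)⁻¹ ^ (d - 2)) ^ 2 := by
          calc ((J u)⁻¹ ^ (d - 2)) ^ 2 ≤ ((3 * (J x)⁻¹) ^ (d - 2)) ^ 2 := by
                have := hJi u
                gcongr
            _ = _ := by
                rw [mul_pow, mul_pow, ← pow_mul, mul_comm (d - 2) 2, pow_mul]; norm_num
        have h3 : (J x)⁻¹ ^ (d - 2) * ((J x)⁻¹ ^ (d - 2)) ^ 2 ≤ (J x)⁻¹ ^ (d + 4) := by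
          rw [← pow_mul, ← pow_add]
          exact pow_le_pow_of_le_one (hJi x).le (hJ1 x) (by omega)
        have hx0 := hJi x
        have hu0 := hJi u
        rw [← ENNReal.ofReal_pow (by positivity), ← ENNReal.ofReal_mul (by positivity),
          show (2 : ℝ≥0∞) = ENNReal.ofReal 2 by simp, ← ENNReal.ofReal_mul (by positivity),
          ← ENNReal.ofReal_mul (by positivity)]
        refine ENNReal.ofReal_le_ofReal ?_
        calc 2 * β * (A * (J x)⁻¹ ^ (d - 2) * (A * (J u)⁻¹ ^ (d - 2)) ^ 2)
            = 2 * β * A ^ 3 * ((J x)⁻¹ ^ (d - 2) * ((J u)⁻¹ ^ (d - 2)) ^ 2) := by ring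
          _ ≤ 2 * β * A ^ 3 * ((J x)⁻¹ ^ (d - 2) * (9 ^ (d - 2) * ((J x)⁻¹ ^ (d - 2)) ^ 2)) := by
            gcongr
          _ = 2 * β * A ^ 3 * 9 ^ (d - 2) * ((J x)⁻¹ ^ (d - 2) * ((J x)⁻¹ ^ (d - 2)) ^ 2) := by ring
          _ ≤ 2 * β * A ^ 3 * 9 ^ (d - 2) * (J x)⁻¹ ^ (d + 4) := by gcongr
          _ = _ := by ring
    refine (Finset.sum_le_sum fun e _ => hone e).trans ?_
    have hx0 := hJi x
    rw [← ENNReal.ofReal_sum_of_nonneg fun e _ => by positivity, Finset.sum_const, Finset.card_univ,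
      Fintype.card_prod, Fintype.card_fin, Fintype.card_bool, nsmul_eq_mul]
    refine ENNReal.ofReal_le_ofReal ?_
    have : 0 ≤ (1 + A) * β * (J x)⁻¹ ^ (d + 4) := by positivity
    push_cast
    nlinarith

end GreenFunction

end WSAW

namespace WSAW
open scoped ENNReal

section Symmetry

variable {S : Type*} {w : List S → ℝ} {τ : S → S}

theorem sfxs_map (τ : S → S) (l : List S) : sfxs (l.map τ) = (sfxs l).map (List.map τ) := by
  induction l with
  | nil => rfl
  | cons e l ih => simp [sfxs, ih]

theorem pfxs_map (τ : S → S) (l : List S) : pfxs (l.map τ) = (pfxs l).map (List.map τ) := by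
  induction l with
  | nil => rfl
  | cons e l ih => simp [pfxs, ih, Function.comp_def]

theorem psplits_map (τ : S → S) (l : List S) :
    psplits (l.map τ) = (psplits l).map fun p => (p.1.map τ, p.2.map τ) := by
  induction l with
  | nil => rfl
  | cons e l ih => simp [psplits, ih, Function.comp_def]

theorem wt_map (hw : ∀ l, w (l.map τ) = w l) (l : List S) : wt w (l.map τ) = wt w l := by
  simp [wt, sfxs_map, pfxs_map, Function.comp_def, hw]

theorem inter_map (hw : ∀ l, w (l.map τ) = w l) (a p : List S) :
    inter w (a.map τ) (p.map τ) = inter w a p := by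
  simp only [inter, sfxs_map, List.map_map, Function.comp_def, ← List.map_append, hw]

theorem edgeKer_map (hw : ∀ l, w (l.map τ) = w l) (a t : List S) :
    edgeKer w (a.map τ) (t.map τ) = edgeKer w a t := by
  simp only [edgeKer, inter_map hw, wt_map hw, ← List.map_dropLast, pfxs_map, List.map_map,
    Function.comp_def]

theorem lace_map (hw : ∀ l, w (l.map τ) = w l) (n : ℕ) (a ρ : List S) :
    lace w n (a.map τ) (ρ.map τ) = lace w n a ρ := by
  induction n generalizing a ρ with
  | zero => simp [lace]
  | succ n ih =>
    simp only [lace, psplits_map, List.map_map, Function.comp_def, edgeKer_map hw, ih,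
      List.map_eq_nil_iff]

theorem laceInf_map (hw : ∀ l, w (l.map τ) = w l) (a ρ : List S) :
    laceInf w (a.map τ) (ρ.map τ) = laceInf w a ρ := by
  rw [laceInf, List.length_map, lace_map hw, laceInf]

variable {d : ℕ}

/-- A lattice symmetry: a permutation of the steps induced by an automorphism of `ℤ^d`. -/
structure IsLatticeSymm (T : (Fin d → ℤ) ≃+ (Fin d → ℤ)) (τ : Fin d × Bool ≃ Fin d × Bool) : Prop where
  step : ∀ e, wsawStep d (τ e) = T (wsawStep d e)

namespace IsLatticeSymm

variable {T : (Fin d → ℤ) ≃+ (Fin d → ℤ)} {τ : Fin d × Bool ≃ Fin d × Bool}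

theorem disp_map (h : IsLatticeSymm T τ) (l : List (Fin d × Bool)) : disp (l.map τ) = T (disp l) := by
  induction l with
  | nil => simp [disp]
  | cons e l ih => rw [List.map_cons, disp_cons, disp_cons, ih, h.step, map_add]

theorem sawW_map (h : IsLatticeSymm T τ) (β : ℝ) (l : List (Fin d × Bool)) :
    sawW β disp (l.map τ) = sawW β disp l := by
  simp [sawW, h.disp_map]

theorem laceInf_map (h : IsLatticeSymm T τ) (β : ℝ) (e : Fin d × Bool) (ρ : List (Fin d × Bool)) :
    laceInf (sawW β disp) [τ e] (ρ.map τ) = laceInf (sawW β disp) [e] ρ :=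
  WSAW.laceInf_map (h.sawW_map β) [e] ρ

end IsLatticeSymm

theorem exists_symm_flip (σ : Fin d → Bool) :
    ∃ T τ, IsLatticeSymm T τ ∧ ∀ x : Fin d → ℤ, T x = flip σ x := by
  refine ⟨{ flip σ with map_add' := fun x y => ?_ }, 
    ⟨fun e => (e.1, if σ e.1 then e.2 else !e.2), fun e => (e.1, if σ e.1 then e.2 else !e.2), ?_, ?_⟩,
    ⟨fun e => ?_⟩, fun x => rfl⟩
  · ext i; simp [flip]; split_ifs <;> ring
  · rintro ⟨i, b⟩; by_cases h : σ i <;> simp [h]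
  · rintro ⟨i, b⟩; by_cases h : σ i <;> simp [h]
  · rcases e with ⟨i, b⟩
    ext j
    by_cases hj : j = i
    · subst hj
      cases h : σ j <;> cases b <;> simp [flip, wsawStep, h]
    · simp [flip, wsawStep, hj]

theorem exists_symm_swap (i j : Fin d) :
    ∃ T τ, IsLatticeSymm T τ ∧ ∀ (x : Fin d → ℤ) k, T x k = x (Equiv.swap i j k) := by
  refine ⟨{ toFun := fun x k => x (Equiv.swap i j k), invFun := fun x k => x (Equiv.swap i j k),
            left_inv := fun x => by ext; simp, right_inv := fun x => by ext; simp,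
            map_add' := fun x y => rfl }, (Equiv.swap i j).prodCongr (Equiv.refl _), ⟨fun e => ?_⟩,
    fun x k => rfl⟩
  ext k
  have : k = Equiv.swap i j e.1 ↔ Equiv.swap i j k = e.1 := by
    rw [← (Equiv.swap i j).apply_eq_iff_eq, Equiv.swap_apply_self]
  simp [wsawStep, this]

end Symmetry

end WSAW

namespace WSAW
open scoped ENNReal

section Renewal

variable {d : ℕ}

/-- The kernel `p` corrected at the origin and its neighbours to have vanishing moments up to
order two, where `s` is its mass and `v` its second moment. -/
noncomputable def corrected (p : (Fin d → ℤ) → ℝ) (s v : ℝ) (x : Fin d → ℤ) : ℝ :=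
  (d * v - s) * (if x = 0 then 1 else 0) -
    v / 2 * (∑ e : Fin d × Bool, if x = wsawStep d e then 1 else 0) + p x

theorem hasSum_corrected {p : (Fin d → ℤ) → ℝ} (s v : ℝ) {f : (Fin d → ℤ) → ℝ}
    (hf : Summable fun x => p x * f x) :
    HasSum (fun x => corrected p s v x * f x)
      ((d * v - s) * f 0 - v / 2 * (∑ e : Fin d × Bool, f (wsawStep d e)) + ∑' x, p x * f x) := by
  have h1 : ∀ a : Fin d → ℤ, HasSum (fun x => (if x = a then (1 : ℝ) else 0) * f x) (f a) := fun a => by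
    convert hasSum_ite_eq a (f a) using 2 with x
    by_cases h : x = a <;> simp [h]
  have h2 := hasSum_sum (s := Finset.univ) fun (e : Fin d × Bool) _ => h1 (wsawStep d e)
  refine ((((h1 0).mul_left (d * v - s)).sub (h2.mul_left (v / 2))).add hf.hasSum).congr_fun ?_
  intro x
  simp only [corrected, ← Finset.sum_mul]
  ring

theorem sum_step_sq (i : Fin d) : ∑ e : Fin d × Bool, ((wsawStep d e i : ℤ) : ℝ) ^ 2 = 2 := by
  rw [Fintype.sum_prod_type, Finset.sum_eq_single i]
  · norm_num [wsawStep]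
  · intro j _ hj
    simp [wsawStep, hj.symm]
  · simp

theorem corrected_flip {p : (Fin d → ℤ) → ℝ} (hp : ∀ σ x, p (flip σ x) = p x) (s v : ℝ)
    (σ : Fin d → Bool) (x : Fin d → ℤ) : corrected p s v (flip σ x) = corrected p s v x := by
  obtain ⟨T, τ, h, hT⟩ := exists_symm_flip σ
  have h0 : flip σ x = 0 ↔ x = 0 := by rw [← hT, map_eq_zero_iff T T.injective]
  have h1 : (∑ e : Fin d × Bool, if flip σ x = wsawStep d e then (1 : ℝ) else 0) =
      ∑ e : Fin d × Bool, if x = wsawStep d e then 1 else 0 := by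
    rw [← τ.sum_comp]
    refine Finset.sum_congr rfl fun e _ => ?_
    rw [h.step, ← hT]
    simp
  simp only [corrected, h0, h1, hp]

theorem abs_corrected_le {p : (Fin d → ℤ) → ℝ} {s v η a : ℝ} (hη : 0 ≤ η) (ha : 0 ≤ a)
    (hp : ∀ x, |p x| ≤ η * (J x)⁻¹ ^ (d + 4)) (hs : |s| ≤ a * η) (hv : |v| ≤ a * η) (x : Fin d → ℤ) :
    |corrected p s v x| ≤ (d * a + a + a * (2 * d * 2 ^ (d + 4)) + 1) * η * (J x)⁻¹ ^ (d + 4) := by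
  have hJ := pow_pos (inv_pos.2 (J_pos x)) (d + 4)
  set j := (J x)⁻¹ ^ (d + 4) with hj
  have h0 : |(if x = 0 then (1 : ℝ) else 0)| ≤ j := by
    split_ifs with h
    · rw [hj, h]; simp [J, nOne]
    · simpa using hJ.le
  have h1 : |∑ e : Fin d × Bool, if x = wsawStep d e then (1 : ℝ) else 0| ≤ 2 * d * 2 ^ (d + 4) * j := by
    refine (Finset.abs_sum_le_sum_abs _ _).trans ((Finset.sum_le_card_nsmul _ _ (2 ^ (d + 4) * j)
      fun e _ => ?_).trans (le_of_eq ?_))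
    · split_ifs with h
      · rw [hj, h, J_step, ← mul_pow]; norm_num
      · rw [abs_zero]; positivity
    · simp; ring
  have h2 : |(d * v - s : ℝ)| ≤ (d * a + a) * η := by
    refine (abs_sub _ _).trans ?_
    rw [abs_mul, Nat.abs_cast]
    have := mul_le_mul_of_nonneg_left hv (Nat.cast_nonneg (α := ℝ) d)
    linarith
  have h3 : |v / 2| ≤ a * η := by
    rw [abs_div, abs_two]
    have := abs_nonneg v
    linarith
  have e1 := mul_le_mul h2 h0 (abs_nonneg _) (by positivity)
  have e2 := mul_le_mul h3 h1 (abs_nonneg _) (by positivity)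
  rw [← abs_mul] at e1 e2
  have e3 := hp x
  rw [corrected]
  refine (abs_add_le _ _).trans ?_
  have := abs_sub ((d * v - s) * (if x = 0 then (1 : ℝ) else 0))
    (v / 2 * (∑ e : Fin d × Bool, if x = wsawStep d e then 1 else 0))
  linarith

theorem exists_moment_bounds (d : ℕ) : ∃ a : ℝ, 0 < a ∧ ∀ (η : ℝ) (p : (Fin d → ℤ) → ℝ), 0 ≤ η →
    (∀ x, |p x| ≤ η * (J x)⁻¹ ^ (d + 4)) →
    (∀ f : (Fin d → ℤ) → ℝ, (∃ M, ∀ x, |f x| ≤ M * J x ^ 2) → Summable fun x => p x * f x) ∧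
    |∑' x, p x * 1| ≤ a * η ∧ ∀ i, |∑' x, p x * (x i : ℝ) ^ 2| ≤ a * η := by
  have hS := summable_hW d
  have key : ∀ (η M : ℝ) (p f : (Fin d → ℤ) → ℝ), 0 ≤ η → (∀ x, |p x| ≤ η * (J x)⁻¹ ^ (d + 4)) →
      (∀ x, |f x| ≤ M * J x ^ 2) → ∀ x, ‖p x * f x‖ ≤ η * M * hW x := fun η M p f hη hp hf x => by
    have hi := inv_pos.2 (J_pos x)
    have hM : 0 ≤ M := by
      have := (abs_nonneg _).trans (hf x)
      have hJ := J_pos x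
      by_contra! h
      nlinarith [pow_pos hJ 2]
    rw [Real.norm_eq_abs, abs_mul]
    refine (mul_le_mul (hp x) (hf x) (abs_nonneg _) (by positivity)).trans ?_
    have h1 : η * (J x)⁻¹ ^ (d + 4) * (M * J x ^ 2) = η * M * (J x)⁻¹ ^ (d + 2) * (J x * (J x)⁻¹) ^ 2 := by
      ring
    rw [h1, J_mul_inv, one_pow, mul_one]
    exact mul_le_mul_of_nonneg_left (pow_le_pow_of_le_one hi.le
      (inv_le_one_of_one_le₀ (one_le_J x)) (by omega)) (by positivity)
  have hb : ∀ (η : ℝ) (p f : (Fin d → ℤ) → ℝ), 0 ≤ η → (∀ x, |p x| ≤ η * (J x)⁻¹ ^ (d + 4)) →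
      (∀ x, |f x| ≤ 1 * J x ^ 2) → |∑' x, p x * f x| ≤ (∑' x : Fin d → ℤ, hW x + 1) * η := by
    intro η p f hη hp hf
    have := tsum_of_norm_bounded (hS.hasSum.mul_left (η * 1)) (key η 1 p f hη hp hf)
    rw [Real.norm_eq_abs] at this
    linarith
  refine ⟨∑' x : Fin d → ℤ, hW x + 1, by
    have : 0 ≤ ∑' x : Fin d → ℤ, hW x := tsum_nonneg fun x => (hW_pos x).le
    linarith,
    fun η p hη hp => ⟨fun f ⟨M, hf⟩ => Summable.of_norm_bounded (hS.mul_left _) (key η M p f hη hp hf),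
      hb η p _ hη hp fun x => ?_, fun i => hb η p _ hη hp fun x => ?_⟩⟩
  · rw [abs_one, one_mul]; exact one_le_pow₀ (one_le_J x)
  · rw [abs_of_nonneg (sq_nonneg _), one_mul]; exact sq_coord_le x i

/-- If `P` solves a renewal equation with a kernel close to a multiple of the nearest-neighbour
one, then it is close to a multiple of a massive Green function. -/
theorem exists_renewal (d : ℕ) (hd : 4 < d) : ∃ c η₀ : ℝ, 0 < c ∧ 0 < η₀ ∧
    ∀ (ι : Type) (P : ι → ℝ) (D : ι → Fin d → ℤ) (z η : ℝ) (p : (Fin d → ℤ) → ℝ),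
    1 / (4 * d) ≤ z → 0 ≤ η → η ≤ η₀ → (∀ x, |p x| ≤ η * (J x)⁻¹ ^ (d + 4)) →
    (∀ σ x, p (flip σ x) = p x) →
    (∀ i j, ∑' x, p x * (x i : ℝ) ^ 2 = ∑' x, p x * (x j : ℝ) ^ 2) →
    (∀ l, 0 ≤ P l) → Summable P → 1 ≤ ∑' l, P l →
    (∀ (f : (Fin d → ℤ) → ℝ) (M : ℝ), (∀ x, |f x| ≤ M) → ∑' l, P l * f (D l) = f 0 +
      ∑' l, P l * (z * (∑ e : Fin d × Bool, f (D l + wsawStep d e)) + ∑' x, p x * f (D l + x))) →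
    ∃ α m : ℝ, 0 < α ∧ α ≤ 4 ∧ 0 < m ∧ 1 / m ≤ 2 * ∑' l, P l ∧ ∀ x,
      |(∑' l, P l * if D l = x then 1 else 0) - α * greenC m x| ≤
        c * η * ∑' l, P l * hW (x - D l) := by
  obtain ⟨a, ha, hA⟩ := exists_moment_bounds d
  obtain ⟨b, hb, hB⟩ := exists_taylor d hd
  obtain ⟨g, hg, hG⟩ := exists_green_bounds d (by omega)
  have hd0 : (0 : ℝ) < d := by exact_mod_cast (by omega : 0 < d)
  set K : ℝ := d * a + a + a * (2 * d * 2 ^ (d + 4)) + 1 with hK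
  refine ⟨4 * (b * K), (4 * (d * a + a))⁻¹, by positivity, by positivity, ?_⟩
  intro ι P D z η p hz hη hη0 hp hfl hsw hP hPs hχ1 htest
  obtain ⟨hpS, hs, hv⟩ := hA η p hη hp
  set s := ∑' x, p x * 1 with hs'
  set v := ∑' x, p x * (x (⟨0, by omega⟩ : Fin d) : ℝ) ^ 2 with hv'
  have hv0 := hv ⟨0, by omega⟩
  rw [← hv'] at hv0
  have hvi : ∀ i, ∑' x, p x * (x i : ℝ) ^ 2 = v := fun i => hsw _ _
  set χ := ∑' l, P l with hχ
  have hbd : ∀ (f : (Fin d → ℤ) → ℝ) (M : ℝ), (∀ x, |f x| ≤ M) → Summable fun x => p x * f x :=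
    fun f M hf => hpS f ⟨M, fun x => by
      have h1 := (abs_nonneg _).trans (hf x)
      have h2 := one_le_pow₀ (one_le_J x) (n := 2)
      nlinarith [hf x]⟩
  have hχs : χ = 1 + χ * (2 * d * z + s) := by
    have h := htest (fun _ => 1) 1 fun _ => by simp
    simp only [mul_one, Finset.sum_const, Finset.card_univ, Fintype.card_prod, Fintype.card_fin,
      Fintype.card_bool, nsmul_eq_mul] at h hs'
    rw [tsum_mul_right, ← hχ, ← hs'] at h
    push_cast at h
    linear_combination h
  have hsmall : (d * a + a) * η ≤ 1 / 4 := by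
    have := mul_le_mul_of_nonneg_left hη0 (by positivity : (0 : ℝ) ≤ d * a + a)
    refine this.trans (le_of_eq ?_)
    field_simp
  have hdv : |d * v| ≤ d * a * η := by
    rw [abs_mul, Nat.abs_cast, mul_assoc]; exact mul_le_mul_of_nonneg_left hv0 hd0.le
  obtain ⟨hv1, hv2⟩ := abs_le.1 hdv
  obtain ⟨hs1, hs2⟩ := abs_le.1 hs
  have hdz : 1 / 4 ≤ d * z := by
    have := mul_le_mul_of_nonneg_left hz hd0.le
    refine le_trans (le_of_eq ?_) this
    field_simp
  have hχ0 : 0 < χ := lt_of_lt_of_le one_pos hχ1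
  have hχi : 1 - 2 * d * z - s = 1 / χ := by
    field_simp; linear_combination hχs
  have hχi' : 0 < 1 / χ := by positivity
  have hT1 : 1 / 4 ≤ d * (2 * z + v) := by linarith [mul_nonneg ha.le hη]
  have hT2 : d * (2 * z + v) ≤ 2 := by linarith [mul_nonneg ha.le hη]
  set T := d * (2 * z + v) with hT
  have hT0 : 0 < T := by linarith
  set α := 1 / T with hα
  have hα0 : 0 < α := by positivity
  have hαT : α * T = 1 := by rw [hα]; field_simp
  have hα4 : α ≤ 4 := by rw [hα, div_le_iff₀ hT0]; linarith
  set m := α / χ with hm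
  have hm0 : 0 < m := by positivity
  have hGb : ∀ x, |greenC m x| ≤ g := fun x => (hG m hm0.le x).2.2.1.trans
    (mul_le_of_le_one_right hg.le (pow_le_one₀ (inv_nonneg.2 (J_pos x).le)
      (inv_le_one_of_one_le₀ (one_le_J x))))
  refine ⟨α, m, hα0, hα4, hm0, ?_, fun x => ?_⟩
  · rw [hm, hα, one_div_div, div_div_eq_mul_div, div_one]; nlinarith
  set f : (Fin d → ℤ) → ℝ := fun y => greenC m (x - y) with hf
  have hfb : ∀ y, |f y| ≤ g := fun y => hGb _
  -- the convolution of the corrected kernel with the Green function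
  have hE : ∀ u, α * ∑' y, corrected p s v y * greenC m (u - y) = (if u = 0 then 1 else 0) -
      α * greenC m u + α * (z * (∑ e : Fin d × Bool, greenC m (u - wsawStep d e)) +
        ∑' y, p y * greenC m (u - y)) := fun u => by
    rw [(hasSum_corrected s v (hbd (fun y => greenC m (u - y)) g fun y => hGb _)).tsum_eq, sub_zero]
    have h := greenC_equation (by omega) hm0 u
    have h1 : 1 + m - α * (d * v - s) = α := by
      have : m = α * (1 - 2 * d * z - s) := by rw [hχi, hm]; ring
      rw [this]; linear_combination -hαT
    rw [← h]
    have h2 : α * (v / 2 + z) = 1 / (2 * d) := by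
      field_simp; linear_combination hαT
    generalize (∑ e : Fin d × Bool, greenC m (u - wsawStep d e)) = S at *
    generalize (∑' y, p y * greenC m (u - y)) = R
    rw [div_eq_mul_one_div S, ← h2]
    linear_combination (-greenC m u) * h1
  have hEb : ∀ u, |∑' y, corrected p s v y * greenC m (u - y)| ≤ b * (K * η) * hW u :=
    hB m (K * η) hm0.le (by positivity) _ (abs_corrected_le hη ha.le hp hs hv0)
      (corrected_flip hfl s v)
      (by
        have h := (hasSum_corrected s v (hbd (fun _ => 1) 1 fun _ => by simp)).tsum_eq
        simp only [mul_one] at h hs'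
        rw [h, ← hs']
        simp
        ring)
      (fun i => by
        have h := (hasSum_corrected s v (hpS (fun x => (x i : ℝ) ^ 2) ⟨1, fun x => by
          rw [abs_of_nonneg (sq_nonneg _), one_mul]; exact sq_coord_le x i⟩)).tsum_eq
        rw [hvi, sum_step_sq] at h
        simp_rw [mul_comm _ (corrected p s v _)]
        rw [h]
        simp)
  have hSb : ∀ F : ι → ℝ, ∀ M, (∀ l, |F l| ≤ M) → Summable fun l => P l * F l := fun F M hF =>
    Summable.of_norm_bounded (hPs.mul_right M) fun l => by
      rw [Real.norm_eq_abs, abs_mul, abs_of_nonneg (hP l)]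
      exact mul_le_mul_of_nonneg_left (hF l) (hP l)
  have hhW : ∀ u : Fin d → ℤ, hW u ≤ 1 := fun u =>
    pow_le_one₀ (inv_nonneg.2 (J_pos u).le) (inv_le_one_of_one_le₀ (one_le_J u))
  have hmain : (∑' l, P l * if D l = x then 1 else 0) - α * greenC m x =
      ∑' l, P l * (α * ∑' y, corrected p s v y * greenC m (x - D l - y)) := by
    have h := htest f g hfb
    have hr : ∀ l, P l * (α * ∑' y, corrected p s v y * greenC m (x - D l - y)) =
        P l * (if D l = x then 1 else 0) - α * (P l * f (D l)) +
        α * (P l * (z * (∑ e : Fin d × Bool, f (D l + wsawStep d e)) + ∑' y, p y * f (D l + y))) :=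
      fun l => by
        rw [hE]
        simp only [hf, sub_sub, sub_eq_zero, eq_comm (a := x)]
        ring
    have hs1 := hSb (fun l => if D l = x then 1 else 0) 1 fun l => by split_ifs <;> simp
    have hs2 := (hSb (fun l => f (D l)) g fun l => hfb _).mul_left α
    have hs3 : Summable fun l => α * (P l * (z * (∑ e : Fin d × Bool, f (D l + wsawStep d e)) +
        ∑' y, p y * f (D l + y))) := by
      have h3 := (hSb (fun l => α * ∑' y, corrected p s v y * greenC m (x - D l - y))
        (α * (b * (K * η))) fun l => by
          rw [abs_mul, abs_of_pos hα0]
          exact mul_le_mul_of_nonneg_left ((hEb _).trans (mul_le_of_le_one_right (by positivity)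
            (hhW _))) hα0.le).sub (hs1.sub hs2)
      refine h3.congr fun l => ?_
      rw [hr]; ring
    simp_rw [hr]
    rw [(hs1.sub hs2).tsum_add hs3, hs1.tsum_sub hs2, tsum_mul_left, tsum_mul_left, h]
    simp only [hf, sub_zero]
    ring
  rw [hmain]
  have := tsum_of_norm_bounded (f := fun l => P l * (α * ∑' y, corrected p s v y *
    greenC m (x - D l - y))) ((hSb (fun l => hW (x - D l)) 1 fun l => by
      rw [abs_of_pos (hW_pos _)]; exact hhW _).hasSum.mul_left (4 * (b * K) * η)) fun l => by
      rw [Real.norm_eq_abs, abs_mul, abs_mul, abs_of_nonneg (hP l), abs_of_pos hα0]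
      have h1 := mul_le_mul hα4 (hEb (x - D l)) (abs_nonneg _) (by norm_num)
      have h2 := mul_le_mul_of_nonneg_left h1 (hP l)
      refine h2.trans (le_of_eq ?_)
      ring
  rwa [Real.norm_eq_abs] at this

end Renewal

end WSAW

namespace WSAW
open scoped ENNReal

section Pushforward

variable {ι Γ : Type*} [DecidableEq Γ]

theorem summable_mul_ite {c : ι → ℝ} {D : ι → Γ} (hc : Summable fun q => |c q|) (x : Γ) :
    Summable fun q => c q * if D q = x then 1 else 0 :=
  Summable.of_norm_bounded hc fun q => by
    rw [Real.norm_eq_abs, abs_mul]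
    refine mul_le_of_le_one_right (abs_nonneg _) ?_
    split_ifs <;> simp

theorem tsum_pushforward {c : ι → ℝ} {D : ι → Γ} {f : Γ → ℝ} (hf : Summable fun q => c q * f (D q)) :
    ∑' x, (∑' q, c q * if D q = x then 1 else 0) * f x = ∑' q, c q * f (D q) := by
  rw [← (Equiv.sigmaFiberEquiv D).tsum_eq fun q => c q * f (D q)]
  refine Eq.trans (tsum_congr fun x => ?_)
    ((Equiv.sigmaFiberEquiv D).summable_iff.2 hf).tsum_sigma.symm
  rw [← tsum_mul_right]
  have h : ∀ q, (c q * if D q = x then 1 else 0) * f x =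
      Set.indicator {q | D q = x} (fun q => c q * f (D q)) q := fun q => by
    by_cases hq : D q = x <;> simp [hq]
  rw [tsum_congr h, ← tsum_subtype]
  rfl

end Pushforward

section Kernel

variable {d : ℕ}

/-- The signed weight of an irreducible walk segment of length at least two. -/
noncomputable def segW (β z : ℝ) (q : (Fin d × Bool) × List (Fin d × Bool)) : ℝ :=
  if q.2 = [] then 0 else z * (laceInf (sawW β disp) [q.1] q.2 * z ^ q.2.length)

/-- The kernel of the irreducible walk segments of length at least two. -/
noncomputable def segKer (d : ℕ) (β z : ℝ) (x : Fin d → ℤ) : ℝ :=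
  ∑' q : (Fin d × Bool) × List (Fin d × Bool),
    segW β z q * if disp (q.1 :: q.2) = x then 1 else 0

theorem segKer_symm {T : (Fin d → ℤ) ≃+ (Fin d → ℤ)} {τ : Fin d × Bool ≃ Fin d × Bool}
    (h : IsLatticeSymm T τ) (β z : ℝ) (x : Fin d → ℤ) : segKer d β z (T x) = segKer d β z x := by
  rw [segKer, ← (τ.prodCongr (Equiv.listEquivOfEquiv τ)).tsum_eq, segKer]
  refine tsum_congr fun q => ?_
  have h1 : disp (τ q.1 :: q.2.map τ) = T (disp (q.1 :: q.2)) := h.disp_map (q.1 :: q.2)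
  simp [segW, h.laceInf_map, h1, Equiv.listEquivOfEquiv]

theorem segKer_flip (β z : ℝ) (σ : Fin d → Bool) (x : Fin d → ℤ) :
    segKer d β z (flip σ x) = segKer d β z x := by
  obtain ⟨T, τ, h, hT⟩ := exists_symm_flip σ
  rw [← hT, segKer_symm h]

theorem segKer_second_moment (β z : ℝ) (i j : Fin d) :
    ∑' x, segKer d β z x * (x i : ℝ) ^ 2 = ∑' x, segKer d β z x * (x j : ℝ) ^ 2 := by
  obtain ⟨T, τ, h, hT⟩ := exists_symm_swap i j
  rw [← T.toEquiv.tsum_eq]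
  refine tsum_congr fun x => ?_
  change segKer d β z (T x) * ((T x i : ℤ) : ℝ) ^ 2 = _
  rw [segKer_symm h, hT, Equiv.swap_apply_left]

theorem ofReal_abs_segW {β z : ℝ} (hz : 0 ≤ z) (q : (Fin d × Bool) × List (Fin d × Bool)) :
    ENNReal.ofReal |segW β z q| = ENNReal.ofReal |laceInf (sawW β disp) [q.1] q.2| *
      ENNReal.ofReal z ^ q.2.length * if q.2 = [] then 0 else ENNReal.ofReal z := by
  unfold segW
  split_ifs with h
  · simp
  · rw [abs_mul, abs_mul, abs_of_nonneg hz, abs_of_nonneg (pow_nonneg hz _), ENNReal.ofReal_mul hz,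
      ENNReal.ofReal_mul (abs_nonneg _), ENNReal.ofReal_pow hz]
    ring

theorem abs_segKer_le {β z η : ℝ} (hz : 0 ≤ z) (hη : 0 ≤ η) {x : Fin d → ℤ}
    (h : ∑ e : Fin d × Bool, ∑' ρ, ENNReal.ofReal |laceInf (sawW β disp) [e] ρ| *
      ENNReal.ofReal z ^ ρ.length *
      (if ρ = [] then 0 else ENNReal.ofReal z * del (disp (e :: ρ) - x)) ≤ ENNReal.ofReal η) :
    |segKer d β z x| ≤ η := by
  rw [← ENNReal.ofReal_le_ofReal_iff hη]
  refine (ofReal_abs_tsum_le _).trans (le_trans (le_of_eq ?_) h)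
  rw [ENNReal.tsum_prod', tsum_fintype]
  refine Finset.sum_congr rfl fun e _ => tsum_congr fun ρ => ?_
  rw [abs_mul, ENNReal.ofReal_mul (abs_nonneg _), ofReal_abs_segW hz]
  by_cases h1 : ρ = [] <;> by_cases h2 : disp (e :: ρ) = x <;> simp [h1, h2, del, sub_eq_zero, mul_assoc]

theorem summable_laceInf {β z c : ℝ} (hz : 0 ≤ z) {e : Fin d × Bool}
    (h : ∑' ρ, ENNReal.ofReal |laceInf (sawW β disp) [e] ρ| * ENNReal.ofReal z ^ ρ.length ≤
      ENNReal.ofReal c) :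
    Summable fun ρ => ‖z * (laceInf (sawW β disp) [e] ρ * z ^ ρ.length)‖ := by
  have h1 : Summable fun ρ => |laceInf (sawW β disp) [e] ρ| * z ^ ρ.length :=
    summable_of_ofReal_tsum (fun ρ => by positivity) (ne_top_of_le_ne_top ENNReal.ofReal_ne_top
      (le_trans (le_of_eq (tsum_congr fun ρ => by
        rw [ENNReal.ofReal_mul (abs_nonneg _), ENNReal.ofReal_pow hz])) h))
  refine (h1.mul_left z).congr fun ρ => ?_
  rw [Real.norm_eq_abs, abs_mul, abs_mul, abs_of_nonneg hz, abs_of_nonneg (pow_nonneg hz _)]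

theorem summable_abs_segW {β z : ℝ}
    (h : ∀ e : Fin d × Bool,
      Summable fun ρ => ‖z * (laceInf (sawW β disp) [e] ρ * z ^ ρ.length)‖) :
    Summable fun q : (Fin d × Bool) × List (Fin d × Bool) => |segW β z q| := by
  refine (summable_prod_of_nonneg fun _ => abs_nonneg _).2 ⟨fun e => ?_, (hasSum_fintype _).summable⟩
  refine Summable.of_nonneg_of_le (fun _ => abs_nonneg _) (fun ρ => ?_) (h e)
  unfold segW
  split_ifs
  · rw [abs_zero]; exact norm_nonneg _
  · exact le_rfl

/-- The renewal equation of the two-point function, against a bounded test function. -/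
theorem tsum_walk_renewal {β z M : ℝ} {f : (Fin d → ℤ) → ℝ} (hf : ∀ x, |f x| ≤ M)
    (hL : ∀ e : Fin d × Bool,
      Summable fun ρ => ‖z * (laceInf (sawW β disp) [e] ρ * z ^ ρ.length)‖)
    (hP : Summable fun l : List (Fin d × Bool) => ‖KZ d β l * z ^ l.length‖) :
    ∑' l, KZ d β l * z ^ l.length * f (disp l) = f 0 + ∑' l, KZ d β l * z ^ l.length *
      (z * (∑ e : Fin d × Bool, f (disp l + wsawStep d e)) +
        ∑' x, segKer d β z x * f (disp l + x)) := by
  have hseg := summable_abs_segW hL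
  have hrec := tsum_expand (P := fun l => KZ d β l * z ^ l.length) (F := fun l => f (disp l))
    (L := fun e ρ => z * (laceInf (sawW β disp) [e] ρ * z ^ ρ.length)) (M := M)
    (fun e l => activity_cons (𝕜 := ℝ) (sawW_step β) z e l) hP hL (fun l => hf _)
  have hb : ∀ F : List (Fin d × Bool) → ℝ, (∀ m, |F m| ≤ M) →
      Summable fun m => KZ d β m * z ^ m.length * F m := fun F hF =>
    Summable.of_norm_bounded (hP.mul_right M) fun m => by
      rw [norm_mul]; exact mul_le_mul_of_nonneg_left (hF m) (norm_nonneg _)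
  have hM0 : 0 ≤ M := (abs_nonneg _).trans (hf 0)
  set P : List (Fin d × Bool) → ℝ := fun l => KZ d β l * z ^ l.length with hPdef
  set H : (Fin d × Bool) × List (Fin d × Bool) → ℝ :=
    fun q => ∑' m, P m * f (disp m + disp (q.1 :: q.2)) with hH
  have hHb : ∀ q, |H q| ≤ (∑' m, ‖P m‖) * M := fun q => by
    refine tsum_of_norm_bounded (f := fun m => P m * f (disp m + disp (q.1 :: q.2)))
      (hP.hasSum.mul_right M) fun m => ?_
    rw [norm_mul]; exact mul_le_mul_of_nonneg_left (hf _) (norm_nonneg _)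
  have hsH : Summable fun q => segW β z q * H q :=
    Summable.of_norm_bounded (hseg.mul_right ((∑' m, ‖P m‖) * M)) fun q => by
      rw [norm_mul]; exact mul_le_mul_of_nonneg_left (hHb q) (abs_nonneg _)
  have h1 : ∀ e : Fin d × Bool, ∑' ρ, z * (laceInf (sawW β disp) [e] ρ * z ^ ρ.length) *
      ∑' m, P m * f (disp (e :: (ρ ++ m))) =
      z * (∑' m, P m * f (disp m + wsawStep d e)) + ∑' ρ, segW β z (e, ρ) * H (e, ρ) := fun e => by
    have h2 : ∀ ρ, z * (laceInf (sawW β disp) [e] ρ * z ^ ρ.length) *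
        ∑' m, P m * f (disp (e :: (ρ ++ m))) =
        (if ρ = [] then z * (∑' m, P m * f (disp m + wsawStep d e)) else 0) +
          segW β z (e, ρ) * H (e, ρ) := fun ρ => by
      have h3 : ∑' m, P m * f (disp (e :: (ρ ++ m))) = H (e, ρ) := tsum_congr fun m => by
        rw [← List.cons_append, disp_append, add_comm]
      rw [h3]
      by_cases hρ : ρ = []
      · subst hρ
        simp [segW, laceInf_nil, hH, disp_singleton]
      · simp [segW, hρ]
    have h4 : Summable fun ρ => segW β z (e, ρ) * H (e, ρ) :=
      hsH.comp_injective (i := fun ρ => (e, ρ)) fun a b h => (Prod.mk.inj h).2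
    rw [tsum_congr h2, (hasSum_ite_eq ([] : List (Fin d × Bool)) _).summable.tsum_add h4,
      tsum_ite_eq]
  have hpush : ∀ m, ∑' x, segKer d β z x * f (disp m + x) =
      ∑' q, segW β z q * f (disp m + disp (q.1 :: q.2)) := fun m =>
    tsum_pushforward (f := fun x => f (disp m + x))
      (D := fun q : (Fin d × Bool) × List (Fin d × Bool) => disp (q.1 :: q.2))
      (Summable.of_norm_bounded (hseg.mul_right M) fun q => by
        rw [norm_mul]; exact mul_le_mul_of_nonneg_left (hf _) (abs_nonneg _))
  have hcomm : ∑' q, segW β z q * H q = ∑' m, P m * ∑' x, segKer d β z x * f (disp m + x) := by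
    have hs : Summable (Function.uncurry fun (q : (Fin d × Bool) × List (Fin d × Bool)) m =>
        segW β z q * (P m * f (disp m + disp (q.1 :: q.2)))) := by
      refine Summable.of_norm_bounded ((hseg.mul_of_nonneg hP (fun _ => abs_nonneg _)
        fun _ => norm_nonneg _).mul_right M) fun p => ?_
      rw [Function.uncurry, norm_mul, norm_mul, ← mul_assoc]
      exact mul_le_mul_of_nonneg_left (hf _) (by positivity)
    have h3 : ∀ q, segW β z q * H q = ∑' m, segW β z q * (P m * f (disp m + disp (q.1 :: q.2))) :=
      fun q => tsum_mul_left.symm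
    rw [tsum_congr h3, ← hs.tsum_comm]
    refine tsum_congr fun m => ?_
    rw [hpush, ← tsum_mul_left]
    exact tsum_congr fun q => by ring
  have hsP : ∀ e : Fin d × Bool, Summable fun m => P m * f (disp m + wsawStep d e) :=
    fun e => hb _ fun m => hf _
  rw [hrec]
  have hP0 : P [] * f (disp ([] : List (Fin d × Bool))) = f 0 := by
    simp [hPdef, KZ, wt_nil, disp]
  rw [hP0]
  congr 1
  refine (Finset.sum_congr rfl fun e _ => h1 e).trans ?_
  rw [Finset.sum_add_distrib, ← tsum_fintype (L := SummationFilter.unconditional _)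
    (f := fun e => ∑' ρ, segW β z (e, ρ) * H (e, ρ)), ← hsH.tsum_prod, hcomm]
  have ha : ∀ m, P m * (z * ∑ e : Fin d × Bool, f (disp m + wsawStep d e)) =
      z * ∑ e : Fin d × Bool, P m * f (disp m + wsawStep d e) := fun m => by
    rw [← Finset.mul_sum]; ring
  have hsa : Summable fun m => P m * (z * ∑ e : Fin d × Bool, f (disp m + wsawStep d e)) := by
    simp_rw [ha]
    exact (summable_sum fun e _ => hsP e).mul_left z
  have hsb : Summable fun m => P m * ∑' x, segKer d β z x * f (disp m + x) := by
    have hbd : ∀ m, ‖∑' x, segKer d β z x * f (disp m + x)‖ ≤ (∑' q, |segW β z q|) * M := fun m => by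
      rw [hpush]
      refine tsum_of_norm_bounded (hseg.hasSum.mul_right M) fun q => ?_
      rw [norm_mul]; exact mul_le_mul_of_nonneg_left (hf _) (abs_nonneg _)
    exact Summable.of_norm_bounded (hP.mul_right _) fun m => by
      rw [norm_mul]; exact mul_le_mul_of_nonneg_left (hbd m) (norm_nonneg _)
  have hadd : ∑' l, P l * (z * (∑ e : Fin d × Bool, f (disp l + wsawStep d e)) +
      ∑' x, segKer d β z x * f (disp l + x)) =
      ∑' l, P l * (z * ∑ e : Fin d × Bool, f (disp l + wsawStep d e)) +
      ∑' l, P l * ∑' x, segKer d β z x * f (disp l + x) := by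
    rw [← hsa.tsum_add hsb]
    exact tsum_congr fun l => mul_add _ _ _
  rw [hadd, tsum_congr ha, tsum_mul_left, Summable.tsum_finsetSum fun e _ => hsP e, Finset.mul_sum]

end Kernel

end WSAW

namespace WSAW
open scoped ENNReal

section Step

variable {d : ℕ}

theorem KZ_nonneg {β : ℝ} (h0 : 0 ≤ β) (h1 : β ≤ 1) (l : List (Fin d × Bool)) : 0 ≤ KZ d β l :=
  (wt_mem (sawW_mem h0 h1 _) l).1

theorem KZ_le_one {β : ℝ} (h0 : 0 ≤ β) (h1 : β ≤ 1) (l : List (Fin d × Bool)) : KZ d β l ≤ 1 :=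
  (wt_mem (sawW_mem h0 h1 _) l).2

theorem kZ_ofReal {β z : ℝ} (h0 : 0 ≤ β) (h1 : β ≤ 1) (hz : 0 ≤ z) (l : List (Fin d × Bool)) :
    kZ d β (ENNReal.ofReal z) l = ENNReal.ofReal (KZ d β l * z ^ l.length) := by
  rw [ENNReal.ofReal_mul (KZ_nonneg h0 h1 l), ENNReal.ofReal_pow hz, kZ]

theorem one_le_tsum_KZ {β z : ℝ} (h0 : 0 ≤ β) (h1 : β ≤ 1) (hz : 0 ≤ z)
    (hP : Summable fun l : List (Fin d × Bool) => KZ d β l * z ^ l.length) :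
    1 ≤ ∑' l : List (Fin d × Bool), KZ d β l * z ^ l.length := by
  have := hP.le_tsum [] fun l _ => mul_nonneg (KZ_nonneg h0 h1 l) (pow_nonneg hz _)
  simpa [KZ, wt_nil] using this

theorem le_two_mul_of_le_add_half {T X : ℝ≥0∞} (hT : T ≠ ⊤) (h : T ≤ X + T / 2) : T ≤ 2 * X := by
  have h1 : T / 2 + T / 2 ≤ X + T / 2 := by rwa [ENNReal.add_halves]
  have h2 := ENNReal.le_of_add_le_add_right (ENNReal.div_ne_top hT (by norm_num)) h1
  rw [ENNReal.div_le_iff_le_mul (by simp) (by simp)] at h2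
  rwa [mul_comm]

/-- Absorption of the two-point function in a convolution inequality. -/
theorem le_of_convolution {G C : (Fin d → ℤ) → ℝ≥0∞} {α ε c : ℝ} (hc : 0 < c) (hε : 0 ≤ ε)
    (hεc : ε * c ≤ 1 / 2) (hε2 : ε ≤ 1 / 2) (hα4 : α ≤ 4)
    (hconv : ∀ x : Fin d → ℤ, ∑' y, ENNReal.ofReal (hW (x - y)) * ENNReal.ofReal (hW y) ≤
      ENNReal.ofReal (c * hW x))
    (hG : ∑' x, G x ≠ ⊤)
    (h : ∀ x, G x ≤ ENNReal.ofReal α * C x +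
      ENNReal.ofReal ε * ∑' y, ENNReal.ofReal (hW (x - y)) * G y) (x : Fin d → ℤ) :
    G x ≤ 4 * (C x + ∑' y, ENNReal.ofReal (hW (x - y)) * C y) := by
  set H := fun x : Fin d → ℤ => ∑' y, ENNReal.ofReal (hW (x - y)) * C y with hH
  set T := fun x : Fin d → ℤ => ∑' y, ENNReal.ofReal (hW (x - y)) * G y with hT
  have hW1 : ∀ u : Fin d → ℤ, ENNReal.ofReal (hW u) ≤ 1 := fun u => by
    rw [ENNReal.ofReal_le_one]
    exact pow_le_one₀ (inv_nonneg.2 (J_pos u).le) (inv_le_one_of_one_le₀ (one_le_J u))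
  have hTfin : ∀ x, T x ≠ ⊤ := fun x => ne_top_of_le_ne_top hG
    (ENNReal.tsum_le_tsum fun y => mul_le_of_le_one_left' (hW1 _))
  have hα : ENNReal.ofReal α ≤ 4 := by
    refine (ENNReal.ofReal_le_ofReal hα4).trans (le_of_eq (by norm_num))
  have hTT : ∀ x, ∑' y, ENNReal.ofReal (hW (x - y)) * T y ≤ ENNReal.ofReal c * T x := fun x => by
    calc ∑' y, ENNReal.ofReal (hW (x - y)) * T y
        = ∑' w, (∑' y, ENNReal.ofReal (hW (x - y)) * ENNReal.ofReal (hW (y - w))) * G w := by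
          simp_rw [hT, ← ENNReal.tsum_mul_left, ← ENNReal.tsum_mul_right]
          rw [ENNReal.tsum_comm]
          exact tsum_congr fun w => tsum_congr fun y => by ring
      _ ≤ ∑' w, ENNReal.ofReal (c * hW (x - w)) * G w := ENNReal.tsum_le_tsum fun w => by
          refine mul_le_mul_left (le_trans (le_of_eq ?_) (hconv (x - w))) _
          rw [← (Equiv.addRight w).tsum_eq]
          refine tsum_congr fun y => ?_
          simp only [Equiv.coe_addRight, add_sub_cancel_right]
          rw [show x - (y + w) = x - w - y by abel]
      _ = _ := by
          simp_rw [hT, ENNReal.ofReal_mul hc.le, mul_assoc]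
          rw [ENNReal.tsum_mul_left]
  have h2 : ∀ x, T x ≤ 2 * (ENNReal.ofReal α * H x) := fun x => by
    refine le_two_mul_of_le_add_half (hTfin x) ?_
    calc T x ≤ ∑' y, (ENNReal.ofReal α * (ENNReal.ofReal (hW (x - y)) * C y) +
          ENNReal.ofReal ε * (ENNReal.ofReal (hW (x - y)) * T y)) :=
          ENNReal.tsum_le_tsum fun y => (mul_le_mul_right (h y) _).trans (le_of_eq (by ring))
      _ = ENNReal.ofReal α * H x + ENNReal.ofReal ε * ∑' y, ENNReal.ofReal (hW (x - y)) * T y := by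
          rw [ENNReal.tsum_add, ENNReal.tsum_mul_left, ENNReal.tsum_mul_left]
      _ ≤ ENNReal.ofReal α * H x + T x / 2 := by
          refine add_le_add le_rfl ((mul_le_mul_right (hTT x) _).trans ?_)
          rw [← mul_assoc, ← ENNReal.ofReal_mul hε, ENNReal.div_eq_inv_mul]
          refine mul_le_mul_left ((ENNReal.ofReal_le_ofReal hεc).trans (le_of_eq ?_)) _
          rw [one_div, ENNReal.ofReal_inv_of_pos two_pos, ENNReal.ofReal_ofNat]
  refine (h x).trans ?_
  rw [mul_add]
  refine add_le_add (mul_le_mul_left hα _) ?_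
  calc ENNReal.ofReal ε * T x ≤ ENNReal.ofReal (1 / 2) * (2 * (4 * H x)) :=
        mul_le_mul' (ENNReal.ofReal_le_ofReal hε2)
          ((h2 x).trans (mul_le_mul_right (mul_le_mul_left hα _) _))
    _ = 4 * H x := by
        rw [← mul_assoc, one_div, ENNReal.ofReal_inv_of_pos two_pos, ENNReal.ofReal_ofNat,
          ENNReal.inv_mul_cancel (by simp) (by simp), one_mul]

theorem exists_bootstrap_step (d : ℕ) (hd : 4 < d) (A₀ : ℝ) : ∃ A b : ℝ, A₀ ≤ A ∧ 0 < A ∧ 0 < b ∧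
    ∀ β, 0 ≤ β → β ≤ 1 → β ≤ b → ∀ z : ℝ, 1 / (4 * d) ≤ z →
    (Summable fun l : List (Fin d × Bool) => KZ d β l * z ^ l.length) →
    (∀ x, GE d β (ENNReal.ofReal z) x ≤ ENNReal.ofReal (A * (J x)⁻¹ ^ (d - 2))) →
    (∀ x, GE d β (ENNReal.ofReal z) x ≤ ENNReal.ofReal (A / 2 * (J x)⁻¹ ^ (d - 2))) ∧
    ∃ m : ℝ, 0 < m ∧ 1 / m ≤ 2 * ∑' l : List (Fin d × Bool), KZ d β l * z ^ l.length ∧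
    ∀ x, GE d β (ENNReal.ofReal z) x ≤ 4 * (ENNReal.ofReal |greenC m x| +
      ∑' y, ENNReal.ofReal (hW (x - y)) * ENNReal.ofReal |greenC m y|) := by
  obtain ⟨g, hg, hG⟩ := exists_green_bounds d (by omega)
  obtain ⟨c, hc, hconv⟩ := exists_conv_hW d
  have hA : 0 < |A₀| + 8 * g * (1 + c) := by positivity
  obtain ⟨b1, c1, hb1, hc1, hlace⟩ := exists_lace_bounds d hd hA
  obtain ⟨c2, η₀, hc2, hη₀, hren⟩ := exists_renewal d hd
  set A := |A₀| + 8 * g * (1 + c) with hAdef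
  refine ⟨A, min b1 (min (η₀ / c1) (1 / (2 * (c2 * c1 * (1 + c))))), ?_, hA, by positivity, ?_⟩
  · have := le_abs_self A₀
    have : 0 ≤ 8 * g * (1 + c) := by positivity
    linarith
  intro β h0 h1 hβ z hz hP hGE
  have hd0 : (0 : ℝ) < d := by exact_mod_cast (by omega : 0 < d)
  have hz0 : 0 ≤ z := le_trans (by positivity) hz
  obtain ⟨hβ1, hβ'⟩ := le_min_iff.1 hβ
  obtain ⟨hβ2, hβ3⟩ := le_min_iff.1 hβ'
  rw [le_div_iff₀ hc1] at hβ2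
  rw [le_div_iff₀ (by positivity)] at hβ3
  obtain ⟨hlace1, hlace2⟩ := hlace β h0 h1 hβ1 (ENNReal.ofReal z) hGE
  have hP0 : ∀ l : List (Fin d × Bool), 0 ≤ KZ d β l * z ^ l.length := fun l =>
    mul_nonneg (KZ_nonneg h0 h1 l) (pow_nonneg hz0 _)
  have hPn : Summable fun l : List (Fin d × Bool) => ‖KZ d β l * z ^ l.length‖ := hP.norm
  obtain ⟨α, m, hα0, hα4, hm, hχ, hx⟩ := hren (List (Fin d × Bool)) (fun l => KZ d β l * z ^ l.length)
    disp z (c1 * β) (segKer d β z) hz (by positivity) (by linarith)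
    (fun x => abs_segKer_le hz0 (by have := J_pos x; positivity) (hlace2 x)) (segKer_flip β z)
    (segKer_second_moment β z) hP0 hP (one_le_tsum_KZ h0 h1 hz0 hP)
    fun f M hf => tsum_walk_renewal hf (fun e => summable_laceInf hz0 (hlace1 e)) hPn
  set ε := c2 * (c1 * β) with hε
  have hε0 : 0 ≤ ε := by positivity
  have hε1 : ε * (1 + c) ≤ 1 / 2 := by rw [hε]; linarith
  have hεc : ε * c ≤ 1 / 2 := by linarith
  have hε2 : ε ≤ 1 / 2 := by linarith [mul_nonneg hε0 hc.le]
  have hGEx : ∀ x, GE d β (ENNReal.ofReal z) x =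
      ENNReal.ofReal (∑' l, KZ d β l * z ^ l.length * if disp l = x then 1 else 0) := fun x => by
    rw [ENNReal.ofReal_tsum_of_nonneg (fun l => mul_nonneg (hP0 l) (by split_ifs <;> simp))
      (summable_mul_ite (c := fun l => KZ d β l * z ^ l.length) (by simpa using hPn) x), GE]
    refine tsum_congr fun l => ?_
    rw [kZ_ofReal h0 h1 hz0, ENNReal.ofReal_mul (hP0 l)]
    by_cases h : disp l = x <;> simp [h, del, sub_eq_zero]
  have hW1 : ∀ u : Fin d → ℤ, hW u ≤ 1 := fun u =>
    pow_le_one₀ (inv_nonneg.2 (J_pos u).le) (inv_le_one_of_one_le₀ (one_le_J u))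
  have hHx : ∀ x, ENNReal.ofReal (∑' l, KZ d β l * z ^ l.length * hW (x - disp l)) =
      ∑' y, ENNReal.ofReal (hW (x - y)) * GE d β (ENNReal.ofReal z) y := fun x => by
    rw [ENNReal.ofReal_tsum_of_nonneg (fun l => mul_nonneg (hP0 l) (hW_pos _).le)
      (Summable.of_nonneg_of_le (fun l => mul_nonneg (hP0 l) (hW_pos _).le)
        (fun l => mul_le_of_le_one_right (hP0 l) (hW1 _)) hP)]
    have := tsum_kZ_mul β (ENNReal.ofReal z) fun y => ENNReal.ofReal (hW (x - y))
    simp_rw [mul_comm (ENNReal.ofReal (hW _)), ← this]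
    exact tsum_congr fun l => by rw [ENNReal.ofReal_mul (hP0 l), kZ_ofReal h0 h1 hz0]
  have hfin : ∑' x, GE d β (ENNReal.ofReal z) x ≠ ⊤ := by
    have := tsum_kZ_mul (d := d) β (ENNReal.ofReal z) fun _ => 1
    simp only [mul_one] at this
    rw [← this]
    simp_rw [kZ_ofReal h0 h1 hz0]
    rw [← ENNReal.ofReal_tsum_of_nonneg hP0 hP]
    exact ENNReal.ofReal_ne_top
  have hmain := le_of_convolution (G := GE d β (ENNReal.ofReal z))
    (C := fun x => ENNReal.ofReal |greenC m x|) hc hε0 hεc hε2 hα4 (hconv (d + 1) le_rfl) hfin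
    fun x => by
      rw [← hHx, ← ENNReal.ofReal_mul hα0.le, ← ENNReal.ofReal_mul hε0,
        ← ENNReal.ofReal_add (by positivity)
          (mul_nonneg hε0 (tsum_nonneg fun l => mul_nonneg (hP0 l) (hW_pos _).le)), hGEx]
      refine ENNReal.ofReal_le_ofReal ?_
      have h3 := le_of_abs_le (hx x)
      have h4 := mul_le_mul_of_nonneg_left (le_abs_self (greenC m x)) hα0.le
      linarith
  refine ⟨fun x => (hmain x).trans ?_, m, hm, hχ, hmain⟩
  have hgx : ∀ y, ENNReal.ofReal |greenC m y| ≤ ENNReal.ofReal g * ENNReal.ofReal ((J y)⁻¹ ^ (d - 2)) :=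
    fun y => by
      rw [← ENNReal.ofReal_mul hg.le]
      exact ENNReal.ofReal_le_ofReal (hG m hm.le y).2.2.1
  have hHg : ∑' y, ENNReal.ofReal (hW (x - y)) * ENNReal.ofReal |greenC m y| ≤
      ENNReal.ofReal g * ENNReal.ofReal (c * (J x)⁻¹ ^ (d - 2)) := by
    refine le_trans (ENNReal.tsum_le_tsum fun y => ?_)
      ((ENNReal.tsum_mul_left (a := ENNReal.ofReal g)).le.trans
        (mul_le_mul_right (hconv (d - 2) (by omega) x) _))
    exact (mul_le_mul_right (hgx y) _).trans (le_of_eq (by ring))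
  have hJ : 0 ≤ (J x)⁻¹ ^ (d - 2) := pow_nonneg (inv_nonneg.2 (J_pos x).le) _
  refine (mul_le_mul_right (add_le_add (hgx x) hHg) _).trans ?_
  rw [← ENNReal.ofReal_mul hg.le, ← ENNReal.ofReal_mul hg.le, ← ENNReal.ofReal_add (by positivity)
    (by positivity), ← ENNReal.ofReal_ofNat, ← ENNReal.ofReal_mul (by norm_num)]
  refine ENNReal.ofReal_le_ofReal ?_
  have : 0 ≤ |A₀| * (J x)⁻¹ ^ (d - 2) := by positivity
  rw [hAdef]
  linarith

end Step

end WSAW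

namespace WSAW
open scoped ENNReal
open Filter

section Growth

variable {d : ℕ}

theorem cZ_nonneg {β : ℝ} (h0 : 0 ≤ β) (h1 : β ≤ 1) (n : ℕ) : 0 ≤ cZ d β n := by
  rw [cZ_eq]; exact Finset.sum_nonneg fun _ _ => KZ_nonneg h0 h1 _

theorem cZ_le {β : ℝ} (h0 : 0 ≤ β) (h1 : β ≤ 1) (n : ℕ) : cZ d β n ≤ (2 * d) ^ n := by
  rw [cZ_eq]
  refine (Finset.sum_le_card_nsmul _ _ 1 fun _ _ => KZ_le_one h0 h1 _).trans (le_of_eq ?_)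
  simp [mul_comm]

theorem tsum_KZ_length {β : ℝ} (h0 : 0 ≤ β) (h1 : β ≤ 1) {φ : ℕ → ℝ} (hφ : ∀ n, 0 ≤ φ n) :
    ∑' l : List (Fin d × Bool), ENNReal.ofReal (KZ d β l * φ l.length) =
      ∑' n, ENNReal.ofReal (cZ d β n * φ n) := by
  rw [tsum_list_ennreal]
  refine tsum_congr fun n => ?_
  rw [cZ_eq, Finset.sum_mul, ENNReal.ofReal_sum_of_nonneg fun s _ =>
    mul_nonneg (KZ_nonneg h0 h1 _) (hφ n)]
  simp

theorem summable_KZ_length {β : ℝ} (h0 : 0 ≤ β) (h1 : β ≤ 1) {φ : ℕ → ℝ} (hφ : ∀ n, 0 ≤ φ n)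
    (h : Summable fun n => cZ d β n * φ n) :
    Summable fun l : List (Fin d × Bool) => KZ d β l * φ l.length := by
  refine summable_of_ofReal_tsum (fun l => mul_nonneg (KZ_nonneg h0 h1 l) (hφ _)) ?_
  rw [tsum_KZ_length h0 h1 hφ, ← ENNReal.ofReal_tsum_of_nonneg
    (fun n => mul_nonneg (cZ_nonneg h0 h1 n) (hφ n)) h]
  exact ENNReal.ofReal_ne_top

theorem summable_succ_pow_mul_geometric (k : ℕ) {q : ℝ} (hq : 0 < q) (hq1 : q < 1) :
    Summable fun n : ℕ => ((n : ℝ) + 1) ^ k * q ^ n := by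
  have h := (summable_nat_add_iff 1).2 (summable_pow_mul_geometric_of_norm_lt_one (R := ℝ) k
    (r := q) (by rwa [Real.norm_eq_abs, abs_of_pos hq]))
  refine (h.mul_right q⁻¹).congr fun n => ?_
  push_cast
  rw [pow_succ]
  field_simp

section

variable {β μ : ℝ}

theorem growth_nonneg (h0 : 0 ≤ β) (h1 : β ≤ 1) (h : HasGrowthConst d β μ) : 0 ≤ μ :=
  ge_of_tendsto' h fun n => Real.rpow_nonneg (cZ_nonneg h0 h1 n) _

theorem growth_le (h0 : 0 ≤ β) (h1 : β ≤ 1) (h : HasGrowthConst d β μ) : μ ≤ 2 * d := by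
  refine le_of_tendsto h ?_
  filter_upwards [eventually_ne_atTop 0] with n hn
  refine (Real.rpow_le_rpow (cZ_nonneg h0 h1 n) (cZ_le h0 h1 n) (by positivity)).trans (le_of_eq ?_)
  exact Real.pow_rpow_inv_natCast (by positivity) hn

theorem growth_summable (h0 : 0 ≤ β) (h1 : β ≤ 1) (h : HasGrowthConst d β μ) (k : ℕ) {z : ℝ}
    (hz : 0 ≤ z) (hzμ : z * μ < 1) : Summable fun n => cZ d β n * (((n : ℝ) + 1) ^ k * z ^ n) := by
  obtain ⟨q, hq1, hq2⟩ := exists_between (max_lt hzμ one_pos)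
  obtain ⟨hq1, hq0⟩ := max_lt_iff.1 hq1
  have ht := h.const_mul z
  refine Summable.of_norm_bounded_eventually_nat (summable_succ_pow_mul_geometric k hq0 hq2) ?_
  filter_upwards [ht.eventually_lt_const hq1, eventually_ne_atTop 0] with n hn hn0
  have hc := cZ_nonneg (d := d) h0 h1 n
  rw [Real.norm_eq_abs, abs_of_nonneg (by positivity)]
  have h2 : cZ d β n * z ^ n ≤ q ^ n := by
    have h3 : (z * cZ d β n ^ ((n : ℝ)⁻¹)) ^ n = cZ d β n * z ^ n := by
      rw [mul_pow, Real.rpow_inv_natCast_pow hc hn0, mul_comm]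
    rw [← h3]
    exact pow_le_pow_left₀ (mul_nonneg hz (Real.rpow_nonneg hc _)) hn.le n
  have h4 := mul_le_mul_of_nonneg_left h2 (by positivity : (0 : ℝ) ≤ ((n : ℝ) + 1) ^ k)
  linarith

theorem growth_summable_KZ (h0 : 0 ≤ β) (h1 : β ≤ 1) (h : HasGrowthConst d β μ) (k : ℕ) {z : ℝ}
    (hz : 0 ≤ z) (hzμ : z * μ < 1) : Summable fun l : List (Fin d × Bool) =>
      KZ d β l * (((l.length : ℝ) + 1) ^ k * z ^ l.length) :=
  summable_KZ_length (φ := fun n => ((n : ℝ) + 1) ^ k * z ^ n) h0 h1 (fun n => by positivity)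
    (growth_summable h0 h1 h k hz hzμ)

end

theorem J_disp_le (l : List (Fin d × Bool)) : J (disp l) ≤ l.length + 1 := by
  induction l with
  | nil => simp [disp, J, nOne]
  | cons e l ih =>
    rw [disp_cons]
    have h1 := nOne_add_le (wsawStep d e) (disp l)
    rw [nOne_step] at h1
    unfold J at ih ⊢
    rw [List.length_cons]
    push_cast
    linarith

theorem pow_le_pow_add_mul {z z' w : ℝ} (hz : 0 ≤ z) (h : z ≤ z') (hw : z' ≤ w) (hw0 : 0 < w) (n : ℕ) :
    z' ^ n ≤ z ^ n + (z' - z) * (n * w ^ n / w) := by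
  induction n with
  | zero => simp
  | succ n ih =>
    have h1 := mul_le_mul_of_nonneg_left ih (hz.trans h)
    have h2 : z ^ n ≤ w ^ n := pow_le_pow_left₀ hz (h.trans hw) n
    have h3 := mul_le_mul_of_nonneg_left h2 (sub_nonneg.2 h)
    have h4 : z' * ((z' - z) * (n * w ^ n / w)) ≤ (z' - z) * (n * w ^ n) := by
      have : 0 ≤ (z' - z) * (n * w ^ n / w) := mul_nonneg (sub_nonneg.2 h) (by positivity)
      refine (mul_le_mul_of_nonneg_right hw this).trans (le_of_eq ?_)
      field_simp
    have h5 : (z' - z) * ((n + 1 : ℕ) * w ^ (n + 1) / w) = (z' - z) * (n * w ^ n) + (z' - z) * w ^ n := by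
      rw [pow_succ]; push_cast; field_simp
    rw [h5, pow_succ, pow_succ]
    nlinarith

/-- Pointwise decay bounds on the two-point function from weighted sums over walks. -/
theorem tsum_KZ_del_le {β : ℝ} (h0 : 0 ≤ β) (h1 : β ≤ 1) (q : ℕ) {φ : ℕ → ℝ} (hφ : ∀ n, 0 ≤ φ n) {B : ℝ}
    (h : ∑' l : List (Fin d × Bool), ENNReal.ofReal (KZ d β l * (((l.length : ℝ) + 1) ^ q * φ l.length)) ≤
      ENNReal.ofReal B) (hB : 0 ≤ B) (x : Fin d → ℤ) :
    ∑' l, ENNReal.ofReal (KZ d β l * φ l.length) * del (disp l - x) ≤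
      ENNReal.ofReal (B * (J x)⁻¹ ^ q) := by
  have hJ := pow_pos (inv_pos.2 (J_pos x)) q
  rw [ENNReal.ofReal_mul hB]
  refine le_trans ?_ (mul_le_mul_left h _)
  rw [← ENNReal.tsum_mul_right]
  refine ENNReal.tsum_le_tsum fun l => ?_
  have hk := KZ_nonneg h0 h1 l
  have hφl := hφ l.length
  unfold del
  split_ifs with hx
  · rw [mul_one, ← ENNReal.ofReal_mul (by positivity)]
    refine ENNReal.ofReal_le_ofReal ?_
    have h2 := J_disp_le l
    rw [sub_eq_zero.1 hx] at h2
    have h3 : 1 ≤ ((l.length : ℝ) + 1) ^ q * (J x)⁻¹ ^ q := by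
      rw [← mul_pow]
      refine one_le_pow₀ ?_
      refine (J_mul_inv x).symm.le.trans ?_
      exact mul_le_mul_of_nonneg_right h2 (inv_nonneg.2 (J_pos x).le)
    have h4 := mul_le_mul_of_nonneg_left h3 (mul_nonneg hk hφl)
    linarith
  · simp

theorem GE_mono {β : ℝ} {ζ ζ' : ℝ≥0∞} (h : ζ ≤ ζ') (x : Fin d → ℤ) : GE d β ζ x ≤ GE d β ζ' x :=
  ENNReal.tsum_le_tsum fun _ => mul_le_mul_left (mul_le_mul_right (pow_le_pow_left₀ zero_le h _) _) _

theorem exists_small_bound (d : ℕ) (hd : 0 < d) : ∃ A : ℝ, 0 < A ∧ ∀ β, 0 ≤ β → β ≤ 1 → ∀ x,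
    GE d β (ENNReal.ofReal (1 / (4 * d))) x ≤ ENNReal.ofReal (A * (J x)⁻¹ ^ (d - 2)) := by
  have hd0 : (0 : ℝ) < d := by exact_mod_cast hd
  have hS := summable_succ_pow_mul_geometric (d - 2) (q := 1 / 2) (by norm_num) (by norm_num)
  set B := ∑' n : ℕ, ((n : ℝ) + 1) ^ (d - 2) * (1 / 2) ^ n with hB
  have hB0 : 0 ≤ B := tsum_nonneg fun n => by positivity
  refine ⟨B + 1, by positivity, fun β h0 h1 x => ?_⟩
  have hz : (0 : ℝ) ≤ 1 / (4 * d) := by positivity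
  have h := tsum_KZ_del_le h0 h1 (d - 2) (φ := fun n => (1 / (4 * d) : ℝ) ^ n) (B := B + 1)
    (fun n => by positivity) ?_ (by positivity) x
  · refine le_trans (le_of_eq ?_) h
    exact tsum_congr fun l => by rw [kZ_ofReal h0 h1 hz]
  · rw [tsum_KZ_length h0 h1 (φ := fun n => ((n : ℝ) + 1) ^ (d - 2) * (1 / (4 * d) : ℝ) ^ n)
      fun n => by positivity]
    refine le_trans (ENNReal.tsum_le_tsum fun n => ENNReal.ofReal_le_ofReal ?_) (le_trans
      (ENNReal.ofReal_tsum_of_nonneg (fun n => by positivity) hS).symm.le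
      (ENNReal.ofReal_le_ofReal (by linarith)))
    have h2 : (2 * d : ℝ) ^ n * (1 / (4 * d)) ^ n = (1 / 2) ^ n := by
      rw [← mul_pow]; congr 1; field_simp; norm_num
    have h3 := mul_le_mul_of_nonneg_right (cZ_le (d := d) h0 h1 n)
      (by positivity : (0 : ℝ) ≤ ((n : ℝ) + 1) ^ (d - 2) * (1 / (4 * d)) ^ n)
    refine h3.trans (le_of_eq ?_)
    rw [← h2]; ring

end Growth

end WSAW

namespace WSAW
open scoped ENNReal
open Filter

section Bootstrap

variable {d : ℕ}

theorem exists_GE_lipschitz {β μ : ℝ} (h0 : 0 ≤ β) (h1 : β ≤ 1) (h : HasGrowthConst d β μ) {w : ℝ} (hw : 0 < w)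
    (hwμ : w * μ < 1) : ∃ L : ℝ, 0 < L ∧ ∀ z z', 0 ≤ z → z ≤ z' → z' ≤ w → ∀ x,
      GE d β (ENNReal.ofReal z') x ≤
        GE d β (ENNReal.ofReal z) x + ENNReal.ofReal ((z' - z) * (L * (J x)⁻¹ ^ (d - 2))) := by
  set φ : ℕ → ℝ := fun n => n * w ^ n / w with hφ
  have hφ0 : ∀ n, 0 ≤ φ n := fun n => by positivity
  have hS : Summable fun l : List (Fin d × Bool) =>
      KZ d β l * (((l.length : ℝ) + 1) ^ (d - 2) * φ l.length) := by
    refine Summable.of_nonneg_of_le (fun l => mul_nonneg (KZ_nonneg h0 h1 l) (by positivity)) (fun l => ?_)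
      ((growth_summable_KZ h0 h1 h (d - 2 + 1) hw.le hwμ).mul_right w⁻¹)
    have hk := KZ_nonneg h0 h1 l
    rw [mul_assoc]
    refine mul_le_mul_of_nonneg_left ?_ hk
    rw [pow_succ, hφ]
    have : (l.length : ℝ) ≤ l.length + 1 := by linarith
    calc ((l.length : ℝ) + 1) ^ (d - 2) * (l.length * w ^ l.length / w)
        ≤ ((l.length : ℝ) + 1) ^ (d - 2) * ((l.length + 1) * w ^ l.length / w) := by gcongr
      _ = _ := by ring
  set L := ∑' l : List (Fin d × Bool), KZ d β l * (((l.length : ℝ) + 1) ^ (d - 2) * φ l.length) with hL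
  have hL0 : 0 ≤ L := tsum_nonneg fun l => mul_nonneg (KZ_nonneg h0 h1 l) (by positivity)
  refine ⟨L + 1, by positivity, fun z z' hz hzz hzw x => ?_⟩
  have hB := tsum_KZ_del_le h0 h1 (d - 2) hφ0 (B := L + 1) ?_ (by positivity) x
  · rw [ENNReal.ofReal_mul (sub_nonneg.2 hzz)]
    refine le_trans ?_ (add_le_add_right (mul_le_mul_right hB _) _)
    unfold GE
    rw [← ENNReal.tsum_mul_left, ← ENNReal.tsum_add]
    refine ENNReal.tsum_le_tsum fun l => ?_
    have hk := KZ_nonneg h0 h1 l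
    have hz' := sub_nonneg.2 hzz
    rw [kZ_ofReal h0 h1 hz, kZ_ofReal h0 h1 (hz.trans hzz), ← mul_assoc, ← add_mul,
      ← ENNReal.ofReal_mul hz', ← ENNReal.ofReal_add (by positivity)
        (mul_nonneg hz' (mul_nonneg hk (hφ0 _)))]
    refine mul_le_mul_left (ENNReal.ofReal_le_ofReal ?_) _
    have := mul_le_mul_of_nonneg_left (pow_le_pow_add_mul hz hzz hzw hw l.length) hk
    refine this.trans (le_of_eq ?_)
    rw [hφ]; ring
  · rw [← ENNReal.ofReal_tsum_of_nonneg (fun l => mul_nonneg (KZ_nonneg h0 h1 l)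
      (mul_nonneg (by positivity) (hφ0 _))) hS]
    exact ENNReal.ofReal_le_ofReal (by linarith)

/-- The continuity argument: a decay bound that improves itself propagates along an interval. -/
theorem GE_le_of_bootstrap {β : ℝ} {A w z₀ L : ℝ} (hA : 0 < A) (hz₀ : 0 ≤ z₀) (hzw : z₀ ≤ w)
    (hL : 0 < L)
    (hlip : ∀ z z', 0 ≤ z → z ≤ z' → z' ≤ w → ∀ x, GE d β (ENNReal.ofReal z') x ≤
        GE d β (ENNReal.ofReal z) x + ENNReal.ofReal ((z' - z) * (L * (J x)⁻¹ ^ (d - 2))))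
    (hstep : ∀ z, z₀ ≤ z → z ≤ w →
      (∀ x, GE d β (ENNReal.ofReal z) x ≤ ENNReal.ofReal (A * (J x)⁻¹ ^ (d - 2))) →
      ∀ x, GE d β (ENNReal.ofReal z) x ≤ ENNReal.ofReal (A / 2 * (J x)⁻¹ ^ (d - 2)))
    (hbase : ∀ x, GE d β (ENNReal.ofReal z₀) x ≤ ENNReal.ofReal (A * (J x)⁻¹ ^ (d - 2))) (x) :
    GE d β (ENNReal.ofReal w) x ≤ ENNReal.ofReal (A * (J x)⁻¹ ^ (d - 2)) := by
  set δ := A / (2 * L) with hδ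
  have hδ0 : 0 < δ := by positivity
  have key : ∀ n : ℕ, ∀ x, GE d β (ENNReal.ofReal (min (z₀ + n * δ) w)) x ≤
      ENNReal.ofReal (A * (J x)⁻¹ ^ (d - 2)) := by
    intro n
    induction n with
    | zero => simpa [min_eq_left hzw] using hbase
    | succ n ih =>
      intro x
      have hJ := pow_pos (inv_pos.2 (J_pos x)) (d - 2)
      have hle : z₀ ≤ min (z₀ + n * δ) w := le_min (le_add_of_nonneg_right (by positivity)) hzw
      have hmono : min (z₀ + n * δ) w ≤ min (z₀ + (n + 1 : ℕ) * δ) w := by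
        refine min_le_min_right _ ?_
        push_cast
        nlinarith
      have hdiff : min (z₀ + (n + 1 : ℕ) * δ) w - min (z₀ + n * δ) w ≤ δ := by
        push_cast
        rcases min_choice (z₀ + n * δ) w with h | h <;> rw [h]
        · have := min_le_left (z₀ + (n + 1) * δ) w
          linarith
        · have := min_le_right (z₀ + (n + 1) * δ) w
          linarith
      refine (hlip _ _ (hz₀.trans hle) hmono (min_le_right _ _) x).trans ?_
      refine (add_le_add_left (hstep _ hle (min_le_right _ _) ih x) _).trans ?_
      rw [← ENNReal.ofReal_add (by positivity) (mul_nonneg (sub_nonneg.2 hmono) (by positivity))]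
      refine ENNReal.ofReal_le_ofReal ?_
      have h1 := mul_le_mul_of_nonneg_right hdiff (mul_nonneg hL.le hJ.le)
      have h2 : δ * (L * (J x)⁻¹ ^ (d - 2)) = A / 2 * (J x)⁻¹ ^ (d - 2) := by
        rw [hδ]; field_simp
      linarith
  obtain ⟨n, hn⟩ := exists_nat_ge ((w - z₀) / δ)
  have h := key n x
  rwa [min_eq_right] at h
  rw [div_le_iff₀ hδ0] at hn
  linarith

theorem tsum_KZ_mono {β : ℝ} (h0 : 0 ≤ β) (h1 : β ≤ 1) {z z' : ℝ} (hz : 0 ≤ z) (h : z ≤ z')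
    (hS : Summable fun l : List (Fin d × Bool) => KZ d β l * z' ^ l.length) :
    Summable (fun l : List (Fin d × Bool) => KZ d β l * z ^ l.length) ∧
      ∑' l : List (Fin d × Bool), KZ d β l * z ^ l.length ≤
        ∑' l : List (Fin d × Bool), KZ d β l * z' ^ l.length := by
  have hle : ∀ l : List (Fin d × Bool), KZ d β l * z ^ l.length ≤ KZ d β l * z' ^ l.length :=
    fun l => mul_le_mul_of_nonneg_left (pow_le_pow_left₀ hz h _) (KZ_nonneg h0 h1 l)
  have hs := Summable.of_nonneg_of_le
    (fun l => mul_nonneg (KZ_nonneg h0 h1 l) (pow_nonneg hz _)) hle hS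
  exact ⟨hs, hs.tsum_le_tsum hle hS⟩

theorem growth_summable_KZ_pow {β μ : ℝ} (h0 : 0 ≤ β) (h1 : β ≤ 1) (h : HasGrowthConst d β μ) {z : ℝ}
    (hz : 0 ≤ z) (hzμ : z * μ < 1) :
    Summable fun l : List (Fin d × Bool) => KZ d β l * z ^ l.length := by
  simpa using growth_summable_KZ h0 h1 h 0 hz hzμ

theorem tsum_KZ_small_le {β : ℝ} (h0 : 0 ≤ β) (h1 : β ≤ 1) (hd : 0 < d)
    (hS : Summable fun l : List (Fin d × Bool) => KZ d β l * (1 / (4 * d)) ^ l.length) :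
    ∑' l : List (Fin d × Bool), KZ d β l * (1 / (4 * d)) ^ l.length ≤ 2 := by
  have hd0 : (0 : ℝ) < d := by exact_mod_cast hd
  rw [← ENNReal.ofReal_le_ofReal_iff (by norm_num), ENNReal.ofReal_tsum_of_nonneg
    (fun l => mul_nonneg (KZ_nonneg h0 h1 l) (by positivity)) hS,
    tsum_KZ_length h0 h1 (φ := fun n => (1 / (4 * d) : ℝ) ^ n) fun n => by positivity]
  refine (ENNReal.tsum_le_tsum fun n => ENNReal.ofReal_le_ofReal
    (?_ : _ ≤ (1 / 2 : ℝ) ^ n)).trans ?_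
  · have h3 := mul_le_mul_of_nonneg_right (cZ_le (d := d) h0 h1 n)
      (by positivity : (0 : ℝ) ≤ (1 / (4 * d)) ^ n)
    refine h3.trans (le_of_eq ?_)
    rw [← mul_pow]; congr 1; field_simp; norm_num
  · rw [← ENNReal.ofReal_tsum_of_nonneg (fun n => by positivity) summable_geometric_two,
      tsum_geometric_two]

/-- Decay of the two-point function, uniformly below the critical point. -/
theorem exists_two_point_bound (d : ℕ) (hd : 4 < d) : ∃ A b : ℝ, 0 < A ∧ 0 < b ∧
    ∀ β, 0 ≤ β → β ≤ 1 → β ≤ b → ∀ μ, HasGrowthConst d β μ → ∀ z : ℝ, 0 ≤ z → z * μ < 1 →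
      (∀ x, GE d β (ENNReal.ofReal z) x ≤ ENNReal.ofReal (A * (J x)⁻¹ ^ (d - 2))) ∧
      ∃ m : ℝ, 0 < m ∧ 1 / m ≤ 4 * ∑' l : List (Fin d × Bool), KZ d β l * z ^ l.length ∧
        ∀ x, GE d β (ENNReal.ofReal z) x ≤ 4 * (ENNReal.ofReal |greenC m x| +
          ∑' y, ENNReal.ofReal (hW (x - y)) * ENNReal.ofReal |greenC m y|) := by
  obtain ⟨A₀, hA₀, hsmall⟩ := exists_small_bound d (by omega)
  obtain ⟨A, b, hAA, hA, hb, hboot⟩ := exists_bootstrap_step d hd A₀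
  refine ⟨A, b, hA, hb, fun β h0 h1 hβ μ h => ?_⟩
  have hd0 : (0 : ℝ) < d := by exact_mod_cast (by omega : 0 < d)
  have hμ := growth_le h0 h1 h
  have hz₀ : (0 : ℝ) < 1 / (4 * d) := by positivity
  have hz₀μ : 1 / (4 * d) * μ < 1 := by
    rw [div_mul_eq_mul_div, div_lt_one (by positivity)]
    linarith
  have hμ0 := growth_nonneg h0 h1 h
  have hbase : ∀ x, GE d β (ENNReal.ofReal (1 / (4 * d))) x ≤
      ENNReal.ofReal (A * (J x)⁻¹ ^ (d - 2)) := fun x =>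
    (hsmall β h0 h1 x).trans (ENNReal.ofReal_le_ofReal
      (mul_le_mul_of_nonneg_right hAA (pow_pos (inv_pos.2 (J_pos x)) _).le))
  have hbig : ∀ z : ℝ, 1 / (4 * d) ≤ z → z * μ < 1 → ∀ x, GE d β (ENNReal.ofReal z) x ≤
      ENNReal.ofReal (A * (J x)⁻¹ ^ (d - 2)) := by
    intro w hzw hw
    have hw0 := hz₀.trans_le hzw
    obtain ⟨L, hL, hlip⟩ := exists_GE_lipschitz h0 h1 h hw0 hw
    refine GE_le_of_bootstrap hA hz₀.le hzw hL hlip (fun z hz hzw hQ => ?_) hbase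
    exact (hboot β h0 h1 hβ z hz (growth_summable_KZ_pow h0 h1 h (hz₀.le.trans hz)
      ((mul_le_mul_of_nonneg_right hzw hμ0).trans_lt hw)) hQ).1
  intro z hz hzμ
  rcases le_total (1 / (4 * d) : ℝ) z with hle | hle
  · have hQ := hbig z hle hzμ
    obtain ⟨-, m, hm, hm1, hm2⟩ := hboot β h0 h1 hβ z hle (growth_summable_KZ_pow h0 h1 h hz hzμ) hQ
    refine ⟨hQ, m, hm, hm1.trans ?_, hm2⟩
    have := one_le_tsum_KZ h0 h1 hz (growth_summable_KZ_pow h0 h1 h hz hzμ)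
    linarith
  · have hS₀ := growth_summable_KZ_pow h0 h1 h hz₀.le hz₀μ
    obtain ⟨-, m, hm, hm1, hm2⟩ := hboot β h0 h1 hβ _ le_rfl hS₀ hbase
    have hmono := GE_mono (d := d) (β := β) (ENNReal.ofReal_le_ofReal hle)
    refine ⟨fun x => (hmono x).trans (hbase x), m, hm, ?_, fun x => (hmono x).trans (hm2 x)⟩
    have h2 := one_le_tsum_KZ h0 h1 hz (growth_summable_KZ_pow h0 h1 h hz hzμ)
    have h3 := tsum_KZ_small_le h0 h1 (by omega) hS₀
    linarith

end Bootstrap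

end WSAW

namespace WSAW
open scoped ENNReal
open Filter

section Torus

variable {d : ℕ}

/-- The indicator of the points of a residue class at distance at least `κ * r` from the origin. -/
noncomputable def farInd (κ : ℝ) {r : ℕ} (a : Fin d → ZMod r) (x : Fin d → ℤ) : ℝ≥0∞ :=
  if toT d r x = a ∧ κ * r ≤ nOne x then 1 else 0

theorem farInd_le_add {κ : ℝ} {r : ℕ} (a : Fin d → ZMod r) (x y : Fin d → ℤ) :
    farInd κ a x ≤ farInd (κ / 2) (a - toT d r y) (x - y) +
      farInd (κ / 2) (a - toT d r (x - y)) y := by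
  unfold farInd
  by_cases h : toT d r x = a ∧ κ * r ≤ nOne x
  · obtain ⟨rfl, h⟩ := h
    have h1 := nOne_add_le (x - y) y
    rw [sub_add_cancel] at h1
    rcases le_total (κ / 2 * r) (nOne (x - y)) with h2 | h2
    · rw [if_pos (⟨by rw [map_sub], h2⟩ : toT d r (x - y) = toT d r x - toT d r y ∧ κ / 2 * r ≤ nOne (x - y))]
      exact le_trans (by split_ifs <;> simp) le_self_add
    · rw [if_pos (⟨by rw [map_sub, sub_sub_cancel], by linarith⟩ :
        toT d r y = toT d r x - toT d r (x - y) ∧ κ / 2 * r ≤ nOne y)]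
      exact le_trans (by split_ifs <;> simp) le_add_self
  · rw [if_neg h]; exact zero_le

theorem tsum_farInd_conv_le {κ : ℝ} {r : ℕ} {H G : (Fin d → ℤ) → ℝ≥0∞} {MH MG : ℝ≥0∞}
    (hH : ∀ a : Fin d → ZMod r, ∑' x, farInd (κ / 2) a x * H x ≤ MH)
    (hG : ∀ a : Fin d → ZMod r, ∑' x, farInd (κ / 2) a x * G x ≤ MG) (a : Fin d → ZMod r) :
    ∑' x, farInd κ a x * ∑' y, H (x - y) * G y ≤ MH * ∑' y, G y + MG * ∑' x, H x := by
  calc ∑' x, farInd κ a x * ∑' y, H (x - y) * G y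
      = ∑' y, ∑' x, farInd κ a x * (H (x - y) * G y) := by
        simp_rw [← ENNReal.tsum_mul_left]
        exact ENNReal.tsum_comm
    _ ≤ ∑' y, ∑' x, (farInd (κ / 2) (a - toT d r y) (x - y) * H (x - y) * G y +
          farInd (κ / 2) (a - toT d r (x - y)) y * (H (x - y) * G y)) := by
        refine ENNReal.tsum_le_tsum fun y => ENNReal.tsum_le_tsum fun x => ?_
        rw [mul_assoc, ← add_mul]
        exact mul_le_mul_left (farInd_le_add a x y) _
    _ = ∑' y, ((∑' u, farInd (κ / 2) (a - toT d r y) u * H u) * G y +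
          ∑' u, farInd (κ / 2) (a - toT d r u) y * (H u * G y)) := by
        refine tsum_congr fun y => ?_
        rw [ENNReal.tsum_add]
        congr 1
        · rw [ENNReal.tsum_mul_right]
          congr 1
          exact (Equiv.subRight y).tsum_eq fun u => farInd (κ / 2) (a - toT d r y) u * H u
        · exact (Equiv.subRight y).tsum_eq fun u => farInd (κ / 2) (a - toT d r u) y * (H u * G y)
    _ ≤ MH * ∑' y, G y + MG * ∑' x, H x := by
        rw [ENNReal.tsum_add]
        refine add_le_add ?_ ?_
        · rw [← ENNReal.tsum_mul_left]
          exact ENNReal.tsum_le_tsum fun y => mul_le_mul_left (hH _) _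
        · rw [ENNReal.tsum_comm, ← ENNReal.tsum_mul_left]
          refine ENNReal.tsum_le_tsum fun u => ?_
          refine le_trans (le_of_eq ?_) (mul_le_mul_left (hG (a - toT d r u)) _)
          rw [← ENNReal.tsum_mul_right]
          exact tsum_congr fun y => by ring

/-- The far part of a residue class carries Green function mass of order `r^{-d} / m`. -/
theorem exists_farInd_green (d : ℕ) (hd : 3 ≤ d) : ∃ c : ℝ, 0 < c ∧ ∀ r : ℕ, 1 ≤ r → ∀ m : ℝ, 0 < m →
    ∀ a : Fin d → ZMod r, ∑' x, farInd (1 / 4) a x * (ENNReal.ofReal |greenC m x| +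
      ∑' y, ENNReal.ofReal (hW (x - y)) * ENNReal.ofReal |greenC m y|) ≤
      ENNReal.ofReal (c / m * (r : ℝ)⁻¹ ^ d) := by
  obtain ⟨c₁, hc₁, h₁⟩ := exists_tested_residue d (κ := 1 / 4) (by norm_num)
  obtain ⟨c₂, hc₂, h₂⟩ := exists_tested_residue d (κ := 1 / 4 / 2) (by norm_num)
  obtain ⟨c₃, hc₃, h₃⟩ := exists_tested_greenC d hd
  obtain ⟨c₄, hc₄, h₄⟩ := exists_tsum_hW d
  refine ⟨c₃ * c₁ + (2 * Real.exp 2 * c₂ * (c₃ * 4 ^ d) + c₃ * c₂ * c₄), by positivity,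
    fun r hr m hm a => ?_⟩
  simp_rw [mul_add]
  rw [ENNReal.tsum_add]
  have hR : (0 : ℝ) ≤ (r : ℝ)⁻¹ ^ d := by positivity
  have e1 := h₃ m hm _ _ (h₁ r hr a)
  have e2 := tsum_farInd_conv_le (κ := 1 / 4) (r := r) (H := fun x => ENNReal.ofReal (hW x))
    (G := fun x => ENNReal.ofReal |greenC m x|)
    (fun a => (h₂ r hr a).tsum_hW) (fun a => h₃ m hm _ _ (h₂ r hr a)) a
  have e3 := h₃ m hm _ _ (tested_one (d := d))
  simp only [one_mul] at e3
  refine (add_le_add e1 (e2.trans (add_le_add (mul_le_mul_right e3 _) (mul_le_mul_right h₄ _)))).trans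
    (le_of_eq ?_)
  rw [← ENNReal.ofReal_mul (by positivity), ← ENNReal.ofReal_mul (by positivity),
    ← ENNReal.ofReal_mul (by positivity), ← ENNReal.ofReal_mul (by positivity),
    ← ENNReal.ofReal_mul (by positivity), ← ENNReal.ofReal_mul (by positivity),
    ← ENNReal.ofReal_add (by positivity) (by positivity),
    ← ENNReal.ofReal_add (by positivity) (by positivity)]
  congr 1
  ring

/-- The minimal representative of a torus point. -/
def minRep {r : ℕ} (x : Fin d → ZMod r) : Fin d → ℤ := fun i => (x i).valMinAbs

theorem minRep_injective (r : ℕ) : Function.Injective (minRep (d := d) (r := r)) := fun _ _ h =>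
  funext fun i => ZMod.injective_valMinAbs (congrFun h i)

theorem J_minRep_add_le {r : ℕ} (x y : Fin d → ZMod r) :
    J (minRep (x + y)) ≤ J (minRep x) + J (minRep y) := by
  have h : nOne (minRep (x + y)) ≤ nOne (minRep x) + nOne (minRep y) := by
    unfold nOne
    rw [← Finset.sum_add_distrib]
    refine Finset.sum_le_sum fun i _ => ?_
    have h1 := (ZMod.natAbs_valMinAbs_add_le (x i) (y i)).trans (Int.natAbs_add_le _ _)
    have h2 : (((minRep (x + y) i).natAbs : ℕ) : ℝ) ≤
        ((minRep x i).natAbs : ℕ) + ((minRep y i).natAbs : ℕ) := by exact_mod_cast h1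
    simpa [Nat.cast_natAbs] using h2
  unfold J; linarith

theorem J_minRep_neg {r : ℕ} (x : Fin d → ZMod r) : J (minRep (-x)) = J (minRep x) := by
  unfold J nOne
  congr 1
  refine Finset.sum_congr rfl fun i => fun _ => ?_
  have h := ZMod.natAbs_valMinAbs_neg (x i)
  have h2 : (((minRep (-x) i).natAbs : ℕ) : ℝ) = ((minRep x i).natAbs : ℕ) := by exact_mod_cast h
  simpa [Nat.cast_natAbs] using h2

theorem abs_coord_le_nOne (x : Fin d → ℤ) (i : Fin d) : |(x i : ℝ)| ≤ nOne x :=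
  Finset.single_le_sum (f := fun i => |(x i : ℝ)|) (fun _ _ => abs_nonneg _) (Finset.mem_univ i)

/-- Short vectors are minimal representatives. -/
theorem eq_minRep {r : ℕ} (hr : 1 ≤ r) {x : Fin d → ℤ} (h : nOne x < 1 / 4 * r) : x = minRep (toT d r x) := by
  have : NeZero r := ⟨by omega⟩
  funext i
  refine ((ZMod.valMinAbs_spec _ _).2 ⟨rfl, ?_⟩).symm
  have h1 := (abs_coord_le_nOne x i).trans_lt h
  rw [abs_lt] at h1
  have hr0 : (1 : ℝ) ≤ r := by exact_mod_cast hr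
  constructor
  · have : (-(r : ℝ)) < x i * 2 := by linarith
    exact_mod_cast this
  · have : (x i : ℝ) * 2 ≤ r := by linarith
    exact_mod_cast this

/-- The induced two-point function on the torus: the minimal representative dominates up to
the far part. -/
theorem tsum_toT_le {r : ℕ} (hr : 1 ≤ r) (G : (Fin d → ℤ) → ℝ≥0∞) (a : Fin d → ZMod r) :
    ∑' x, G x * del (toT d r x - a) ≤ G (minRep a) + ∑' x, farInd (1 / 4) a x * G x := by
  have h : ∀ x, G x * del (toT d r x - a) ≤
      (if x = minRep a then G x else 0) + farInd (1 / 4) a x * G x := by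
    intro x
    unfold del
    split_ifs with h1 h2 h2
    · rw [mul_one]; exact le_self_add
    · have hx := sub_eq_zero.1 h1
      have : 1 / 4 * (r : ℝ) ≤ nOne x := by
        by_contra h3
        exact h2 (hx ▸ eq_minRep hr (not_le.1 h3))
      rw [farInd, if_pos ⟨hx, this⟩, mul_one, one_mul, zero_add]
    · simp
    · simp
  refine (ENNReal.tsum_le_tsum h).trans ?_
  rw [ENNReal.tsum_add, tsum_ite_eq]

end Torus

end WSAW

namespace WSAW
open scoped ENNReal
open Filter

section TorusLace

variable {d : ℕ}

theorem tsum_dispT_mul {β : ℝ} {ζ : ℝ≥0∞} {r : ℕ} (f : (Fin d → ℤ) → ℝ≥0∞) (F : (Fin d → ZMod r) → ℝ≥0∞) :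
    ∑' l, kZ d β ζ l * f (disp l) * F (dispT r l) =
      ∑' a, (∑' x, GE d β ζ x * f x * del (toT d r x - a)) * F a := by
  rw [tsum_weight_mul_eq (fun l => kZ d β ζ l * f (disp l)) (dispT r) F]
  refine tsum_congr fun a => ?_
  congr 1
  have h := tsum_kZ_mul (d := d) β ζ fun x => f x * del (toT d r x - a)
  refine (tsum_congr fun l => ?_).trans (h.trans (tsum_congr fun x => ?_))
  · rw [mul_assoc]; rfl
  · rw [mul_assoc]

theorem isLine_torus (hd : 4 < d) {r : ℕ} (hr : 1 ≤ r) {β : ℝ} (h0 : 0 ≤ β) (h1 : β ≤ 1) {ζ : ℝ≥0∞}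
    {A a τ E : ℝ} (hA : 0 ≤ A) (hτ : 0 ≤ τ)
    (ha : ∑' x : Fin d → ℤ, ENNReal.ofReal (hW x) ≤ ENNReal.ofReal a)
    (hG : ∀ x, GE d β ζ x ≤ ENNReal.ofReal (A * (J x)⁻¹ ^ (d - 2)))
    (hfar : ∀ y : Fin d → ZMod r, ∑' x, farInd (1 / 4) y x * GE d β ζ x ≤ ENNReal.ofReal τ)
    (hV : (r : ℝ) ^ d * τ ^ 2 ≤ E) :
    IsLine (dispT r) (kZ d β ζ) (fun x => ENNReal.ofReal (A * (J (minRep x))⁻¹ ^ (d - 2) + τ))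
      (2 ^ (d - 2)) (2 * (ENNReal.ofReal (A ^ 2) * ENNReal.ofReal a) + 2 * ENNReal.ofReal E) where
  D_append := dispT_append r
  k_append := kZ_append h0 h1 ζ
  even x := by rw [J_minRep_neg]
  quasi x y := quasi_of_length (N := fun x : Fin d → ZMod r => J (minRep x)) (fun x => J_pos _)
    J_minRep_add_le (d - 2) hA hτ x y
  sq := by
    have : NeZero r := ⟨by omega⟩
    have hJ : ∀ x : Fin d → ℤ, 0 ≤ A * (J x)⁻¹ ^ (d - 2) := fun x =>
      mul_nonneg hA (pow_pos (inv_pos.2 (J_pos x)) _).le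
    have h : ∀ x : Fin d → ZMod r, ENNReal.ofReal (A * (J (minRep x))⁻¹ ^ (d - 2) + τ) ^ 2 ≤
        2 * ENNReal.ofReal (A * (J (minRep x))⁻¹ ^ (d - 2)) ^ 2 + 2 * ENNReal.ofReal (τ ^ 2) := by
      intro x
      have hJx := hJ (minRep x)
      rw [← ENNReal.ofReal_pow (add_nonneg hJx hτ), ← ENNReal.ofReal_pow hJx,
        show (2 : ℝ≥0∞) = ENNReal.ofReal 2 by simp, ← ENNReal.ofReal_mul (by norm_num),
        ← ENNReal.ofReal_mul (by norm_num), ← ENNReal.ofReal_add (by positivity) (by positivity)]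
      refine ENNReal.ofReal_le_ofReal ?_
      nlinarith [sq_nonneg (A * (J (minRep x))⁻¹ ^ (d - 2) - τ)]
    refine (ENNReal.tsum_le_tsum h).trans ?_
    rw [ENNReal.tsum_add, ENNReal.tsum_mul_left, ENNReal.tsum_mul_left]
    refine add_le_add (mul_le_mul_right ?_ _) (mul_le_mul_right ?_ _)
    · refine (ENNReal.tsum_comp_le_tsum_of_injective (minRep_injective r)
        fun x => ENNReal.ofReal (A * (J x)⁻¹ ^ (d - 2)) ^ 2).trans ?_
      refine (ENNReal.tsum_le_tsum fun x => ofReal_weight_sq d hd hA x).trans ?_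
      rw [ENNReal.tsum_mul_left]
      exact mul_le_mul_right ha _
    · rw [tsum_fintype, Finset.sum_const, nsmul_eq_mul]
      refine le_trans (le_of_eq ?_) (ENNReal.ofReal_le_ofReal hV)
      rw [ENNReal.ofReal_mul (by positivity)]
      congr 1
      simp [ZMod.card, ENNReal.ofReal_pow]
  line F := by
    have h := tsum_dispT_mul (d := d) (β := β) (ζ := ζ) (fun _ => 1) F
    simp only [mul_one] at h
    rw [h]
    refine ENNReal.tsum_le_tsum fun a => mul_le_mul_left ((tsum_toT_le hr _ a).trans ?_) _
    rw [ENNReal.ofReal_add (mul_nonneg hA (pow_pos (inv_pos.2 (J_pos _)) _).le) hτ]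
    exact add_le_add (hG _) (hfar a)

/-- The indicator of a walk that returns on the torus but not on the lattice. -/
noncomputable def wrapInd (r : ℕ) (l : List (Fin d × Bool)) : ℝ≥0∞ :=
  if dispT r l = 0 ∧ disp l ≠ 0 then 1 else 0

/-- The indicator of a walk with displacement at least `κ * r`. -/
noncomputable def longInd (κ : ℝ) (r : ℕ) (l : List (Fin d × Bool)) : ℝ≥0∞ :=
  if κ * r ≤ nOne (disp l) then 1 else 0

theorem le_nOne_of_toT_eq_zero {r : ℕ} {x : Fin d → ℤ} (h : toT d r x = 0) (hx : x ≠ 0) : (r : ℝ) ≤ nOne x := by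
  obtain ⟨i, hi⟩ := Function.ne_iff.1 hx
  have h1 : ((x i : ℤ) : ZMod r) = 0 := congrFun h i
  have h2 := Int.le_of_dvd (abs_pos.2 hi) ((dvd_abs _ _).2 ((ZMod.intCast_zmod_eq_zero_iff_dvd _ _).1 h1))
  refine le_trans ?_ (abs_coord_le_nOne x i)
  exact_mod_cast h2

theorem isLong_torus {r : ℕ} {β : ℝ} {ζ θ : ℝ≥0∞}
    (hfar : ∀ y : Fin d → ZMod r, ∑' x, farInd (1 / 4) y x * GE d β ζ x ≤ θ) :
    IsLong (dispT r) (kZ d β ζ) (wrapInd r) (longInd (1 / 2) r) (longInd (1 / 4) r) θ where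
  bad_le l := by
    unfold wrapInd
    split_ifs with h
    · have h1 := le_nOne_of_toT_eq_zero h.1 h.2
      have hr : (0 : ℝ) ≤ r := r.cast_nonneg
      rw [h.1, del_zero, longInd, if_pos (by linarith), one_mul]
    · exact zero_le
  bad_append a b := by
    unfold wrapInd
    split_ifs with h
    · have h1 := le_nOne_of_toT_eq_zero h.1 h.2
      rw [disp_append] at h1
      have h2 := nOne_add_le (disp a) (disp b)
      rw [add_comm, ← dispT_append, h.1, del_zero, one_mul]
      unfold longInd
      rcases le_total (1 / 2 * (r : ℝ)) (nOne (disp a)) with h3 | h3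
      · rw [if_pos h3]; exact le_self_add
      · rw [if_pos (show 1 / 2 * (r : ℝ) ≤ nOne (disp b) by linarith)]; exact le_add_self
    · exact zero_le
  append a b := by
    unfold longInd
    split_ifs with h h1 h2 h2
    all_goals first | exact zero_le | exact le_self_add | exact le_add_self | skip
    rw [disp_append] at h
    have := nOne_add_le (disp a) (disp b)
    exact absurd (by linarith) h1
  le l := by
    unfold longInd
    have hr : (0 : ℝ) ≤ r := r.cast_nonneg
    split_ifs with h h1
    · exact le_rfl
    · exact absurd (by linarith) h1
    · exact zero_le
    · exact le_rfl
  long F := by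
    have h := tsum_dispT_mul (d := d) (β := β) (ζ := ζ) (r := r)
      (fun x => if 1 / 4 * (r : ℝ) ≤ nOne x then 1 else 0) F
    refine le_trans (le_of_eq h) ?_
    rw [← ENNReal.tsum_mul_left]
    refine ENNReal.tsum_le_tsum fun a => mul_le_mul_left (le_trans (ENNReal.tsum_le_tsum fun x => ?_)
      (hfar a)) _
    unfold farInd del
    rw [sub_eq_zero]
    by_cases h1 : toT d r x = a <;> simp [h1]

/-- The multiplicative correction between the torus and lattice weights. -/
noncomputable def wrapW (β : ℝ) (r : ℕ) (l : List (Fin d × Bool)) : ℝ :=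
  if dispT r l = 0 ∧ disp l ≠ 0 then 1 - β else 1

theorem sawW_dispT_eq (β : ℝ) (r : ℕ) (l : List (Fin d × Bool)) :
    sawW β (dispT r) l = sawW β disp l * wrapW β r l := by
  unfold sawW wrapW
  by_cases h : disp l = 0
  · have : dispT r l = 0 := by rw [dispT, h, map_zero]
    simp [h, this]
  · by_cases h2 : dispT r l = 0 <;> simp [h, h2]

theorem wrapW_mem {β : ℝ} (h0 : 0 ≤ β) (h1 : β ≤ 1) (r : ℕ) (l : List (Fin d × Bool)) :
    0 ≤ wrapW β r l ∧ wrapW β r l ≤ 1 := by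
  unfold wrapW; split_ifs <;> constructor <;> linarith

theorem one_sub_wrapW (β : ℝ) (r : ℕ) (l : List (Fin d × Bool)) :
    ENNReal.ofReal (1 - wrapW β r l) = ENNReal.ofReal β * wrapInd r l := by
  unfold wrapW wrapInd; split_ifs <;> simp

theorem KT_nonneg {β : ℝ} (h0 : 0 ≤ β) (h1 : β ≤ 1) (r : ℕ) (l : List (Fin d × Bool)) : 0 ≤ KT d r β l :=
  (wt_mem (sawW_mem h0 h1 _) l).1

theorem KT_le_KZ {β : ℝ} (h0 : 0 ≤ β) (h1 : β ≤ 1) (r : ℕ) (l : List (Fin d × Bool)) :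
    KT d r β l ≤ KZ d β l := by
  rw [KT, wt_mul (sawW_dispT_eq β r)]
  exact mul_le_of_le_one_right (KZ_nonneg h0 h1 l) (wt_mem (wrapW_mem h0 h1 r) l).2

theorem one_sub_sawW_le_dispT (β : ℝ) (r : ℕ) (l : List (Fin d × Bool)) :
    ENNReal.ofReal (1 - sawW β disp l) ≤ ENNReal.ofReal β * del (dispT r l) := by
  rw [one_sub_sawW]
  refine mul_le_mul_right ?_ _
  unfold del
  split_ifs with h h'
  · exact le_rfl
  · exact absurd (by rw [dispT, h, map_zero]) h'
  all_goals exact zero_le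

theorem tsum_laceInf_torus_sub_le (hd : 4 < d) {r : ℕ} (hr : 1 ≤ r) {β : ℝ} (h0 : 0 ≤ β) (h1 : β ≤ 1)
    {ζ : ℝ≥0∞} {A a τ E : ℝ} (hA : 0 ≤ A) (hτ : 0 ≤ τ)
    (ha : ∑' x : Fin d → ℤ, ENNReal.ofReal (hW x) ≤ ENNReal.ofReal a)
    (hG : ∀ x, GE d β ζ x ≤ ENNReal.ofReal (A * (J x)⁻¹ ^ (d - 2)))
    (hfar : ∀ y : Fin d → ZMod r, ∑' x, farInd (1 / 4) y x * GE d β ζ x ≤ ENNReal.ofReal τ)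
    (hV : (r : ℝ) ^ d * τ ^ 2 ≤ E) {B : ℝ≥0∞}
    (hB : B = 2 * (ENNReal.ofReal (A ^ 2) * ENNReal.ofReal a) + 2 * ENNReal.ofReal E)
    (hβ : ENNReal.ofReal β * (1 + 4 * 2 ^ (d - 2) * B) ≤ 1) (hβ' : ENNReal.ofReal β * (4 * B) ≤ 1)
    (hζ : ζ ≠ 0) (hζ' : ζ ≠ ⊤) (e : Fin d × Bool) :
    ∑' ρ, ENNReal.ofReal |laceInf (sawW β (dispT r)) [e] ρ - laceInf (sawW β disp) [e] ρ| * ζ ^ ρ.length ≤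
      2 * (ENNReal.ofReal β * diffConst (2 ^ (d - 2)) B * ENNReal.ofReal τ) / ζ := by
  have hline := isLine_torus hd hr h0 h1 hA hτ ha hG hfar hV
  rw [← hB] at hline
  have hlong := isLong_torus hfar
  set q : List (Fin d × Bool) → List (Fin d × Bool) → ℝ≥0∞ := fun a t =>
    ENNReal.ofReal β * ((sfxs a).map fun s => del (dispT r t + dispT r s)).sum * kZ d β ζ t with hq
  set qd : List (Fin d × Bool) → List (Fin d × Bool) → ℝ≥0∞ := fun a t =>
    ENNReal.ofReal |edgeKer (sawW β (dispT r)) a t - edgeKer (sawW β disp) a t| * ζ ^ t.length with hqd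
  have hqb : EdgeBound (dispT r) (kZ d β ζ) (ENNReal.ofReal β) q := fun a t => le_rfl
  have hqdb : DiffBound (dispT r) (kZ d β ζ) (wrapInd r) (ENNReal.ofReal β) qd :=
    edgeKer_diff_bound (dispT_append r) (sawW_dispT_eq β r) (sawW_mem h0 h1 _) (wrapW_mem h0 h1 r)
      (one_sub_sawW_le_dispT β r) (fun l => (one_sub_wrapW β r l).le) fun _ => le_rfl
  refine tsum_laceInf_sub_le (q := q) (qd := qd) ?_ ?_ (fun _ _ => le_rfl) [e] fun n => ?_
  · exact edgeKer_bound (dispT_append r) (sawW_mem h0 h1 _) (one_sub_sawW_le_dispT β r) fun _ => le_rfl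
  · exact edgeKer_bound (dispT_append r) (sawW_mem h0 h1 _) (fun l => (one_sub_sawW β _ l).le)
      fun l => mul_le_mul_left (ENNReal.ofReal_le_ofReal (KT_le_KZ h0 h1 r l)) _
  · rw [ENNReal.le_div_iff_mul_le (Or.inl hζ) (Or.inl hζ'), mul_comm]
    refine le_trans ?_ (hline.tsum_dlace hqb hlong hqdb hβ hβ' n (dispT r [e]))
    refine le_trans (le_of_eq ?_) (ENNReal.le_tsum [e])
    rw [sub_self, del_zero, mul_one, kZ_singleton]

end TorusLace

end WSAW

namespace WSAW
open scoped ENNReal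
open Filter

section Susceptibility

variable {d : ℕ}

theorem sum_splits_append {S : Type*} (f : List S → ℝ≥0∞) (l : List S) :
    ((splits l).map fun p => f (p.1 ++ p.2)).sum = (l.length + 1) * f l := by
  have h1 : ∀ p ∈ splits l, f (p.1 ++ p.2) = f l := fun p hp => by rw [mem_splits.1 hp]
  have h2 : (splits l).length = l.length + 1 := by
    induction l with
    | nil => rfl
    | cons e l ih => rw [splits_cons, List.length_cons, List.length_map, ih (fun p hp => by
        rw [mem_splits.1 hp]), List.length_cons]
  rw [List.map_congr_left h1, List.map_const', List.sum_replicate, h2, nsmul_eq_mul]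
  push_cast
  rfl

theorem kZ_mul_le {β : ℝ} (h0 : 0 ≤ β) (h1 : β ≤ 1) (ζ : ℝ≥0∞) (a b : List (Fin d × Bool)) :
    kZ d β ζ a * kZ d β ζ b ≤ kZ d β ζ (a ++ b) + ENNReal.ofReal β * (((pfxs b).map fun p =>
      ((sfxs a).map fun s => del (disp p + disp s)).sum).sum * (kZ d β ζ a * kZ d β ζ b)) := by
  set P := ((pfxs b).map (inter (sawW β disp) a)).prod with hP
  have hw := sawW_mem h0 h1 (disp (d := d))
  have hP01 := prod_inter_mem hw a (pfxs b)
  have ha := KZ_nonneg h0 h1 a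
  have hb := KZ_nonneg h0 h1 b
  have h2 : ENNReal.ofReal (1 - P) ≤ ENNReal.ofReal β * ((pfxs b).map fun p =>
      ((sfxs a).map fun s => del (disp p + disp s)).sum).sum := by
    refine (ofReal_one_sub_list_prod_le _ _ fun p _ => inter_mem hw a p).trans ?_
    rw [← List.sum_map_mul_left]
    refine list_sum_le _ _ _ fun p _ => ?_
    refine (ofReal_one_sub_inter_le hw (b := fun l => del (disp l))
      (fun l => (one_sub_sawW β _ l).le) a p).trans (le_of_eq ?_)
    simp only [disp_append, add_comm]
  have h3 : ENNReal.ofReal (KZ d β a) * ENNReal.ofReal (KZ d β b) =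
      ENNReal.ofReal (KZ d β (a ++ b)) +
        ENNReal.ofReal (1 - P) * (ENNReal.ofReal (KZ d β a) * ENNReal.ofReal (KZ d β b)) := by
    have h4 : KZ d β (a ++ b) = KZ d β a * P * KZ d β b := wt_append _ a b
    have h5 := sub_nonneg.2 hP01.2
    rw [h4, ← ENNReal.ofReal_mul ha, ← ENNReal.ofReal_mul h5,
      ← ENNReal.ofReal_add (mul_nonneg (mul_nonneg ha hP01.1) hb) (by positivity)]
    congr 1
    ring
  have h6 : kZ d β ζ a * kZ d β ζ b = kZ d β ζ (a ++ b) +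
      ENNReal.ofReal (1 - P) * (kZ d β ζ a * kZ d β ζ b) := by
    unfold kZ
    rw [List.length_append, pow_add]
    calc _ = ENNReal.ofReal (KZ d β a) * ENNReal.ofReal (KZ d β b) * (ζ ^ a.length * ζ ^ b.length) := by ring
      _ = _ := by rw [h3]; ring
  calc _ = _ := h6
    _ ≤ _ := by
      rw [← mul_assoc (ENNReal.ofReal β)]
      exact add_le_add_right (mul_le_mul_left h2 _) _

/-- The susceptibility satisfies a quadratic differential inequality. -/
theorem sq_tsum_kZ_le {β : ℝ} (h0 : 0 ≤ β) (h1 : β ≤ 1) (ζ : ℝ≥0∞) :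
    (∑' l, kZ d β ζ l) * ∑' l, kZ d β ζ l ≤ ∑' l : List (Fin d × Bool), (l.length + 1) * kZ d β ζ l +
      ENNReal.ofReal β * (∑' x, GE d β ζ x * GE d β ζ (-x)) *
        ((∑' l, kZ d β ζ l) * ∑' l, kZ d β ζ l) := by
  set X := ∑' l, kZ d β ζ l with hX
  have e1 : X * X = ∑' a, ∑' b, kZ d β ζ a * kZ d β ζ b := by
    rw [hX, ← ENNReal.tsum_mul_right]
    exact tsum_congr fun a => ENNReal.tsum_mul_left.symm
  have e2 : ∑' a, ∑' b, kZ d β ζ (a ++ b) = ∑' l : List (Fin d × Bool), (l.length + 1) * kZ d β ζ l := by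
    rw [← tsum_splits fun a b => kZ d β ζ (a ++ b)]
    exact tsum_congr fun l => sum_splits_append _ l
  have e3 : ∀ a, ∑' b, ((pfxs b).map fun p => ((sfxs a).map fun s => del (disp p + disp s)).sum).sum *
      kZ d β ζ b ≤ ((sfxs a).map fun s => ∑' p, kZ d β ζ p * del (disp p + disp s)).sum * X := by
    intro a
    calc _ = ∑' b, ((pfxs b).map fun p => ((sfxs a).map fun s => del (disp p + disp s)).sum * kZ d β ζ b).sum := by
          refine tsum_congr fun b => ?_
          rw [List.sum_map_mul_right]
      _ ≤ ∑' p, ∑' b, ((sfxs a).map fun s => del (disp p + disp s)).sum * kZ d β ζ (p ++ b) :=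
          tsum_pfxs_le fun b p => ((sfxs a).map fun s => del (disp p + disp s)).sum * kZ d β ζ b
      _ ≤ ∑' p, ∑' b, ((sfxs a).map fun s => del (disp p + disp s)).sum * (kZ d β ζ p * kZ d β ζ b) :=
          ENNReal.tsum_le_tsum fun p => ENNReal.tsum_le_tsum fun b =>
            mul_le_mul_right (kZ_append h0 h1 ζ p b) _
      _ = (∑' p, kZ d β ζ p * ((sfxs a).map fun s => del (disp p + disp s)).sum) * X := by
          rw [← ENNReal.tsum_mul_right]
          refine tsum_congr fun p => ?_
          rw [hX, ← ENNReal.tsum_mul_left]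
          exact tsum_congr fun b => by ring
      _ = _ := by
          congr 1
          rw [← tsum_list_sum]
          exact tsum_congr fun p => by rw [List.sum_map_mul_left]
  have e4 : ∑' a, kZ d β ζ a * ((sfxs a).map fun s => ∑' p, kZ d β ζ p * del (disp p + disp s)).sum ≤
      (∑' x, GE d β ζ x * GE d β ζ (-x)) * X := by
    set W : List (Fin d × Bool) → ℝ≥0∞ := fun s => ∑' p, kZ d β ζ p * del (disp p + disp s) with hW'
    calc _ = ∑' a, ((sfxs a).map fun s => kZ d β ζ a * W s).sum :=
          tsum_congr fun a => by rw [List.sum_map_mul_left]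
      _ ≤ ∑' s, ∑' b, kZ d β ζ (b ++ s) * W s := tsum_sfxs_le fun a s => kZ d β ζ a * W s
      _ ≤ ∑' s, ∑' b, kZ d β ζ b * kZ d β ζ s * W s :=
          ENNReal.tsum_le_tsum fun s => ENNReal.tsum_le_tsum fun b =>
            mul_le_mul_left (kZ_append h0 h1 ζ b s) _
      _ = (∑' s, kZ d β ζ s * W s) * X := by
          rw [← ENNReal.tsum_mul_right]
          refine tsum_congr fun s => ?_
          rw [hX, ← ENNReal.tsum_mul_left]
          exact tsum_congr fun b => by ring
      _ = _ := by
          congr 1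
          refine (tsum_kZ_mul β ζ fun x => ∑' p, kZ d β ζ p * del (disp p + x)).trans ?_
          refine tsum_congr fun x => ?_
          have : GE d β ζ (-x) = ∑' p, kZ d β ζ p * del (disp p + x) := by
            simp only [GE, sub_neg_eq_add]
          rw [this]
  calc X * X = _ := e1
    _ ≤ ∑' a, ∑' b, (kZ d β ζ (a ++ b) + ENNReal.ofReal β * (((pfxs b).map fun p =>
          ((sfxs a).map fun s => del (disp p + disp s)).sum).sum * (kZ d β ζ a * kZ d β ζ b))) :=
        ENNReal.tsum_le_tsum fun a => ENNReal.tsum_le_tsum fun b => kZ_mul_le h0 h1 ζ a b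
    _ = _ + ENNReal.ofReal β * ∑' a, kZ d β ζ a * ∑' b, ((pfxs b).map fun p =>
          ((sfxs a).map fun s => del (disp p + disp s)).sum).sum * kZ d β ζ b := by
        simp_rw [ENNReal.tsum_add]
        rw [e2, ← ENNReal.tsum_mul_left]
        congr 1
        refine tsum_congr fun a => ?_
        rw [← ENNReal.tsum_mul_left, ← ENNReal.tsum_mul_left]
        exact tsum_congr fun b => by ring
    _ ≤ _ := by
        refine add_le_add_right ?_ _
        rw [mul_assoc, ← mul_assoc (∑' x, GE d β ζ x * GE d β ζ (-x))]
        refine mul_le_mul_right ?_ _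
        refine le_trans ?_ (mul_le_mul_left e4 _)
        rw [← ENNReal.tsum_mul_right]
        exact ENNReal.tsum_le_tsum fun a => by
          rw [mul_assoc]
          exact mul_le_mul_right (e3 a) _

/-- A positive solution of a quadratic differential inequality stays below its blow-up profile. -/
theorem mul_sub_le_of_quadratic_growth {F : ℝ → ℝ} {κ w : ℝ} (hκ : 0 < κ)
    (hF : ∀ z z', 0 < z → z ≤ z' → z' < w → F z + (z' - z) * (κ * F z ^ 2) ≤ F z')
    {z : ℝ} (hz : 0 < z) (hpos : 0 < F z) : κ * F z * (w - z) ≤ 2 := by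
  have key : ∀ n : ℕ, ∀ z, 0 < z → 0 < F z → ∀ y, z + 2 / (κ * F z) ≤ y → y < w → 2 ^ n * F z ≤ F y := by
    intro n
    induction n with
    | zero =>
      intro z hz hpos y hy hyw
      have hzy : z ≤ y := le_trans (le_add_of_nonneg_right (by positivity)) hy
      have := hF z y hz hzy hyw
      have : 0 ≤ (y - z) * (κ * F z ^ 2) := mul_nonneg (sub_nonneg.2 hzy) (by positivity)
      linarith
    | succ n ih =>
      intro z hz hpos y hy hyw
      have hh : 0 < 1 / (κ * F z) := by positivity
      have e : 2 / (κ * F z) = 1 / (κ * F z) + 1 / (κ * F z) := by ring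
      have h1 := hF z (z + 1 / (κ * F z)) hz (by linarith) (by linarith)
      have h2 : (z + 1 / (κ * F z) - z) * (κ * F z ^ 2) = F z := by field_simp; ring
      have h3 : 2 * F z ≤ F (z + 1 / (κ * F z)) := by linarith
      have h4 : 2 / (κ * F (z + 1 / (κ * F z))) ≤ 1 / (κ * F z) := by
        rw [div_le_div_iff₀ (by have := h3; nlinarith) (by positivity)]
        nlinarith
      have h5 := ih (z + 1 / (κ * F z)) (by linarith) (by linarith) y (by linarith) hyw
      rw [pow_succ]
      have : (2 : ℝ) ^ n * (2 * F z) ≤ 2 ^ n * F (z + 1 / (κ * F z)) :=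
        mul_le_mul_of_nonneg_left h3 (by positivity)
      linarith
  by_contra! h
  have hy : z + 2 / (κ * F z) < w := by
    have : 2 / (κ * F z) < w - z := by
      rw [div_lt_iff₀ (by positivity)]; linarith
    linarith
  obtain ⟨n, hn⟩ := pow_unbounded_of_one_lt (F (z + 2 / (κ * F z)) / F z) (one_lt_two : (1 : ℝ) < 2)
  rw [div_lt_iff₀ hpos] at hn
  exact absurd (key n z hz hpos _ le_rfl hy) (not_le.2 hn)

end Susceptibility

end WSAW

namespace WSAW
open scoped ENNReal
open Filter

section CriticalGrowth

variable {d : ℕ}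

theorem pow_succ_add_mul_le {z z' : ℝ} (hz : 0 ≤ z) (h : z ≤ z') (n : ℕ) :
    z ^ (n + 1) + (z' - z) * ((n + 1) * z ^ n) ≤ z' ^ (n + 1) := by
  induction n with
  | zero => simp
  | succ n ih =>
    have h1 := mul_le_mul_of_nonneg_left ih (hz.trans h)
    have h2 := mul_le_mul_of_nonneg_right h
      (mul_nonneg (sub_nonneg.2 h) (by positivity : (0 : ℝ) ≤ (n + 1) * z ^ n))
    have h3 : z ^ (n + 1 + 1) + (z' - z) * ((n + 1 + 1) * z ^ (n + 1)) =
        z' * z ^ (n + 1) + z * ((z' - z) * ((n + 1) * z ^ n)) := by ring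
    have h4 : z' * z' ^ (n + 1) = z' ^ (n + 1 + 1) := by ring
    rw [mul_add, h4] at h1
    push_cast
    rw [h3]
    linarith

theorem tsum_kZ_ofReal {β : ℝ} (h0 : 0 ≤ β) (h1 : β ≤ 1) {z : ℝ} (hz : 0 ≤ z)
    (hS : Summable fun l : List (Fin d × Bool) => KZ d β l * z ^ l.length) :
    ∑' l, kZ d β (ENNReal.ofReal z) l =
      ENNReal.ofReal (∑' l : List (Fin d × Bool), KZ d β l * z ^ l.length) := by
  rw [ENNReal.ofReal_tsum_of_nonneg (fun l => mul_nonneg (KZ_nonneg h0 h1 l) (pow_nonneg hz _)) hS]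
  exact tsum_congr fun l => kZ_ofReal h0 h1 hz l

theorem tsum_GE_sq_le (hd : 4 < d) {β : ℝ} {ζ : ℝ≥0∞} {A a : ℝ} (hA : 0 ≤ A)
    (ha : ∑' x : Fin d → ℤ, ENNReal.ofReal (hW x) ≤ ENNReal.ofReal a)
    (hG : ∀ x, GE d β ζ x ≤ ENNReal.ofReal (A * (J x)⁻¹ ^ (d - 2))) :
    ∑' x, GE d β ζ x * GE d β ζ (-x) ≤ ENNReal.ofReal (A ^ 2) * ENNReal.ofReal a := by
  refine (ENNReal.tsum_le_tsum fun x => (mul_le_mul' (hG x) (hG (-x))).trans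
    (le_trans (le_of_eq ?_) (ofReal_weight_sq d hd hA x))).trans ?_
  · rw [J_neg, sq]
  · rw [ENNReal.tsum_mul_left]
    exact mul_le_mul_right ha _

theorem exists_susceptibility_bound (d : ℕ) (hd : 4 < d) {A : ℝ} (hA : 0 ≤ A) : ∃ b : ℝ, 0 < b ∧
    ∀ β, 0 ≤ β → β ≤ 1 → β ≤ b → ∀ μ, HasGrowthConst d β μ → 0 < μ →
    (∀ z : ℝ, 0 ≤ z → z * μ < 1 → ∀ x, GE d β (ENNReal.ofReal z) x ≤
      ENNReal.ofReal (A * (J x)⁻¹ ^ (d - 2))) →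
    ∀ ε : ℝ, 0 < ε → ε ≤ 1 / 2 → ∀ z : ℝ, 0 ≤ z → z ≤ μ⁻¹ * (1 - ε) →
      ∑' l : List (Fin d × Bool), KZ d β l * z ^ l.length ≤ 8 / ε := by
  obtain ⟨a, ha0, ha⟩ := exists_tsum_hW d
  set B := ENNReal.ofReal (A ^ 2) * ENNReal.ofReal a with hB
  obtain ⟨b, hb, hbB⟩ := exists_ofReal_mul_le_one (X := 2 * B)
    (ENNReal.mul_ne_top (by simp) (ENNReal.mul_ne_top ENNReal.ofReal_ne_top ENNReal.ofReal_ne_top))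
  refine ⟨b, hb, fun β h0 h1 hβ μ h hμ hG ε hε hε2 z hz hzε => ?_⟩
  have hlt : ∀ y, y < μ⁻¹ → y * μ < 1 := fun y hy => by
    rwa [← lt_inv_mul_iff₀' hμ, mul_one]
  set X : ℝ → ℝ := fun z => ∑' l : List (Fin d × Bool), KZ d β l * z ^ l.length with hX
  have hS : ∀ y, 0 ≤ y → y < μ⁻¹ → Summable fun l : List (Fin d × Bool) => KZ d β l * y ^ l.length :=
    fun y hy hy' => growth_summable_KZ_pow h0 h1 h hy (hlt y hy')
  have hX1 : ∀ y, 0 ≤ y → y < μ⁻¹ → 1 ≤ X y := fun y hy hy' => one_le_tsum_KZ h0 h1 hy (hS y hy hy')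
  set Y : ℝ → ℝ := fun z => ∑' l : List (Fin d × Bool), KZ d β l * ((l.length + 1) * z ^ l.length) with hY
  have hSY : ∀ y, 0 ≤ y → y < μ⁻¹ →
      Summable fun l : List (Fin d × Bool) => KZ d β l * ((l.length + 1) * y ^ l.length) :=
    fun y hy hy' => by simpa using growth_summable_KZ h0 h1 h 1 hy (hlt y hy')
  have hXY : ∀ y, 0 ≤ y → y < μ⁻¹ → X y * X y ≤ 2 * Y y := by
    intro y hy hy'
    have hXn : 0 ≤ X y := zero_le_one.trans (hX1 y hy hy')
    have hYn : 0 ≤ Y y := tsum_nonneg fun l => mul_nonneg (KZ_nonneg h0 h1 l) (by positivity)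
    have e1 := sq_tsum_kZ_le (d := d) h0 h1 (ENNReal.ofReal y)
    have e2 : ∑' l : List (Fin d × Bool), ((l.length : ℝ≥0∞) + 1) * kZ d β (ENNReal.ofReal y) l =
        ENNReal.ofReal (Y y) := by
      rw [hY, ENNReal.ofReal_tsum_of_nonneg (fun l => mul_nonneg (KZ_nonneg h0 h1 l) (by positivity))
        (hSY y hy hy')]
      refine tsum_congr fun l => ?_
      rw [kZ_ofReal h0 h1 hy, mul_left_comm (KZ d β l), ENNReal.ofReal_mul (p := (l.length : ℝ) + 1) (by positivity),
        ENNReal.ofReal_add (by positivity) zero_le_one, ENNReal.ofReal_natCast, ENNReal.ofReal_one]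
    rw [e2, tsum_kZ_ofReal h0 h1 hy (hS y hy hy'), ← ENNReal.ofReal_mul hXn] at e1
    have e3 : ENNReal.ofReal β * ∑' x, GE d β (ENNReal.ofReal y) x * GE d β (ENNReal.ofReal y) (-x) ≤ 2⁻¹ := by
      refine (mul_le_mul_right (tsum_GE_sq_le hd hA ha (hG y hy (hlt y hy'))) _).trans ?_
      have := hbB β hβ
      rw [mul_left_comm] at this
      rwa [ENNReal.mul_le_iff_le_inv (by simp) (by simp), mul_one] at this
    have e4 : ENNReal.ofReal (X y * X y) ≤ 2 * ENNReal.ofReal (Y y) := by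
      refine le_two_mul_of_le_add_half ENNReal.ofReal_ne_top (e1.trans (add_le_add_right ?_ _))
      rw [ENNReal.div_eq_inv_mul]
      exact mul_le_mul_left e3 _
    rw [show (2 : ℝ≥0∞) = ENNReal.ofReal 2 by simp, ← ENNReal.ofReal_mul (by norm_num),
      ENNReal.ofReal_le_ofReal_iff (by positivity)] at e4
    exact e4
  have hF : ∀ z z', 0 < z → z ≤ z' → z' < μ⁻¹ →
      z * X z + (z' - z) * (μ ^ 2 / 2 * (z * X z) ^ 2) ≤ z' * X z' := by
    intro y y' hy hyy hy'
    have hy1 := hyy.trans_lt hy'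
    have hsum : y * X y + (y' - y) * Y y ≤ y' * X y' := by
      rw [hX, hY]
      simp only [← tsum_mul_left]
      rw [← ((hS y hy.le hy1).mul_left y).tsum_add ((hSY y hy.le hy1).mul_left (y' - y))]
      refine Summable.tsum_le_tsum (fun l => ?_) (((hS y hy.le hy1).mul_left y).add
        ((hSY y hy.le hy1).mul_left (y' - y))) ((hS y' (hy.le.trans hyy) hy').mul_left y')
      have := mul_le_mul_of_nonneg_left (pow_succ_add_mul_le hy.le hyy l.length) (KZ_nonneg h0 h1 l)
      refine le_trans (le_of_eq ?_) (this.trans (le_of_eq ?_)) <;> ring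
    have h2 : μ ^ 2 / 2 * (y * X y) ^ 2 ≤ Y y := by
      have h3 := hXY y hy.le hy1
      have h4 : (y * μ) ^ 2 ≤ 1 := pow_le_one₀ (by positivity) (hlt y hy1).le
      have h5 := mul_le_mul_of_nonneg_right h4 (mul_self_nonneg (X y))
      nlinarith
    have := mul_le_mul_of_nonneg_left h2 (sub_nonneg.2 hyy)
    linarith
  have hw0 : 0 < μ⁻¹ := inv_pos.2 hμ
  have hz1 : 0 < μ⁻¹ * (1 - ε) := mul_pos hw0 (by linarith)
  have hz2 : μ⁻¹ * (1 - ε) < μ⁻¹ := by nlinarith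
  have hX0 := hX1 _ hz1.le hz2
  have hfin := mul_sub_le_of_quadratic_growth (F := fun z => z * X z) (κ := μ ^ 2 / 2) (by positivity) hF hz1
    (mul_pos hz1 (by linarith))
  refine (tsum_KZ_mono h0 h1 hz hzε (hS _ hz1.le hz2)).2.trans ?_
  change X (μ⁻¹ * (1 - ε)) ≤ 8 / ε
  rw [le_div_iff₀ hε]
  have h6 : μ ^ 2 / 2 * (μ⁻¹ * (1 - ε) * X (μ⁻¹ * (1 - ε))) * (μ⁻¹ - μ⁻¹ * (1 - ε)) =
      (1 - ε) * (X (μ⁻¹ * (1 - ε)) * ε) / 2 := by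
    generalize X (μ⁻¹ * (1 - ε)) = x
    field_simp
    ring
  rw [h6] at hfin
  have h7 : 0 ≤ X (μ⁻¹ * (1 - ε)) * ε := by positivity
  nlinarith

end CriticalGrowth

end WSAW

namespace WSAW
open scoped ENNReal
open Filter

section Renewal

variable {S : Type*} {w w' : List S → ℝ}

theorem norm_complex_activity (f : List S → ℝ) (z : ℂ) (ρ : List S) :
    ‖z * ((f ρ : ℂ) * z ^ ρ.length)‖ = ‖z‖ * (|f ρ| * ‖z‖ ^ ρ.length) := by
  rw [norm_mul, norm_mul, norm_pow, Complex.norm_real, Real.norm_eq_abs]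

theorem summable_norm_activity {f : List S → ℝ} {z : ℂ} (hz : z ≠ 0) {M : ℝ} (hM : 0 ≤ M)
    (h : ∑' ρ, ENNReal.ofReal |f ρ| * ENNReal.ofReal ‖z‖ ^ ρ.length ≤ ENNReal.ofReal (M / ‖z‖)) :
    (Summable fun ρ => ‖z * ((f ρ : ℂ) * z ^ ρ.length)‖) ∧
      ∑' ρ, ‖z * ((f ρ : ℂ) * z ^ ρ.length)‖ ≤ M := by
  have hz0 : 0 < ‖z‖ := norm_pos_iff.2 hz
  have heq : ∑' ρ, ENNReal.ofReal ‖z * ((f ρ : ℂ) * z ^ ρ.length)‖ =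
      ENNReal.ofReal ‖z‖ * ∑' ρ, ENNReal.ofReal |f ρ| * ENNReal.ofReal ‖z‖ ^ ρ.length := by
    rw [← ENNReal.tsum_mul_left]
    refine tsum_congr fun ρ => ?_
    rw [norm_complex_activity, ENNReal.ofReal_mul hz0.le, ENNReal.ofReal_mul (abs_nonneg _),
      ENNReal.ofReal_pow hz0.le]
  have hle : ∑' ρ, ENNReal.ofReal ‖z * ((f ρ : ℂ) * z ^ ρ.length)‖ ≤ ENNReal.ofReal M := by
    rw [heq]
    refine (mul_le_mul_right h _).trans ?_
    rw [← ENNReal.ofReal_mul hz0.le, mul_div_cancel₀ _ hz0.ne']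
  have hS : Summable fun ρ => ‖z * ((f ρ : ℂ) * z ^ ρ.length)‖ :=
    summable_of_ofReal_tsum (fun _ => norm_nonneg _) (hle.trans_lt ENNReal.ofReal_lt_top).ne
  refine ⟨hS, ?_⟩
  rwa [← ENNReal.ofReal_tsum_of_nonneg (fun _ => norm_nonneg _) hS,
    ENNReal.ofReal_le_ofReal_iff hM] at hle

variable [Fintype S]

theorem tsum_activity_eq (he : ∀ e, w [e] = 1) {z : ℂ}
    (hP : Summable fun l => ‖(wt w l : ℂ) * z ^ l.length‖)
    (hL : ∀ e, Summable fun ρ => ‖z * ((laceInf w [e] ρ : ℂ) * z ^ ρ.length)‖) :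
    ∑' l, (wt w l : ℂ) * z ^ l.length =
      1 + (∑ e, ∑' ρ, z * ((laceInf w [e] ρ : ℂ) * z ^ ρ.length)) *
        ∑' l, (wt w l : ℂ) * z ^ l.length := by
  have h := tsum_expand (F := fun _ => (1 : ℂ)) (M := 1)
    (fun e l => activity_cons (𝕜 := ℂ) he z e l) hP hL (fun _ => by simp)
  simp only [mul_one] at h
  refine h.trans ?_
  simp only [tsum_mul_right, Finset.sum_mul, wt_nil]
  simp

theorem norm_sub_le_of_renewal {x y p q : ℂ} {δ : ℝ} (hx : x = 1 + p * x) (hy : y = 1 + q * y)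
    (hδ : ‖q - p‖ ≤ δ) (hxδ : ‖x‖ * δ ≤ 1 / 2) : ‖y - x‖ ≤ 2 * ‖x‖ ^ 2 * δ := by
  have h : y - x = x * y * (q - p) := by linear_combination x * hy - y * hx
  have h1 : ‖y - x‖ ≤ ‖x‖ * ‖y‖ * δ := by
    rw [h, norm_mul, norm_mul]
    exact mul_le_mul_of_nonneg_left hδ (by positivity)
  have h2 : ‖y‖ ≤ ‖y - x‖ + ‖x‖ := by simpa using norm_add_le (y - x) x
  have h3 : ‖x‖ * ‖y‖ * δ ≤ ‖y‖ / 2 := by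
    have := mul_le_mul_of_nonneg_right hxδ (norm_nonneg y)
    linarith
  have h4 : ‖y‖ ≤ 2 * ‖x‖ := by linarith
  have h5 : ‖x‖ * ‖y‖ * δ ≤ ‖x‖ * (2 * ‖x‖) * δ :=
    mul_le_mul_of_nonneg_right (mul_le_mul_of_nonneg_left h4 (norm_nonneg _))
      ((norm_nonneg _).trans hδ)
  linarith

theorem norm_tsum_activity_sub_le (he : ∀ e, w [e] = 1) (he' : ∀ e, w' [e] = 1) {z : ℂ}
    (hz : z ≠ 0) {δ c : ℝ} (hδ0 : 0 ≤ δ) (hc : 0 ≤ c)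
    (hP : Summable fun l => ‖(wt w l : ℂ) * z ^ l.length‖)
    (hP' : Summable fun l => ‖(wt w' l : ℂ) * z ^ l.length‖)
    (hL : ∀ e, ∑' ρ, ENNReal.ofReal |laceInf w [e] ρ| * ENNReal.ofReal ‖z‖ ^ ρ.length ≤
      ENNReal.ofReal c)
    (hD : ∀ e, ∑' ρ, ENNReal.ofReal |laceInf w' [e] ρ - laceInf w [e] ρ| *
      ENNReal.ofReal ‖z‖ ^ ρ.length ≤ ENNReal.ofReal (δ / ‖z‖))
    (hxδ : ‖∑' l, (wt w l : ℂ) * z ^ l.length‖ * (Fintype.card S * δ) ≤ 1 / 2) :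
    ‖∑' l, (wt w' l : ℂ) * z ^ l.length - ∑' l, (wt w l : ℂ) * z ^ l.length‖ ≤
      2 * ‖∑' l, (wt w l : ℂ) * z ^ l.length‖ ^ 2 * (Fintype.card S * δ) := by
  have hz0 : 0 < ‖z‖ := norm_pos_iff.2 hz
  have hLs : ∀ e, Summable fun ρ => ‖z * ((laceInf w [e] ρ : ℂ) * z ^ ρ.length)‖ := fun e =>
    (summable_norm_activity (M := c * ‖z‖) hz (by positivity)
      (by rw [mul_div_cancel_right₀ _ hz0.ne']; exact hL e)).1
  have hDs := fun e => summable_norm_activity hz hδ0 (hD e)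
  have hLs' : ∀ e, Summable fun ρ => ‖z * ((laceInf w' [e] ρ : ℂ) * z ^ ρ.length)‖ := fun e => by
    refine Summable.of_nonneg_of_le (fun _ => norm_nonneg _) (fun ρ => ?_) ((hDs e).1.add (hLs e))
    refine le_trans (le_of_eq ?_) (norm_add_le _ _)
    congr 1
    push_cast
    ring
  refine norm_sub_le_of_renewal (tsum_activity_eq he hP hLs) (tsum_activity_eq he' hP' hLs') ?_ hxδ
  rw [← Finset.sum_sub_distrib]
  refine (norm_sum_le_of_le _ (f := _) (n := fun _ => δ) fun e _ => ?_).trans ?_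
  · rw [← (hLs' e).of_norm.tsum_sub (hLs e).of_norm]
    refine le_trans (le_of_eq ?_) ((norm_tsum_le_tsum_norm (hDs e).1).trans (hDs e).2)
    congr 1
    refine tsum_congr fun ρ => ?_
    push_cast
    ring
  · simp

end Renewal

section Susceptibility

variable {d : ℕ}

theorem sawW_dispT_step {r : ℕ} (hr : 3 ≤ r) (β : ℝ) (e : Fin d × Bool) :
    sawW β (dispT r) [e] = 1 := by
  have : Fact (1 < r) := ⟨by omega⟩
  rw [sawW, if_neg]
  intro h
  have h1 := congrFun h e.1
  rw [dispT, disp_singleton] at h1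
  revert h1
  simp only [toT, AddMonoidHom.coe_mk, ZeroHom.coe_mk, wsawStep, if_true, Pi.zero_apply]
  cases e.2 <;> simp

theorem cT_zero_eq (r : ℕ) (β : ℝ) : cT d r β 0 = cZ d β 0 := by
  rw [cT_eq, cZ_eq]
  simp [KT, KZ, wt_nil]

theorem chiT_zero_eq (r : ℕ) (β : ℝ) : chiT d r β 0 = chi d β 0 := by
  rw [chiT, chi, tsum_eq_single 0 (fun n hn => by simp [hn]),
    tsum_eq_single 0 (fun n hn => by simp [hn]), cT_zero_eq]

theorem chiR_eq {β : ℝ} (h0 : 0 ≤ β) (h1 : β ≤ 1) {z : ℝ} (hz : 0 ≤ z)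
    (hS : Summable fun l : List (Fin d × Bool) => KZ d β l * z ^ l.length) :
    chiR d β z = ∑' l : List (Fin d × Bool), KZ d β l * z ^ l.length := by
  have hz' : ∀ n : ℕ, 0 ≤ z ^ n := fun n => pow_nonneg hz n
  have hS' : Summable fun n => cZ d β n * z ^ n := by
    refine summable_of_ofReal_tsum (fun n => mul_nonneg (cZ_nonneg h0 h1 n) (hz' n)) ?_
    rw [← tsum_KZ_length h0 h1 hz', ← ENNReal.ofReal_tsum_of_nonneg
      (fun l => mul_nonneg (KZ_nonneg h0 h1 l) (hz' _)) hS]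
    exact ENNReal.ofReal_ne_top
  have h := tsum_KZ_length (d := d) h0 h1 hz'
  rw [← ENNReal.ofReal_tsum_of_nonneg (fun l => mul_nonneg (KZ_nonneg h0 h1 l) (hz' _)) hS,
    ← ENNReal.ofReal_tsum_of_nonneg (fun n => mul_nonneg (cZ_nonneg h0 h1 n) (hz' n)) hS'] at h
  rw [ENNReal.ofReal_eq_ofReal_iff (tsum_nonneg fun l => mul_nonneg (KZ_nonneg h0 h1 l) (hz' _))
    (tsum_nonneg fun n => mul_nonneg (cZ_nonneg h0 h1 n) (hz' n))] at h
  exact h.symm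

theorem chiR_nonneg {β : ℝ} (h0 : 0 ≤ β) (h1 : β ≤ 1) {z : ℝ} (hz : 0 ≤ z) : 0 ≤ chiR d β z :=
  tsum_nonneg fun n => mul_nonneg (cZ_nonneg h0 h1 n) (pow_nonneg hz n)

theorem tsum_farInd_GE_le {r : ℕ} {β τ c m X : ℝ} {ζ : ℝ≥0∞} (hc : 0 ≤ c) (hm : 1 / m ≤ 4 * X)
    (hτ : τ = 16 * c * X * (r : ℝ)⁻¹ ^ d) (y : Fin d → ZMod r)
    (hg : ∑' x, farInd (1 / 4) y x * (ENNReal.ofReal |greenC m x| +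
      ∑' u, ENNReal.ofReal (hW (x - u)) * ENNReal.ofReal |greenC m u|) ≤
        ENNReal.ofReal (c / m * (r : ℝ)⁻¹ ^ d))
    (hG : ∀ x, GE d β ζ x ≤ 4 * (ENNReal.ofReal |greenC m x| +
      ∑' u, ENNReal.ofReal (hW (x - u)) * ENNReal.ofReal |greenC m u|)) :
    ∑' x, farInd (1 / 4) y x * GE d β ζ x ≤ ENNReal.ofReal τ := by
  refine (ENNReal.tsum_le_tsum fun x => (mul_le_mul_right (hG x) _).trans
    (mul_left_comm _ _ _).le).trans ?_
  rw [ENNReal.tsum_mul_left]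
  refine (mul_le_mul_right hg _).trans ?_
  rw [show (4 : ℝ≥0∞) = ENNReal.ofReal 4 by simp, ← ENNReal.ofReal_mul (by norm_num)]
  refine ENNReal.ofReal_le_ofReal ?_
  have h1 : 0 ≤ (r : ℝ)⁻¹ ^ d := by positivity
  have h2 := mul_le_mul_of_nonneg_left hm (mul_nonneg hc h1)
  rw [hτ, div_eq_mul_one_div c m]
  nlinarith

/-- The susceptibilities on the torus and on the lattice are close, with an error governed by
the susceptibility per unit volume. -/
theorem exists_norm_chiT_sub_chi_le (d : ℕ) (hd : 4 < d) : ∃ b C : ℝ, 0 < b ∧ 0 < C ∧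
    ∀ β : ℝ, 0 < β → β ≤ b → ∀ μ : ℝ, HasGrowthConst d β μ → ∀ r : ℕ, 3 ≤ r → ∀ z : ℂ,
      ‖z‖ ≤ μ⁻¹ * (1 - (Real.sqrt ((r : ℝ) ^ d))⁻¹) →
        ‖chiT d r β z - chi d β z‖ ≤
          C * β * ‖chi d β z‖ ^ 2 * chiR d β ‖z‖ / (r : ℝ) ^ d := by
  obtain ⟨A, b₁, hA, hb₁, hG⟩ := exists_two_point_bound d hd
  obtain ⟨b₂, hb₂, hX⟩ := exists_susceptibility_bound d hd hA.le
  obtain ⟨b₃, c, hb₃, hc, hlace⟩ := exists_lace_bounds d hd hA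
  obtain ⟨cg, hcg, hfar⟩ := exists_farInd_green d (by omega)
  obtain ⟨a, ha0, ha⟩ := exists_tsum_hW d
  set E : ℝ := 256 * cg ^ 2 * 64 with hE
  set B : ℝ≥0∞ := 2 * (ENNReal.ofReal (A ^ 2) * ENNReal.ofReal a) + 2 * ENNReal.ofReal E with hB
  have hBt : B ≠ ⊤ := by
    rw [hB]; finiteness
  have hKt : diffConst (2 ^ (d - 2)) B ≠ ⊤ := diffConst_ne_top (by finiteness) hBt
  set K : ℝ := (diffConst (2 ^ (d - 2)) B).toReal with hK
  have hK0 : 0 ≤ K := ENNReal.toReal_nonneg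
  have hKe : diffConst (2 ^ (d - 2)) B = ENNReal.ofReal K := (ENNReal.ofReal_toReal hKt).symm
  obtain ⟨b₄, hb₄, h₄⟩ := exists_ofReal_mul_le_one (X := 1 + 4 * 2 ^ (d - 2) * B) (by finiteness)
  obtain ⟨b₅, hb₅, h₅⟩ := exists_ofReal_mul_le_one (X := 4 * B) (by finiteness)
  set n : ℝ := (Fintype.card (Fin d × Bool) : ℝ) with hn
  have hn0 : 0 ≤ n := by rw [hn]; positivity
  set Q : ℝ := n * (2 * K * (16 * cg)) with hQ
  have hQ0 : 0 ≤ Q := by positivity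
  refine ⟨min (min (min 1 b₁) (min b₂ b₃)) (min (min b₄ b₅) (1 / (2 * (64 * Q + 1)))), 2 * Q + 1,
    by positivity, by positivity, fun β hβ0 hβ μ h r hr z hz => ?_⟩
  simp only [le_min_iff] at hβ
  obtain ⟨⟨⟨h1, hβ₁⟩, hβ₂, hβ₃⟩, ⟨hβ₄, hβ₅⟩, hβ₆⟩ := hβ
  have h0 := hβ0.le
  have hr0 : (0 : ℝ) < r := by positivity
  have hV0 : (0 : ℝ) < (r : ℝ) ^ d := by positivity
  rcases eq_or_ne z 0 with rfl | hz0
  · rw [chiT_zero_eq, sub_self, norm_zero]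
    exact div_nonneg (mul_nonneg (by positivity) (chiR_nonneg h0 h1 le_rfl)) hV0.le
  set s := Real.sqrt ((r : ℝ) ^ d) with hs
  have hs2 : s ^ 2 = (r : ℝ) ^ d := Real.sq_sqrt hV0.le
  have hs_ge : 2 ≤ s := by
    refine Real.le_sqrt_of_sq_le ?_
    have h3 : (3 : ℝ) ≤ r := by exact_mod_cast hr
    calc (2 : ℝ) ^ 2 ≤ 3 ^ 2 := by norm_num
      _ ≤ (r : ℝ) ^ 2 := by gcongr
      _ ≤ (r : ℝ) ^ d := pow_le_pow_right₀ (by linarith) (by omega)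
  have hs0 : 0 < s := by linarith
  have hε : 0 < s⁻¹ := by positivity
  have hε2 : s⁻¹ ≤ 1 / 2 := by rw [← one_div]; exact one_div_le_one_div_of_le (by norm_num) hs_ge
  have hz1 : 0 < ‖z‖ := norm_pos_iff.2 hz0
  have hμ : 0 < μ := by
    have := hz1.trans_le hz
    exact inv_pos.1 (pos_of_mul_pos_left this (by linarith))
  have hzμ : ‖z‖ * μ < 1 := by
    have h2 := mul_le_mul_of_nonneg_right hz hμ.le
    have h3 : μ⁻¹ * (1 - s⁻¹) * μ = 1 - s⁻¹ := by field_simp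
    linarith
  obtain ⟨hGz, m, hm, hmX, hGm⟩ := hG β h0 h1 hβ₁ μ h ‖z‖ hz1.le hzμ
  have hS := growth_summable_KZ_pow h0 h1 h hz1.le hzμ
  set X : ℝ := ∑' l : List (Fin d × Bool), KZ d β l * ‖z‖ ^ l.length with hXdef
  have hX1 : 1 ≤ X := one_le_tsum_KZ h0 h1 hz1.le hS
  have hXs : X ≤ 8 * s := by
    have := hX β h0 h1 hβ₂ μ h hμ (fun y hy hyμ => (hG β h0 h1 hβ₁ μ h y hy hyμ).1) s⁻¹ hε hε2
      ‖z‖ hz1.le hz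
    rwa [div_inv_eq_mul] at this
  have hX2 : X ^ 2 ≤ 64 * (r : ℝ) ^ d := by
    have := pow_le_pow_left₀ (by linarith) hXs 2
    rw [← hs2]; linarith
  set τ : ℝ := 16 * cg * X * (r : ℝ)⁻¹ ^ d with hτ
  have hτ0 : 0 ≤ τ := by positivity
  have hτV : τ * (r : ℝ) ^ d = 16 * cg * X := by
    rw [hτ, inv_pow]; field_simp
  have hVτ : (r : ℝ) ^ d * τ ^ 2 ≤ E := by
    have e1 : (r : ℝ) ^ d * τ ^ 2 * (r : ℝ) ^ d = 256 * cg ^ 2 * X ^ 2 := by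
      linear_combination (τ * (r : ℝ) ^ d + 16 * cg * X) * hτV
    refine le_of_mul_le_mul_right (a := (r : ℝ) ^ d) ?_ hV0
    rw [e1, hE]
    have := mul_le_mul_of_nonneg_left hX2 (by positivity : (0 : ℝ) ≤ 256 * cg ^ 2)
    linarith
  have hτX : τ * X ≤ 16 * cg * 64 := by
    refine le_of_mul_le_mul_right (a := (r : ℝ) ^ d) ?_ hV0
    have := mul_le_mul_of_nonneg_left hX2 (by positivity : (0 : ℝ) ≤ 16 * cg)
    nlinarith
  set δ : ℝ := 2 * (β * K * τ) with hδ
  have hδ0 : 0 ≤ δ := by positivity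
  have hnδ : n * δ = β * Q * X / (r : ℝ) ^ d := by
    rw [eq_div_iff hV0.ne', hδ, hQ]
    linear_combination 2 * n * β * K * hτV
  have hPeq : ∀ l : List (Fin d × Bool), ‖(KZ d β l : ℂ) * z ^ l.length‖ = KZ d β l * ‖z‖ ^ l.length :=
    fun l => by
      rw [norm_mul, norm_pow, Complex.norm_real, Real.norm_of_nonneg (KZ_nonneg h0 h1 l)]
  have hP : Summable fun l : List (Fin d × Bool) => ‖(KZ d β l : ℂ) * z ^ l.length‖ := by
    simpa only [hPeq] using hS
  have hP' : Summable fun l : List (Fin d × Bool) => ‖(KT d r β l : ℂ) * z ^ l.length‖ := by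
    refine Summable.of_nonneg_of_le (fun _ => norm_nonneg _) (fun l => ?_) hS
    rw [norm_mul, norm_pow, Complex.norm_real, Real.norm_of_nonneg (KT_nonneg h0 h1 r l)]
    exact mul_le_mul_of_nonneg_right (KT_le_KZ h0 h1 r l) (by positivity)
  have hχX : ‖∑' l : List (Fin d × Bool), (KZ d β l : ℂ) * z ^ l.length‖ ≤ X := by
    refine (norm_tsum_le_tsum_norm hP).trans (le_of_eq ?_)
    simp only [hPeq, hXdef]
  have hD : ∀ e : Fin d × Bool, ∑' ρ, ENNReal.ofReal
      |laceInf (sawW β (dispT r)) [e] ρ - laceInf (sawW β disp) [e] ρ| *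
        ENNReal.ofReal ‖z‖ ^ ρ.length ≤ ENNReal.ofReal (δ / ‖z‖) := fun e => by
    refine (tsum_laceInf_torus_sub_le hd (by omega : 1 ≤ r) h0 h1 hA.le hτ0 ha hGz
      (fun y => tsum_farInd_GE_le hcg.le hmX hτ y (hfar r (by omega) m hm y) hGm) hVτ hB
      (h₄ β hβ₄) (h₅ β hβ₅) (by simpa using hz0) ENNReal.ofReal_ne_top e).trans (le_of_eq ?_)
    rw [hKe, ENNReal.ofReal_div_of_pos hz1, ← ENNReal.ofReal_mul h0,
      ← ENNReal.ofReal_mul (mul_nonneg h0 hK0), hδ, ENNReal.ofReal_mul zero_le_two,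
      ENNReal.ofReal_ofNat]
  have hxδ : X * (n * δ) ≤ 1 / 2 := by
    have e1 : X * (n * δ) = β * (2 * K * n) * (τ * X) := by rw [hδ]; ring
    have e2 := mul_le_mul_of_nonneg_left hτX (by positivity : 0 ≤ β * (2 * K * n))
    have e3 : β * (64 * Q + 1) ≤ 1 / 2 := by
      rw [le_div_iff₀ (by positivity)] at hβ₆
      linarith
    have e4 : β * (2 * K * n) * (16 * cg * 64) = β * (64 * Q) := by rw [hQ]; ring
    linarith
  have key := norm_tsum_activity_sub_le (sawW_step β) (sawW_dispT_step hr β) hz0 hδ0 hc.le hP hP'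
    (hlace β h0 h1 hβ₃ _ hGz).1 hD
    ((mul_le_mul_of_nonneg_right hχX (by positivity)).trans hxδ)
  rw [chi_eq hP.of_norm, chiT_eq hP'.of_norm, chiR_eq h0 h1 hz1.le hS]
  refine key.trans ?_
  change 2 * ‖∑' l : List (Fin d × Bool), (KZ d β l : ℂ) * z ^ l.length‖ ^ 2 * (n * δ) ≤ _
  rw [hnδ, ← hXdef]
  generalize ‖∑' l : List (Fin d × Bool), (KZ d β l : ℂ) * z ^ l.length‖ = x
  have e1 : 2 * x ^ 2 * (β * Q * X / (r : ℝ) ^ d) = 2 * Q * (β * x ^ 2 * X / (r : ℝ) ^ d) := by ring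
  have e2 : (2 * Q + 1) * β * x ^ 2 * X / (r : ℝ) ^ d =
      2 * Q * (β * x ^ 2 * X / (r : ℝ) ^ d) + β * x ^ 2 * X / (r : ℝ) ^ d := by ring
  have e3 : 0 ≤ β * x ^ 2 * X / (r : ℝ) ^ d := by positivity
  linarith

end Susceptibility

end WSAW

/-- `χ^𝕋(z) = χ(z)(1 + O(β χ(z)(r² + χ(|z|))/V))` for `|z| ≤ z_c(1 - V^{-1/2})`. -/
theorem statement3 (d : ℕ) (hd : 4 < d) :
    ∃ β0 C : ℝ, 0 < β0 ∧ 0 < C ∧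
      ∀ β : ℝ, 0 < β → β ≤ β0 →
        ∀ μ : ℝ, HasGrowthConst d β μ →
          ∀ r : ℕ, 3 ≤ r →
            ∀ z : ℂ, ‖z‖ ≤ μ⁻¹ * (1 - (Real.sqrt ((r : ℝ) ^ d))⁻¹) →
              ‖chiT d r β z - chi d β z‖ ≤
                C * β * ‖chi d β z‖ ^ 2 * ((r : ℝ) ^ 2 + chiR d β ‖z‖) / (r : ℝ) ^ d := by
  obtain ⟨b, C, hb, hC, h⟩ := WSAW.exists_norm_chiT_sub_chi_le d hd
  refine ⟨b, C, hb, hC, fun β hβ0 hβ μ hμ r hr z hz => (h β hβ0 hβ μ hμ r hr z hz).trans ?_⟩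
  gcongr
  exact le_add_of_nonneg_left (by positivity)
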